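/- Let G be a plane graph with outer cycle C, let p1, p2 ∈ V(C), and let L be a list assignment for G such that |L(v)| ≥ 5 for every v ∈ V(G) − V(C), |L(v)| ≥ 3 for every v ∈ V(C) − {p1, p2}, |L(p1)| ≥ 1 and |L(p2)| ≥ 2. Then G has an L-coloring if and only if the pair (G, L) does not contain a coloring harmonica from p1 to p2. -/

import Mathlib

/-!
Common definitions: plane graphs (given by a concrete embedding in the plane),
outer face, canvases, list colorings, governments, harmonicas and coloring
harmonicas, following Postle–Thomas,
"Five-list-coloring graphs on surfaces III".
-/

open Set

universe u

/-- A finite simple graph together with an embedding in the plane: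
each vertex gets a point, each edge a simple arc joining its endpoints;
arcs avoid other vertices, and two distinct edges meet only in common
endpoints. -/
structure PlaneGraph (V : Type u) where
  verts : Set V
  Adj : V → V → Prop
  finite_verts : verts.Finite
  adj_symm : ∀ u v, Adj u v → Adj v u
  adj_irrefl : ∀ v, ¬Adj v v
  adj_mem : ∀ u v, Adj u v → u ∈ verts
  pos : V → ℝ × ℝ
  arc : Sym2 V → Set (ℝ × ℝ)
  pos_injOn : Set.InjOn pos verts
  arc_arc : ∀ u v, Adj u v → ∃ f : ℝ → ℝ × ℝ,
    ContinuousOn f (Set.Icc 0 1) ∧ Set.InjOn f (Set.Icc 0 1) ∧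
    f '' Set.Icc 0 1 = arc s(u, v) ∧ f 0 = pos u ∧ f 1 = pos v
  arc_avoid : ∀ u v, Adj u v → ∀ w ∈ verts, pos w ∈ arc s(u, v) → w = u ∨ w = v
  arc_meet : ∀ u v x y, Adj u v → Adj x y → s(u, v) ≠ s(x, y) →
    arc s(u, v) ∩ arc s(x, y) ⊆ pos '' (({u, v} : Set V) ∩ ({x, y} : Set V))

namespace PlaneGraph

variable {V : Type u}

/-- The point set of the drawing of the plane graph. -/
def image (G : PlaneGraph V) : Set (ℝ × ℝ) :=
  G.pos '' G.verts ∪ ⋃ (u : V) (v : V) (_ : G.Adj u v), G.arc s(u, v)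

/-- The outer (unbounded) face of the drawing. -/
def outerFace (G : PlaneGraph V) : Set (ℝ × ℝ) :=
  {p | p ∉ G.image ∧ ¬Bornology.IsBounded (connectedComponentIn G.imageᶜ p)}

/-- A vertex incident with (i.e. on the boundary of) the outer face. -/
def OnOuter (G : PlaneGraph V) (v : V) : Prop := G.pos v ∈ frontier G.outerFace

/-- An edge incident with (i.e. on the boundary of) the outer face. -/
def EdgeOnOuter (G : PlaneGraph V) (u v : V) : Prop :=
  G.arc s(u, v) ⊆ frontier G.outerFace

/-- The vertices of the boundary of the outer face. -/
def boundaryVerts (G : PlaneGraph V) : Set V := {v | v ∈ G.verts ∧ G.OnOuter v}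

/-- Connectivity of a plane graph. -/
def Connected (G : PlaneGraph V) : Prop :=
  G.verts.Nonempty ∧ ∀ u ∈ G.verts, ∀ v ∈ G.verts, Relation.ReflTransGen G.Adj u v

/-- `H` is a (plane) subgraph of `G`, drawn the same way. -/
def IsSubgraph (H G : PlaneGraph V) : Prop :=
  H.verts ⊆ G.verts ∧ (∀ u v, H.Adj u v → G.Adj u v) ∧
  (∀ v ∈ H.verts, H.pos v = G.pos v) ∧
  (∀ u v, H.Adj u v → H.arc s(u, v) = G.arc s(u, v))

/-- Delete a set of vertices (and all incident edges) from a plane graph. -/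
def deleteVerts (G : PlaneGraph V) (s : Set V) : PlaneGraph V where
  verts := G.verts \ s
  Adj u v := G.Adj u v ∧ u ∉ s ∧ v ∉ s
  finite_verts := G.finite_verts.subset Set.diff_subset
  adj_symm := fun u v h => ⟨G.adj_symm u v h.1, h.2.2, h.2.1⟩
  adj_irrefl := fun v h => G.adj_irrefl v h.1
  adj_mem := fun u v h => ⟨G.adj_mem u v h.1, h.2.1⟩
  pos := G.pos
  arc := G.arc
  pos_injOn := G.pos_injOn.mono Set.diff_subset
  arc_arc := fun u v h => G.arc_arc u v h.1
  arc_avoid := fun u v h w hw hm => G.arc_avoid u v h.1 w hw.1 hm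
  arc_meet := fun u v x y h h' hne => G.arc_meet u v x y h.1 h'.1 hne

/-- `G` has a proper coloring from the lists `L`. -/
def HasLColoring (G : PlaneGraph V) (L : V → Finset ℕ) : Prop :=
  ∃ φ : V → ℕ, (∀ v ∈ G.verts, φ v ∈ L v) ∧ ∀ u v, G.Adj u v → φ u ≠ φ v

/-- A vertex of degree exactly one. -/
def DegreeOne (G : PlaneGraph V) (x : V) : Prop :=
  (∃ a, G.Adj x a) ∧ ∀ a b, G.Adj x a → G.Adj x b → a = b

end PlaneGraph

/-- The cyclic successor of an index in a list. -/
def cycNext {V : Type u} (C : List V) (i : Fin C.length) : Fin C.length :=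
  ⟨((i : ℕ) + 1) % C.length, Nat.mod_lt _ (lt_of_le_of_lt (Nat.zero_le _) i.isLt)⟩

/-- The list `C` is a cycle of `G` whose image is exactly the boundary of the
outer face of `G`; i.e. `G` is a plane graph with outer cycle `C`. -/
def PlaneGraph.IsOuterCycle {V : Type u} (G : PlaneGraph V) (C : List V) : Prop :=
  C.Nodup ∧ 3 ≤ C.length ∧ (∀ v ∈ C, v ∈ G.verts) ∧
  (∀ i : Fin C.length, G.Adj (C.get i) (C.get (cycNext C i))) ∧
  frontier G.outerFace =
    G.pos '' {v | v ∈ C} ∪ ⋃ i : Fin C.length, G.arc s(C.get i, C.get (cycNext C i))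

/-- `pq` is an edge of the cycle (given as a list) `C`. -/
def IsCycleEdge {V : Type u} (C : List V) (p q : V) : Prop :=
  ∃ i : Fin C.length, s(p, q) = s(C.get i, C.get (cycNext C i))

/-- `(G, S, L)` is a canvas, where the subgraph `S` of the boundary of the
outer face of `G` is given by its vertex set `Sverts` and adjacency `SAdj`. -/
structure IsCanvas {V : Type u} (G : PlaneGraph V) (Sverts : Set V) (SAdj : V → V → Prop)
    (L : V → Finset ℕ) : Prop where
  sadj_symm : ∀ u v, SAdj u v → SAdj v u
  sadj_sub : ∀ u v, SAdj u v → G.Adj u v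
  sadj_mem : ∀ u v, SAdj u v → u ∈ Sverts
  sverts_sub : Sverts ⊆ G.verts
  sverts_outer : ∀ v ∈ Sverts, G.OnOuter v
  sedges_outer : ∀ u v, SAdj u v → G.EdgeOnOuter u v
  lists_nonempty : ∀ v ∈ G.verts, (L v).Nonempty
  card_inner : ∀ v ∈ G.verts, ¬G.OnOuter v → 5 ≤ (L v).card
  card_outside_S : ∀ v ∈ G.verts, v ∉ Sverts → 3 ≤ (L v).card
  scolorable : ∃ φ : V → ℕ, (∀ v ∈ Sverts, φ v ∈ L v) ∧ ∀ u v, SAdj u v → φ u ≠ φ v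

/-- The adjacency relation of the single-edge path `p₁p₂`. -/
def pathAdj {V : Type u} (p1 p2 : V) : V → V → Prop :=
  fun u v => (u = p1 ∧ v = p2) ∨ (u = p2 ∧ v = p1)

/-- `(G, P, L)` is a canvas whose precolored subgraph is a path `P = p₁p₂` of
length one (in the boundary of the outer face of `G`). -/
def IsPathCanvas {V : Type u} (G : PlaneGraph V) (p1 p2 : V) (L : V → Finset ℕ) : Prop :=
  p1 ≠ p2 ∧ IsCanvas G {p1, p2} (pathAdj p1 p2) L

/-- `c = (c₁, c₂)` is a proper `L`-coloring of the edge `p₁p₂`. -/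
def ProperEdgeColoring {V : Type u} (L : V → Finset ℕ) (p1 p2 : V) (c : ℕ × ℕ) : Prop :=
  c.1 ∈ L p1 ∧ c.2 ∈ L p2 ∧ c.1 ≠ c.2

/-- `Φ_T(P', 𝒞)`: the colorings of the edge `q₁q₂` extendable to an `L`-coloring
of `G` whose restriction to `p₁p₂` lies in `C`. -/
def Phi {V : Type u} (G : PlaneGraph V) (L : V → Finset ℕ) (p1 p2 q1 q2 : V)
    (C : Set (ℕ × ℕ)) : Set (ℕ × ℕ) :=
  {c | ∃ φ : V → ℕ, (∀ v ∈ G.verts, φ v ∈ L v) ∧ (∀ u v, G.Adj u v → φ u ≠ φ v) ∧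
    (φ p1, φ p2) ∈ C ∧ φ q1 = c.1 ∧ φ q2 = c.2}

/-- The set of colors used on the first vertex of the path. -/
def fstColors (C : Set (ℕ × ℕ)) : Set ℕ := Prod.fst '' C

/-- The set of colors used on the second vertex of the path. -/
def sndColors (C : Set (ℕ × ℕ)) : Set ℕ := Prod.snd '' C

/-- A dictatorship: at least two (distinct) colorings, all agreeing on one of
the two vertices (the dictator). -/
def IsDictatorship (C : Set (ℕ × ℕ)) : Prop :=
  (∃ c ∈ C, ∃ d ∈ C, c ≠ d) ∧
  ((∃ a, ∀ c ∈ C, c.1 = a) ∨ (∃ a, ∀ c ∈ C, c.2 = a))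

/-- A democracy: exactly the two colorings `(x, y)` and `(y, x)`. -/
def IsDemocracy (C : Set (ℕ × ℕ)) : Prop :=
  ∃ x y : ℕ, x ≠ y ∧ C = {(x, y), (y, x)}

/-- A government is a dictatorship or a democracy. -/
def IsGovernment (C : Set (ℕ × ℕ)) : Prop := IsDictatorship C ∨ IsDemocracy C

/-- A confederacy: not a government, but the union of two governments. -/
def IsConfederacy (C : Set (ℕ × ℕ)) : Prop :=
  ¬IsGovernment C ∧ ∃ C1 C2 : Set (ℕ × ℕ), IsGovernment C1 ∧ IsGovernment C2 ∧ C = C1 ∪ C2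

/-- The canvas `(G, p₁p₂, L)` is a harmonica from the path `p₁p₂` to the path
`q₁q₂` with government `C`. -/
inductive IsHarmonica {V : Type u} (L : V → Finset ℕ) :
    PlaneGraph V → V → V → V → V → Set (ℕ × ℕ) → Prop where
  /-- Rule (i): `G = P = P'`. -/
  | same (G : PlaneGraph V) (p1 p2 q1 q2 : V) (C : Set (ℕ × ℕ))
      (hcanvas : IsPathCanvas G p1 p2 L)
      (hproper : ∀ c ∈ C, ProperEdgeColoring L p1 p2 c)
      (hgov : IsGovernment C)
      (hq : (q1 = p1 ∧ q2 = p2) ∨ (q1 = p2 ∧ q2 = p1))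
      (hverts : G.verts = {p1, p2})
      (hedges : ∀ u v, G.Adj u v → pathAdj p1 p2 u v) :
      IsHarmonica L G p1 p2 q1 q2 C
  /-- Rule (ii): `C` is a dictatorship, `G = P ∪ P'`, `V(P) ∩ V(P') = {z}`
  where `z` is the dictator. -/
  | cherry (G : PlaneGraph V) (p1 p2 q1 q2 z : V) (C : Set (ℕ × ℕ))
      (hcanvas : IsPathCanvas G p1 p2 L)
      (hproper : ∀ c ∈ C, ProperEdgeColoring L p1 p2 c)
      (hdict : IsDictatorship C)
      (hq : q1 ≠ q2) (hqadj : G.Adj q1 q2) (hqout : G.EdgeOnOuter q1 q2)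
      (hverts : G.verts = {p1, p2, q1, q2})
      (hedges : ∀ u v, G.Adj u v → pathAdj p1 p2 u v ∨ pathAdj q1 q2 u v)
      (hz : (({p1, p2} : Set V) ∩ ({q1, q2} : Set V)) = {z})
      (hzdict : (z = p1 ∧ ∃ a, ∀ c ∈ C, c.1 = a) ∨ (z = p2 ∧ ∃ a, ∀ c ∈ C, c.2 = a)) :
      IsHarmonica L G p1 p2 q1 q2 C
  /-- Rule (iii): `C` is a dictatorship with dictator `z ∈ V(P)` in color `c`,
  sitting on a triangle `z u₁ u₂`. -/
  | dict (G : PlaneGraph V) (p1 p2 q1 q2 z w u1 u2 : V) (c : ℕ) (L0 : Finset ℕ)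
      (C C' : Set (ℕ × ℕ))
      (hcanvas : IsPathCanvas G p1 p2 L)
      (hproper : ∀ d ∈ C, ProperEdgeColoring L p1 p2 d)
      (hdict : IsDictatorship C)
      (hq : q1 ≠ q2) (hqadj : G.Adj q1 q2) (hqout : G.EdgeOnOuter q1 q2)
      (hz : (z = p1 ∧ w = p2 ∧ (∀ d ∈ C, d.1 = c) ∧
              (u1 = w → sndColors C = (L0 : Set ℕ)) ∧
              (u2 = w → sndColors C = (L0 : Set ℕ))) ∨
            (z = p2 ∧ w = p1 ∧ (∀ d ∈ C, d.2 = c) ∧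
              (u1 = w → fstColors C = (L0 : Set ℕ)) ∧
              (u2 = w → fstColors C = (L0 : Set ℕ))))
      (hzu1 : G.Adj z u1) (hzu2 : G.Adj z u2) (hu12 : G.Adj u1 u2)
      (hL0 : L0.card = 2)
      (hLu1 : u1 ∉ ({p1, p2} : Set V) → L u1 = L0 ∪ {c})
      (hLu2 : u2 ∉ ({p1, p2} : Set V) → L u2 = L0 ∪ {c})
      (hu1P : u1 ∈ ({p1, p2} : Set V) → u1 = w)
      (hu2P : u2 ∈ ({p1, p2} : Set V) → u2 = w)
      (hdem : IsDemocracy C')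
      (hC'1 : fstColors C' = (L0 : Set ℕ)) (hC'2 : sndColors C' = (L0 : Set ℕ))
      (hrec : IsHarmonica L (G.deleteVerts (({p1, p2} : Set V) \ {u1, u2})) u1 u2 q1 q2 C') :
      IsHarmonica L G p1 p2 q1 q2 C
  /-- Rule (iv), with `i = 1`: `C` is a democracy, `z` is a common neighbor of
  `p₁, p₂`, and `p₁` is deleted. -/
  | demo1 (G : PlaneGraph V) (p1 p2 q1 q2 z : V) (a b c : ℕ) (L0 : Finset ℕ)
      (C C' : Set (ℕ × ℕ))
      (hcanvas : IsPathCanvas G p1 p2 L)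
      (hproper : ∀ d ∈ C, ProperEdgeColoring L p1 p2 d)
      (hdemC : IsDemocracy C)
      (hq : q1 ≠ q2) (hqadj : G.Adj q1 q2) (hqout : G.EdgeOnOuter q1 q2)
      (hz1 : G.Adj z p1) (hz2 : G.Adj z p2)
      (hLz : L z = L0 ∪ {c})
      (hC1 : fstColors C = (L0 : Set ℕ)) (hC2 : sndColors C = (L0 : Set ℕ))
      (hab : a ≠ b) (hL0ab : (L0 : Set ℕ) = {a, b})
      (hC' : C' = {(c, a), (c, b)})
      (hrec : IsHarmonica L (G.deleteVerts {p1}) z p2 q1 q2 C') :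
      IsHarmonica L G p1 p2 q1 q2 C
  /-- Rule (iv), with `i = 2`: `C` is a democracy, `z` is a common neighbor of
  `p₁, p₂`, and `p₂` is deleted. -/
  | demo2 (G : PlaneGraph V) (p1 p2 q1 q2 z : V) (a b c : ℕ) (L0 : Finset ℕ)
      (C C' : Set (ℕ × ℕ))
      (hcanvas : IsPathCanvas G p1 p2 L)
      (hproper : ∀ d ∈ C, ProperEdgeColoring L p1 p2 d)
      (hdemC : IsDemocracy C)
      (hq : q1 ≠ q2) (hqadj : G.Adj q1 q2) (hqout : G.EdgeOnOuter q1 q2)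
      (hz1 : G.Adj z p1) (hz2 : G.Adj z p2)
      (hLz : L z = L0 ∪ {c})
      (hC1 : fstColors C = (L0 : Set ℕ)) (hC2 : sndColors C = (L0 : Set ℕ))
      (hab : a ≠ b) (hL0ab : (L0 : Set ℕ) = {a, b})
      (hC' : C' = {(c, a), (c, b)})
      (hrec : IsHarmonica L (G.deleteVerts {p2}) z p1 q1 q2 C') :
      IsHarmonica L G p1 p2 q1 q2 C

/-- `(G, L)` is a coloring harmonica from `uv` to `w` (source `Sum.inr (u, v)`)
or from `u` to `w` (source `Sum.inl u`). -/
inductive IsColoringHarmonica {V : Type u} [DecidableEq V] :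
    PlaneGraph V → (V → Finset ℕ) → V ⊕ V × V → V → Prop where
  /-- `G` is a triangle with vertex set `{u, v, w}`, `L(u) = L(v) = L(w)` and
  `|L(u)| = 2`. -/
  | tri (G : PlaneGraph V) (L : V → Finset ℕ) (u v w : V)
      (hconn : G.Connected) (huv : u ≠ v) (huw : u ≠ w) (hvw : v ≠ w)
      (hu : G.OnOuter u) (hv : G.OnOuter v) (hw : G.OnOuter w)
      (huvout : G.EdgeOnOuter u v)
      (hverts : G.verts = {u, v, w})
      (hadjuv : G.Adj u v) (hadjvw : G.Adj v w) (hadjuw : G.Adj u w)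
      (hLuv : L u = L v) (hLvw : L v = L w) (hcard : (L u).card = 2) :
      IsColoringHarmonica G L (Sum.inr (u, v)) w
  /-- There is a triangle `uvz` on the outer face; delete one or both of
  `u, v` and recurse from `z`. -/
  | step (G : PlaneGraph V) (L : V → Finset ℕ) (u v w z : V) (s : Set V)
      (hconn : G.Connected) (huv : u ≠ v) (huw : u ≠ w) (hvw : v ≠ w)
      (hu : G.OnOuter u) (hv : G.OnOuter v) (hw : G.OnOuter w)
      (huvout : G.EdgeOnOuter u v)
      (hadjuv : G.Adj u v) (hadjuz : G.Adj u z) (hadjvz : G.Adj v z)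
      (hz : G.OnOuter z)
      (hLuv : L u = L v) (hsub : L u ⊆ L z)
      (hcardu : (L u).card = 2) (hcardz : (L z).card = 3)
      (hs : s = {u} ∨ s = {v} ∨ s = ({u, v} : Set V))
      (hrec : IsColoringHarmonica (G.deleteVerts s)
        (Function.update L z (L z \ L u)) (Sum.inl z) w) :
      IsColoringHarmonica G L (Sum.inr (u, v)) w
  /-- `|L(u)| = 1`, `u` sits on a triangle `uxy`; delete `u` and recurse
  from `xy`. -/
  | vert (G : PlaneGraph V) (L : V → Finset ℕ) (u w x y : V)
      (hconn : G.Connected) (huw : u ≠ w)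
      (hu : G.OnOuter u) (hw : G.OnOuter w)
      (hx : G.OnOuter x) (hy : G.OnOuter y)
      (hadjux : G.Adj u x) (hadjuy : G.Adj u y) (hadjxy : G.Adj x y)
      (hcardu : (L u).card = 1)
      (hLxy : L x \ L u = L y \ L u) (hcardx : (L x \ L u).card = 2)
      (hrec : IsColoringHarmonica (G.deleteVerts {u})
        (Function.update (Function.update L x (L x \ L u)) y (L y \ L u))
        (Sum.inr (x, y)) w) :
      IsColoringHarmonica G L (Sum.inl u) w

/-- `(G, L)` contains a coloring harmonica `(H, L')` with the given source and
target: `H` is a subgraph of `G` and `L'` agrees with `L` on `V(H)`. -/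
def ContainsColoringHarmonica {V : Type u} [DecidableEq V] (G : PlaneGraph V)
    (L : V → Finset ℕ) (st : V ⊕ V × V) (w : V) : Prop :=
  ∃ (H : PlaneGraph V) (L' : V → Finset ℕ), H.IsSubgraph G ∧
    (∀ x ∈ H.verts, L' x = L x) ∧ IsColoringHarmonica H L' st w

/-- `v` is a cutvertex of the boundary of the outer face of `G`. -/
def BoundaryCutvertex {V : Type u} (G : PlaneGraph V) (v : V) : Prop :=
  ∃ a b : V, a ∈ G.boundaryVerts ∧ b ∈ G.boundaryVerts ∧ a ≠ v ∧ b ≠ v ∧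
    Relation.ReflTransGen (fun x y => G.Adj x y ∧ G.EdgeOnOuter x y) a b ∧
    ¬Relation.ReflTransGen
      (fun x y => G.Adj x y ∧ G.EdgeOnOuter x y ∧ x ≠ v ∧ y ≠ v) a b

open Classical in
/-- The list assignment of the democratic reduction `T(P, L0, x)`:
remove the colors of `L0` from the list of `x` and from the lists of all
neighbors of `P` other than `y`. -/
noncomputable def reducedL {V : Type u} (G : PlaneGraph V) (L : V → Finset ℕ)
    (L0 : Finset ℕ) (Q : List V) (x y : V) : V → Finset ℕ := fun w =>
  if w = x ∨ (w ≠ y ∧ ∃ p ∈ Q, G.Adj w p) then L w \ L0 else L w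

/-- The vertex set of the precolored subgraph of the democratic reduction:
`S ∖ V(P)`, together with `x` as an isolated vertex if its new list is
smaller than 3. -/
def reducedSverts {V : Type u} (Sverts : Set V) (Q : List V) (x : V)
    (L' : V → Finset ℕ) : Set V :=
  {v | (v ∈ Sverts ∧ v ∉ Q) ∨ (v = x ∧ (L' x).card < 3)}

/-- The adjacency of the precolored subgraph of the democratic reduction:
`S ∖ V(P)`. -/
def reducedSAdj {V : Type u} (SAdj : V → V → Prop) (Q : List V) : V → V → Prop :=
  fun u v => SAdj u v ∧ u ∉ Q ∧ v ∉ Q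



set_option linter.unusedVariables false
set_option linter.unusedSectionVars false

namespace HC

/-! ### Connectivity -/
section conn
variable {W : Type*} (G : SimpleGraph W)

/-- `T` is closed under adjacency inside `S`. -/
def Clo (S T : Set W) : Prop := ∀ a ∈ T, ∀ b ∈ S, G.Adj a b → b ∈ T

/-- `S` induces a connected subgraph. -/
def Conn (S : Set W) : Prop :=
  S.Nonempty ∧ ∀ T ⊆ S, T.Nonempty → Clo G S T → S ⊆ T

/-- two sets are joined by an edge -/
def Tch (S T : Set W) : Prop := ∃ a ∈ S, ∃ b ∈ T, G.Adj a b

/-- the component of `v` in `S` -/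
def comp (S : Set W) (v : W) : Set W := {x | x ∈ S ∧ ∀ T, v ∈ T → Clo G S T → x ∈ T}

/-- neighbourhood of a set -/
def Nb (K : Set W) : Set W := {v | ∃ k ∈ K, G.Adj k v}

variable {G}

lemma Tch.symm {S T : Set W} (h : Tch G S T) : Tch G T S := by
  obtain ⟨a, ha, b, hb, h⟩ := h
  exact ⟨b, hb, a, ha, h.symm⟩

lemma Clo.compl {S T : Set W} (h : Clo G S T) (_hT : T ⊆ S) : Clo G S (S \ T) := by
  intro a ha b hb hab
  refine ⟨hb, fun hbT => ha.2 (h b hbT a ha.1 hab.symm)⟩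

lemma Clo.mono {S S' T : Set W} (h : Clo G S T) (hS : S' ⊆ S) : Clo G S' (T ∩ S') := by
  intro a ha b hb hab
  exact ⟨h a ha.1 b (hS hb) hab, hb⟩

lemma conn_singleton (v : W) : Conn G {v} := by
  refine ⟨⟨v, rfl⟩, fun T hT ⟨a, ha⟩ _ x hx => ?_⟩
  have := hT ha
  simp only [mem_singleton_iff] at *
  subst this; subst hx; exact ha

lemma Conn.union_of {S T : Set W} (hS : Conn G S) (hT : Conn G T)
    (h : (S ∩ T).Nonempty ∨ Tch G S T) : Conn G (S ∪ T) := by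
  refine ⟨hS.1.mono subset_union_left, fun A hA hne hcl => ?_⟩
  have key1 : (A ∩ S).Nonempty → S ⊆ A := fun hn => by
    have := hS.2 (A ∩ S) inter_subset_right hn (hcl.mono subset_union_left)
    exact fun x hx => (this hx).1
  have key2 : (A ∩ T).Nonempty → T ⊆ A := fun hn => by
    have := hT.2 (A ∩ T) inter_subset_right hn (hcl.mono subset_union_right)
    exact fun x hx => (this hx).1
  have a1 : S ⊆ A → T ⊆ A := by
    intro hSA
    rcases h with ⟨x, hx⟩ | ⟨a, ha, b, hb, hab⟩
    · exact key2 ⟨x, hSA hx.1, hx.2⟩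
    · exact key2 ⟨b, hcl a (hSA ha) b (Or.inr hb) hab, hb⟩
  have a2 : T ⊆ A → S ⊆ A := by
    intro hSA
    rcases h with ⟨x, hx⟩ | ⟨a, ha, b, hb, hab⟩
    · exact key1 ⟨x, hSA hx.2, hx.1⟩
    · exact key1 ⟨a, hcl b (hSA hb) a (Or.inl ha) hab.symm, ha⟩
  obtain ⟨x, hx⟩ := hne
  rcases hA hx with h | h
  · have := key1 ⟨x, hx, h⟩
    exact union_subset this (a1 this)
  · have := key2 ⟨x, hx, h⟩
    exact union_subset (a2 this) this

lemma Conn.union {S T : Set W} (hS : Conn G S) (hT : Conn G T)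
    (h : Tch G S T) : Conn G (S ∪ T) := hS.union_of hT (Or.inr h)

lemma conn_pair {a b : W} (h : G.Adj a b) : Conn G {a, b} := by
  rw [Set.insert_eq]
  exact (conn_singleton (G := G) a).union (conn_singleton b) ⟨a, rfl, b, rfl, h⟩

lemma Conn.insert {S : Set W} (hS : Conn G S) {a b : W} (hb : b ∈ S) (h : G.Adj a b) :
    Conn G (insert a S) := by
  rw [Set.insert_eq]
  exact (conn_singleton (G := G) a).union hS ⟨a, rfl, b, hb, h⟩

lemma comp_subset (S : Set W) (v : W) : comp G S v ⊆ S := fun _ h => h.1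

lemma mem_comp {S : Set W} {v : W} (h : v ∈ S) : v ∈ comp G S v := ⟨h, fun _ h _ => h⟩

lemma comp_clo (S : Set W) (v : W) : Clo G S (comp G S v) := by
  intro a ha b hb hab
  exact ⟨hb, fun T hv hT => hT a (ha.2 T hv hT) b hb hab⟩

lemma comp_min {S T : Set W} {v : W} (hv : v ∈ T) (hT : Clo G S T) : comp G S v ⊆ T :=
  fun _ h => h.2 T hv hT

lemma comp_conn {S : Set W} {v : W} (h : v ∈ S) : Conn G (comp G S v) := by
  refine ⟨⟨v, mem_comp h⟩, fun T hT hne hcl => ?_⟩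
  have hclS : Clo G S T := by
    intro a ha b hb hab
    exact hcl a ha b (comp_clo S v a (hT ha) b hb hab) hab
  by_cases hv : v ∈ T
  · exact comp_min hv hclS
  · exfalso
    have := comp_min (T := S \ T) ⟨h, hv⟩ (hclS.compl (hT.trans (comp_subset S v)))
    obtain ⟨x, hx⟩ := hne
    exact (this (hT hx)).2 hx

lemma Conn.subset_comp {S T : Set W} {v : W} (hT : Conn G T) (hv : v ∈ T) (hTS : T ⊆ S) :
    T ⊆ comp G S v := by
  have := hT.2 (comp G S v ∩ T) inter_subset_right ⟨v, mem_comp (hTS hv), hv⟩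
    ((comp_clo S v).mono hTS)
  exact fun x hx => (this hx).1

/-- connected set is inside a closed set as soon as it meets it -/
lemma Conn.subset_of_clo {S T A : Set W} (hT : Conn G T) (hTS : T ⊆ S) (hA : Clo G S A)
    (h : (T ∩ A).Nonempty) : T ⊆ A := by
  obtain ⟨x, hx⟩ := h
  exact (hT.subset_comp hx.1 hTS).trans (comp_min hx.2 hA)

end conn

/-! ### Weak models -/
section wm
variable {W : Type*} (G : SimpleGraph W)

def WM5 (S : Set W) : Prop := ∃ (p : Fin 5 → W) (E : Fin 5 → Fin 5 → Set W),
  (∀ i j, i ≠ j → Conn G (E i j) ∧ E i j ⊆ S ∧ p i ∈ E i j ∧ p j ∈ E i j ∧ E i j = E j i) ∧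
  (∀ i j k l, i ≠ j → k ≠ l → i ≠ k → i ≠ l → j ≠ k → j ≠ l → Disjoint (E i j) (E k l))

def WM33 (S : Set W) : Prop := ∃ (p q : Fin 3 → W) (E : Fin 3 → Fin 3 → Set W),
  (∀ i j, Conn G (E i j) ∧ E i j ⊆ S ∧ p i ∈ E i j ∧ q j ∈ E i j) ∧
  (∀ i j k l, i ≠ k → j ≠ l → Disjoint (E i j) (E k l))

variable {G}

lemma branch5 {S : Set W} (X : Fin 5 → Set W) (hc : ∀ i, Conn G (X i)) (hS : ∀ i, X i ⊆ S)
    (hd : ∀ i j, i ≠ j → Disjoint (X i) (X j)) (ht : ∀ i j, i < j → Tch G (X i) (X j)) :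
    WM5 G S := by
  choose p hp using fun i => (hc i).1
  have ht' : ∀ i j, i ≠ j → Tch G (X i) (X j) := by
    intro i j h
    rcases lt_or_gt_of_ne h with h | h
    · exact ht i j h
    · exact (ht j i h).symm
  refine ⟨p, fun i j => X i ∪ X j, ?_, ?_⟩
  · intro i j hij
    exact ⟨(hc i).union (hc j) (ht' i j hij), union_subset (hS i) (hS j), Or.inl (hp i),
      Or.inr (hp j), union_comm _ _⟩
  · intro i j k l _ _ h1 h2 h3 h4
    simp only [disjoint_union_left, disjoint_union_right]
    exact ⟨⟨hd _ _ h1, hd _ _ h3⟩, hd _ _ h2, hd _ _ h4⟩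

lemma branch33 {S : Set W} (X Y : Fin 3 → Set W) (hc : ∀ i, Conn G (X i)) (hS : ∀ i, X i ⊆ S)
    (hc' : ∀ i, Conn G (Y i)) (hS' : ∀ i, Y i ⊆ S)
    (hd : ∀ i j, i ≠ j → Disjoint (X i) (X j)) (hd' : ∀ i j, i ≠ j → Disjoint (Y i) (Y j))
    (hd'' : ∀ i j, Disjoint (X i) (Y j)) (ht : ∀ i j, Tch G (X i) (Y j)) :
    WM33 G S := by
  choose p hp using fun i => (hc i).1
  choose q hq using fun i => (hc' i).1
  refine ⟨p, q, fun i j => X i ∪ Y j, ?_, ?_⟩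
  · intro i j
    exact ⟨(hc i).union (hc' j) (ht i j), union_subset (hS i) (hS' j), Or.inl (hp i),
      Or.inr (hq j)⟩
  · intro i j k l h1 h2
    simp only [disjoint_union_left, disjoint_union_right]
    exact ⟨⟨hd _ _ h1, (hd'' k j).symm⟩, hd'' _ _, hd' _ _ h2⟩

end wm

/-! ### Apex graph and the class `PL` -/
section apex
variable {V : Type u} (G : SimpleGraph V)

def Ap (B : Set V) : SimpleGraph (Option V) where
  Adj x y := match x, y with
    | some a, some b => G.Adj a b
    | some a, none => a ∈ B
    | none, some b => b ∈ B
    | none, none => False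
  symm := ⟨by
    intro x y h
    match x, y, h with
    | some a, some b, h => exact h.symm
    | some a, none, h => exact h
    | none, some b, h => exact h⟩
  loopless := ⟨by
    intro x h
    match x, h with
    | some a, h => exact G.irrefl h⟩

@[simp] lemma Ap_some (B : Set V) (a b : V) : (Ap G B).Adj (some a) (some b) ↔ G.Adj a b := Iff.rfl
@[simp] lemma Ap_none (B : Set V) (b : V) : (Ap G B).Adj none (some b) ↔ b ∈ B := Iff.rfl
@[simp] lemma Ap_none' (B : Set V) (b : V) : (Ap G B).Adj (some b) none ↔ b ∈ B := Iff.rfl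
@[simp] lemma Ap_nn (B : Set V) : (Ap G B).Adj none none ↔ False := Iff.rfl

/-- `U` with apex -/
def up (U : Set V) : Set (Option V) := insert none (some '' U)

@[simp] lemma some_mem_up {U : Set V} {a : V} : some a ∈ up U ↔ a ∈ U := by simp [up]
@[simp] lemma none_mem_up {U : Set V} : none ∈ up U := by simp [up]

/-- planar with `B` on the outer face -/
def PL (U B : Set V) : Prop := ¬ WM5 (Ap G B) (up U) ∧ ¬ WM33 (Ap G B) (up U)

/-- every component of `K` meets `B` -/
def Reach (B K : Set V) : Prop := ∀ T ⊆ K, T.Nonempty → Clo G K T → (T ∩ B).Nonempty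

variable {G}

lemma Reach.conn {B K : Set V} (h : Reach G B K) : Conn (Ap G B) (up K) := by
  refine ⟨⟨none, by simp⟩, fun T hT hne hcl => ?_⟩
  have hn : none ∈ T := by
    by_contra hn
    have hne' : (some ⁻¹' T).Nonempty := by
      obtain ⟨x, hx⟩ := hne
      cases x with
      | none => exact absurd hx hn
      | some a => exact ⟨a, hx⟩
    obtain ⟨b, hb, hbB⟩ := h (some ⁻¹' T) (fun a ha => by simpa using hT ha) hne' (by
      intro a ha b hb hab
      exact hcl (some a) ha (some b) (by simpa using hb) hab)
    exact hn (hcl (some b) hb none (by simp) hbB)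
  have hK : K ⊆ some ⁻¹' T := by
    by_contra hK
    obtain ⟨x, hx, hxT⟩ := not_subset.1 hK
    obtain ⟨b, hb, hbB⟩ := h (K \ (some ⁻¹' T)) sdiff_subset ⟨x, hx, hxT⟩ (by
      intro a ha b hb hab
      refine ⟨hb, fun hbT => ha.2 (hcl (some b) hbT (some a) (by simpa using ha.1) hab.symm)⟩)
    exact hb.2 (hcl none hn (some b) (by simpa using hb.1) hbB)
  intro x hx
  cases x with
  | none => exact hn
  | some a => exact hK (by simpa using hx)

lemma reach_of_subset {B K : Set V} (h : K ⊆ B) : Reach G B K :=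
  fun T hT ⟨x, hx⟩ _ => ⟨x, hx, h (hT hx)⟩

lemma reach_empty {B : Set V} : Reach G B ∅ := reach_of_subset (empty_subset _)

lemma Conn.reach {B K : Set V} (h : Conn G K) (hB : (K ∩ B).Nonempty) : Reach G B K :=
  fun T hT hne hcl => hB.mono (inter_subset_inter_left _ (h.2 T hT hne hcl))

lemma Conn.some {B S : Set V} (h : Conn G S) : Conn (Ap G B) (some '' S) := by
  refine ⟨h.1.image _, fun T hT hne hcl => ?_⟩
  have := h.2 (Option.some ⁻¹' T) (fun a ha => by simpa using hT ha) (by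
      obtain ⟨x, hx⟩ := hne
      obtain ⟨a, _, rfl⟩ := hT hx
      exact ⟨a, hx⟩) (by
      intro a ha b hb hab
      exact hcl (Option.some a) ha (Option.some b) ⟨b, hb, rfl⟩ hab)
  rintro _ ⟨a, ha, rfl⟩
  exact this ha

/-- transfer of a connected set between graphs -/
lemma Conn.transfer {W W' : Type*} {G : SimpleGraph W} {G' : SimpleGraph W'} {S : Set W}
    {S' : Set W'} (h : Conn G S) (R : W → Set W')
    (h1 : ∀ a ∈ S, Conn G' (R a)) (h2 : S' = ⋃ a ∈ S, R a)
    (h3 : ∀ a ∈ S, ∀ b ∈ S, G.Adj a b → (R a ∩ R b).Nonempty ∨ Tch G' (R a) (R b)) :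
    Conn G' S' := by
  subst h2
  have hsub : ∀ a ∈ S, R a ⊆ ⋃ a ∈ S, R a := fun a ha => subset_biUnion_of_mem ha
  refine ⟨?_, fun T hT hne hcl => ?_⟩
  · obtain ⟨a, ha⟩ := h.1
    obtain ⟨x, hx⟩ := (h1 a ha).1
    exact ⟨x, hsub a ha hx⟩
  · have key : ∀ a ∈ S, (R a ∩ T).Nonempty → R a ⊆ T := fun a ha hn =>
      (h1 a ha).subset_of_clo (hsub a ha) hcl hn
    have := h.2 {a | a ∈ S ∧ R a ⊆ T} (fun a ha => ha.1) (by
      obtain ⟨x, hx⟩ := hne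
      have := hT hx
      simp only [mem_iUnion] at this
      obtain ⟨a, ha, hxa⟩ := this
      exact ⟨a, ha, key a ha ⟨x, hxa, hx⟩⟩) (by
      intro a ha b hb hab
      refine ⟨hb, key b hb ?_⟩
      rcases h3 a ha.1 b hb hab with ⟨x, hx⟩ | ⟨x, hx, y, hy, hxy⟩
      · exact ⟨x, hx.2, ha.2 hx.1⟩
      · exact ⟨y, hy, hcl x (ha.2 hx) y (hsub b hb hy) hxy⟩)
    exact iUnion₂_subset fun a ha => (this ha).2

/-- transfer of weak models -/
lemma WM5.transfer {W W' : Type*} {G : SimpleGraph W} {G' : SimpleGraph W'} {S : Set W}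
    {S' : Set W'} (h : WM5 G S) (f : Set W → Set W') (g : W → W')
    (hg : ∀ a E, a ∈ E → E ⊆ S → Conn G E → (∃ b ∈ E, b ≠ a) → g a ∈ f E)
    (hc : ∀ E ⊆ S, Conn G E → (∃ a ∈ E, ∃ b ∈ E, a ≠ b) → Conn G' (f E) ∧ f E ⊆ S')
    (hd : ∀ E ⊆ S, ∀ F ⊆ S, Conn G E → Conn G F → (∃ a ∈ E, ∃ b ∈ E, a ≠ b) →
      (∃ a ∈ F, ∃ b ∈ F, a ≠ b) → Disjoint E F → Disjoint (f E) (f F)) : WM5 G' S' := by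
  obtain ⟨p, E, h1, h2⟩ := h
  have hpp : ∀ i j, i ≠ j → p i ≠ p j := by
    intro i j hij hp
    obtain ⟨k, l, hk⟩ : ∃ k l : Fin 5, k ≠ l ∧ i ≠ k ∧ i ≠ l ∧ j ≠ k ∧ j ≠ l := by
      clear hp; revert i j; decide
    have := h2 i k j l hk.2.1 hk.2.2.2.2 hij hk.2.2.1 hk.2.2.2.1.symm hk.1
    exact disjoint_left.1 this (h1 i k hk.2.1).2.2.1 (hp ▸ (h1 j l hk.2.2.2.2).2.2.1)
  have hE : ∀ i j, i ≠ j → ∃ a ∈ E i j, ∃ b ∈ E i j, a ≠ b := fun i j hij =>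
    ⟨p i, (h1 i j hij).2.2.1, p j, (h1 i j hij).2.2.2.1, hpp i j hij⟩
  refine ⟨g ∘ p, fun i j => f (E i j), fun i j hij => ?_, ?_⟩
  · obtain ⟨a, b, c, d, e⟩ := h1 i j hij
    have := hc _ b a (hE i j hij)
    exact ⟨this.1, this.2, hg _ _ c b a ⟨p j, d, (hpp i j hij).symm⟩,
      hg _ _ d b a ⟨p i, c, hpp i j hij⟩, by simp only [e]⟩
  · intro i j k l a b c d e f
    exact hd _ (h1 _ _ a).2.1 _ (h1 _ _ b).2.1 (h1 _ _ a).1 (h1 _ _ b).1 (hE _ _ a) (hE _ _ b)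
      (h2 i j k l a b c d e f)

lemma WM33.transfer {W W' : Type*} {G : SimpleGraph W} {G' : SimpleGraph W'} {S : Set W}
    {S' : Set W'} (h : WM33 G S) (f : Set W → Set W') (g : W → W')
    (hg : ∀ a E, a ∈ E → E ⊆ S → Conn G E → (∃ b ∈ E, b ≠ a) → g a ∈ f E)
    (hc : ∀ E ⊆ S, Conn G E → (∃ a ∈ E, ∃ b ∈ E, a ≠ b) → Conn G' (f E) ∧ f E ⊆ S')
    (hd : ∀ E ⊆ S, ∀ F ⊆ S, Conn G E → Conn G F → (∃ a ∈ E, ∃ b ∈ E, a ≠ b) →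
      (∃ a ∈ F, ∃ b ∈ F, a ≠ b) → Disjoint E F → Disjoint (f E) (f F)) : WM33 G' S' := by
  obtain ⟨p, q, E, h1, h2⟩ := h
  have hpp : ∀ i j, p i ≠ q j := by
    intro i j hp
    obtain ⟨k, l, hk⟩ : ∃ k l : Fin 3, i ≠ k ∧ j ≠ l := by
      clear hp; revert i j; decide
    have := h2 i l k j hk.1 hk.2.symm
    exact disjoint_left.1 this (h1 i l).2.2.1 (hp ▸ (h1 k j).2.2.2)
  have hE : ∀ i j, ∃ a ∈ E i j, ∃ b ∈ E i j, a ≠ b := fun i j =>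
    ⟨p i, (h1 i j).2.2.1, q j, (h1 i j).2.2.2, hpp i j⟩
  refine ⟨g ∘ p, g ∘ q, fun i j => f (E i j), fun i j => ?_, ?_⟩
  · obtain ⟨a, b, c, d⟩ := h1 i j
    have := hc _ b a (hE i j)
    exact ⟨this.1, this.2, hg _ _ c b a ⟨q j, d, (hpp i j).symm⟩,
      hg _ _ d b a ⟨p i, c, hpp i j⟩⟩
  · intro i j k l a b
    exact hd _ (h1 _ _).2.1 _ (h1 _ _).2.1 (h1 _ _).1 (h1 _ _).1 (hE _ _) (hE _ _)
      (h2 i j k l a b)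

/-- common transfer for `PL` -/
lemma PL.transfer {U B U' B' : Set V} (h : PL G U B) (f : Set (Option V) → Set (Option V))
    (g : Option V → Option V)
    (hg : ∀ a E, a ∈ E → E ⊆ up U' → Conn (Ap G B') E → (∃ b ∈ E, b ≠ a) → g a ∈ f E)
    (hc : ∀ E ⊆ up U', Conn (Ap G B') E → (∃ a ∈ E, ∃ b ∈ E, a ≠ b) →
      Conn (Ap G B) (f E) ∧ f E ⊆ up U)
    (hd : ∀ E ⊆ up U', ∀ F ⊆ up U', Conn (Ap G B') E → Conn (Ap G B') F →
      (∃ a ∈ E, ∃ b ∈ E, a ≠ b) →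
      (∃ a ∈ F, ∃ b ∈ F, a ≠ b) → Disjoint E F → Disjoint (f E) (f F)) : PL G U' B' :=
  ⟨fun hw => h.1 (hw.transfer f g hg hc hd), fun hw => h.2 (hw.transfer f g hg hc hd)⟩

lemma PL.expose {U B K : Set V} (h : PL G U B) (hK : K ⊆ U) (hr : Reach G B K) :
    PL G (U \ K) (B ∪ Nb G K) := by
  classical
  refine h.transfer (fun E => if none ∈ E then E ∪ up K else E) id ?_ ?_ ?_
  · intro a E ha _ _ _
    simp only [id]
    split_ifs
    · exact Or.inl ha
    · exact ha
  · intro E hE hc _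
    have hupU : up (U \ K) ⊆ up U := by
      intro x hx
      cases x with
      | none => simp
      | some a => exact some_mem_up.2 (some_mem_up.1 hx).1
    split_ifs with hn
    · constructor
      · refine hc.transfer (fun a => if a = none then up K else {a}) ?_ ?_ ?_
        · intro a _
          split_ifs
          · exact hr.conn
          · exact conn_singleton _
        · ext x
          simp only [mem_union, mem_iUnion]
          constructor
          · rintro (hx | hx)
            · refine ⟨x, hx, ?_⟩
              split_ifs with hx0
              · subst hx0; simp
              · rfl
            · exact ⟨none, hn, by simpa using hx⟩
          · rintro ⟨a, ha, hxa⟩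
            split_ifs at hxa with h0
            · exact Or.inr hxa
            · rw [mem_singleton_iff] at hxa
              subst hxa; exact Or.inl ha
        · intro a ha b hb hab
          right
          match a, b, hab with
          | some a, some b, hab => exact ⟨some a, by simp, some b, by simp, hab⟩
          | some a, none, hab =>
            rcases hab with hab | ⟨k, hk, hab⟩
            · exact ⟨some a, by simp, none, by simp, hab⟩
            · exact ⟨some a, by simp, some k, by simpa using hk, hab.symm⟩
          | none, some a, hab =>
            rcases hab with hab | ⟨k, hk, hab⟩
            · exact ⟨none, by simp, some a, by simp, hab⟩
            · exact ⟨some k, by simpa using hk, some a, by simp, hab⟩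
      · refine union_subset (hE.trans hupU) ?_
        intro x hx
        cases x with
        | none => simp
        | some a => exact some_mem_up.2 (hK (some_mem_up.1 hx))
    · refine ⟨hc.transfer (fun a => {a}) (fun a _ => conn_singleton a) (by simp) ?_, hE.trans hupU⟩
      intro a ha b hb hab
      right
      match a, b, hab with
      | some a, some b, hab => exact ⟨some a, by simp, some b, by simp, hab⟩
      | some a, none, hab => exact absurd hb hn
      | none, some a, hab => exact absurd ha hn
  · have key : ∀ E F : Set (Option V), F ⊆ up (U \ K) → Disjoint E F → none ∉ F →
        Disjoint (E ∪ up K) F := by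
      intro E F hF hd hn
      refine disjoint_union_left.2 ⟨hd, disjoint_left.2 ?_⟩
      intro x hx hxF
      cases x with
      | none => exact hn hxF
      | some a => exact (some_mem_up.1 (hF hxF)).2 (some_mem_up.1 hx)
    intro E hE F hF _ _ _ _ hd
    by_cases h1 : none ∈ E <;> by_cases h2 : none ∈ F <;> simp only [h1, h2, if_true, if_false]
    · exact absurd h2 (disjoint_left.1 hd h1)
    · exact key E F hF hd h2
    · exact (key F E hE hd.symm h1).symm
    · exact hd

lemma PL.mono {U B U' B' : Set V} (h : PL G U B) (hU : U' ⊆ U) (hB : B' ∩ U' ⊆ B) :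
    PL G U' B' := by
  refine h.transfer id id (fun a E ha _ _ _ => ha) ?_ (fun E _ F _ _ _ _ _ h => h)
  intro E hE hc _
  have hup : up U' ⊆ up U := by
    intro x hx
    cases x with
    | none => simp
    | some a => exact some_mem_up.2 (hU (some_mem_up.1 hx))
  refine ⟨hc.transfer (fun a => {a}) (fun a _ => conn_singleton a) (by simp) ?_, hE.trans hup⟩
  intro a ha b hb hab
  right
  match a, b, hab with
  | some a, some b, hab => exact ⟨some a, by simp, some b, by simp, hab⟩
  | some a, none, hab => exact ⟨some a, by simp, none, by simp, hB ⟨hab, some_mem_up.1 (hE ha)⟩⟩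
  | none, some a, hab => exact ⟨none, by simp, some a, by simp, hB ⟨hab, some_mem_up.1 (hE hb)⟩⟩

lemma PL.plus {U : Set V} (h : PL G U ∅) (b : V) (hb : b ∈ U) : PL G U {b} := by
  classical
  have key : ∀ E : Set (Option V), Conn (Ap G {b}) E → (∃ a ∈ E, ∃ b ∈ E, a ≠ b) → none ∈ E →
      some b ∈ E := by
    intro E hc hE hn
    by_contra hb
    have := hc.2 {none} (by simpa using hn) ⟨none, rfl⟩ (by
      intro a ha x hx hax
      rw [mem_singleton_iff] at ha
      subst ha
      cases x with
      | none => simp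
      | some x =>
        have hxb : x = b := hax
        subst hxb; exact absurd hx hb)
    obtain ⟨a, ha, c, hc, hac⟩ := hE
    have h1 := this ha
    have h2 := this hc
    simp only [mem_singleton_iff] at h1 h2
    exact hac (h1.trans h2.symm)
  refine h.transfer (fun E => E \ {none}) (fun a => if a = none then some b else a) ?_ ?_ ?_
  · intro a E ha hE hc ⟨c, hcE, hca⟩
    split_ifs with h0
    · subst h0
      exact ⟨key E hc ⟨c, hcE, none, ha, hca⟩ ha, by simp⟩
    · exact ⟨ha, h0⟩
  · intro E hE hc h2
    constructor
    · refine hc.transfer (fun a => if a = none then {some b} else {a}) ?_ ?_ ?_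
      · intro a _
        split_ifs <;> exact conn_singleton _
      · ext x
        simp only [mem_sdiff, mem_singleton_iff, mem_iUnion]
        constructor
        · rintro ⟨hx, h0⟩
          exact ⟨x, hx, by simp [h0]⟩
        · rintro ⟨a, ha, hxa⟩
          split_ifs at hxa with h0
          · rw [mem_singleton_iff] at hxa
            subst h0 hxa
            exact ⟨key E hc h2 ha, by simp⟩
          · rw [mem_singleton_iff] at hxa
            subst hxa; exact ⟨ha, h0⟩
      · intro a ha x hx hax
        match a, x, hax with
        | some a, some x, hab => right; exact ⟨some a, by simp, some x, by simp, hab⟩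
        | some a, none, hab =>
          left
          have : a = b := hab
          subst this
          exact ⟨some a, by simp⟩
        | none, some a, hab =>
          left
          have : a = b := hab
          subst this
          exact ⟨some a, by simp⟩
    · exact sdiff_subset.trans hE
  · intro E _ F _ _ _ _ _ hd
    exact hd.mono sdiff_subset sdiff_subset

end apex
end HC

namespace HC

/-! ### Forbidden configurations -/
section shapes
variable {V : Type u} {G : SimpleGraph V}

lemma some_sub_up {U S : Set V} (h : S ⊆ U) : some '' S ⊆ up U := by
  rintro _ ⟨a, ha, rfl⟩; exact some_mem_up.2 (h ha)

lemma up_sub_up {U S : Set V} (h : S ⊆ U) : up S ⊆ up U := by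
  intro x hx
  cases x with
  | none => simp
  | some a => exact some_mem_up.2 (h (some_mem_up.1 hx))

lemma disj_some {S T : Set V} (h : Disjoint S T) :
    Disjoint (some '' S : Set (Option V)) (some '' T) :=
  (disjoint_image_iff (Option.some_injective V)).2 h

lemma disj_up {S T : Set V} (h : Disjoint S T) : Disjoint (some '' S) (up T) := by
  refine disjoint_left.2 ?_
  rintro _ ⟨a, ha, rfl⟩ h2
  exact disjoint_left.1 h ha (some_mem_up.1 h2)

lemma tch_some {B S T : Set V} (h : Tch G S T) : Tch (Ap G B) (some '' S) (some '' T) := by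
  obtain ⟨a, ha, b, hb, hab⟩ := h
  exact ⟨some a, ⟨a, ha, rfl⟩, some b, ⟨b, hb, rfl⟩, hab⟩

lemma tch_up {B S T : Set V} (h : (S ∩ B).Nonempty ∨ Tch G S T) :
    Tch (Ap G B) (some '' S) (up T) := by
  rcases h with ⟨a, ha, hb⟩ | ⟨a, ha, b, hb, hab⟩
  · exact ⟨some a, ⟨a, ha, rfl⟩, none, by simp, hb⟩
  · exact ⟨some a, ⟨a, ha, rfl⟩, some b, some_mem_up.2 hb, hab⟩

lemma PL.k5 {U B : Set V} (h : PL G U B) (X0 X1 X2 X3 Y : Set V)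
    (c0 : Conn G X0) (c1 : Conn G X1) (c2 : Conn G X2) (c3 : Conn G X3) (cY : Reach G B Y)
    (u0 : X0 ⊆ U) (u1 : X1 ⊆ U) (u2 : X2 ⊆ U) (u3 : X3 ⊆ U) (uY : Y ⊆ U)
    (d01 : Disjoint X0 X1) (d02 : Disjoint X0 X2) (d03 : Disjoint X0 X3)
    (d12 : Disjoint X1 X2) (d13 : Disjoint X1 X3) (d23 : Disjoint X2 X3)
    (e0 : Disjoint X0 Y) (e1 : Disjoint X1 Y) (e2 : Disjoint X2 Y) (e3 : Disjoint X3 Y)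
    (t01 : Tch G X0 X1) (t02 : Tch G X0 X2) (t03 : Tch G X0 X3)
    (t12 : Tch G X1 X2) (t13 : Tch G X1 X3) (t23 : Tch G X2 X3)
    (b0 : (X0 ∩ B).Nonempty ∨ Tch G X0 Y) (b1 : (X1 ∩ B).Nonempty ∨ Tch G X1 Y)
    (b2 : (X2 ∩ B).Nonempty ∨ Tch G X2 Y) (b3 : (X3 ∩ B).Nonempty ∨ Tch G X3 Y) : False := by
  refine h.1 (branch5 (fun i => match i with
    | 0 => some '' X0 | 1 => some '' X1 | 2 => some '' X2 | 3 => some '' X3 | 4 => up Y)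
    ?_ ?_ ?_ ?_)
  · intro i
    fin_cases i
    exacts [c0.some, c1.some, c2.some, c3.some, cY.conn]
  · intro i
    fin_cases i
    exacts [some_sub_up u0, some_sub_up u1, some_sub_up u2, some_sub_up u3, up_sub_up uY]
  · intro i j hij
    fin_cases i <;> fin_cases j <;> first | exact absurd rfl hij | skip
    exacts [disj_some d01, disj_some d02, disj_some d03, disj_up e0,
      disj_some d01.symm, disj_some d12, disj_some d13, disj_up e1,
      disj_some d02.symm, disj_some d12.symm, disj_some d23, disj_up e2,
      disj_some d03.symm, disj_some d13.symm, disj_some d23.symm, disj_up e3,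
      (disj_up e0).symm, (disj_up e1).symm, (disj_up e2).symm, (disj_up e3).symm]
  · intro i j hij
    fin_cases i <;> fin_cases j <;> first | exact absurd hij (by decide) | skip
    exacts [tch_some t01, tch_some t02, tch_some t03, tch_up b0, tch_some t12, tch_some t13,
      tch_up b1, tch_some t23, tch_up b2, tch_up b3]

lemma PL.k33a {U B : Set V} (h : PL G U B) (X0 X1 Y Z0 Z1 Z2 : Set V)
    (c0 : Conn G X0) (c1 : Conn G X1) (cY : Reach G B Y)
    (c0' : Conn G Z0) (c1' : Conn G Z1) (c2' : Conn G Z2)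
    (u0 : X0 ⊆ U) (u1 : X1 ⊆ U) (uY : Y ⊆ U) (u0' : Z0 ⊆ U) (u1' : Z1 ⊆ U) (u2' : Z2 ⊆ U)
    (d01 : Disjoint X0 X1) (d0Y : Disjoint X0 Y) (d1Y : Disjoint X1 Y)
    (d01' : Disjoint Z0 Z1) (d02' : Disjoint Z0 Z2) (d12' : Disjoint Z1 Z2)
    (e00 : Disjoint X0 Z0) (e01 : Disjoint X0 Z1) (e02 : Disjoint X0 Z2)
    (e10 : Disjoint X1 Z0) (e11 : Disjoint X1 Z1) (e12 : Disjoint X1 Z2)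
    (eY0 : Disjoint Z0 Y) (eY1 : Disjoint Z1 Y) (eY2 : Disjoint Z2 Y)
    (t00 : Tch G X0 Z0) (t01 : Tch G X0 Z1) (t02 : Tch G X0 Z2)
    (t10 : Tch G X1 Z0) (t11 : Tch G X1 Z1) (t12 : Tch G X1 Z2)
    (b0 : (Z0 ∩ B).Nonempty ∨ Tch G Z0 Y) (b1 : (Z1 ∩ B).Nonempty ∨ Tch G Z1 Y)
    (b2 : (Z2 ∩ B).Nonempty ∨ Tch G Z2 Y) : False := by
  refine h.2 (branch33 (fun i => match i with
    | 0 => some '' X0 | 1 => some '' X1 | 2 => up Y) (fun i => match i with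
    | 0 => some '' Z0 | 1 => some '' Z1 | 2 => some '' Z2) ?_ ?_ ?_ ?_ ?_ ?_ ?_ ?_)
  · intro i
    fin_cases i
    exacts [c0.some, c1.some, cY.conn]
  · intro i
    fin_cases i
    exacts [some_sub_up u0, some_sub_up u1, up_sub_up uY]
  · intro i
    fin_cases i
    exacts [c0'.some, c1'.some, c2'.some]
  · intro i
    fin_cases i
    exacts [some_sub_up u0', some_sub_up u1', some_sub_up u2']
  · intro i j hij
    fin_cases i <;> fin_cases j <;> first | exact absurd rfl hij | skip
    exacts [disj_some d01, disj_up d0Y, disj_some d01.symm, disj_up d1Y, (disj_up d0Y).symm,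
      (disj_up d1Y).symm]
  · intro i j hij
    fin_cases i <;> fin_cases j <;> first | exact absurd rfl hij | skip
    exacts [disj_some d01', disj_some d02', disj_some d01'.symm, disj_some d12',
      disj_some d02'.symm, disj_some d12'.symm]
  · intro i j
    fin_cases i <;> fin_cases j
    exacts [disj_some e00, disj_some e01, disj_some e02, disj_some e10, disj_some e11,
      disj_some e12, (disj_up eY0).symm, (disj_up eY1).symm, (disj_up eY2).symm]
  · intro i j
    fin_cases i <;> fin_cases j
    exacts [tch_some t00, tch_some t01, tch_some t02, tch_some t10, tch_some t11, tch_some t12,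
      (tch_up b0).symm, (tch_up b1).symm, (tch_up b2).symm]

lemma PL.k33 {U B : Set V} (h : PL G U B) (X0 X1 Y Z0 Z1 Z2 : Set V)
    (c0 : Conn G X0) (c1 : Conn G X1) (cY : Conn G Y)
    (c0' : Conn G Z0) (c1' : Conn G Z1) (c2' : Conn G Z2)
    (u0 : X0 ⊆ U) (u1 : X1 ⊆ U) (uY : Y ⊆ U) (u0' : Z0 ⊆ U) (u1' : Z1 ⊆ U) (u2' : Z2 ⊆ U)
    (d01 : Disjoint X0 X1) (d0Y : Disjoint X0 Y) (d1Y : Disjoint X1 Y)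
    (d01' : Disjoint Z0 Z1) (d02' : Disjoint Z0 Z2) (d12' : Disjoint Z1 Z2)
    (e00 : Disjoint X0 Z0) (e01 : Disjoint X0 Z1) (e02 : Disjoint X0 Z2)
    (e10 : Disjoint X1 Z0) (e11 : Disjoint X1 Z1) (e12 : Disjoint X1 Z2)
    (eY0 : Disjoint Z0 Y) (eY1 : Disjoint Z1 Y) (eY2 : Disjoint Z2 Y)
    (t00 : Tch G X0 Z0) (t01 : Tch G X0 Z1) (t02 : Tch G X0 Z2)
    (t10 : Tch G X1 Z0) (t11 : Tch G X1 Z1) (t12 : Tch G X1 Z2)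
    (b0 : Tch G Z0 Y) (b1 : Tch G Z1 Y) (b2 : Tch G Z2 Y) : False := by
  obtain ⟨y, hy⟩ := cY.1
  have h' : PL G U {y} := by
    refine PL.plus (h.mono subset_rfl (by simp)) y (uY hy)
  exact h'.k33a X0 X1 Y Z0 Z1 Z2 c0 c1 (cY.reach ⟨y, hy, rfl⟩) c0' c1' c2' u0 u1 uY u0' u1' u2'
    d01 d0Y d1Y d01' d02' d12' e00 e01 e02 e10 e11 e12 eY0 eY1 eY2 t00 t01 t02 t10 t11 t12
    (Or.inr b0) (Or.inr b1) (Or.inr b2)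

/-- no adjacent (or single) separating pair of boundary vertices -/
def NoSep (G : SimpleGraph V) (U B : Set V) : Prop :=
  ∀ x ∈ U ∩ B, ∀ y ∈ U ∩ B, (x = y ∨ G.Adj x y) → ∀ K ⊆ U \ {x, y}, K.Nonempty →
    Clo G (U \ {x, y}) K → U \ {x, y} ⊆ K

lemma NoSep.conn {U B : Set V} (h : NoSep G U B) {x y z : V} (hx : x ∈ U ∩ B) (hy : y ∈ U ∩ B)
    (hxy : x = y ∨ G.Adj x y) (hz : z ∈ U) (hzx : z ≠ x) (hzy : z ≠ y) :
    Conn G (U \ {x, y}) :=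
  ⟨⟨z, hz, by simp [hzx, hzy]⟩, h x hx y hy hxy⟩

/-- degree lemma -/
lemma NoSep.deg {U B : Set V} (hn : NoSep G U B) (h : PL G U B) {b b1 b2 b3 : V}
    (hb : b ∈ U ∩ B) (hb1 : b1 ∈ U ∩ B) (hb2 : b2 ∈ U ∩ B) (hb3 : b3 ∈ U ∩ B)
    (a1 : G.Adj b b1) (a2 : G.Adj b b2) (a3 : G.Adj b b3)
    (n12 : b1 ≠ b2) (n13 : b1 ≠ b3) (n23 : b2 ≠ b3) : False := by
  have n01 := a1.ne
  have n02 := a2.ne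
  have n03 := a3.ne
  have c1 : Conn G (U \ {b, b1}) := hn.conn hb hb1 (Or.inr a1) hb2.1 n02.symm n12.symm
  have c2 : Conn G (U \ {b, b2}) := hn.conn hb hb2 (Or.inr a2) hb1.1 n01.symm n12
  have c3 : Conn G (U \ {b, b3}) := hn.conn hb hb3 (Or.inr a3) hb1.1 n01.symm n13
  let p : Fin 5 → Option V := ![some b, some b1, some b2, some b3, none]
  let E : Fin 5 → Fin 5 → Set (Option V) := fun i j => match i, j with
    | 0, 1 => some '' {b, b1} | 1, 0 => some '' {b, b1}
    | 0, 2 => some '' {b, b2} | 2, 0 => some '' {b, b2}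
    | 0, 3 => some '' {b, b3} | 3, 0 => some '' {b, b3}
    | 2, 3 => some '' (U \ {b, b1}) | 3, 2 => some '' (U \ {b, b1})
    | 1, 3 => some '' (U \ {b, b2}) | 3, 1 => some '' (U \ {b, b2})
    | 1, 2 => some '' (U \ {b, b3}) | 2, 1 => some '' (U \ {b, b3})
    | 0, 4 => {some b, none} | 4, 0 => {some b, none}
    | 1, 4 => {some b1, none} | 4, 1 => {some b1, none}
    | 2, 4 => {some b2, none} | 4, 2 => {some b2, none}
    | 3, 4 => {some b3, none} | 4, 3 => {some b3, none}
    | _, _ => ∅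
  have main : ∀ i j : Fin 5, i < j → Conn (Ap G B) (E i j) ∧ E i j ⊆ up U ∧ p i ∈ E i j ∧
      p j ∈ E i j ∧ E i j = E j i := by
    intro i j hij
    fin_cases i <;> fin_cases j <;> first | exact absurd hij (by decide) | skip
    · exact ⟨(conn_pair a1).some, some_sub_up (by rintro x (rfl | rfl); exacts [hb.1, hb1.1]),
        by simp [p, E], by simp [p, E], rfl⟩
    · exact ⟨(conn_pair a2).some, some_sub_up (by rintro x (rfl | rfl); exacts [hb.1, hb2.1]),
        by simp [p, E], by simp [p, E], rfl⟩
    · exact ⟨(conn_pair a3).some, some_sub_up (by rintro x (rfl | rfl); exacts [hb.1, hb3.1]),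
        by simp [p, E], by simp [p, E], rfl⟩
    · refine ⟨conn_pair ?_, ?_, by simp [p, E], by simp [p, E], rfl⟩
      · exact hb.2
      · rintro x (rfl | rfl)
        · exact some_mem_up.2 hb.1
        · exact none_mem_up
    · refine ⟨c3.some, some_sub_up sdiff_subset, ?_, ?_, rfl⟩
      · exact ⟨b1, ⟨hb1.1, by simp [n01.symm, n13]⟩, rfl⟩
      · exact ⟨b2, ⟨hb2.1, by simp [n02.symm, n23]⟩, rfl⟩
    · refine ⟨c2.some, some_sub_up sdiff_subset, ?_, ?_, rfl⟩
      · exact ⟨b1, ⟨hb1.1, by simp [n01.symm, n12]⟩, rfl⟩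
      · exact ⟨b3, ⟨hb3.1, by simp [n03.symm, n23.symm]⟩, rfl⟩
    · refine ⟨conn_pair ?_, ?_, by simp [p, E], by simp [p, E], rfl⟩
      · exact hb1.2
      · rintro x (rfl | rfl)
        · exact some_mem_up.2 hb1.1
        · exact none_mem_up
    · refine ⟨c1.some, some_sub_up sdiff_subset, ?_, ?_, rfl⟩
      · exact ⟨b2, ⟨hb2.1, by simp [n02.symm, n12.symm]⟩, rfl⟩
      · exact ⟨b3, ⟨hb3.1, by simp [n03.symm, n13.symm]⟩, rfl⟩
    · refine ⟨conn_pair ?_, ?_, by simp [p, E], by simp [p, E], rfl⟩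
      · exact hb2.2
      · rintro x (rfl | rfl)
        · exact some_mem_up.2 hb2.1
        · exact none_mem_up
    · refine ⟨conn_pair ?_, ?_, by simp [p, E], by simp [p, E], rfl⟩
      · exact hb3.2
      · rintro x (rfl | rfl)
        · exact some_mem_up.2 hb3.1
        · exact none_mem_up
  have main' : ∀ i j : Fin 5, i ≠ j → Conn (Ap G B) (E i j) ∧ E i j ⊆ up U ∧ p i ∈ E i j ∧
      p j ∈ E i j ∧ E i j = E j i := by
    intro i j hij
    rcases lt_or_gt_of_ne hij with h | h
    · exact main i j h
    · obtain ⟨a, b, c, d, e⟩ := main j i h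
      rw [← e]
      exact ⟨a, b, d, c, rfl⟩
  have d2 : ∀ (A : Set V) (v : V), v ∉ A → Disjoint (some '' A) ({some v, none} : Set (Option V)) := by
    intro A v hv
    rw [disjoint_left]
    rintro _ ⟨a, ha, rfl⟩ h2
    simp only [mem_insert_iff, Option.some.injEq, mem_singleton_iff, reduceCtorEq, or_false] at h2
    exact hv (h2 ▸ ha)
  have dis : ∀ i j k l : Fin 5, i < j → k < l → i < k → j ≠ k → j ≠ l →
      Disjoint (E i j) (E k l) := by
    intro i j k l h1 h2 h3 h4 h5
    fin_cases i <;> fin_cases j <;> first | exact absurd h1 (by decide) | skip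
    all_goals fin_cases k <;> first | exact absurd h3 (by decide) | exact absurd rfl h4 | skip
    all_goals fin_cases l <;> first | exact absurd h2 (by decide) | exact absurd rfl h5 | skip
    · exact disj_some disjoint_sdiff_right
    · exact d2 _ _ (by simp [n02.symm, n12.symm])
    · exact d2 _ _ (by simp [n03.symm, n13.symm])
    · exact disj_some disjoint_sdiff_right
    · exact d2 _ _ (by simp [n01.symm, n12])
    · exact d2 _ _ (by simp [n03.symm, n23.symm])
    · exact disj_some disjoint_sdiff_right
    · exact d2 _ _ (by simp [n01.symm, n13])
    · exact d2 _ _ (by simp [n02.symm, n23])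
    · exact (d2 _ _ (by simp)).symm
    · exact (d2 _ _ (by simp)).symm
    · exact (d2 _ _ (by simp)).symm
    · exact d2 _ _ (by simp)
    · exact d2 _ _ (by simp)
    · exact (d2 _ _ (by simp)).symm
  refine h.1 ⟨p, E, main', ?_⟩
  have dis2 : ∀ i j k l : Fin 5, i < j → k < l → i ≠ k → i ≠ l → j ≠ k → j ≠ l →
      Disjoint (E i j) (E k l) := by
    intro i j k l h1 h2 h3 h4 h5 h6
    rcases lt_or_gt_of_ne h3 with h | h
    · exact dis i j k l h1 h2 h h5 h6
    · exact (dis k l i j h2 h1 h h4.symm h6.symm).symm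
  intro i j k l h1 h2 h3 h4 h5 h6
  rcases lt_or_gt_of_ne h1 with h | h <;> rcases lt_or_gt_of_ne h2 with h' | h'
  · exact dis2 i j k l h h' h3 h4 h5 h6
  · rw [(main' k l h2).2.2.2.2]
    exact dis2 i j l k h h' h4 h3 h6 h5
  · rw [(main' i j h1).2.2.2.2]
    exact dis2 j i k l h h' h5 h6 h3 h4
  · rw [(main' i j h1).2.2.2.2, (main' k l h2).2.2.2.2]
    exact dis2 j i l k h h' h6 h5 h4 h3

end shapes
end HC

namespace HC

/-! ### Colorings and Thomassen's theorem -/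
section col
variable {V : Type u} (G : SimpleGraph V)

def IsCol (U : Set V) (L : V → Finset ℕ) (φ : V → ℕ) : Prop :=
  (∀ v ∈ U, φ v ∈ L v) ∧ ∀ a ∈ U, ∀ b ∈ U, G.Adj a b → φ a ≠ φ b

def Col (U : Set V) (L : V → Finset ℕ) : Prop := ∃ φ, IsCol G U L φ

/-- list sizes outside the special set `S` -/
def Lst (U B S : Set V) (L : V → Finset ℕ) : Prop :=
  ∀ v ∈ U, v ∉ S → 3 ≤ (L v).card ∧ (v ∉ B → 5 ≤ (L v).card)

variable {G}

lemma IsCol.mono {U U' : Set V} {L L' : V → Finset ℕ} {φ : V → ℕ} (h : IsCol G U L φ)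
    (hU : U' ⊆ U) (hL : ∀ v ∈ U', L v ⊆ L' v) : IsCol G U' L' φ :=
  ⟨fun v hv => hL v hv (h.1 v (hU hv)), fun a ha b hb => h.2 a (hU ha) b (hU hb)⟩

lemma Col.mono {U U' : Set V} {L L' : V → Finset ℕ} (h : Col G U L)
    (hU : U' ⊆ U) (hL : ∀ v ∈ U', L v ⊆ L' v) : Col G U' L' := by
  obtain ⟨φ, h⟩ := h
  exact ⟨φ, h.mono hU hL⟩

open Classical in
lemma IsCol.glue {U1 U2 : Set V} {L : V → Finset ℕ} {φ1 φ2 : V → ℕ} (h1 : IsCol G U1 L φ1)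
    (h2 : IsCol G U2 L φ2)
    (h : ∀ a ∈ U1, ∀ b ∈ U2, b ∉ U1 → G.Adj a b → φ1 a ≠ φ2 b) :
    IsCol G (U1 ∪ U2) L (fun v => if v ∈ U1 then φ1 v else φ2 v) := by
  refine ⟨fun v hv => ?_, fun a ha b hb hab => ?_⟩
  · by_cases hv1 : v ∈ U1
    · simpa [hv1] using h1.1 v hv1
    · simpa [hv1] using h2.1 v (hv.resolve_left hv1)
  · by_cases ha1 : a ∈ U1 <;> by_cases hb1 : b ∈ U1 <;> simp only [ha1, hb1, if_true, if_false]
    · exact h1.2 a ha1 b hb1 hab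
    · exact h a ha1 b (hb.resolve_left hb1) hb1 hab
    · exact (h b hb1 a (ha.resolve_left ha1) ha1 hab.symm).symm
    · exact h2.2 a (ha.resolve_left ha1) b (hb.resolve_left hb1) hab

/-- extend a coloring of `U \ D` to `D` -/
lemma Col.extend {U D : Set V} {L : V → Finset ℕ} {φ ψ : V → ℕ} (h1 : IsCol G (U \ D) L φ)
    (h2 : IsCol G D L ψ) (h : ∀ a ∈ U \ D, ∀ b ∈ D, G.Adj a b → φ a ≠ ψ b) : Col G U L :=
  ⟨_, (h1.glue h2 fun a ha b hb _ => h a ha b hb).mono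
    (by intro x hx; by_cases hxD : x ∈ D; exacts [Or.inr hxD, Or.inl ⟨hx, hxD⟩])
    (fun _ _ => Finset.Subset.refl _)⟩

/-- extend a coloring of `U \ {v}` to `v` -/
lemma Col.extend1 {U : Set V} {v : V} {L : V → Finset ℕ} {φ : V → ℕ} (h1 : IsCol G (U \ {v}) L φ)
    {c : ℕ} (hc : c ∈ L v) (h : ∀ a ∈ U, G.Adj a v → φ a ≠ c) : Col G U L := by
  refine Col.extend h1 (ψ := fun _ => c) ⟨?_, ?_⟩ ?_
  · rintro x rfl; exact hc
  · rintro x rfl y rfl hxy; exact absurd hxy (G.irrefl)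
  · rintro a ha b rfl hab
    exact h a ha.1 hab

open Classical in
/-- removing colors `X` at vertices of `S` -/
noncomputable def rm (L : V → Finset ℕ) (S : Set V) (X : Finset ℕ) : V → Finset ℕ :=
  fun v => if v ∈ S then L v \ X else L v

lemma rm_sub (L : V → Finset ℕ) (S : Set V) (X : Finset ℕ) (v : V) : rm L S X v ⊆ L v := by
  unfold rm; split_ifs
  · exact Finset.sdiff_subset
  · exact Finset.Subset.refl _

lemma rm_mem {L : V → Finset ℕ} {S : Set V} {X : Finset ℕ} {v : V} (h : v ∈ S) :
    rm L S X v = L v \ X := by simp [rm, h]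

lemma rm_nmem {L : V → Finset ℕ} {S : Set V} {X : Finset ℕ} {v : V} (h : v ∉ S) :
    rm L S X v = L v := by simp [rm, h]

lemma exists_ne_of_two {X : Finset ℕ} (h : 2 ≤ X.card) (a : ℕ) : ∃ x ∈ X, x ≠ a := by
  by_contra hh
  push Not at hh
  have := Finset.card_le_card (show X ⊆ {a} from fun x hx => by simp [hh x hx])
  simp at this; omega

lemma card_sdiff_ge (A X : Finset ℕ) (n : ℕ) (h : n + X.card ≤ A.card) : n ≤ (A \ X).card := by
  have := Finset.le_card_sdiff X A
  omega

lemma exists_sub2 {A : Finset ℕ} (h : 2 ≤ A.card) : ∃ X ⊆ A, X.card = 2 :=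
  Finset.exists_subset_card_eq h

/-- Thomassen's theorem for sets smaller than `n`. -/
def TP (G : SimpleGraph V) (U : Set V) : Prop :=
  ∀ (B : Set V) (L : V → Finset ℕ) (p q : V) (f : V → ℕ), PL G U B → p ∈ U ∩ B → q ∈ U ∩ B →
    (p = q ∨ G.Adj p q) → (G.Adj p q → f p ≠ f q) → f p ∈ L p → f q ∈ L q →
    Lst U B {p, q} L → ∃ φ, IsCol G U L φ ∧ φ p = f p ∧ φ q = f q

lemma TP.zero {U B : Set V} {L : V → Finset ℕ} (h : TP G U) (hP : PL G U B)
    (hL : Lst U B ∅ L) : Col G U L := by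
  rcases (U ∩ B).eq_empty_or_nonempty with hB | ⟨p, hp⟩
  · rcases U.eq_empty_or_nonempty with hU | ⟨p, hp⟩
    · exact ⟨fun _ => 0, by simp [hU, IsCol]⟩
    · have h5 : ∀ v ∈ U, 5 ≤ (L v).card := by
        intro v hv
        refine (hL v hv (by simp)).2 fun hvB => ?_
        have : v ∈ U ∩ B := ⟨hv, hvB⟩
        simp [hB] at this
      have hne : (L p).Nonempty := by
        rw [← Finset.card_pos]; have := h5 p hp; omega
      obtain ⟨c, hc⟩ := hne
      obtain ⟨φ, hφ, _⟩ := h {p} L p p (fun _ => c)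
        (PL.plus (hP.mono subset_rfl (by simp)) p hp) ⟨hp, rfl⟩ ⟨hp, rfl⟩ (Or.inl rfl)
        (fun h => absurd h G.irrefl) hc hc
        (fun v hv _ => ⟨by have := h5 v hv; omega, fun _ => h5 v hv⟩)
      exact ⟨φ, hφ⟩
  · have hne : (L p).Nonempty := by
      rw [← Finset.card_pos]; have := (hL p hp.1 (by simp)).1; omega
    obtain ⟨c, hc⟩ := hne
    obtain ⟨φ, hφ, _⟩ := h B L p p (fun _ => c) hP hp hp (Or.inl rfl)
      (fun h => absurd h G.irrefl) hc hc (fun v hv _ => hL v hv (by simp))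
    exact ⟨φ, hφ⟩

/-- splitting along a clique of boundary vertices of size at most two -/
lemma TP.split {U B K : Set V} {L : V → Finset ℕ} {x y : V} {φ : V → ℕ}
    (hT : TP G (K ∪ {x, y})) (hP : PL G U B)
    (hx : x ∈ U ∩ B) (hy : y ∈ U ∩ B) (hxy : x = y ∨ G.Adj x y) (hK : K ⊆ U \ {x, y})
    (hcl : Clo G (U \ {x, y}) K) (hφ : IsCol G (U \ K) L φ)
    (hL : Lst K B ∅ L) : ∃ φ', IsCol G U L φ' ∧ ∀ v ∈ U \ K, φ' v = φ v := by
  classical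
  have hxK : x ∉ K := fun h => (hK h).2 (by simp)
  have hyK : y ∉ K := fun h => (hK h).2 (by simp)
  have hsub : K ∪ {x, y} ⊆ U := by
    rintro v (h | rfl | rfl)
    exacts [(hK h).1, hx.1, hy.1]
  obtain ⟨ψ, hψ, hψx, hψy⟩ := hT B L x y φ (hP.mono hsub inter_subset_left)
    ⟨Or.inr (by simp), hx.2⟩ ⟨Or.inr (by simp), hy.2⟩ hxy
    (hφ.2 x ⟨hx.1, hxK⟩ y ⟨hy.1, hyK⟩) (hφ.1 x ⟨hx.1, hxK⟩) (hφ.1 y ⟨hy.1, hyK⟩)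
    (by
      rintro v (hv | hv) hv'
      · exact hL v hv (by simp)
      · exact absurd hv hv')
  have hg := hφ.glue (hψ.mono subset_union_left (fun _ _ => Finset.Subset.refl _)) (by
    intro a ha b hb _ hab
    by_cases hax : a = x
    · subst hax; rw [← hψx]
      exact hψ.2 a (Or.inr (by simp)) b (Or.inl hb) hab
    by_cases hay : a = y
    · subst hay; rw [← hψy]
      exact hψ.2 a (Or.inr (by simp)) b (Or.inl hb) hab
    exact absurd (hcl b hb a ⟨ha.1, by simp [hax, hay]⟩ hab.symm) ha.2)
  refine ⟨_, hg.mono ?_ (fun _ _ => Finset.Subset.refl _), fun v hv => by simp [hv]⟩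
  intro v hv
  by_cases h : v ∈ K
  exacts [Or.inr h, Or.inl ⟨hv, h⟩]

variable [Finite V]

theorem thomassen (U : Set V) : TP G U := by
  induction hn : U.ncard using Nat.strong_induction_on generalizing U with
  | _ n ih =>
  have IH : ∀ U' : Set V, U' ⊂ U → TP G U' := fun U' h =>
    ih U'.ncard (hn ▸ Set.ncard_lt_ncard h) U' rfl
  clear ih hn
  intro B L p q f hP hp hq hpq hf hfp hfq hL
  by_cases hns : NoSep G U B
  swap
  · unfold NoSep at hns
    push Not at hns
    obtain ⟨x, hx, y, hy, hxy, K, hK, hKne, hcl, hnot⟩ := hns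
    -- choose the side without `p, q`
    have main : ∀ K ⊆ U \ {x, y}, K.Nonempty → ((U \ {x, y}) \ K).Nonempty →
        Clo G (U \ {x, y}) K → p ∉ K → q ∉ K →
        ∃ φ, IsCol G U L φ ∧ φ p = f p ∧ φ q = f q := by
      intro K hK ⟨k, hk⟩ ⟨k', hk'⟩ hcl hpK hqK
      obtain ⟨φ, hφ, hφp, hφq⟩ := IH (U \ K) ⟨sdiff_subset, fun h => (h (hK hk).1).2 hk⟩ B L p q f
        (hP.mono sdiff_subset inter_subset_left) ⟨⟨hp.1, hpK⟩, hp.2⟩ ⟨⟨hq.1, hqK⟩, hq.2⟩ hpq hf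
        hfp hfq (fun v hv h => hL v hv.1 h)
      have hss : K ∪ {x, y} ⊂ U := by
        refine ⟨?_, fun h => ?_⟩
        · rintro v (h | rfl | rfl)
          exacts [(hK h).1, hx.1, hy.1]
        · rcases h hk'.1.1 with h | h
          · exact hk'.2 h
          · exact hk'.1.2 h
      obtain ⟨φ', h1, h2⟩ := TP.split (IH _ hss) hP hx hy hxy hK hcl hφ (by
        intro v hv _
        refine hL v (hK hv).1 ?_
        rintro (rfl | rfl)
        exacts [hpK hv, hqK hv])
      exact ⟨φ', h1, by rw [h2 p ⟨hp.1, hpK⟩, hφp], by rw [h2 q ⟨hq.1, hqK⟩, hφq]⟩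
    obtain ⟨k', hk', hk'K⟩ := not_subset.1 hnot
    by_cases hpqK : p ∉ K ∧ q ∉ K
    · exact main K hK hKne ⟨k', hk', hk'K⟩ hcl hpqK.1 hpqK.2
    · obtain ⟨k, hk⟩ := hKne
      have hcl' := hcl.compl hK
      refine main ((U \ {x, y}) \ K) sdiff_subset ⟨k', hk', hk'K⟩ ⟨k, hK hk, fun h => h.2 hk⟩
        hcl' ?_ ?_
      · intro h
        have : q ∈ K := by
          by_contra hq'; exact hpqK ⟨h.2, hq'⟩
        rcases hpq with rfl | hpq
        · exact h.2 this
        · exact h.2 (hcl q this p h.1 hpq.symm)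
      · intro h
        have : p ∈ K := by
          by_contra hq'; exact hpqK ⟨hq', h.2⟩
        rcases hpq with rfl | hpq
        · exact h.2 this
        · exact h.2 (hcl p this q h.1 hpq)
  by_cases hv : ∃ v ∈ U ∩ B, v ≠ p ∧ v ≠ q ∧ G.Adj p v
  · obtain ⟨v, hv, hvp, hvq, hpv⟩ := hv
    have hLv := (hL v hv.1 (by simp [hvp, hvq])).1
    obtain ⟨X, hX, hX2⟩ := exists_sub2 (A := L v \ {f p}) (card_sdiff_ge _ _ _ (by simp; omega))
    have hss : U \ {v} ⊂ U := ⟨sdiff_subset, fun h => (h hv.1).2 rfl⟩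
    have hPL : PL G (U \ {v}) (B ∪ Nb G {v}) := hP.expose (by simpa using hv.1)
      (reach_of_subset (by simpa using hv.2))
    obtain ⟨φ, hφ, hφp, hφq⟩ := IH _ hss (B ∪ Nb G {v}) (rm L (Nb G {v} \ B) X) p q f hPL
      ⟨⟨hp.1, by simpa using hvp.symm⟩, Or.inl hp.2⟩ ⟨⟨hq.1, by simpa using hvq.symm⟩, Or.inl hq.2⟩
      hpq hf
      (by rw [rm_nmem (fun h => h.2 hp.2)]; exact hfp)
      (by rw [rm_nmem (fun h => h.2 hq.2)]; exact hfq)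
      (by
        intro z hz hz'
        have := hL z hz.1 hz'
        by_cases hzS : z ∈ Nb G {v} \ B
        · rw [rm_mem hzS]
          refine ⟨card_sdiff_ge _ _ _ ?_, fun h => absurd (Or.inr hzS.1) h⟩
          have := this.2 hzS.2; omega
        · rw [rm_nmem hzS]
          exact ⟨this.1, fun h => this.2 fun hB => h (Or.inl hB)⟩)
    -- pick the color of `v`
    obtain ⟨c, hc, hcu⟩ : ∃ c ∈ X, ∀ u ∈ U ∩ B, u ≠ p → G.Adj u v → φ u ≠ c := by
      by_cases hu : ∃ u ∈ U ∩ B, u ≠ p ∧ G.Adj u v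
      · obtain ⟨u, hu, hup, huv⟩ := hu
        obtain ⟨c, hc, hcu⟩ := exists_ne_of_two (X := X) (by omega) (φ u)
        refine ⟨c, hc, fun u' hu' hu'p hu'v => ?_⟩
        by_cases huu : u' = u
        · subst huu; exact hcu.symm
        · exact (hns.deg hP hv hp hu hu' hpv.symm huv.symm hu'v.symm hup.symm hu'p.symm
            (Ne.symm huu)).elim
      · push Not at hu
        have : X.Nonempty := by rw [← Finset.card_pos]; omega
        obtain ⟨c, hc⟩ := this
        exact ⟨c, hc, fun u h1 h2 h3 => absurd h3 (hu u h1 h2)⟩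
    have hcL : c ∈ L v \ {f p} := hX hc
    simp only [Finset.mem_sdiff, Finset.mem_singleton] at hcL
    classical
    have hfin := (hφ.mono subset_rfl (L' := L) (fun z _ => rm_sub _ _ _ z)).glue
      (U2 := {v}) (φ2 := fun _ => c) (by
        refine ⟨?_, ?_⟩
        · rintro x rfl; exact hcL.1
        · rintro x rfl y rfl hxy; exact absurd hxy (G.irrefl)) (by
        rintro a ha b rfl _ hab
        by_cases haB : a ∈ B
        · by_cases hap : a = p
          · rw [hap, hφp]; exact Ne.symm hcL.2
          · exact hcu a ⟨ha.1, haB⟩ hap hab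
        · have := hφ.1 a ha
          rw [rm_mem (show a ∈ Nb G {b} \ B from ⟨⟨b, rfl, hab.symm⟩, haB⟩)] at this
          rintro rfl
          exact (Finset.mem_sdiff.1 this).2 hc)
    refine ⟨_, hfin.mono (by intro x hx; by_cases h : x = v; exacts [Or.inr h, Or.inl ⟨hx, h⟩])
      (fun _ _ => Finset.Subset.refl _), ?_, ?_⟩
    · simp [hp.1, hvp.symm, hφp]
    · simp [hq.1, hvq.symm, hφq]
  · push Not at hv
    have hss : U \ {p} ⊂ U := ⟨sdiff_subset, fun h => (h hp.1).2 rfl⟩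
    have hPL : PL G (U \ {p}) (B ∪ Nb G {p}) := hP.expose (by simpa using hp.1)
      (reach_of_subset (by simpa using hp.2))
    have hLst : Lst (U \ {p}) (B ∪ Nb G {p}) {q} (rm L (Nb G {p} \ B) {f p}) := by
      intro z hz hz'
      have := hL z hz.1 (by
        rintro (h | h)
        exacts [hz.2 h, hz' h])
      by_cases hzS : z ∈ Nb G {p} \ B
      · rw [rm_mem hzS]
        refine ⟨card_sdiff_ge _ _ _ ?_, fun h => absurd (Or.inr hzS.1) h⟩
        have := this.2 hzS.2; simp; omega
      · rw [rm_nmem hzS]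
        exact ⟨this.1, fun h => this.2 fun hB => h (Or.inl hB)⟩
    obtain ⟨φ, hφ, hφq⟩ : ∃ φ, IsCol G (U \ {p}) (rm L (Nb G {p} \ B) {f p}) φ ∧
        (q ≠ p → φ q = f q) := by
      by_cases hqp : q = p
      · subst hqp
        obtain ⟨φ, hφ⟩ := (IH _ hss).zero hPL (by
          intro v hv _; exact hLst v hv hv.2)
        exact ⟨φ, hφ, fun h => absurd rfl h⟩
      · obtain ⟨φ, hφ, h, _⟩ := IH _ hss _ (rm L (Nb G {p} \ B) {f p}) q q f hPL
          ⟨⟨hq.1, hqp⟩, Or.inl hq.2⟩ ⟨⟨hq.1, hqp⟩, Or.inl hq.2⟩ (Or.inl rfl)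
          (fun h => absurd h G.irrefl) (by rw [rm_nmem (fun h => h.2 hq.2)]; exact hfq)
          (by rw [rm_nmem (fun h => h.2 hq.2)]; exact hfq) (by simpa using hLst)
        exact ⟨φ, hφ, fun _ => h⟩
    classical
    have hfin := (hφ.mono subset_rfl (L' := L) (fun z _ => rm_sub _ _ _ z)).glue
      (U2 := {p}) (φ2 := fun _ => f p) (by
        refine ⟨?_, ?_⟩
        · rintro x rfl; exact hfp
        · rintro x rfl y rfl hxy; exact absurd hxy (G.irrefl)) (by
        rintro a ha b rfl _ hab
        by_cases haB : a ∈ B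
        · by_cases haq : a = q
          · subst haq
            rw [hφq hab.ne]
            exact (hf hab.symm).symm
          · exact absurd hab.symm (hv a ⟨ha.1, haB⟩ hab.ne haq)
        · have := hφ.1 a ha
          rw [rm_mem (show a ∈ Nb G {b} \ B from ⟨⟨b, rfl, hab.symm⟩, haB⟩)] at this
          intro h
          rw [h] at this
          simp at this)
    refine ⟨_, hfin.mono (by intro x hx; by_cases h : x = p; exacts [Or.inr h, Or.inl ⟨hx, h⟩])
      (fun _ _ => Finset.Subset.refl _), ?_, ?_⟩
    · simp
    · by_cases hqp : q = p
      · subst hqp; simp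
      · simp [hq.1, hqp, hφq hqp]

end col
end HC

namespace HC

/-! ### Two-colorings of runs of boundary vertices -/
section runs
variable {V : Type u} {G : SimpleGraph V}

/-- every vertex of `S` has at most two neighbours in `C` -/
def Deg2 (G : SimpleGraph V) (S C : Set V) : Prop :=
  ∀ v ∈ S, ∀ a ∈ C, ∀ b ∈ C, ∀ c ∈ C, G.Adj v a → G.Adj v b → G.Adj v c → a = b ∨ a = c ∨ b = c

def TwoCol (G : SimpleGraph V) (S : Set V) : Prop :=
  ∃ g : V → Bool, ∀ a ∈ S, ∀ b ∈ S, G.Adj a b → g a ≠ g b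

lemma Deg2.mono {S C S' C' : Set V} (h : Deg2 G S C) (hS : S' ⊆ S) (hC : C' ⊆ C) :
    Deg2 G S' C' := fun v hv a ha b hb c hc =>
  h v (hS hv) a (hC ha) b (hC hb) c (hC hc)

lemma TwoCol.mono {S S' : Set V} (h : TwoCol G S) (hS : S' ⊆ S) : TwoCol G S' := by
  obtain ⟨g, hg⟩ := h
  exact ⟨g, fun a ha b hb => hg a (hS ha) b (hS hb)⟩

lemma Conn.exit {C T : Set V} (hC : Conn G C) (hT : T ⊆ C) (hne : T.Nonempty)
    (hneq : ¬ C ⊆ T) : ∃ v ∈ T, ∃ u ∈ C, u ∉ T ∧ G.Adj v u := by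
  by_contra h
  push Not at h
  refine hneq (hC.2 T hT hne fun a ha b hb hab => ?_)
  by_contra hbT
  exact h a ha b hb hbT hab

variable [Finite V]

lemma bip {C S : Set V} (hC : Conn G C) (hS : S ⊆ C) (hne : ¬ C ⊆ S) (hd : Deg2 G S C) :
    TwoCol G S := by
  classical
  induction hn : S.ncard using Nat.strong_induction_on generalizing S with
  | _ n ih =>
  rcases S.eq_empty_or_nonempty with rfl | hSne
  · exact ⟨fun _ => true, by simp⟩
  obtain ⟨v, hv, u, hu, huS, hvu⟩ := hC.exit hS hSne hne
  have hss : S \ {v} ⊂ S := ⟨sdiff_subset, fun h => (h hv).2 rfl⟩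
  obtain ⟨g, hg⟩ := ih _ (hn ▸ Set.ncard_lt_ncard hss) (S := S \ {v}) (hss.subset.trans hS)
    (fun h => hne (h.trans hss.subset)) (hd.mono hss.subset subset_rfl) rfl
  have key : ∃ c : Bool, ∀ a ∈ S, G.Adj v a → g a ≠ c := by
    by_cases h : ∃ a ∈ S, G.Adj v a
    · obtain ⟨a, ha, hva⟩ := h
      refine ⟨!g a, fun a' ha' hva' => ?_⟩
      rcases hd v hv a (hS ha) a' (hS ha') u hu hva hva' hvu with h | h | h
      · subst h; simp
      · subst h; exact absurd ha huS
      · subst h; exact absurd ha' huS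
    · push Not at h
      exact ⟨true, fun a ha hva => absurd hva (h a ha)⟩
  obtain ⟨c, hc⟩ := key
  refine ⟨Function.update g v c, fun a ha b hb hab => ?_⟩
  by_cases hav : a = v
  · subst hav
    rw [Function.update_self, Function.update_of_ne hab.ne']
    exact (hc b hb hab).symm
  · by_cases hbv : b = v
    · subst hbv
      rw [Function.update_self, Function.update_of_ne hav]
      exact hc a ha hab.symm
    · rw [Function.update_of_ne hav, Function.update_of_ne hbv]
      exact hg a ⟨ha, hav⟩ b ⟨hb, hbv⟩ hab

/-- removing a vertex with one neighbour keeps connectedness -/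
lemma Conn.leaf {S : Set V} (hS : Conn G S) {b b' : V} (hb : b ∈ S) (hb' : b' ∈ S)
    (hbb : b' ≠ b) (h : ∀ v ∈ S, G.Adj b v → v = b') : Conn G (S \ {b}) := by
  refine ⟨⟨b', hb', hbb⟩, fun T hT hne hcl => ?_⟩
  by_cases h' : b' ∈ T
  · have := hS.2 (Insert.insert b T) (by
      rintro x (rfl | hx)
      exacts [hb, (hT hx).1]) ⟨b, Or.inl rfl⟩ (by
      rintro x (rfl | hx) y hy hxy
      · exact Or.inr (h y hy hxy ▸ h')
      · by_cases hyb : y = b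
        · exact Or.inl hyb
        · exact Or.inr (hcl x hx y ⟨hy, hyb⟩ hxy))
    intro x hx
    rcases this hx.1 with h | h
    · exact absurd h hx.2
    · exact h
  · have := hS.2 T (hT.trans sdiff_subset) hne (by
      intro x hx y hy hxy
      by_cases hyb : y = b
      · subst hyb
        have := h x (hT hx).1 hxy.symm
        subst this
        exact absurd hx h'
      · exact hcl x hx y ⟨hy, hyb⟩ hxy)
    exact absurd rfl (hT (this hb)).2

lemma ports {C S : Set V} (hS : Conn G S) (hSC : S ⊆ C) (hd : Deg2 G S C) {b u : V} (hb : b ∈ S)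
    (hu : u ∈ C) (huS : u ∉ S) (hbu : G.Adj b u) :
    ∃ b2 u2 : V, ∀ v ∈ S, ∀ t ∈ C, t ∉ S → G.Adj v t → (v = b ∧ t = u) ∨ (v = b2 ∧ t = u2) := by
  classical
  induction hn : S.ncard using Nat.strong_induction_on generalizing S b u with
  | _ n ih =>
  by_cases hsub : S ⊆ {b}
  · by_cases h : ∃ t ∈ C, t ∉ S ∧ t ≠ u ∧ G.Adj b t
    · obtain ⟨t, ht, htS, htu, hbt⟩ := h
      refine ⟨b, t, fun v hv t' ht' ht'S hvt' => ?_⟩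
      have hvb : v = b := hsub hv
      subst hvb
      rcases hd v hb t ht t' ht' u hu hbt hvt' hbu with h | h | h
      · exact Or.inr ⟨rfl, h.symm⟩
      · exact absurd h htu
      · exact Or.inl ⟨rfl, h⟩
    · push Not at h
      refine ⟨b, u, fun v hv t' ht' ht'S hvt' => ?_⟩
      have hvb : v = b := hsub hv
      subst hvb
      by_contra hh
      push Not at hh
      exact h t' ht' ht'S (hh.1 rfl) hvt'
  · obtain ⟨x, hx, b', hb', hb'b, hbb'⟩ := hS.exit (T := {b}) (by simpa using hb) ⟨b, rfl⟩ hsub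
    simp only [mem_singleton_iff] at hx hb'b
    subst hx
    have hnb : ∀ t ∈ C, G.Adj x t → t = u ∨ t = b' := by
      intro t ht hxt
      rcases hd x hb t ht u hu b' (hSC hb') hxt hbu hbb' with h | h | h
      · exact Or.inl h
      · exact Or.inr h
      · subst h; exact absurd hb' huS
    have hcon := hS.leaf hb hb' hb'b (fun v hv hxv => (hnb v (hSC hv) hxv).resolve_left
      (fun h => huS (h ▸ hv)))
    have hss : S \ {x} ⊂ S := ⟨sdiff_subset, fun h => (h hb).2 rfl⟩
    obtain ⟨b2, u2, h2⟩ := ih _ (hn ▸ Set.ncard_lt_ncard hss) hcon (hss.subset.trans hSC)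
      (hd.mono hss.subset subset_rfl) (b := b') (u := x) ⟨hb', hb'b⟩ (hSC hb) (by simp) hbb'.symm rfl
    refine ⟨b2, u2, fun v hv t ht htS hvt => ?_⟩
    by_cases hvx : v = x
    · subst hvx
      rcases hnb t ht hvt with h | h
      · exact Or.inl ⟨rfl, h⟩
      · subst h; exact absurd hb' htS
    · rcases h2 v ⟨hv, hvx⟩ t ht (fun h => htS h.1) hvt with h | h
      · exact absurd hb (h.2 ▸ htS)
      · exact Or.inr h

/-- deleting a vertex from a non-2-colorable run keeps it connected -/
lemma cyc_del {P : Set V} (hP : Conn G P) (hd : Deg2 G P P) (hn : ¬ TwoCol G P) {x : V}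
    (hx : x ∈ P) (hne : ¬ P ⊆ {x}) : Conn G (P \ {x}) := by
  classical
  obtain ⟨z, hz, hzx⟩ := not_subset.1 hne
  refine ⟨⟨z, hz, hzx⟩, fun T hT hTne hcl => ?_⟩
  by_contra hcon
  apply hn
  obtain ⟨g, hg⟩ := bip hP (sdiff_subset : P \ {x} ⊆ P) (fun h => (h hx).2 rfl)
    (hd.mono sdiff_subset subset_rfl)
  -- both sides touch `x`
  have touch : ∀ T ⊆ P \ {x}, T.Nonempty → Clo G (P \ {x}) T → ∃ t ∈ T, G.Adj x t := by
    intro T hT hTne hcl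
    obtain ⟨v, hv, u, hu, huT, hvu⟩ := hP.exit (hT.trans sdiff_subset) hTne
      (fun h => (hT (h hx)).2 rfl)
    have : u = x := by
      by_contra hux
      exact huT (hcl v hv u ⟨hu, hux⟩ hvu)
    subst this
    exact ⟨v, hv, hvu.symm⟩
  obtain ⟨t1, ht1, ha1⟩ := touch T hT hTne hcl
  obtain ⟨y, hy, hyT⟩ := not_subset.1 hcon
  obtain ⟨t2, ht2, ha2⟩ := touch ((P \ {x}) \ T) sdiff_subset ⟨y, hy, hyT⟩ (hcl.compl hT)
  have h12 : t1 ≠ t2 := fun h => ht2.2 (h ▸ ht1)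
  have hnb : ∀ t ∈ P, G.Adj x t → t = t1 ∨ t = t2 := by
    intro t ht hxt
    rcases hd x hx t ht t1 (hT ht1).1 t2 ht2.1.1 hxt ha1 ha2 with h | h | h
    exacts [Or.inl h, Or.inr h, absurd h h12]
  refine ⟨fun v => if v = x then true else if v ∈ T then xor (g v) (g t1) else xor (g v) (g t2), ?_⟩
  have hxt : ∀ t ∈ P, G.Adj x t →
      (if t = x then true else if t ∈ T then xor (g t) (g t1) else xor (g t) (g t2)) = false := by
    intro t ht hxt
    rw [if_neg hxt.ne']
    rcases hnb t ht hxt with rfl | rfl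
    · simp [ht1]
    · simp [ht2.2]
  intro a ha b hb hab
  by_cases hax : a = x
  · subst hax
    simp only [if_true]
    rw [hxt b hb hab]; simp
  · by_cases hbx : b = x
    · subst hbx
      simp only [if_true]
      rw [hxt a ha hab.symm]; simp
    · have h1 := hg a ⟨ha, hax⟩ b ⟨hb, hbx⟩ hab
      simp only [hax, hbx, if_false]
      by_cases haT : a ∈ T
      · have hbT := hcl a haT b ⟨hb, hbx⟩ hab
        simpa [haT, hbT] using h1
      · have hbT : b ∉ T := fun h => haT (hcl b h a ⟨ha, hax⟩ hab.symm)
        simpa [haT, hbT] using h1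

lemma cyc {U B P : Set V} {w : V} (hPL : PL G U B) (hns : NoSep G U B) (hP : Conn G P)
    (hPB : P ⊆ U ∩ B) (hcl : Clo G (U ∩ B) P) (hw : w ∈ U ∩ B) (hwP : w ∉ P)
    (hd : Deg2 G P P) : TwoCol G P := by
  classical
  by_contra hn
  set K := comp G (U \ P) w with hK
  have hwU : w ∈ U \ P := ⟨hw.1, hwP⟩
  have hKc : Conn G K := comp_conn hwU
  have hwK : w ∈ K := mem_comp hwU
  have hKs : K ⊆ U \ P := comp_subset _ _
  have hKcl : Clo G (U \ P) K := comp_clo _ _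
  have hnot2 : ∀ x y, ¬ P ⊆ {x, y} := by
    intro x y h
    apply hn
    refine ⟨fun v => decide (v = x), fun a ha b hb hab => ?_⟩
    have hne := hab.ne
    rcases h ha with h1 | h1 <;> rcases h hb with h2 | h2
    · exact absurd (h1.trans h2.symm) hne
    · simp only [mem_singleton_iff] at h2; subst h1; subst h2; simp [hne.symm]
    · simp only [mem_singleton_iff] at h1; subst h1; subst h2; simp [hne]
    · simp only [mem_singleton_iff] at h1 h2; exact absurd (h1.trans h2.symm) hne
  have hnot1 : ∀ x, ¬ P ⊆ {x} := fun x h => hnot2 x x (by simpa using h)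
  -- attachments
  have small : ∀ x ∈ P, ∀ y ∈ P, (x = y ∨ G.Adj x y) → ∃ z ∈ P, z ≠ x ∧ z ≠ y ∧ Tch G {z} K := by
    intro x hx y hy hxy
    by_contra hcon
    push Not at hcon
    have h1 : Clo G (U \ {x, y}) K := by
      intro a ha b hb hab
      by_cases hbP : b ∈ P
      · have hb2 := hb.2
        simp only [mem_insert_iff, mem_singleton_iff, not_or] at hb2
        exact absurd ⟨b, rfl, a, ha, hab.symm⟩ (hcon b hbP hb2.1 hb2.2)
      · exact hKcl a ha b ⟨hb.1, hbP⟩ hab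
    have h2 := hns x (hPB hx) y (hPB hy) hxy K (fun v hv => ⟨(hKs hv).1, by
      rintro (rfl | rfl)
      exacts [(hKs hv).2 hx, (hKs hv).2 hy]⟩) hKc.1 h1
    apply hnot2 x y
    intro v hv
    by_contra hvxy
    exact (hKs (h2 ⟨(hPB hv).1, hvxy⟩)).2 hv
  have hPU : P ⊆ U := fun v hv => (hPB hv).1
  have hKU : K ⊆ U := fun v hv => (hKs hv).1
  have hdK : ∀ S ⊆ P, Disjoint S K := fun S hS => disjoint_left.2 fun v hv hv' => (hKs hv').2 (hS hv)
  have hadj : ∀ x ∈ P, ∀ y ∈ P, x ≠ y → Tch G {x} K → Tch G {y} K → G.Adj x y := by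
    intro x hx y hy hxy tx ty
    by_contra hnadj
    have cx := cyc_del hP hd hn hx (hnot1 x)
    have cy := cyc_del hP hd hn hy (hnot1 y)
    -- two neighbours of x
    have two : ∀ x ∈ P, ∃ x1 ∈ P, ∃ x2 ∈ P, x1 ≠ x2 ∧ G.Adj x x1 ∧ G.Adj x x2 := by
      intro x hx
      by_contra h2
      push Not at h2
      apply hn
      obtain ⟨g, hg⟩ := bip hP (sdiff_subset : P \ {x} ⊆ P) (fun h => (h hx).2 rfl)
        (hd.mono sdiff_subset subset_rfl)
      obtain ⟨v, hv, x1, hx1, hx1v, hvx1⟩ := hP.exit (T := {x}) (by simpa using hx) ⟨x, rfl⟩ (hnot1 x)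
      simp only [mem_singleton_iff] at hv
      subst hv
      have huniq : ∀ b ∈ P, G.Adj v b → b = x1 := by
        intro b hb hvb
        by_contra hne
        exact h2 b hb x1 hx1 hne hvb hvx1
      refine ⟨Function.update g v (!g x1), fun a ha b hb hab => ?_⟩
      by_cases hav : a = v
      · subst hav
        rw [Function.update_self, Function.update_of_ne hab.ne', huniq b hb hab]
        simp
      · by_cases hbv : b = v
        · subst hbv
          rw [Function.update_self, Function.update_of_ne hav, huniq a ha hab.symm]
          simp
        · rw [Function.update_of_ne hav, Function.update_of_ne hbv]
          exact hg a ⟨ha, hav⟩ b ⟨hb, hbv⟩ hab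
    obtain ⟨x1, hx1, x2, hx2, hx12, hax1, hax2⟩ := two x hx
    have hx1y : x1 ≠ y := fun h => hnadj (h ▸ hax1)
    have hx2y : x2 ≠ y := fun h => hnadj (h ▸ hax2)
    have m1 : x1 ∈ P \ {x, y} := ⟨hx1, by simp [hax1.ne', hx1y]⟩
    have m2 : x2 ∈ P \ {x, y} := ⟨hx2, by simp [hax2.ne', hx2y]⟩
    -- closed sets of P \ {x,y} touch both x and y
    have toy : ∀ A ⊆ P \ {x, y}, A.Nonempty → Clo G (P \ {x, y}) A → Tch G A {y} := by
      intro A hA hAne hAcl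
      obtain ⟨v, hv, u, hu, huA, hvu⟩ := cx.exit (T := A)
        (fun v hv => ⟨(hA hv).1, fun h => (hA hv).2 (Or.inl h)⟩) hAne
        (fun h => (hA (h ⟨hy, hxy.symm⟩)).2 (Or.inr rfl))
      have : u = y := by
        by_contra huy
        exact huA (hAcl v hv u ⟨hu.1, by
          rintro (h | h)
          exacts [hu.2 h, huy h]⟩ hvu)
      subst this
      exact ⟨v, hv, u, rfl, hvu⟩
    have tox : ∀ A ⊆ P \ {x, y}, A.Nonempty → Clo G (P \ {x, y}) A → Tch G A {x} := by
      intro A hA hAne hAcl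
      obtain ⟨v, hv, u, hu, huA, hvu⟩ := cy.exit (T := A)
        (fun v hv => ⟨(hA hv).1, fun h => (hA hv).2 (Or.inr h)⟩) hAne
        (fun h => (hA (h ⟨hx, hxy⟩)).2 (Or.inl rfl))
      have : u = x := by
        by_contra huy
        exact huA (hAcl v hv u ⟨hu.1, by
          rintro (h | h)
          exacts [huy h, hu.2 h]⟩ hvu)
      subst this
      exact ⟨v, hv, u, rfl, hvu⟩
    set A1 := comp G (P \ {x, y}) x1 with hA1
    set A2 := comp G (P \ {x, y}) x2 with hA2
    have cA1 : Conn G A1 := comp_conn m1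
    have cA2 : Conn G A2 := comp_conn m2
    have sA1 : A1 ⊆ P \ {x, y} := comp_subset _ _
    have sA2 : A2 ⊆ P \ {x, y} := comp_subset _ _
    have clA1 : Clo G (P \ {x, y}) A1 := comp_clo _ _
    have clA2 : Clo G (P \ {x, y}) A2 := comp_clo _ _
    have hdis : Disjoint A1 A2 := by
      by_contra hnd
      obtain ⟨v, hv1, hv2⟩ := not_disjoint_iff.1 hnd
      have hsub := cA2.subset_of_clo sA2 clA1 ⟨v, hv2, hv1⟩
      have hx2A : x2 ∈ A1 := hsub (mem_comp m2)
      -- y's neighbours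
      obtain ⟨y1, hy1, y2, hy2, hy12, hay1, hay2⟩ := two y hy
      have all : P \ {x, y} ⊆ A1 := by
        intro v hv
        by_contra hvA
        obtain ⟨u, hu, z, hz, huz⟩ := tox ((P \ {x, y}) \ A1) sdiff_subset ⟨v, hv, hvA⟩
          (clA1.compl sA1)
        simp only [mem_singleton_iff] at hz
        subst hz
        rcases hd z hx u hu.1.1 x1 hx1 x2 hx2 huz.symm hax1 hax2 with h | h | h
        · exact hu.2 (h ▸ mem_comp m1)
        · exact hu.2 (h ▸ hx2A)
        · exact hx12 h
      have my1 : y1 ∈ A1 := all ⟨hy1, by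
        rintro (h | h)
        · exact hnadj (h ▸ hay1.symm)
        · exact hay1.ne' h⟩
      have my2 : y2 ∈ A1 := all ⟨hy2, by
        rintro (h | h)
        · exact hnadj (h ▸ hay2.symm)
        · exact hay2.ne' h⟩
      have hxA : x ∉ A1 := fun h => (sA1 h).2 (Or.inl rfl)
      have hyA : y ∉ A1 := fun h => (sA1 h).2 (Or.inr rfl)
      obtain ⟨b2, u2, hp⟩ := ports cA1 (sA1.trans sdiff_subset) (hd.mono (sA1.trans sdiff_subset) subset_rfl)
        (mem_comp m1) hx hxA hax1.symm
      have e1 := hp x2 hx2A x hx hxA hax2.symm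
      have e2 := hp y1 my1 y hy hyA hay1.symm
      have e3 := hp y2 my2 y hy hyA hay2.symm
      rcases e1 with e1 | e1
      · exact hx12 e1.1.symm
      rcases e2 with e2 | e2
      · exact hxy e2.2.symm
      · exact hxy (e1.2.trans e2.2.symm)
    refine hPL.k33a {x} {y} ∅ A1 A2 K (conn_singleton _) (conn_singleton _) reach_empty cA1 cA2 hKc
      (by simpa using hPU hx) (by simpa using hPU hy) (by simp)
      (sA1.trans (sdiff_subset.trans hPU)) (sA2.trans (sdiff_subset.trans hPU)) hKU
      (by simpa using hxy) (by simp) (by simp) hdis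
      (hdK _ (sA1.trans sdiff_subset)) (hdK _ (sA2.trans sdiff_subset))
      (by simpa using fun h => (sA1 h).2 (Or.inl rfl))
      (by simpa using fun h => (sA2 h).2 (Or.inl rfl))
      (hdK _ (by simpa using hx))
      (by simpa using fun h => (sA1 h).2 (Or.inr rfl))
      (by simpa using fun h => (sA2 h).2 (Or.inr rfl))
      (hdK _ (by simpa using hy)) (by simp) (by simp) (by simp)
      (tox A1 sA1 cA1.1 clA1).symm (tox A2 sA2 cA2.1 clA2).symm tx
      (toy A1 sA1 cA1.1 clA1).symm (toy A2 sA2 cA2.1 clA2).symm ty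
      (Or.inl ⟨x1, mem_comp m1, (hPB hx1).2⟩) (Or.inl ⟨x2, mem_comp m2, (hPB hx2).2⟩)
      (Or.inl ⟨w, hwK, hw.2⟩)
  obtain ⟨p0, hp0⟩ := hP.1
  obtain ⟨x, hx, -, -, tx⟩ := small p0 hp0 p0 hp0 (Or.inl rfl)
  obtain ⟨y, hy, hyx, -, ty⟩ := small x hx x hx (Or.inl rfl)
  have axy := hadj x hx y hy hyx.symm tx ty
  obtain ⟨z, hz, hzx, hzy, tz⟩ := small x hx y hy (Or.inr axy)
  have axz := hadj x hx z hz hzx.symm tx tz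
  have ayz := hadj y hy z hz hzy.symm ty tz
  exact hPL.k5 {x} {y} {z} K ∅ (conn_singleton _) (conn_singleton _) (conn_singleton _) hKc reach_empty
    (by simpa using hPU hx) (by simpa using hPU hy) (by simpa using hPU hz) hKU (by simp)
    (by simpa using hyx.symm) (by simpa using hzx.symm) (hdK _ (by simpa using hx))
    (by simpa using hzy.symm) (hdK _ (by simpa using hy)) (hdK _ (by simpa using hz))
    (by simp) (by simp) (by simp) (by simp)
    ⟨x, rfl, y, rfl, axy⟩ ⟨x, rfl, z, rfl, axz⟩ tx ⟨y, rfl, z, rfl, ayz⟩ ty tz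
    (Or.inl ⟨x, rfl, (hPB hx).2⟩) (Or.inl ⟨y, rfl, (hPB hy).2⟩) (Or.inl ⟨z, rfl, (hPB hz).2⟩)
    (Or.inl ⟨w, hwK, hw.2⟩)

end runs
end HC

namespace HC

/-! ### Instances, tightness, reductions -/
section inst
variable {V : Type u} {G : SimpleGraph V}
variable {U B : Set V} {L : V → Finset ℕ} {x y w : V} {M : Finset ℕ}

/-- `S` separates `a` from `b` in `U` -/
def Sep (G : SimpleGraph V) (U S : Set V) (a b : V) : Prop :=
  ∃ T ⊆ U \ S, a ∈ T ∧ b ∉ T ∧ Clo G (U \ S) T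

structure Inst (G : SimpleGraph V) (U B : Set V) (L : V → Finset ℕ) (x y w : V) (M : Finset ℕ) :
    Prop where
  pl : PL G U B
  hx : x ∈ U ∩ B
  hy : y ∈ U ∩ B
  hxy : x = y ∨ G.Adj x y
  hw : w ∈ U ∩ B
  wx : w ≠ x
  wy : w ≠ y
  lx : L x = M
  ly : L y = M
  hM : M.card = 2 ∨ (M.card = 1 ∧ x = y)
  lw : 2 ≤ (L w).card
  lst : Lst U B {x, y, w} L

def Tight (G : SimpleGraph V) (U B : Set V) (L : V → Finset ℕ) (x y w : V) (M : Finset ℕ) : Prop :=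
  (M.card = 1 ∧ ∃ q ∈ U ∩ B, ∃ r ∈ U ∩ B, q ≠ w ∧ r ≠ w ∧ G.Adj x q ∧ G.Adj x r ∧ G.Adj q r ∧
    L q \ M = L r \ M ∧ (L q \ M).card = 2 ∧ Sep G U {q, r} x w ∧ ¬ Sep G U {q} x w ∧
    ¬ Sep G U {r} x w) ∨
  (M.card = 2 ∧ x ≠ y ∧ ∃ z ∈ U ∩ B, G.Adj x z ∧ G.Adj y z ∧
    ((z ≠ w ∧ M ⊆ L z ∧ (L z).card = 3) ∨ (z = w ∧ L w = M)))

def NN (G : SimpleGraph V) (U : Set V) : Prop := ∀ B L x y w M, Inst G U B L x y w M →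
  ¬ Tight G U B L x y w M → Col G U L

structure Crit (G : SimpleGraph V) (U B : Set V) (L : V → Finset ℕ) (x y w : V) (M : Finset ℕ) :
    Prop where
  inst : Inst G U B L x y w M
  nt : ¬ Tight G U B L x y w M
  nc : ¬ Col G U L
  ih : ∀ U' ⊂ U, NN G U'

lemma Lst.mono' {U U' B B' S S' : Set V} {L L' : V → Finset ℕ} (h : Lst U B S L) (hU : U' ⊆ U)
    (hB : ∀ v ∈ U', v ∈ B → v ∈ B') (hS : ∀ v ∈ U', v ∈ S → v ∈ S')
    (hL : ∀ v ∈ U', v ∉ S' → L v ⊆ L' v) : Lst U' B' S' L' := by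
  intro v hv hvS
  have := h v (hU hv) (fun h => hvS (hS v hv h))
  have h2 := Finset.card_le_card (hL v hv hvS)
  exact ⟨by omega, fun hB' => by have := this.2 (fun h => hB' (hB v hv h)); omega⟩

lemma Inst.swap
    (h : Inst G U B L x y w M) : Inst G U B L y x w M :=
  ⟨h.pl, h.hy, h.hx, h.hxy.imp Eq.symm SimpleGraph.Adj.symm, h.hw, h.wy, h.wx, h.ly, h.lx,
    h.hM.imp id (And.imp id Eq.symm), h.lw, h.lst.mono' subset_rfl (fun _ _ h => h)
    (by rintro v _ (h | h | h) <;> simp_all) (fun _ _ _ => Finset.Subset.refl _)⟩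

lemma Crit.swap
    (h : Crit G U B L x y w M) : Crit G U B L y x w M := by
  refine ⟨h.inst.swap, fun ht => h.nt ?_, h.nc, h.ih⟩
  rcases ht with ⟨h1, h2⟩ | ⟨h1, h2, z, hz, h3, h4, h5⟩
  · have : x = y := by
      rcases h.inst.hM with h | h
      · omega
      · exact h.2
    subst this; exact Or.inl ⟨h1, h2⟩
  · exact Or.inr ⟨h1, h2.symm, z, hz, h4, h3, h5⟩

lemma Crit.use {U B U' B' : Set V} {L L' : V → Finset ℕ} {x y w x' y' w' : V} {M M' : Finset ℕ}
    (h : Crit G U B L x y w M) (hU : U' ⊆ U) (hne : ∃ v ∈ U, v ∉ U')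
    (hi : Inst G U' B' L' x' y' w' M') (ht : ¬ Tight G U' B' L' x' y' w' M') : Col G U' L' := by
  obtain ⟨v, hv, hv'⟩ := hne
  exact h.ih U' ⟨hU, fun hh => hv' (hh hv)⟩ B' L' x' y' w' M' hi ht

/-- removing pieces behind a clique -/
lemma sep_stable {U K A : Set V} {S : Set V} {p w : V} (hA : ∀ a ∈ A, ∀ b ∈ A, a = b ∨ G.Adj a b)
    (hAU : A ⊆ U) (hK : K ⊆ U \ A) (hcl : Clo G (U \ A) K) (hwK : w ∉ K) (hS : Disjoint S K)
    (h : Sep G (U \ K) S p w) : Sep G U S p w := by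
  classical
  obtain ⟨T, hT, hp, hw, hTc⟩ := h
  have hAK : ∀ a ∈ A, a ∉ K := fun a ha h => (hK h).2 ha
  have hTK : ∀ a ∈ T, a ∉ K := fun a ha h => (hT ha).1.2 h
  have hKA : ∀ a ∈ K, ∀ b ∈ U, G.Adj a b → b ∈ K ∨ b ∈ A := by
    intro a ha b hb hab
    by_cases hbA : b ∈ A
    · exact Or.inr hbA
    · exact Or.inl (hcl a ha b ⟨hb, hbA⟩ hab)
  by_cases hm : ∃ a ∈ A, a ∈ T
  · obtain ⟨a0, ha0, ha0T⟩ := hm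
    refine ⟨T ∪ K, ?_, Or.inl hp, by simp [hw, hwK], ?_⟩
    · rintro v (hv | hv)
      · exact ⟨(hT hv).1.1, (hT hv).2⟩
      · exact ⟨(hK hv).1, fun h => disjoint_left.1 hS h hv⟩
    · rintro a (ha | ha) b hb hab
      · by_cases hbK : b ∈ K
        · exact Or.inr hbK
        · exact Or.inl (hTc a ha b ⟨⟨hb.1, hbK⟩, hb.2⟩ hab)
      · rcases hKA a ha b hb.1 hab with h | h
        · exact Or.inr h
        · left
          rcases hA a0 ha0 b h with h' | h'
          · exact h' ▸ ha0T
          · exact hTc a0 ha0T b ⟨⟨hb.1, hAK b h⟩, hb.2⟩ h'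
  · push Not at hm
    refine ⟨T, fun v hv => ⟨(hT hv).1.1, (hT hv).2⟩, hp, hw, ?_⟩
    intro a ha b hb hab
    by_cases hbK : b ∈ K
    · exfalso
      rcases hKA b hbK a (hT ha).1.1 hab.symm with h | h
      · exact hTK a ha h
      · exact hm a h ha
    · exact hTc a ha b ⟨⟨hb.1, hbK⟩, hb.2⟩ hab

lemma Sep.restrict {U U' S : Set V} {a b : V} (h : Sep G U S a b) (hU : U' ⊆ U) (ha : a ∈ U') :
    Sep G U' S a b := by
  obtain ⟨T, hT, hp, hw, hTc⟩ := h
  refine ⟨T ∩ U', fun v hv => ⟨hv.2, (hT hv.1).2⟩, ⟨hp, ha⟩, fun h => hw h.1, ?_⟩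
  intro a ha b hb hab
  exact ⟨hTc a ha.1 b ⟨hU hb.1, hb.2⟩ hab, hb.1⟩

lemma tight_stable {U B K A : Set V} {L : V → Finset ℕ} {x y w : V} {M : Finset ℕ}
    (hA : ∀ a ∈ A, ∀ b ∈ A, a = b ∨ G.Adj a b) (hAU : A ⊆ U) (hK : K ⊆ U \ A)
    (hcl : Clo G (U \ A) K) (hwK : w ∉ K) (hx : x ∈ U \ K)
    (h : Tight G (U \ K) B L x y w M) : Tight G U B L x y w M := by
  rcases h with ⟨h1, q, hq, r, hr, h2, h3, h4, h5, h6, h7, h8, h9, h10, h11⟩ |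
    ⟨h1, h2, z, hz, h3⟩
  · refine Or.inl ⟨h1, q, ⟨hq.1.1, hq.2⟩, r, ⟨hr.1.1, hr.2⟩, h2, h3, h4, h5, h6, h7, h8,
      sep_stable hA hAU hK hcl hwK ?_ h9, fun h => h10 (h.restrict sdiff_subset hx),
      fun h => h11 (h.restrict sdiff_subset hx)⟩
    rw [disjoint_left]
    rintro v (rfl | rfl)
    exacts [hq.1.2, hr.1.2]
  · exact Or.inr ⟨h1, h2, z, ⟨hz.1.1, hz.2⟩, h3⟩

variable [Finite V]

/-- coloring after removing a piece behind a clique -/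
lemma Crit.remove {U B K A : Set V} {L : V → Finset ℕ} {x y w : V} {M : Finset ℕ}
    (h : Crit G U B L x y w M)
    (hA : ∀ a ∈ A, ∀ b ∈ A, a = b ∨ G.Adj a b) (hAU : A ⊆ U) (hK : K ⊆ U \ A)
    (hcl : Clo G (U \ A) K) (hne : K.Nonempty) (hwK : w ∉ K) (hx : x ∉ K) (hy : y ∉ K) :
    Col G (U \ K) L := by
  have hi := h.inst
  refine h.use sdiff_subset (hne.imp fun v hv => ⟨(hK hv).1, fun h => h.2 hv⟩)
    (B' := B) (x' := x) (y' := y) (w' := w) (M' := M)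
    ⟨hi.pl.mono sdiff_subset inter_subset_left, ⟨⟨hi.hx.1, hx⟩, hi.hx.2⟩, ⟨⟨hi.hy.1, hy⟩, hi.hy.2⟩,
      hi.hxy, ⟨⟨hi.hw.1, hwK⟩, hi.hw.2⟩, hi.wx, hi.wy, hi.lx, hi.ly, hi.hM, hi.lw,
      hi.lst.mono' sdiff_subset (fun _ _ h => h) (fun _ _ h => h)
        (fun _ _ _ => Finset.Subset.refl _)⟩
    fun ht => h.nt (tight_stable hA hAU hK hcl hwK ⟨hi.hx.1, hx⟩ ht)

lemma Crit.lstK {K : Set V}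
    (h : Crit G U B L x y w M) (hK : K ⊆ U) (hwK : w ∉ K) (hx : x ∉ K) (hy : y ∉ K) :
    Lst K B ∅ L := h.inst.lst.mono' hK (fun _ _ h => h)
    (by rintro v hv (rfl | rfl | rfl) <;> exact absurd hv ‹_›) (fun _ _ _ => Finset.Subset.refl _)

lemma Crit.R1 {K : Set V}
    (h : Crit G U B L x y w M) {a b : V} (ha : a ∈ U ∩ B) (hb : b ∈ U ∩ B)
    (hab : a = b ∨ G.Adj a b) (hK : K ⊆ U \ {a, b}) (hcl : Clo G (U \ {a, b}) K)
    (hne : K.Nonempty) (hwK : w ∉ K) (hx : x ∉ K) (hy : y ∉ K) : False := by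
  obtain ⟨φ, hφ⟩ := h.remove (A := {a, b}) (by
    rintro c (rfl | rfl) d (rfl | rfl)
    exacts [Or.inl rfl, hab, hab.imp Eq.symm SimpleGraph.Adj.symm, Or.inl rfl])
    (by rintro c (rfl | rfl); exacts [ha.1, hb.1]) hK hcl hne hwK hx hy
  obtain ⟨_, hh, _⟩ := TP.split (thomassen _) h.inst.pl ha hb hab hK hcl hφ
    (h.lstK (hK.trans sdiff_subset) hwK hx hy)
  exact h.nc ⟨_, hh⟩

/-- extending a coloring into the interior of a triangle with a boundary vertex -/
lemma PL.tri {U B K : Set V} {L : V → Finset ℕ} (hp : PL G U B) {a b z : V} {φ : V → ℕ}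
    (ha : a ∈ U) (hb : b ∈ U) (hz : z ∈ U ∩ B)
    (hab : G.Adj a b) (haz : G.Adj a z) (hbz : G.Adj b z)
    (hK : K ⊆ U \ {a, b, z}) (hcl : Clo G (U \ {a, b, z}) K) (hKB : Disjoint K B)
    (hφ : IsCol G (U \ K) L φ) (hlst : Lst K B ∅ L) : Col G U L := by
  classical
  have haK : a ∉ K := fun h => (hK h).2 (by simp)
  have hbK : b ∉ K := fun h => (hK h).2 (by simp)
  have hzK : z ∉ K := fun h => (hK h).2 (by simp)
  have hKU : K ∪ {a, b, z} ⊆ U := by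
    rintro v (h | rfl | rfl | rfl)
    exacts [(hK h).1, ha, hb, hz.1]
  have hpl : PL G ((K ∪ {a, b, z}) \ {z}) ({z} ∪ Nb G {z}) :=
    (hp.mono hKU (B' := {z}) (by rintro v ⟨rfl, _⟩; exact hz.2)).expose
      (by rintro v rfl; simp) (reach_of_subset subset_rfl)
  have hKs : K ∪ {a, b} ⊆ (K ∪ {a, b, z}) \ {z} := by
    rintro v (h | rfl | rfl)
    · exact ⟨Or.inl h, fun h' => hzK (h' ▸ h)⟩
    · exact ⟨by simp, haz.ne⟩
    · exact ⟨by simp, hbz.ne⟩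
  have hpl2 : PL G (K ∪ {a, b}) ({z} ∪ Nb G {z}) := hpl.mono hKs inter_subset_left
  let L' : V → Finset ℕ := fun v => if v = a then {φ a} else if v = b then {φ b} else
    if G.Adj z v then L v \ {φ z} else L v
  have hNz : ∀ v, v ∈ Nb G {z} ↔ G.Adj z v := fun v => by simp [Nb]
  obtain ⟨ψ, hψ, hψa, hψb⟩ := thomassen (G := G) (K ∪ {a, b}) _ L' a b φ hpl2
    ⟨by simp, Or.inr ((hNz a).2 haz.symm)⟩ ⟨by simp, Or.inr ((hNz b).2 hbz.symm)⟩ (Or.inr hab)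
    (fun _ => hφ.2 a ⟨ha, haK⟩ b ⟨hb, hbK⟩ hab) (by simp [L']) (by simp [L', hab.ne']) (by
      rintro v (hv | hv) hvS
      · have h1 := hlst v hv (by simp)
        have h5 := h1.2 (fun hB => disjoint_left.1 hKB hv hB)
        have hva : v ≠ a := fun h => haK (h ▸ hv)
        have hvb : v ≠ b := fun h => hbK (h ▸ hv)
        simp only [L', hva, hvb, if_false]
        split_ifs with hzv
        · have := card_sdiff_ge (L v) {φ z} 4 (by simp; omega)
          exact ⟨by omega, fun hh => absurd (Or.inr ((hNz v).2 hzv)) hh⟩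
        · exact ⟨by omega, fun _ => h5⟩
      · exact absurd hv hvS)
  refine Col.extend hφ (D := K) (ψ := ψ) ⟨?_, ?_⟩ ?_
  · intro v hv
    have hva : v ≠ a := fun h => haK (h ▸ hv)
    have hvb : v ≠ b := fun h => hbK (h ▸ hv)
    have := hψ.1 v (Or.inl hv)
    simp only [L', hva, hvb, if_false] at this
    split_ifs at this
    · exact (Finset.mem_sdiff.1 this).1
    · exact this
  · exact fun c hc d hd => hψ.2 c (Or.inl hc) d (Or.inl hd)
  · intro c hc v hv hcv
    have hva : v ≠ a := fun h => haK (h ▸ hv)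
    have hvb : v ≠ b := fun h => hbK (h ▸ hv)
    by_cases hca : c = a
    · subst hca
      rw [← hψa]
      exact hψ.2 c (by simp) v (Or.inl hv) hcv
    by_cases hcb : c = b
    · subst hcb
      rw [← hψb]
      exact hψ.2 c (by simp) v (Or.inl hv) hcv
    by_cases hcz : c = z
    · subst hcz
      have := hψ.1 v (Or.inl hv)
      simp only [L', hva, hvb, if_false, hcv, if_true] at this
      intro h
      simp [h] at this
    · exact absurd (hcl v hv c ⟨hc.1, by simp [hca, hcb, hcz]⟩ hcv.symm) hc.2

lemma Crit.R2 {K : Set V}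
    (h : Crit G U B L x y w M) {a b z : V} (ha : a ∈ U) (hb : b ∈ U) (hz : z ∈ U ∩ B)
    (hab : G.Adj a b) (haz : G.Adj a z) (hbz : G.Adj b z)
    (hK : K ⊆ U \ {a, b, z}) (hcl : Clo G (U \ {a, b, z}) K)
    (hne : K.Nonempty) (hKB : Disjoint K B) : False := by
  have hi := h.inst
  have hwK : w ∉ K := fun hh => disjoint_left.1 hKB hh hi.hw.2
  have hxK : x ∉ K := fun hh => disjoint_left.1 hKB hh hi.hx.2
  have hyK : y ∉ K := fun hh => disjoint_left.1 hKB hh hi.hy.2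
  obtain ⟨φ, hφ⟩ := h.remove (A := {a, b, z}) (by
    rintro c (rfl | rfl | rfl) d (rfl | rfl | rfl) <;>
      simp [hab, haz, hbz, hab.symm, haz.symm, hbz.symm])
    (by rintro c (rfl | rfl | rfl); exacts [ha, hb, hz.1]) hK hcl hne hwK hxK hyK
  exact h.nc (hi.pl.tri ha hb hz hab haz hbz hK hcl hKB hφ
    (h.lstK (hK.trans sdiff_subset) hwK hxK hyK))

/-- two precolorable source vertices -/
lemma Inst.pick
    (h : Inst G U B L x y w M) {c : ℕ} (hc : c ∈ M) : ∃ f : V → ℕ, f x = c ∧ f y ∈ M ∧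
      (G.Adj x y → f x ≠ f y) := by
  classical
  rcases h.hxy with hxy | hxy
  · exact ⟨fun _ => c, rfl, hc, fun h => absurd (hxy ▸ h) (G.irrefl)⟩
  · have hM : 2 ≤ M.card := by
      rcases h.hM with h | ⟨_, h⟩
      · omega
      · exact absurd (h ▸ hxy) (G.irrefl)
    obtain ⟨d, hd, hdc⟩ := exists_ne_of_two hM c
    refine ⟨fun v => if v = x then c else d, by simp, by simp [hxy.ne', hd], fun _ => ?_⟩
    simp [hxy.ne', hdc.symm]

lemma Inst.Mne
    (h : Inst G U B L x y w M) : M.Nonempty := by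
  rw [← Finset.card_pos]
  rcases h.hM with h | h <;> omega

lemma Crit.connU
    (h : Crit G U B L x y w M) : Conn G U := by
  have hi := h.inst
  have main : ∀ T ⊆ U, Clo G U T → x ∈ T → U ⊆ T := by
    intro T hT hcl hxT
    by_contra hne
    obtain ⟨v, hv, hvT⟩ := not_subset.1 hne
    have hyT : y ∈ T := by
      rcases hi.hxy with h | h
      · exact h ▸ hxT
      · exact hcl x hxT y hi.hy.1 h
    have hcl' := hcl.compl hT
    by_cases hwT : w ∈ T
    · refine h.R1 hi.hx hi.hx (Or.inl rfl) (K := U \ T) ?_ ?_ ⟨v, hv, hvT⟩ (by simp [hwT])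
        (by simp [hxT]) (by simp [hyT])
      · rintro a ha
        exact ⟨ha.1, by rintro (rfl | rfl) <;> exact ha.2 hxT⟩
      · exact fun a ha b hb => hcl' a ha b hb.1
    · obtain ⟨c, hc⟩ := hi.Mne
      obtain ⟨f, rfl, hf2, hf3⟩ := hi.pick hc
      obtain ⟨φ, hφ, _⟩ := thomassen (G := G) T B L x y f (hi.pl.mono hT inter_subset_left)
        ⟨hxT, hi.hx.2⟩ ⟨hyT, hi.hy.2⟩ hi.hxy hf3 (by rwa [hi.lx]) (by rwa [hi.ly])
        (hi.lst.mono' hT (fun _ _ h => h) (by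
          rintro v hv (rfl | rfl | rfl)
          · simp
          · simp
          · exact absurd hv hwT) (fun _ _ _ => Finset.Subset.refl _))
      obtain ⟨d, hd⟩ : (L w).Nonempty := by rw [← Finset.card_pos]; have := hi.lw; omega
      obtain ⟨ψ, hψ, _⟩ := thomassen (G := G) (U \ T) B L w w (fun _ => d)
        (hi.pl.mono sdiff_subset inter_subset_left)
        ⟨⟨hi.hw.1, hwT⟩, hi.hw.2⟩ ⟨⟨hi.hw.1, hwT⟩, hi.hw.2⟩ (Or.inl rfl)
        (fun h => absurd h G.irrefl) hd hd
        (hi.lst.mono' sdiff_subset (fun _ _ h => h) (by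
          rintro v hv (rfl | rfl | rfl)
          · exact absurd hxT hv.2
          · exact absurd hyT hv.2
          · simp) (fun _ _ _ => Finset.Subset.refl _))
      exact h.nc (Col.extend hψ hφ fun a ha b hb hab => absurd (hcl b hb a ha.1 hab.symm) ha.2)
  refine ⟨⟨x, hi.hx.1⟩, fun T hT hne hcl => ?_⟩
  by_cases hxT : x ∈ T
  · exact main T hT hcl hxT
  · have := main (U \ T) sdiff_subset (hcl.compl hT) ⟨hi.hx.1, hxT⟩
    obtain ⟨v, hv⟩ := hne
    exact absurd hv (this (hT hv)).2

end inst
end HC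

namespace HC

section cutv
variable {V : Type u} {G : SimpleGraph V} [Finite V]

lemma Sep.up_cut {U U1 S : Set V} {v p w : V} (hU1 : U1 ⊆ U) (hvU : v ∈ U1)
    (hcl : Clo G (U \ {v}) (U1 \ {v})) (hw : w ∉ U1) (hS : S ⊆ U1)
    (h : Sep G U1 S p v) : Sep G U S p w := by
  obtain ⟨T, hT, hp, hv, hTc⟩ := h
  refine ⟨T, fun a ha => ⟨hU1 (hT ha).1, (hT ha).2⟩, hp, fun h => hw (hT h).1, ?_⟩
  intro a ha b hb hab
  have hav : a ≠ v := fun h => hv (h ▸ ha)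
  by_cases hbv : b = v
  · exact hTc a ha b ⟨hbv ▸ hvU, hb.2⟩ hab
  · exact hTc a ha b ⟨(hcl a ⟨(hT ha).1, hav⟩ b ⟨hb.1, hbv⟩ hab).1, hb.2⟩ hab

/-- separating in the big graph gives separating in the small one -/
lemma Sep.down_cut {U U1 U2 : Set V} {v q p w : V} (hU1 : U1 ⊆ U) (hU2 : U2 ⊆ U) (hp : p ∈ U1)
    (h2 : Conn G U2) (hv2 : v ∈ U2) (hw2 : w ∈ U2) (hq : q ∉ U2)
    (h : Sep G U {q} p w) : Sep G U1 {q} p v := by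
  obtain ⟨T, hT, hpT, hwT, hTc⟩ := h
  refine ⟨T ∩ U1, fun a ha => ⟨ha.2, (hT ha.1).2⟩, ⟨hpT, hp⟩, fun hv => hwT ?_, ?_⟩
  · have := h2.subset_of_clo (S := U \ {q}) (A := T)
      (fun a ha => ⟨hU2 ha, fun h => hq (h ▸ ha)⟩) hTc ⟨v, hv2, hv.1⟩
    exact this hw2
  · intro a ha b hb hab
    exact ⟨hTc a ha.1 b ⟨hU1 hb.1, hb.2⟩ hab, hb.1⟩

lemma Crit.nocut_aux {U B : Set V} {L : V → Finset ℕ} {x y w : V} {M : Finset ℕ}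
    (h : Crit G U B L x y w M) {v : V} (hv : v ∈ U ∩ B) (hvw : v ≠ w) {K : Set V}
    (hK : K ⊆ U \ {v}) (hcl : Clo G (U \ {v}) K) (hwK : w ∈ K) (hne : ¬ U \ {v} ⊆ K) :
    False := by
  classical
  have hi := h.inst
  have hvK : v ∉ K := fun h => (hK h).2 rfl
  have hcl' := hcl.compl hK
  have hpair : ∀ S : Set V, S \ {v, v} = S \ {v} := fun S => by simp
  -- the other side meets the source
  have hK'σ : ∃ s, (s = x ∨ s = y) ∧ s ∈ (U \ {v}) \ K := by
    by_contra hcon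
    push Not at hcon
    obtain ⟨a, ha, haK⟩ := not_subset.1 hne
    exact h.R1 hv hv (Or.inl rfl) (K := (U \ {v}) \ K) (by rw [hpair]; exact sdiff_subset)
      (by rw [hpair]; exact hcl') ⟨a, ha, haK⟩ (fun h => h.2 hwK) (hcon x (Or.inl rfl))
      (hcon y (Or.inr rfl))
  have hxK : x ∉ K := by
    intro hxK
    obtain ⟨s, rfl | rfl, hs⟩ := hK'σ
    · exact hs.2 hxK
    · rcases hi.hxy with he | he
      · exact hs.2 (he ▸ hxK)
      · exact hs.2 (hcl x hxK _ hs.1 he)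
  have hyK : y ∉ K := by
    intro hyK
    obtain ⟨s, rfl | rfl, hs⟩ := hK'σ
    · rcases hi.hxy with he | he
      · exact hs.2 (he ▸ hyK)
      · exact hs.2 (hcl y hyK _ hs.1 he.symm)
    · exact hs.2 hyK
  set U1 := U \ K with hU1
  set U2 := K ∪ {v} with hU2
  have hU2U : U2 ⊆ U := by
    rintro a (ha | rfl)
    exacts [(hK ha).1, hv.1]
  have hvU1 : v ∈ U1 := ⟨hv.1, hvK⟩
  have hxU1 : x ∈ U1 := ⟨hi.hx.1, hxK⟩
  have hyU1 : y ∈ U1 := ⟨hi.hy.1, hyK⟩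
  have hwU2 : w ∈ U2 := Or.inl hwK
  have glue : ∀ φ1 φ2, IsCol G U1 L φ1 → IsCol G U2 L φ2 → φ1 v = φ2 v → False := by
    intro φ1 φ2 h1 h2 hvv
    refine h.nc (Col.extend h1 (D := K) (h2.mono subset_union_left
      (fun _ _ => Finset.Subset.refl _)) ?_)
    intro a ha b hb hab
    by_cases hav : a = v
    · subst hav
      rw [hvv]
      exact h2.2 a (Or.inr rfl) b (Or.inl hb) hab
    · exact absurd (hcl b hb a ⟨ha.1, hav⟩ hab.symm) ha.2
  -- coloring of the `w`-side
  have side2 : ∀ Y : Finset ℕ, Y ⊆ L v → Y.card = 2 → ∃ φ, IsCol G U2 L φ ∧ φ v ∈ Y := by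
    intro Y hY hY2
    obtain ⟨s, -, hs⟩ := hK'σ
    obtain ⟨φ, hφ⟩ := h.use hU2U ⟨s, hs.1.1, by rintro (h | h); exacts [hs.2 h, hs.1.2 h]⟩
      (B' := B) (L' := Function.update L v Y) (x' := v) (y' := v) (w' := w) (M' := Y)
      ⟨hi.pl.mono hU2U inter_subset_left, ⟨Or.inr rfl, hv.2⟩, ⟨Or.inr rfl, hv.2⟩, Or.inl rfl,
        ⟨hwU2, hi.hw.2⟩, hvw.symm, hvw.symm, by simp, by simp, Or.inl hY2,
        by rw [Function.update_of_ne hvw.symm]; exact hi.lw,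
        hi.lst.mono' hU2U (fun _ _ h => h) (by
          rintro a (ha | ha) (rfl | rfl | rfl)
          · exact absurd ha hxK
          · exact absurd ha hyK
          · simp
          · exact Or.inl ha
          · exact Or.inl ha
          · simp) (by
          intro a _ ha
          rw [Function.update_of_ne (fun h => ha (Or.inl h))])⟩
      (by
        rintro (⟨h1, _⟩ | ⟨_, h2, _⟩)
        · omega
        · exact h2 rfl)
    refine ⟨φ, hφ.mono subset_rfl (fun a _ => ?_), by simpa using hφ.1 v (Or.inr rfl)⟩
    by_cases hav : a = v
    · subst hav; simpa using hY
    · rw [Function.update_of_ne hav]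
  have side1 : ∀ f : V → ℕ, f x ∈ M → f y ∈ M → (G.Adj x y → f x ≠ f y) →
      ((v = x ∨ v = y) → ∃ φ, IsCol G U1 L φ ∧ φ v = f v) := by
    intro f hf1 hf2 hf3 hvσ
    obtain ⟨φ, hφ, h1, h2⟩ := thomassen (G := G) U1 B L x y f
      (hi.pl.mono sdiff_subset inter_subset_left) ⟨hxU1, hi.hx.2⟩ ⟨hyU1, hi.hy.2⟩ hi.hxy hf3
      (by rwa [hi.lx]) (by rwa [hi.ly]) (hi.lst.mono' sdiff_subset (fun _ _ h => h) (by
        rintro a ha (rfl | rfl | rfl)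
        · simp
        · simp
        · exact absurd hwK ha.2) (fun _ _ _ => Finset.Subset.refl _))
    refine ⟨φ, hφ, ?_⟩
    rcases hvσ with rfl | rfl
    exacts [h1, h2]
  have hM2 : (v = x ∨ v = y) → M.card = 2 := by
    intro hvσ
    rcases hi.hM with h2 | ⟨_, hxy⟩
    · exact h2
    · exfalso
      obtain ⟨s, hs, hs'⟩ := hK'σ
      apply hs'.1.2
      subst hxy
      rcases hvσ with rfl | rfl <;> rcases hs with rfl | rfl <;> rfl
  by_cases hvσ : v = x ∨ v = y
  · have hLv : L v = M := by
      rcases hvσ with rfl | rfl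
      exacts [hi.lx, hi.ly]
    obtain ⟨φ2, hφ2, hm⟩ := side2 M (by rw [hLv]) (hM2 hvσ)
    have : ∃ f : V → ℕ, f x ∈ M ∧ f y ∈ M ∧ (G.Adj x y → f x ≠ f y) ∧ f v = φ2 v := by
      rcases hvσ with rfl | rfl
      · obtain ⟨f, h1, h2, h3⟩ := hi.pick hm
        exact ⟨f, h1 ▸ hm, h2, h3, h1⟩
      · obtain ⟨f, h1, h2, h3⟩ := hi.swap.pick hm
        exact ⟨f, h2, h1 ▸ hm, fun h => (h3 h.symm).symm, h1⟩
    obtain ⟨f, h1, h2, h3, h4⟩ := this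
    obtain ⟨φ1, hφ1, h5⟩ := side1 f h1 h2 h3 hvσ
    exact glue φ1 φ2 hφ1 hφ2 (h5.trans h4)
  push Not at hvσ
  -- `v` as a sink
  let Gd := (L v).filter fun c => ∃ φ, IsCol G U1 L φ ∧ φ v = c
  have hLv3 : 3 ≤ (L v).card := (hi.lst v hv.1 (by simp [hvσ.1, hvσ.2, hvw])).1
  have hGd : 2 ≤ Gd.card := by
    by_contra hcon
    push Not at hcon
    have hX := card_sdiff_ge (L v) Gd 2 (by omega)
    set X := L v \ Gd with hXdef
    have hbad : ¬ Col G U1 (Function.update L v X) := by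
      rintro ⟨φ, hφ⟩
      have h1 : φ v ∈ X := by simpa using hφ.1 v hvU1
      have h2 := Finset.mem_sdiff.1 h1
      apply h2.2
      refine Finset.mem_filter.2 ⟨h2.1, φ, hφ.mono subset_rfl (fun a _ => ?_), rfl⟩
      by_cases hav : a = v
      · subst hav; simp [hXdef]
      · rw [Function.update_of_ne hav]
    apply hbad
    have upne : ∀ a, a ≠ v → Function.update L v X a = L a := fun a ha =>
      Function.update_of_ne ha _ _
    have hcl1 : Clo G (U \ {v}) (U1 \ {v}) := by
      intro a ha b hb hab
      exact ⟨⟨hb.1, fun hbK => ha.1.2 (hcl b hbK a ⟨ha.1.1, ha.2⟩ hab.symm)⟩, hb.2⟩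
    have hconn2 : Conn G U2 := by
      refine ⟨⟨v, Or.inr rfl⟩, fun T hT hTne hTc => ?_⟩
      by_cases hvT : v ∈ T
      · have h3 := h.connU.2 (T ∪ U1) (by
          rintro a (ha | ha)
          exacts [hU2U (hT ha), ha.1]) ⟨v, Or.inl hvT⟩ (by
          rintro a (ha | ha) b hb hab
          · by_cases hbK : b ∈ K
            · exact Or.inl (hTc a ha b (Or.inl hbK) hab)
            · exact Or.inr ⟨hb, hbK⟩
          · by_cases hbK : b ∈ K
            · left
              by_cases hav : a = v
              · exact hTc a (hav ▸ hvT) b (Or.inl hbK) hab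
              · exact absurd (hcl b hbK a ⟨ha.1, hav⟩ hab.symm) ha.2
            · exact Or.inr ⟨hb, hbK⟩)
        rintro a (ha | rfl)
        · rcases h3 (hK ha).1 with h | h
          · exact h
          · exact absurd ha h.2
        · exact hvT
      · exfalso
        have hTK : T ⊆ K := fun a ha => (hT ha).resolve_right fun h => hvT (h ▸ ha)
        have h3 := h.connU.2 T (hT.trans hU2U) hTne (by
          intro a ha b hb hab
          by_cases hbv : b = v
          · exact hTc a ha b (Or.inr hbv) hab
          · exact hTc a ha b (Or.inl (hcl a (hTK ha) b ⟨hb, hbv⟩ hab)) hab)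
        exact hvT (h3 hv.1)
    refine h.use sdiff_subset ⟨w, hi.hw.1, fun h => h.2 hwK⟩ (B' := B) (x' := x) (y' := y)
      (w' := v) (M' := M) ⟨hi.pl.mono sdiff_subset inter_subset_left, ⟨hxU1, hi.hx.2⟩,
        ⟨hyU1, hi.hy.2⟩, hi.hxy, ⟨hvU1, hv.2⟩, hvσ.1, hvσ.2, by rw [upne _ hvσ.1.symm, hi.lx],
        by rw [upne _ hvσ.2.symm, hi.ly], hi.hM, by simpa using hX,
        hi.lst.mono' sdiff_subset (fun _ _ h => h) (by
          rintro a ha (rfl | rfl | rfl)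
          · simp
          · simp
          · exact absurd hwK ha.2) (by
          intro a _ ha
          rw [upne a (fun h => ha (by simp [h]))])⟩ ?_
    rintro (⟨h1, q, hq, r, hr, h2, h3, h4, h5, h6, h7, h8, h9, h10, h11⟩ |
      ⟨h1, h2, z, hz, h3, h4, h5⟩)
    · refine h.nt (Or.inl ⟨h1, q, ⟨hq.1.1, hq.2⟩, r, ⟨hr.1.1, hr.2⟩, ?_, ?_, h4, h5, h6, ?_, ?_,
        h9.up_cut sdiff_subset hvU1 hcl1 (fun h => h.2 hwK) ?_, ?_, ?_⟩)
      · rintro rfl; exact hq.1.2 hwK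
      · rintro rfl; exact hr.1.2 hwK
      · rwa [upne q h2, upne r h3] at h7
      · rwa [upne q h2] at h8
      · rintro a (rfl | rfl)
        exacts [hq.1, hr.1]
      · exact fun hs => h10 (hs.down_cut sdiff_subset hU2U hxU1 hconn2 (Or.inr rfl) hwU2
          (by rintro (h | h); exacts [hq.1.2 h, h2 h]))
      · exact fun hs => h11 (hs.down_cut sdiff_subset hU2U hxU1 hconn2 (Or.inr rfl) hwU2
          (by rintro (h | h); exacts [hr.1.2 h, h3 h]))
    · have hzw : z ≠ w := by rintro rfl; exact hz.1.2 hwK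
      refine h.nt (Or.inr ⟨h1, h2, z, ⟨hz.1.1, hz.2⟩, h3, h4, Or.inl ⟨hzw, ?_⟩⟩)
      rcases h5 with ⟨h6, h7⟩ | ⟨rfl, h6⟩
      · rwa [upne z h6] at h7
      · rw [Function.update_self] at h6
        have hsub : M ⊆ L z := by rw [← h6]; exact Finset.sdiff_subset
        refine ⟨hsub, ?_⟩
        have h8 : X.card = 2 := by rw [h6]; exact h1
        have h9 : (L z).card ≤ X.card + Gd.card := by
          rw [hXdef]
          have := Finset.card_le_card (show L z ⊆ (L z \ Gd) ∪ Gd by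
            intro a ha; by_cases h : a ∈ Gd <;> simp [ha, h])
          exact this.trans (Finset.card_union_le _ _)
        omega
  obtain ⟨Y, hY, hY2⟩ := exists_sub2 hGd
  obtain ⟨φ2, hφ2, hm⟩ := side2 Y (hY.trans (Finset.filter_subset _ _)) hY2
  obtain ⟨_, φ1, hφ1, hh⟩ := Finset.mem_filter.1 (hY hm)
  exact glue φ1 φ2 hφ1 hφ2 hh

lemma Crit.nocut {U B : Set V} {L : V → Finset ℕ} {x y w : V} {M : Finset ℕ}
    (h : Crit G U B L x y w M) {v : V} (hv : v ∈ U ∩ B) {K : Set V}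
    (hK : K ⊆ U \ {v}) (hne : K.Nonempty) (hcl : Clo G (U \ {v}) K) : U \ {v} ⊆ K := by
  have hi := h.inst
  have hpair : ∀ S : Set V, S \ {v, v} = S \ {v} := fun S => by simp
  by_contra hcon
  by_cases hvw : v = w
  · subst hvw
    have main : ∀ K ⊆ U \ {v}, Clo G (U \ {v}) K → x ∈ K → ¬ U \ {v} ⊆ K → False := by
      intro K hK hcl hxK hcon
      have hyK : y ∈ K := by
        rcases hi.hxy with he | he
        · exact he ▸ hxK
        · exact hcl x hxK y ⟨hi.hy.1, hi.wy.symm⟩ he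
      obtain ⟨a, ha, haK⟩ := not_subset.1 hcon
      exact h.R1 hv hv (Or.inl rfl) (K := (U \ {v}) \ K) (by rw [hpair]; exact sdiff_subset)
        (by rw [hpair]; exact hcl.compl hK) ⟨a, ha, haK⟩ (fun h => h.1.2 rfl) (fun h => h.2 hxK)
        (fun h => h.2 hyK)
    by_cases hxK : x ∈ K
    · exact main K hK hcl hxK hcon
    · refine main _ sdiff_subset (hcl.compl hK) ⟨⟨hi.hx.1, hi.wx.symm⟩, hxK⟩ fun hh => ?_
      obtain ⟨a, ha⟩ := hne
      exact (hh (hK ha)).2 ha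
  · by_cases hwK : w ∈ K
    · exact h.nocut_aux hv hvw hK hcl hwK hcon
    · refine h.nocut_aux hv hvw sdiff_subset (hcl.compl hK) ⟨⟨hi.hw.1, fun h => hvw h.symm⟩, hwK⟩
        fun hh => ?_
      obtain ⟨a, ha⟩ := hne
      exact (hh (hK ha)).2 ha

end cutv
end HC

namespace HC

section run
variable {V : Type u} {G : SimpleGraph V}

/-- the lists after deleting the run `P` that will be colored from `X` -/
noncomputable def rl (G : SimpleGraph V) (B : Set V) (L : V → Finset ℕ) (P : Set V)
    (X : Finset ℕ) : V → Finset ℕ := rm L (Nb G P \ B) X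

lemma rl_B {B P : Set V} {L : V → Finset ℕ} {X : Finset ℕ} {v : V} (h : v ∈ B) :
    rl G B L P X v = L v := rm_nmem fun hh => hh.2 h

lemma rl_sub {B P : Set V} {L : V → Finset ℕ} {X : Finset ℕ} (v : V) :
    rl G B L P X v ⊆ L v := rm_sub _ _ _ _

lemma run_pl {U B P : Set V} (h : PL G U B) (hP : P ⊆ U ∩ B) : PL G (U \ P) (B ∪ Nb G P) :=
  h.expose (hP.trans inter_subset_left) (reach_of_subset (hP.trans inter_subset_right))

lemma run_lst {U B S P : Set V} {L : V → Finset ℕ} {X : Finset ℕ} (h : Lst U B S L)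
    (hX : X.card ≤ 2) : Lst (U \ P) (B ∪ Nb G P) S (rl G B L P X) := by
  intro v hv hvS
  have h1 := h v hv.1 hvS
  by_cases hvB : v ∈ B
  · rw [rl_B hvB]
    exact ⟨h1.1, fun h => absurd (Or.inl hvB) h⟩
  · have h5 := h1.2 hvB
    by_cases hvN : v ∈ Nb G P
    · have : rl G B L P X v = L v \ X := rm_mem ⟨hvN, hvB⟩
      rw [this]
      exact ⟨card_sdiff_ge _ _ _ (by omega), fun h => absurd (Or.inr hvN) h⟩
    · have : rl G B L P X v = L v := rm_nmem fun hh => hvN hh.1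
      rw [this]
      exact ⟨h1.1, fun _ => h5⟩

lemma run_ext {U B P : Set V} {L : V → Finset ℕ} {X : Finset ℕ} {φ ψ : V → ℕ} (hP : P ⊆ U)
    (h1 : IsCol G (U \ P) (rl G B L P X) φ) (h2 : IsCol G P (fun _ => X) ψ)
    (h3 : ∀ v ∈ P, X ⊆ L v)
    (h4 : ∀ v ∈ P, ∀ u ∈ U ∩ B, u ∉ P → G.Adj v u → φ u ≠ ψ v) :
    ∃ φ', IsCol G U L φ' ∧ (∀ v ∈ U \ P, φ' v = φ v) ∧ ∀ v ∈ P, φ' v = ψ v := by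
  classical
  refine ⟨fun v => if v ∈ P then ψ v else φ v, ⟨fun v hv => ?_, fun a ha b hb hab => ?_⟩, ?_, ?_⟩
  · by_cases hvP : v ∈ P
    · simpa [hvP] using h3 v hvP (h2.1 v hvP)
    · simpa [hvP] using rl_sub v (h1.1 v ⟨hv, hvP⟩)
  · have key : ∀ v ∈ P, ∀ u ∈ U, u ∉ P → G.Adj v u → φ u ≠ ψ v := by
      intro v hv u hu huP hvu
      by_cases huB : u ∈ B
      · exact h4 v hv u ⟨hu, huB⟩ huP hvu
      · have h5 := h1.1 u ⟨hu, huP⟩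
        have : rl G B L P X u = L u \ X := rm_mem ⟨⟨v, hv, hvu⟩, huB⟩
        rw [this] at h5
        intro h6
        exact (Finset.mem_sdiff.1 h5).2 (h6 ▸ h2.1 v hv)
    by_cases haP : a ∈ P <;> by_cases hbP : b ∈ P <;> simp only [haP, hbP, if_true, if_false]
    · exact h2.2 a haP b hbP hab
    · exact (key a haP b hb hbP hab).symm
    · exact key b hbP a ha haP hab.symm
    · exact h1.2 a ⟨ha, haP⟩ b ⟨hb, hbP⟩ hab
  · intro v hv; simp [hv.2]
  · intro v hv; simp [hv]

lemma twocol_pick {P : Set V} (h : TwoCol G P) {X : Finset ℕ} (hX : X.card = 2) (b : V) {c : ℕ}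
    (hc : c ∈ X) : ∃ ψ : V → ℕ, IsCol G P (fun _ => X) ψ ∧ ψ b = c := by
  obtain ⟨g, hg⟩ := h
  obtain ⟨d, hd, hdc⟩ := exists_ne_of_two hX.ge c
  refine ⟨fun v => if g v = g b then c else d, ⟨fun v _ => ?_, fun v hv u hu hvu => ?_⟩, by simp⟩
  · dsimp only
    split_ifs
    exacts [hc, hd]
  · have := hg v hv u hu hvu
    by_cases h1 : g v = g b <;> by_cases h2 : g u = g b <;> simp only [h1, h2, if_true, if_false]
    · exact absurd (h1.trans h2.symm) this
    · exact hdc.symm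
    · exact hdc
    · exfalso
      revert this h1 h2
      cases g v <;> cases g u <;> cases g b <;> simp

lemma run_fin {U B P : Set V} {L : V → Finset ℕ} {X : Finset ℕ} {φ : V → ℕ} (hP : P ⊆ U)
    (hX : X.card = 2)
    (h1 : IsCol G (U \ P) (rl G B L P X) φ) (h2 : TwoCol G P)
    (h3 : ∀ v ∈ P, X ⊆ L v) {b2 u2 : V}
    (h4 : ∀ v ∈ P, ∀ u ∈ U ∩ B, u ∉ P → G.Adj v u → φ u ∉ X ∨ (v = b2 ∧ u = u2)) :
    ∃ φ', IsCol G U L φ' ∧ (∀ v ∈ U \ P, φ' v = φ v) := by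
  obtain ⟨c, hc, hcu⟩ := exists_ne_of_two hX.ge (φ u2)
  obtain ⟨ψ, hψ, hψb⟩ := twocol_pick h2 hX b2 hc
  obtain ⟨φ', ha, hb, _⟩ := run_ext (φ := φ) (ψ := ψ) hP h1 hψ h3 (by
    intro v hv u hu huP hvu
    rcases h4 v hv u hu huP hvu with h | ⟨rfl, rfl⟩
    · exact fun h' => h (h' ▸ hψ.1 v hv)
    · rw [hψb]; exact hcu.symm)
  exact ⟨φ', ha, hb⟩

lemma NoSep.deg2 {U B P : Set V} (hn : NoSep G U B) (h : PL G U B) (hP : P ⊆ U ∩ B) :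
    Deg2 G P (U ∩ B) := by
  intro v hv a ha b hb c hc hva hvb hvc
  by_contra hcon
  push Not at hcon
  exact hn.deg h (hP hv) ha hb hc hva hvb hvc hcon.1 hcon.2.1 hcon.2.2

variable [Finite V]

lemma run_port {U B P : Set V} {L : V → Finset ℕ} {X : Finset ℕ} {φ : V → ℕ} (hP : P ⊆ U ∩ B)
    (hX : X.card = 2) (hc : Conn G P) (hd : Deg2 G P (U ∩ B))
    (h1 : IsCol G (U \ P) (rl G B L P X) φ)
    (h3 : ∀ v ∈ P, X ⊆ L v) {b u : V} (hb : b ∈ P) (hu : u ∈ U ∩ B) (huP : u ∉ P)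
    (hbu : G.Adj b u) (hφu : φ u ∉ X) :
    ∃ φ', IsCol G U L φ' ∧ (∀ v ∈ U \ P, φ' v = φ v) := by
  obtain ⟨b2, u2, hp⟩ := ports hc hP hd hb hu huP hbu
  have hC : Conn G (insert u P) := hc.insert hb hbu.symm
  have ht : TwoCol G P := bip hC (subset_insert u P) (fun h => huP (h (Or.inl rfl)))
    (hd.mono subset_rfl (by rintro v (rfl | hv); exacts [hu, hP hv]))
  refine run_fin (hP.trans inter_subset_left) hX h1 ht h3 (b2 := b2) (u2 := u2) ?_
  intro v hv t ht htP hvt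
  rcases hp v hv t ht htP hvt with ⟨rfl, rfl⟩ | h
  · exact Or.inl hφu
  · exact Or.inr h

lemma run_T {U B S P : Set V} {L : V → Finset ℕ} {X : Finset ℕ} (h : PL G U B) (hP : P ⊆ U ∩ B)
    (hL : Lst U B S L) (hX : X.card ≤ 2) {p q : V} (hp : p ∈ U ∩ B) (hpP : p ∉ P)
    (hq : q ∈ U ∩ B) (hqP : q ∉ P) (hpq : p = q ∨ G.Adj p q) (hS : ∀ v ∈ S, v ∉ P → v = p ∨ v = q)
    (f : V → ℕ) (hfp : f p ∈ L p) (hfq : f q ∈ L q) (hf : G.Adj p q → f p ≠ f q) :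
    ∃ φ, IsCol G (U \ P) (rl G B L P X) φ ∧ φ p = f p ∧ φ q = f q := by
  refine thomassen (U \ P) (B ∪ Nb G P) _ p q f (run_pl h hP) ⟨⟨hp.1, hpP⟩, Or.inl hp.2⟩
    ⟨⟨hq.1, hqP⟩, Or.inl hq.2⟩ hpq hf (by rwa [rl_B hp.2]) (by rwa [rl_B hq.2]) ?_
  refine (run_lst hL hX).mono' subset_rfl (fun _ _ h => h) ?_ (fun _ _ _ => Finset.Subset.refl _)
  intro v hv hvS
  exact hS v hvS hv.2

lemma run_T1 {U B S P : Set V} {L : V → Finset ℕ} {X : Finset ℕ} (h : PL G U B) (hP : P ⊆ U ∩ B)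
    (hL : Lst U B S L) (hX : X.card ≤ 2) {p : V} (hp : p ∈ U ∩ B) (hpP : p ∉ P)
    (hS : ∀ v ∈ S, v ∉ P → v = p) {d : ℕ} (hd : d ∈ L p) :
    ∃ φ, IsCol G (U \ P) (rl G B L P X) φ ∧ φ p = d := by
  obtain ⟨φ, h1, h2, _⟩ := run_T h hP hL hX hp hpP hp hpP (Or.inl rfl)
    (fun v hv hvP => Or.inl (hS v hv hvP)) (fun _ => d) hd hd (fun h => absurd h G.irrefl)
  exact ⟨φ, h1, h2⟩

/-- triangles of outer vertices -/
lemma NoSep.tri {U B : Set V} (hn : NoSep G U B) (h : PL G U B) {a b c v : V}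
    (ha : a ∈ U ∩ B) (hb : b ∈ U ∩ B) (hc : c ∈ U ∩ B) (hv : v ∈ U ∩ B)
    (hab : G.Adj a b) (hac : G.Adj a c) (hbc : G.Adj b c) (va : v ≠ a) (vb : v ≠ b) (vc : v ≠ c) :
    False := by
  set K := comp G (U \ {a, b, c}) v with hK
  have hvU : v ∈ U \ {a, b, c} := ⟨hv.1, by simp [va, vb, vc]⟩
  have hvK : v ∈ K := mem_comp hvU
  have hKs : K ⊆ U \ {a, b, c} := comp_subset _ _
  have haK : a ∉ K := fun h => (hKs h).2 (by simp)
  have hbK : b ∉ K := fun h => (hKs h).2 (by simp)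
  have hcK : c ∉ K := fun h => (hKs h).2 (by simp)
  have tch : ∀ s t r : V, s ∈ U ∩ B → t ∈ U ∩ B → r ∈ U → G.Adj s t → r ∉ K → r ≠ s → r ≠ t →
      (∀ z ∈ U, z ≠ s → z ≠ t → z ≠ r → z ∈ U \ {a, b, c}) →
      K ⊆ U \ {s, t} → Tch G {r} K := by
    intro s t r hs ht hr hst hrK hrs hrt hz hKst
    by_contra hcon
    have := hn s hs t ht (Or.inr hst) K hKst ⟨v, hvK⟩ (by
      intro p hp q hq hpq
      by_cases hqr : q = r
      · subst hqr; exact absurd ⟨q, rfl, p, hp, hpq.symm⟩ hcon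
      · refine comp_clo _ _ p hp q (hz q hq.1 (fun h => hq.2 (by simp [h]))
          (fun h => hq.2 (by simp [h])) hqr) hpq)
    exact hrK (this ⟨hr, by simp [hrs, hrt]⟩)
  have t1 := tch b c a hb hc ha.1 hbc haK hab.ne hac.ne
    (fun z hz h1 h2 h3 => ⟨hz, by simp [h1, h2, h3]⟩)
    (fun z hz => ⟨(hKs hz).1, fun hh => (hKs hz).2 (by rcases hh with rfl | rfl <;> simp)⟩)
  have t2 := tch a c b ha hc hb.1 hac hbK hab.ne' hbc.ne
    (fun z hz h1 h2 h3 => ⟨hz, by simp [h1, h2, h3]⟩)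
    (fun z hz => ⟨(hKs hz).1, fun hh => (hKs hz).2 (by rcases hh with rfl | rfl <;> simp)⟩)
  have t3 := tch a b c ha hb hc.1 hab hcK hac.ne' hbc.ne'
    (fun z hz h1 h2 h3 => ⟨hz, by simp [h1, h2, h3]⟩)
    (fun z hz => ⟨(hKs hz).1, fun hh => (hKs hz).2 (by rcases hh with rfl | rfl <;> simp)⟩)
  refine h.k5 {a} {b} {c} K ∅ (conn_singleton a) (conn_singleton b) (conn_singleton c)
    (comp_conn hvU) reach_empty (by simpa using ha.1) (by simpa using hb.1) (by simpa using hc.1)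
    (hKs.trans sdiff_subset) (empty_subset _) (by simpa using hab.ne) (by simpa using hac.ne)
    (by simpa using haK) (by simpa using hbc.ne) (by simpa using hbK) (by simpa using hcK)
    (by simp) (by simp) (by simp) (by simp) ⟨a, rfl, b, rfl, hab⟩ ⟨a, rfl, c, rfl, hac⟩ t1
    ⟨b, rfl, c, rfl, hbc⟩ t2 t3 (Or.inl ⟨a, rfl, ha.2⟩) (Or.inl ⟨b, rfl, hb.2⟩)
    (Or.inl ⟨c, rfl, hc.2⟩) (Or.inl ⟨v, hvK, hv.2⟩)

/-- chordless case, two source vertices -/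
lemma Crit.chordlessD {U B : Set V} {L : V → Finset ℕ} {x y w : V} {M : Finset ℕ}
    (h : Crit G U B L x y w M) (hM : M.card = 2) (hns : NoSep G U B) : False := by
  classical
  have hi := h.inst
  set Q : Set V := {b | b ∈ U ∩ B ∧ b ≠ w ∧ M ⊆ L b} with hQ
  set P := comp G Q x with hPdef
  have hxQ : x ∈ Q := ⟨hi.hx, hi.wx.symm, by rw [hi.lx]⟩
  have hyQ : y ∈ Q := ⟨hi.hy, hi.wy.symm, by rw [hi.ly]⟩
  have hxP : x ∈ P := mem_comp hxQ
  have hyP : y ∈ P := by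
    rcases hi.hxy with he | he
    · exact he ▸ hxP
    · exact comp_clo _ _ x hxP y hyQ he
  have hPQ : P ⊆ Q := comp_subset _ _
  have hPB : P ⊆ U ∩ B := fun a ha => (hPQ ha).1
  have hPc : Conn G P := comp_conn hxQ
  have hwP : w ∉ P := fun hh => (hPQ hh).2.1 rfl
  have hML : ∀ v ∈ P, M ⊆ L v := fun v hv => (hPQ hv).2.2
  have hd : Deg2 G P (U ∩ B) := hns.deg2 hi.pl hPB
  have hS : ∀ v ∈ ({x, y, w} : Set V), v ∉ P → v = w := by
    rintro v (rfl | rfl | rfl) hv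
    exacts [absurd hxP hv, absurd hyP hv, rfl]
  obtain ⟨d0, hd0⟩ : (L w).Nonempty := by rw [← Finset.card_pos]; have := hi.lw; omega
  by_cases hb : ∃ b ∈ P, ∃ u ∈ U ∩ B, u ∉ P ∧ G.Adj b u ∧ u ≠ w
  · obtain ⟨b, hb, u, hu, huP, hbu, huw⟩ := hb
    have hMu : ¬ M ⊆ L u := fun hh => huP (comp_clo _ _ b hb u ⟨hu, huw, hh⟩ hbu)
    have hux : u ≠ x := fun hh => huP (hh ▸ hxP)
    have huy : u ≠ y := fun hh => huP (hh ▸ hyP)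
    have h3 : 3 ≤ (L u).card := (hi.lst u hu.1 (by simp [hux, huy, huw])).1
    have h2 : 2 ≤ (L u \ M).card := by
      have h4 : (L u ∩ M).card < M.card := Finset.card_lt_card
        ⟨Finset.inter_subset_right, fun hh => hMu (hh.trans Finset.inter_subset_left)⟩
      have := Finset.card_sdiff_add_card_inter (L u) M
      omega
    obtain ⟨Y, hY, hY2⟩ := exists_sub2 h2
    obtain ⟨φ, hφ⟩ := h.use (U' := U \ P) sdiff_subset ⟨x, hi.hx.1, fun hh => hh.2 hxP⟩
      (B' := B ∪ Nb G P) (L' := Function.update (rl G B L P M) u Y) (x' := u) (y' := u) (w' := w)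
      (M' := Y) ⟨run_pl hi.pl hPB, ⟨⟨hu.1, huP⟩, Or.inl hu.2⟩, ⟨⟨hu.1, huP⟩, Or.inl hu.2⟩, Or.inl rfl,
        ⟨⟨hi.hw.1, hwP⟩, Or.inl hi.hw.2⟩, huw.symm, huw.symm, by simp, by simp, Or.inl hY2,
        by rw [Function.update_of_ne huw.symm, rl_B hi.hw.2]; exact hi.lw,
        (run_lst hi.lst hM.le).mono' subset_rfl (fun _ _ h => h) (by
          intro v hv hvS
          simp [hS v hvS hv.2]) (by
          intro v _ hv
          rw [Function.update_of_ne (fun h => hv (by simp [h]))])⟩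
      (by
        rintro (⟨h1, _⟩ | ⟨_, h2, _⟩)
        · omega
        · exact h2 rfl)
    have hφu : φ u ∈ Y := by simpa using hφ.1 u ⟨hu.1, huP⟩
    obtain ⟨φ', h', _⟩ := run_port hPB hM hPc hd (φ := φ) (hφ.mono subset_rfl (by
      intro v hv
      by_cases hvu : v = u
      · subst hvu
        rw [Function.update_self, rl_B hu.2]
        exact hY.trans Finset.sdiff_subset
      · rw [Function.update_of_ne hvu])) hML hb hu huP hbu
      (Finset.mem_sdiff.1 (hY hφu)).2
    exact h.nc ⟨φ', h'⟩
  push Not at hb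
  by_cases hc : ∃ b ∈ P, G.Adj b w
  swap
  · push Not at hc
    have hno : ∀ b ∈ P, ∀ u ∈ U ∩ B, u ∉ P → ¬ G.Adj b u := by
      intro b hbP u hu huP hbu
      exact hc b hbP (hb b hbP u hu huP hbu ▸ hbu)
    have ht : TwoCol G P := cyc hi.pl hns hPc hPB (by
      intro a ha b hb hab
      by_contra hbP
      exact hno a ha b hb hbP hab) hi.hw hwP (hd.mono subset_rfl hPB)
    obtain ⟨φ, hφ, _⟩ := run_T1 (X := M) hi.pl hPB hi.lst hM.le hi.hw hwP hS hd0
    obtain ⟨φ', h', _⟩ := run_fin (hPB.trans inter_subset_left) hM hφ ht hML (b2 := x) (u2 := x)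
      (fun v hv u hu huP hvu => absurd hvu (hno v hv u hu huP))
    exact h.nc ⟨φ', h'⟩
  obtain ⟨b, hbP, hbw⟩ := hc
  by_cases hLw : L w ⊆ M
  swap
  · obtain ⟨d, hd1, hd2⟩ := Finset.not_subset.1 hLw
    obtain ⟨φ, hφ, hφw⟩ := run_T1 (X := M) hi.pl hPB hi.lst hM.le hi.hw hwP hS hd1
    obtain ⟨φ', h', _⟩ := run_port hPB hM hPc hd hφ hML hbP hi.hw hwP hbw (by rwa [hφw])
    exact h.nc ⟨φ', h'⟩
  have hLwM : L w = M := Finset.eq_of_subset_of_card_le hLw (by have := hi.lw; omega)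
  have hC : Conn G (insert w P) := hPc.insert hbP hbw.symm
  have hCB : insert w P ⊆ U ∩ B := by
    rintro v (rfl | hv); exacts [hi.hw, hPB hv]
  have ht : TwoCol G P := bip hC (subset_insert w P) (fun h => hwP (h (Or.inl rfl)))
    (hd.mono subset_rfl hCB)
  obtain ⟨g, hg⟩ := ht
  by_cases hsame : ∀ v ∈ P, G.Adj v w → g v = g b
  · obtain ⟨c, hc⟩ := hi.Mne
    obtain ⟨e, he, hec⟩ := exists_ne_of_two hM.ge c
    obtain ⟨φ, hφ, hφw⟩ := run_T1 (X := M) hi.pl hPB hi.lst hM.le hi.hw hwP hS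
      (d := e) (by rw [hLwM]; exact he)
    let ψ : V → ℕ := fun v => if g v = g b then c else e
    have hψ : IsCol G P (fun _ => M) ψ := by
      refine ⟨fun v _ => ?_, fun v hv u hu hvu => ?_⟩
      · dsimp only [ψ]; split_ifs
        exacts [hc, he]
      · have := hg v hv u hu hvu
        by_cases h1 : g v = g b <;> by_cases h2 : g u = g b <;>
          simp only [ψ, h1, h2, if_true, if_false]
        · exact absurd (h1.trans h2.symm) this
        · exact hec.symm
        · exact hec
        · exfalso
          revert this h1 h2
          cases g v <;> cases g u <;> cases g b <;> simp
    obtain ⟨φ', h', _⟩ := run_ext (hPB.trans inter_subset_left) hφ hψ hML (by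
      intro v hv u hu huP hvu
      have : u = w := hb v hv u hu huP hvu
      subst this
      rw [hφw]
      simp only [ψ, hsame v hv hvu, if_true]
      exact hec)
    exact h.nc ⟨φ', h'⟩
  push Not at hsame
  obtain ⟨b2, hb2P, hb2w, hgb⟩ := hsame
  have hbb : b ≠ b2 := fun hh => hgb (by rw [hh])
  by_cases hP0 : P ⊆ {x, y}
  · refine h.nt (Or.inr ⟨hM, ?_⟩)
    have hb1 := hP0 hbP
    have hb2 := hP0 hb2P
    have : x ≠ y ∧ G.Adj x w ∧ G.Adj y w := by
      rcases hb1 with rfl | rfl <;> rcases hb2 with rfl | rfl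
      · exact absurd rfl hbb
      · exact ⟨hbb, hbw, hb2w⟩
      · exact ⟨hbb.symm, hb2w, hbw⟩
      · exact absurd rfl hbb
    exact ⟨this.1, w, hi.hw, this.2.1, this.2.2, Or.inr ⟨rfl, hLwM⟩⟩
  · obtain ⟨b0, hb0P, hb0⟩ := not_subset.1 hP0
    have hb0w : b0 ≠ w := fun hh => hwP (hh ▸ hb0P)
    have hb0x : b0 ≠ x := fun hh => hb0 (by simp [hh])
    have hb0y : b0 ≠ y := fun hh => hb0 (by simp [hh])
    have h3 : 3 ≤ (L b0).card := (hi.lst b0 (hPB hb0P).1 (by simp [hb0x, hb0y, hb0w])).1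
    obtain ⟨d, hd1, hd2⟩ : ∃ d ∈ L b0, d ∉ M := by
      by_contra hcon
      push Not at hcon
      have := Finset.card_le_card (show L b0 ⊆ M from hcon)
      omega
    set R := insert w P \ {b0} with hR
    have hRC : R ⊆ insert w P := sdiff_subset
    have hRB : R ⊆ U ∩ B := hRC.trans hCB
    have htR : TwoCol G R := bip hC hRC (fun hh => (hh (Or.inr hb0P)).2 rfl)
      (hns.deg2 hi.pl hRB |>.mono subset_rfl hCB)
    have hb0R : b0 ∉ R := fun hh => hh.2 rfl
    obtain ⟨φ, hφ, hφb⟩ := run_T1 (P := R) (X := M) hi.pl hRB hi.lst hM.le (hPB hb0P) hb0R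
      (by
        rintro v (rfl | rfl | rfl) hv
        · exact absurd ⟨Or.inr hxP, hb0x.symm⟩ hv
        · exact absurd ⟨Or.inr hyP, hb0y.symm⟩ hv
        · exact absurd ⟨Or.inl rfl, hb0w.symm⟩ hv) hd1
    obtain ⟨φ', h', _⟩ := run_fin (hRB.trans inter_subset_left) hM hφ htR (by
      rintro v ⟨rfl | hv, _⟩
      · rw [hLwM]
      · exact hML v hv) (b2 := x) (u2 := x) (by
      intro v hv u hu huR hvu
      left
      by_cases hub : u = b0
      · rw [hub, hφb]; exact hd2
      · exfalso
        have huP : u ∉ P := fun hh => huR ⟨Or.inr hh, hub⟩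
        have huw : u ≠ w := fun hh => huR ⟨Or.inl hh, hub⟩
        rcases hv.1 with rfl | hvP
        · exact hns.deg hi.pl hi.hw (hPB hbP) (hPB hb2P) hu hbw.symm hb2w.symm hvu hbb
            (fun hh => huP (hh ▸ hbP)) (fun hh => huP (hh ▸ hb2P))
        · exact huw (hb v hvP u hu huP hvu))
    exact h.nc ⟨φ', h'⟩

end run
end HC

namespace HC

section chordlessV
variable {V : Type u} {G : SimpleGraph V} [Finite V]

def NSep (G : SimpleGraph V) (U : Set V) (a b : V) : Prop :=
  ∀ K ⊆ U \ {a, b}, K.Nonempty → Clo G (U \ {a, b}) K → U \ {a, b} ⊆ K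

lemma tch1 {a b : V} (h : G.Adj a b) : Tch G {a} {b} := ⟨a, rfl, b, rfl, h⟩

lemma sub1 {U : Set V} {a : V} (h : a ∈ U) : ({a} : Set V) ⊆ U := by
  rintro _ rfl; exact h

lemma dis1 {K : Set V} {a : V} (h : a ∉ K) : Disjoint {a} K := by simpa using h

lemma dis1' {K : Set V} {a : V} (h : a ∉ K) : Disjoint K {a} := by simpa using h

/-- the middle vertex of a fan has no further neighbours -/
lemma Crit.middle {U B : Set V} {L : V → Finset ℕ} {x y w : V} {M : Finset ℕ}
    (h : Crit G U B L x y w M) {b m n t : V} (hb : b ∈ U ∩ B) (hm : m ∈ U ∩ B) (hn : n ∈ U ∩ B)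
    (ht : t ∈ U) (hbm : G.Adj b m) (hbn : G.Adj b n) (hbt : G.Adj b t) (hmt : G.Adj m t)
    (hnt : G.Adj n t) (hmn : m ≠ n) (s1 : NSep G U b m) (s2 : NSep G U b n) :
    ∀ v ∈ U, G.Adj b v → v = m ∨ v = n ∨ v = t := by
  intro v hv hbv
  by_contra hcon
  push Not at hcon
  obtain ⟨vm, vn, vt⟩ := hcon
  have hpl := h.inst.pl
  have hvS : v ∈ U \ {b, m, n, t} := ⟨hv, by simp [vm, vn, vt, hbv.ne']⟩
  set R := comp G (U \ {b, m, n, t}) v with hR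
  have hvR : v ∈ R := mem_comp hvS
  have hRc : Conn G R := comp_conn hvS
  have hRs : R ⊆ U \ {b, m, n, t} := comp_subset _ _
  have hRU : R ⊆ U := hRs.trans sdiff_subset
  have bR : b ∉ R := fun hh => (hRs hh).2 (by simp)
  have mR : m ∉ R := fun hh => (hRs hh).2 (by simp)
  have nR : n ∉ R := fun hh => (hRs hh).2 (by simp)
  have tR : t ∉ R := fun hh => (hRs hh).2 (by simp)
  have tbR : Tch G R {b} := ⟨v, hvR, b, rfl, hbv.symm⟩
  have hcl : ∀ a ∈ R, ∀ c ∈ U, G.Adj a c → c ∈ R ∨ c = b ∨ c = m ∨ c = n ∨ c = t := by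
    intro a ha c hc hac
    by_cases hcS : c ∈ ({b, m, n, t} : Set V)
    · exact Or.inr (by simpa using hcS)
    · exact Or.inl (comp_clo _ _ a ha c ⟨hc, hcS⟩ hac)
  have key : Tch G R {m} → Tch G R {n} → False := by
    intro h1 h2
    refine hpl.k33a R {t} ∅ {b} {m} {n} hRc (conn_singleton _) reach_empty (conn_singleton _)
      (conn_singleton _) (conn_singleton _) hRU (sub1 ht) (empty_subset _) (sub1 hb.1) (sub1 hm.1)
      (sub1 hn.1) (dis1' tR) (by simp) (by simp) (by simpa using hbm.ne) (by simpa using hbn.ne)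
      (by simpa using hmn) (dis1' bR) (dis1' mR) (dis1' nR) (by simpa using hbt.ne')
      (by simpa using hmt.ne') (by simpa using hnt.ne') (by simp) (by simp) (by simp) tbR h1 h2
      (tch1 hbt.symm) (tch1 hmt.symm) (tch1 hnt.symm) (Or.inl ⟨b, rfl, hb.2⟩)
      (Or.inl ⟨m, rfl, hm.2⟩) (Or.inl ⟨n, rfl, hn.2⟩)
  by_cases hRt : Tch G R {t}
  swap
  · refine key ?_ ?_
    · by_contra hc
      have := s2 R (fun a ha => ⟨hRU ha, by
        rintro (rfl | rfl); exacts [bR ha, nR ha]⟩) hRc.1 (by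
        intro a ha c hc' hac
        rcases hcl a ha c hc'.1 hac with h | rfl | rfl | rfl | rfl
        · exact h
        · exact absurd (by simp) hc'.2
        · exact absurd ⟨a, ha, c, rfl, hac⟩ hc
        · exact absurd (by simp) hc'.2
        · exact absurd ⟨a, ha, c, rfl, hac⟩ hRt)
      exact mR (this ⟨hm.1, by simp [hbm.ne', hmn]⟩)
    · by_contra hc
      have := s1 R (fun a ha => ⟨hRU ha, by
        rintro (rfl | rfl); exacts [bR ha, mR ha]⟩) hRc.1 (by
        intro a ha c hc' hac
        rcases hcl a ha c hc'.1 hac with h | rfl | rfl | rfl | rfl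
        · exact h
        · exact absurd (by simp) hc'.2
        · exact absurd (by simp) hc'.2
        · exact absurd ⟨a, ha, c, rfl, hac⟩ hc
        · exact absurd ⟨a, ha, c, rfl, hac⟩ hRt)
      exact nR (this ⟨hn.1, by simp [hbn.ne', hmn.symm]⟩)
  by_cases hRB : Disjoint R B
  swap
  · refine hpl.k33a {b} {t} ∅ {m} {n} R (conn_singleton _) (conn_singleton _) reach_empty
      (conn_singleton _) (conn_singleton _) hRc (sub1 hb.1) (sub1 ht) (empty_subset _) (sub1 hm.1)
      (sub1 hn.1) hRU (by simpa using hbt.ne) (by simp) (by simp) (by simpa using hmn) (dis1 mR)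
      (dis1 nR) (by simpa using hbm.ne) (by simpa using hbn.ne) (dis1 bR)
      (by simpa using hmt.ne') (by simpa using hnt.ne') (dis1 tR) (by simp) (by simp) (by simp)
      (tch1 hbm) (tch1 hbn) tbR.symm (tch1 hmt.symm) (tch1 hnt.symm) hRt.symm
      (Or.inl ⟨m, rfl, hm.2⟩) (Or.inl ⟨n, rfl, hn.2⟩) (Or.inl (not_disjoint_iff_nonempty_inter.1 hRB))
  by_cases hRm : Tch G R {m}
  · have hRn : ¬ Tch G R {n} := fun hh => key hRm hh
    exact h.R2 hm.1 ht hb hmt hbm.symm hbt.symm (K := R) (fun a ha => ⟨hRU ha, by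
      rintro (rfl | rfl | rfl); exacts [mR ha, tR ha, bR ha]⟩) (by
      intro a ha c hc' hac
      rcases hcl a ha c hc'.1 hac with h | rfl | rfl | rfl | rfl
      · exact h
      · exact absurd (by simp) hc'.2
      · exact absurd (by simp) hc'.2
      · exact absurd ⟨a, ha, c, rfl, hac⟩ hRn
      · exact absurd (by simp) hc'.2) hRc.1 hRB
  · exact h.R2 hn.1 ht hb hnt hbn.symm hbt.symm (K := R) (fun a ha => ⟨hRU ha, by
      rintro (rfl | rfl | rfl); exacts [nR ha, tR ha, bR ha]⟩) (by
      intro a ha c hc' hac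
      rcases hcl a ha c hc'.1 hac with h | rfl | rfl | rfl | rfl
      · exact h
      · exact absurd (by simp) hc'.2
      · exact absurd ⟨a, ha, c, rfl, hac⟩ hRm
      · exact absurd (by simp) hc'.2
      · exact absurd (by simp) hc'.2) hRc.1 hRB

structure Start (G : SimpleGraph V) (U B : Set V) (L : V → Finset ℕ) (p : V) (c : ℕ) (s s' t : V)
    (M1 M2 : Finset ℕ) : Prop where
  hs : s ∈ U ∩ B
  hs' : s' ∈ U ∩ B
  ht : t ∈ U
  htB : t ∉ B
  ne : s ≠ s'
  ps : G.Adj p s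
  ps' : G.Adj p s'
  pt : G.Adj p t
  st : G.Adj s t
  st' : G.Adj s' t
  c1 : c ∉ M1
  c2 : c ∉ M2
  m1 : M1.card = 2
  m2 : M2.card = 2
  ls : L s = insert c M1
  ls' : L s' = insert c M2
  lt : L t = insert c (M1 ∪ M2)
  dis : Disjoint M1 M2

lemma Start.symm {U B : Set V} {L : V → Finset ℕ} {p : V} {c : ℕ} {s s' t : V}
    {M1 M2 : Finset ℕ} (h : Start G U B L p c s s' t M1 M2) : Start G U B L p c s' s t M2 M1 :=
  ⟨h.hs', h.hs, h.ht, h.htB, h.ne.symm, h.ps', h.ps, h.pt, h.st', h.st, h.c2, h.c1, h.m2, h.m1,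
    h.ls', h.ls, by rw [h.lt, Finset.union_comm], h.dis.symm⟩

variable {U B : Set V} {L : V → Finset ℕ} {p w : V} {c : ℕ}

/-- `p` has two outer neighbours with lists of size three containing `c` -/
lemma Crit.nbrs
    (h : Crit G U B L p p w {c}) (hp2 : Deg2 G {p} (U ∩ B)) (hpw : ¬ G.Adj p w) :
    ∃ s ∈ U ∩ B, ∃ s' ∈ U ∩ B, s ≠ s' ∧ G.Adj p s ∧ G.Adj p s' ∧ ∃ M1 M2 : Finset ℕ,
      c ∉ M1 ∧ c ∉ M2 ∧ M1.card = 2 ∧ M2.card = 2 ∧ L s = insert c M1 ∧ L s' = insert c M2 := by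
  classical
  have hi := h.inst
  obtain ⟨d0, hd0⟩ : (L w).Nonempty := by rw [← Finset.card_pos]; have := hi.lw; omega
  have hPp : ({p} : Set V) ⊆ U ∩ B := sub1 hi.hx
  have hA : ∃ s ∈ U ∩ B, G.Adj p s := by
    by_contra hcon
    push Not at hcon
    obtain ⟨φ, hφ, _⟩ := run_T1 (P := {p}) (X := {c}) hi.pl hPp hi.lst (by simp) hi.hw hi.wx
      (by rintro v (rfl | rfl | rfl) hv; exacts [absurd rfl hv, absurd rfl hv, rfl]) hd0
    obtain ⟨φ', h', _⟩ := run_ext (ψ := fun _ => c) (sub1 hi.hx.1) hφ ⟨by simp, by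
      rintro a rfl b rfl hab; exact absurd hab G.irrefl⟩ (by rintro v rfl; rw [hi.lx])
      (by rintro v rfl u hu _ huv; exact absurd huv (hcon u hu))
    exact h.nc ⟨φ', h'⟩
  have hA2 : ∀ s ∈ U ∩ B, G.Adj p s → ∃ s' ∈ U ∩ B, G.Adj p s' ∧ s' ≠ s ∧ (L s' \ {c}).card ≤ 2 := by
    intro s hs hps
    by_contra hcon
    push Not at hcon
    have hsw : s ≠ w := fun hh => hpw (hh ▸ hps)
    have h3 : 3 ≤ (L s).card := (hi.lst s hs.1 (by simp [hps.ne', hsw])).1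
    obtain ⟨Y, hY, hY2⟩ := exists_sub2 (card_sdiff_ge (L s) {c} 2 (by simpa using h3))
    let L' : V → Finset ℕ := fun v => if v = s then Y else if G.Adj p v then L v \ {c} else L v
    obtain ⟨φ, hφ⟩ := h.use (U' := U \ {p}) sdiff_subset ⟨p, hi.hx.1, by simp⟩
      (B' := B ∪ Nb G {p}) (L' := L') (x' := s) (y' := s) (w' := w) (M' := Y)
      ⟨run_pl hi.pl hPp, ⟨⟨hs.1, hps.ne'⟩, Or.inl hs.2⟩, ⟨⟨hs.1, hps.ne'⟩, Or.inl hs.2⟩, Or.inl rfl,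
        ⟨⟨hi.hw.1, hi.wx⟩, Or.inl hi.hw.2⟩, hsw.symm, hsw.symm, by simp [L'], by simp [L'],
        Or.inl hY2, by simpa [L', hsw.symm, hpw] using hi.lw, by
          intro v hv hvS
          have hvs : v ≠ s := fun hh => hvS (by simp [hh])
          have hvw : v ≠ w := fun hh => hvS (by simp [hh])
          have hvp : v ≠ p := hv.2
          have h1 := hi.lst v hv.1 (by simp [hvp, hvw])
          simp only [L', hvs, if_false]
          split_ifs with hpv
          · refine ⟨?_, fun hh => absurd (Or.inr ⟨p, rfl, hpv⟩) hh⟩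
            by_cases hvB : v ∈ B
            · exact hcon v ⟨hv.1, hvB⟩ hpv hvs
            · have := h1.2 hvB
              exact card_sdiff_ge _ _ _ (by simp; omega)
          · exact ⟨h1.1, fun hh => h1.2 fun hB => hh (Or.inl hB)⟩⟩
      (by
        rintro (⟨h1, _⟩ | ⟨_, h2, _⟩)
        · omega
        · exact h2 rfl)
    have hsub : ∀ v ∈ U \ {p}, L' v ⊆ L v ∧ (G.Adj p v → c ∉ L' v) := by
      intro v hv
      simp only [L']
      split_ifs with h1 h2
      · subst h1
        exact ⟨hY.trans Finset.sdiff_subset, fun _ hc => by simpa using (Finset.mem_sdiff.1 (hY hc)).2⟩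
      · exact ⟨Finset.sdiff_subset, fun _ => by simp⟩
      · exact ⟨Finset.Subset.refl _, fun h => absurd h h2⟩
    refine h.nc (Col.extend1 (v := p) (c := c) (hφ.mono subset_rfl fun v hv => (hsub v hv).1)
      (by rw [hi.lx]; simp) ?_)
    intro a ha hap hac
    have := hφ.1 a ⟨ha, hap.ne⟩
    exact (hsub a ⟨ha, hap.ne⟩).2 hap.symm (hac ▸ this)
  have fin : ∀ s ∈ U ∩ B, G.Adj p s → (L s \ {c}).card ≤ 2 → ∃ M1 : Finset ℕ, c ∉ M1 ∧ M1.card = 2 ∧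
      L s = insert c M1 := by
    intro s hs hps h2
    have hsw : s ≠ w := fun hh => hpw (hh ▸ hps)
    have h3 : 3 ≤ (L s).card := (hi.lst s hs.1 (by simp [hps.ne', hsw])).1
    have hcs : c ∈ L s := by
      by_contra hcs
      rw [Finset.sdiff_singleton_eq_erase, Finset.erase_eq_of_notMem hcs] at h2
      omega
    refine ⟨(L s).erase c, by simp, ?_, by rw [Finset.insert_erase hcs]⟩
    rw [Finset.sdiff_singleton_eq_erase] at h2
    have := Finset.card_erase_of_mem hcs
    omega
  obtain ⟨s0, hs0, ps0⟩ := hA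
  obtain ⟨s1, hs1, ps1, n10, k1⟩ := hA2 s0 hs0 ps0
  obtain ⟨s2, hs2, ps2, n21, k2⟩ := hA2 s1 hs1 ps1
  obtain ⟨M1, a1, a2, a3⟩ := fin s1 hs1 ps1 k1
  obtain ⟨M2, b1, b2, b3⟩ := fin s2 hs2 ps2 k2
  exact ⟨s1, hs1, s2, hs2, n21.symm, ps1, ps2, M1, M2, a1, b1, a2, b2, a3, b3⟩

lemma Crit.start_aux
    (h : Crit G U B L p p w {c}) (hp2 : Deg2 G {p} (U ∩ B)) (hpw : ¬ G.Adj p w)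
    {s s' : V} {M1 M2 : Finset ℕ} (hs : s ∈ U ∩ B) (hs' : s' ∈ U ∩ B) (ne : s ≠ s')
    (ps : G.Adj p s) (ps' : G.Adj p s') (c1 : c ∉ M1) (c2 : c ∉ M2) (m1 : M1.card = 2)
    (m2 : M2.card = 2) (ls : L s = insert c M1) (ls' : L s' = insert c M2)
    (hss : ¬ G.Adj s s') (hsd : Deg2 G {s} (U ∩ B)) :
    ∃ t, Start G U B L p c s s' t M1 M2 := by
  classical
  have hi := h.inst
  have hsw : s ≠ w := fun hh => hpw (hh ▸ ps)
  have hsw' : s' ≠ w := fun hh => hpw (hh ▸ ps')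
  have hPB : ({s} : Set V) ⊆ U ∩ B := sub1 hs
  have hpU : p ∈ U \ {s} := ⟨hi.hx.1, ps.ne⟩
  have hnb : ∀ v ∈ U ∩ B, G.Adj p v → v = s ∨ v = s' := by
    intro v hv hpv
    rcases hp2 p rfl v hv s hs s' hs' hpv ps ps' with hh | hh | hh
    exacts [Or.inl hh, Or.inr hh, absurd hh ne]
  have hnc : ¬ Col G (U \ {s}) (rl G B L {s} M1) := by
    rintro ⟨φ, hφ⟩
    have hφp : φ p = c := by
      have := hφ.1 p hpU
      rw [rl_B hi.hx.2, hi.lx] at this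
      simpa using this
    have ht : TwoCol G {s} := ⟨fun _ => true, by
      rintro a rfl b rfl hab; exact absurd hab G.irrefl⟩
    obtain ⟨φ', h', _⟩ := run_port hPB m1 (conn_singleton s) hsd hφ
      (by rintro v rfl; rw [ls]; exact Finset.subset_insert _ _) rfl hi.hx ps.ne ps.symm
      (by rwa [hφp])
    exact h.nc ⟨φ', h'⟩
  have htight : Tight G (U \ {s}) (B ∪ Nb G {s}) (rl G B L {s} M1) p p w {c} := by
    by_contra hnt
    refine hnc (h.use sdiff_subset ⟨s, hs.1, by simp⟩ (B' := B ∪ Nb G {s}) (x' := p) (y' := p)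
      (w' := w) (M' := {c}) ⟨run_pl hi.pl hPB, ⟨hpU, Or.inl hi.hx.2⟩, ⟨hpU, Or.inl hi.hx.2⟩,
        Or.inl rfl, ⟨⟨hi.hw.1, hsw.symm⟩, Or.inl hi.hw.2⟩, hi.wx, hi.wy,
        by rw [rl_B hi.hx.2, hi.lx], by rw [rl_B hi.hx.2, hi.lx], Or.inr ⟨by simp, rfl⟩,
        by rw [rl_B hi.hw.2]; exact hi.lw, run_lst hi.lst m1.le⟩ hnt)
  rcases htight with ⟨-, q, hq, r, hr, qw, rw', pq, pr, qr, heq, hcard, hsep, hn1, hn2⟩ |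
    ⟨_, hh, _⟩
  swap
  · exact absurd rfl hh
  have hin : ∀ v, v ∈ (U \ {s}) ∩ (B ∪ Nb G {s}) → G.Adj p v → v = s' ∨ (v ∉ B ∧ G.Adj s v) := by
    intro v hv hpv
    by_cases hvB : v ∈ B
    · exact Or.inl ((hnb v ⟨hv.1.1, hvB⟩ hpv).resolve_left hv.1.2)
    · rcases hv.2 with hh | ⟨_, rfl, hh⟩
      · exact absurd hh hvB
      · exact Or.inr ⟨hvB, hh⟩
  have fin : ∀ t, t ∈ U → t ∉ B → G.Adj s t → G.Adj p t → G.Adj s' t →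
      rl G B L {s} M1 s' \ {c} = rl G B L {s} M1 t \ {c} → ∃ t, Start G U B L p c s s' t M1 M2 := by
    intro t ht htB hst hpt hs't he
    rw [rl_B hs'.2, ls'] at he
    have h5 : 5 ≤ (L t).card := (hi.lst t ht (by
      rintro (rfl | rfl | rfl)
      exacts [htB hi.hx.2, htB hi.hx.2, htB hi.hw.2])).2 htB
    have : rl G B L {s} M1 t = L t \ M1 := rm_mem ⟨⟨s, rfl, hst⟩, htB⟩
    rw [this] at he
    have he2 : M2 = (L t \ M1) \ {c} := by
      rw [← he]
      ext a
      simp only [Finset.mem_sdiff, Finset.mem_insert, Finset.mem_singleton]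
      constructor
      · intro ha; exact ⟨Or.inr ha, fun hh => c2 (hh ▸ ha)⟩
      · rintro ⟨rfl | ha, hh⟩
        · exact absurd rfl hh
        · exact ha
    have hdis : Disjoint M1 M2 := by
      rw [Finset.disjoint_left, he2]
      intro a ha hh
      exact (Finset.mem_sdiff.1 (Finset.mem_sdiff.1 hh).1).2 ha
    have hsub : L t ⊆ insert c (M1 ∪ M2) := by
      intro a ha
      rw [he2]
      simp only [Finset.mem_insert, Finset.mem_union, Finset.mem_sdiff, Finset.mem_singleton]
      tauto
    have hlt : L t = insert c (M1 ∪ M2) := by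
      refine Finset.eq_of_subset_of_card_le hsub ?_
      have h1 := Finset.card_insert_le c (M1 ∪ M2)
      have h2 := Finset.card_union_le M1 M2
      omega
    exact ⟨t, hs, hs', ht, htB, ne, ps, ps', hpt, hst, hs't, c1, c2, m1, m2, ls, ls', hlt, hdis⟩
  rcases hin q hq pq with rfl | ⟨hqB, hsq⟩
  · rcases hin r hr pr with rfl | ⟨hrB, hsr⟩
    · exact absurd qr G.irrefl
    · exact fin r hr.1.1 hrB hsr pr qr heq
  · rcases hin r hr pr with rfl | ⟨hrB, hsr⟩
    · exact fin q hq.1.1 hqB hsq pq qr.symm heq.symm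
    · exfalso
      have hwS : w ∈ (U \ {s}) \ {q, r} := ⟨⟨hi.hw.1, hsw.symm⟩, by simp [qw.symm, rw'.symm]⟩
      set K := comp G ((U \ {s}) \ {q, r}) w with hK
      have hwK : w ∈ K := mem_comp hwS
      have hKs : K ⊆ (U \ {s}) \ {q, r} := comp_subset _ _
      have hKc : Conn G K := comp_conn hwS
      have qK : q ∉ K := fun hh => (hKs hh).2 (by simp)
      have rK : r ∉ K := fun hh => (hKs hh).2 (by simp)
      have sK : s ∉ K := fun hh => (hKs hh).1.2 rfl
      have pK : p ∉ K := by
        obtain ⟨T, hT, hpT, hwT, hTc⟩ := hsep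
        intro hpK
        have := hKc.subset_of_clo hKs hTc ⟨p, hpK, hpT⟩
        exact hwT (this hwK)
      have tr : Tch G {r} K := by
        by_contra hcon
        refine hn1 ⟨((U \ {s}) \ {q}) \ K, sdiff_subset, ⟨⟨hpU, pq.ne⟩, pK⟩, fun hh => hh.2 hwK, ?_⟩
        refine Clo.compl ?_ (fun a ha => ⟨(hKs ha).1, fun hh => qK (hh ▸ ha)⟩)
        intro a ha b hb hab
        by_cases hbr : b = r
        · subst hbr; exact absurd ⟨b, rfl, a, ha, hab.symm⟩ hcon
        · exact comp_clo _ _ a ha b ⟨hb.1, by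
            rintro (rfl | rfl)
            · exact hb.2 rfl
            · exact hbr rfl⟩ hab
      have tq : Tch G {q} K := by
        by_contra hcon
        refine hn2 ⟨((U \ {s}) \ {r}) \ K, sdiff_subset, ⟨⟨hpU, pr.ne⟩, pK⟩, fun hh => hh.2 hwK, ?_⟩
        refine Clo.compl ?_ (fun a ha => ⟨(hKs ha).1, fun hh => rK (hh ▸ ha)⟩)
        intro a ha b hb hab
        by_cases hbr : b = q
        · subst hbr; exact absurd ⟨b, rfl, a, ha, hab.symm⟩ hcon
        · exact comp_clo _ _ a ha b ⟨hb.1, by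
            rintro (rfl | rfl)
            · exact hbr rfl
            · exact hb.2 rfl⟩ hab
      exact hi.pl.k5 {p} {q} {r} {s} K (conn_singleton _) (conn_singleton _) (conn_singleton _)
        (conn_singleton _) (hKc.reach ⟨w, hwK, hi.hw.2⟩) (sub1 hi.hx.1) (sub1 hq.1.1)
        (sub1 hr.1.1) (sub1 hs.1) (hKs.trans (sdiff_subset.trans sdiff_subset))
        (by simpa using pq.ne) (by simpa using pr.ne) (by simpa using ps.ne)
        (by simpa using qr.ne) (by simpa using hsq.ne') (by simpa using hsr.ne')
        (dis1 pK) (dis1 qK) (dis1 rK) (dis1 sK) (tch1 pq) (tch1 pr) (tch1 ps) (tch1 qr)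
        (tch1 hsq.symm) (tch1 hsr.symm) (Or.inl ⟨p, rfl, hi.hx.2⟩) (Or.inr tq) (Or.inr tr)
        (Or.inl ⟨s, rfl, hs.2⟩)

lemma Crit.start
    (h : Crit G U B L p p w {c}) (hp2 : Deg2 G {p} (U ∩ B)) (hpw : ¬ G.Adj p w)
    (htri : ∀ s ∈ U ∩ B, ∀ s' ∈ U ∩ B, G.Adj p s → G.Adj p s' → ¬ G.Adj s s')
    (hdeg : ∀ s ∈ U ∩ B, ∀ s' ∈ U ∩ B, s ≠ s' → G.Adj p s → G.Adj p s' →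
      Deg2 G {s} (U ∩ B) ∨ Deg2 G {s'} (U ∩ B)) :
    ∃ s s' t M1 M2, Start G U B L p c s s' t M1 M2 ∧ Deg2 G {s} (U ∩ B) := by
  obtain ⟨s, hs, s', hs', ne, ps, ps', M1, M2, c1, c2, m1, m2, l1, l2⟩ := h.nbrs hp2 hpw
  rcases hdeg s hs s' hs' ne ps ps' with hd | hd
  · obtain ⟨t, ht⟩ := h.start_aux hp2 hpw hs hs' ne ps ps' c1 c2 m1 m2 l1 l2
      (htri s hs s' hs' ps ps') hd
    exact ⟨s, s', t, M1, M2, ht, hd⟩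
  · obtain ⟨t, ht⟩ := h.start_aux hp2 hpw hs' hs ne.symm ps' ps c2 c1 m2 m1 l2 l1
      (htri s' hs' s hs ps' ps) hd
    exact ⟨s', s, t, M2, M1, ht, hd⟩

end chordlessV
end HC

namespace HC

section chordlessV2
variable {V : Type u} {G : SimpleGraph V}

open Classical in
lemma IsCol.upd {U : Set V} {v : V} {L : V → Finset ℕ} {φ : V → ℕ} (h1 : IsCol G (U \ {v}) L φ)
    {c : ℕ} (hc : c ∈ L v) (h : ∀ a ∈ U, G.Adj a v → φ a ≠ c) :
    IsCol G U L (Function.update φ v c) := by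
  refine ⟨fun a ha => ?_, fun a ha b hb hab => ?_⟩
  · by_cases hav : a = v
    · subst hav; simpa using hc
    · rw [Function.update_of_ne hav]; exact h1.1 a ⟨ha, hav⟩
  · by_cases hav : a = v
    · subst hav
      rw [Function.update_self, Function.update_of_ne hab.ne']
      exact (h b hb hab.symm).symm
    · rw [Function.update_of_ne hav]
      by_cases hbv : b = v
      · subst hbv; rw [Function.update_self]; exact h a ha hab
      · rw [Function.update_of_ne hbv]; exact h1.2 a ⟨ha, hav⟩ b ⟨hb, hbv⟩ hab

variable [Finite V]

variable {U B : Set V} {L : V → Finset ℕ} {p w : V} {c : ℕ}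

lemma Crit.stepD
    (h : Crit G U B L p p w {c}) (hns : NoSep G U B) (hpw : ¬ G.Adj p w)
    {s s' t : V} {M1 M2 : Finset ℕ} (St : Start G U B L p c s s' t M1 M2) :
    ∃ z ∈ U ∩ B, G.Adj s' z ∧ G.Adj t z ∧ z ≠ p ∧ z ≠ s ∧
      ((z ≠ w ∧ M2 ⊆ L z ∧ (L z).card = 3) ∨ (z = w ∧ L w = M2)) := by
  classical
  have hi := h.inst
  have hsw : s ≠ w := fun hh => hpw (hh ▸ St.ps)
  have hsw' : s' ≠ w := fun hh => hpw (hh ▸ St.ps')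
  have htw : t ≠ w := fun hh => St.htB (hh ▸ hi.hw.2)
  have hPB : ({s} : Set V) ⊆ U ∩ B := sub1 St.hs
  have hss : ¬ G.Adj s s' := fun hh => hns.tri hi.pl hi.hx St.hs St.hs' hi.hw St.ps St.ps' hh hi.wx
    hsw.symm hsw'.symm
  have hN := h.middle hi.hx St.hs St.hs' St.ht St.ps St.ps' St.pt St.st St.st' St.ne
    (hns p hi.hx s St.hs (Or.inr St.ps)) (hns p hi.hx s' St.hs' (Or.inr St.ps'))
  have hpU : p ∈ U \ {s} := ⟨hi.hx.1, St.ps.ne⟩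
  set L1 := rl G B L {s} M1 with hL1
  have hnc : ¬ Col G (U \ {s}) L1 := by
    rintro ⟨φ, hφ⟩
    have hφp : φ p = c := by
      have := hφ.1 p hpU
      rw [hL1, rl_B hi.hx.2, hi.lx] at this
      simpa using this
    obtain ⟨φ', h', _⟩ := run_port hPB St.m1 (conn_singleton s) (hns.deg2 hi.pl hPB) hφ
      (by rintro v rfl; rw [St.ls]; exact Finset.subset_insert _ _) rfl hi.hx St.ps.ne St.ps.symm
      (by rw [hφp]; exact St.c1)
    exact h.nc ⟨φ', h'⟩
  let L' := Function.update (Function.update L1 t M2) s' M2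
  have hLt : L' t = M2 := by simp [L', Function.update_of_ne St.st'.ne']
  have hLs : L' s' = M2 := by simp [L']
  have hLo : ∀ v, v ≠ t → v ≠ s' → L' v = L1 v := fun v h1 h2 => by
    simp [L', Function.update_of_ne h2, Function.update_of_ne h1]
  have tU : t ∈ ((U \ {s}) \ {p}) ∩ (B ∪ Nb G {s}) :=
    ⟨⟨⟨St.ht, St.st.ne'⟩, St.pt.ne'⟩, Or.inr ⟨s, rfl, St.st⟩⟩
  have sU : s' ∈ ((U \ {s}) \ {p}) ∩ (B ∪ Nb G {s}) :=
    ⟨⟨⟨St.hs'.1, St.ne.symm⟩, St.ps'.ne'⟩, Or.inl St.hs'.2⟩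
  have hT : Tight G ((U \ {s}) \ {p}) (B ∪ Nb G {s}) L' t s' w M2 := by
    by_contra hT
    obtain ⟨φ, hφ⟩ := h.use (U' := ((U \ {s}) \ {p})) (sdiff_subset.trans sdiff_subset)
      ⟨p, hi.hx.1, by simp⟩
      ⟨(run_pl hi.pl hPB).mono sdiff_subset inter_subset_left, tU, sU, Or.inr St.st'.symm,
        ⟨⟨⟨hi.hw.1, hsw.symm⟩, hi.wx⟩, Or.inl hi.hw.2⟩, htw.symm, hsw'.symm, hLt, hLs, Or.inl St.m2,
        by rw [hLo w htw.symm hsw'.symm, hL1, rl_B hi.hw.2]; exact hi.lw,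
        (run_lst (P := {s}) (X := M1) hi.lst St.m1.le).mono' sdiff_subset (fun _ _ h => h)
          (by
            rintro v hv (rfl | rfl | rfl)
            exacts [absurd rfl hv.2, absurd rfl hv.2, by simp])
          (fun v hv hvS => by
            rw [hLo v (fun hh => hvS (by simp [hh])) (fun hh => hvS (by simp [hh]))])⟩ hT
    have hφ1 : IsCol G ((U \ {s}) \ {p}) L1 φ := hφ.mono subset_rfl (by
      intro v hv
      by_cases h1 : v = s'
      · subst h1; rw [hLs, hL1, rl_B St.hs'.2, St.ls']; exact Finset.subset_insert _ _
      by_cases h2 : v = t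
      · subst h2
        rw [hLt, hL1, show rl G B L {s} M1 v = L v \ M1 from rm_mem ⟨⟨s, rfl, St.st⟩, St.htB⟩,
          St.lt]
        intro a ha
        rw [Finset.mem_sdiff]
        exact ⟨by simp [ha], fun hh => Finset.disjoint_left.1 St.dis hh ha⟩
      rw [hLo v h2 h1])
    refine hnc (Col.extend1 (v := p) (c := c) hφ1 (by rw [hL1, rl_B hi.hx.2, hi.lx]; simp) ?_)
    intro a ha hap hac
    have ha' := hφ.1 a ⟨ha, hap.ne⟩
    rcases hN a ha.1 hap.symm with rfl | rfl | rfl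
    · exact ha.2 rfl
    · rw [hLs, hac] at ha'; exact St.c2 ha'
    · rw [hLt, hac] at ha'; exact St.c2 ha'
  rcases hT with ⟨h1, _⟩ | ⟨-, -, z, hz, tz, sz, hzz⟩
  · have := St.m2; omega
  have hLz : L' z = L1 z := hLo z tz.ne' sz.ne'
  by_cases hzB : z ∈ B
  · refine ⟨z, ⟨hz.1.1.1, hzB⟩, sz, tz, hz.1.2, hz.1.1.2, ?_⟩
    rw [hLz, hL1, rl_B hzB] at hzz
    rwa [hLo w htw.symm hsw'.symm, hL1, rl_B hi.hw.2] at hzz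
  exfalso
  have hsz : G.Adj s z := by
    rcases hz.2 with hh | ⟨_, rfl, hh⟩
    · exact absurd hh hzB
    · exact hh
  have hzU : z ∈ U := hz.1.1.1
  have zp : z ≠ p := hz.1.2
  have hNt : ∀ v ∈ U, G.Adj t v → v = p ∨ v = s ∨ v = s' ∨ v = z := by
    intro v hv htv
    by_contra hcon
    push Not at hcon
    obtain ⟨vp, vs, vs', vz⟩ := hcon
    have hvS : v ∈ U \ {p, s, s', t, z} := ⟨hv, by simp [vp, vs, vs', vz, htv.ne']⟩
    set R := comp G (U \ {p, s, s', t, z}) v with hR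
    have hvR : v ∈ R := mem_comp hvS
    have hRc : Conn G R := comp_conn hvS
    have hRs : R ⊆ U \ {p, s, s', t, z} := comp_subset _ _
    have hRU : R ⊆ U := hRs.trans sdiff_subset
    have pR : p ∉ R := fun hh => (hRs hh).2 (by simp)
    have sR : s ∉ R := fun hh => (hRs hh).2 (by simp)
    have sR' : s' ∉ R := fun hh => (hRs hh).2 (by simp)
    have tR : t ∉ R := fun hh => (hRs hh).2 (by simp)
    have zR : z ∉ R := fun hh => (hRs hh).2 (by simp)
    have ttR : Tch G {t} R := ⟨t, rfl, v, hvR, htv⟩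
    have hcl : ∀ a ∈ R, ∀ c ∈ U, G.Adj a c → c ∈ R ∨ c = s ∨ c = s' ∨ c = t ∨ c = z := by
      intro a ha c hc hac
      by_cases hcp : c = p
      · subst hcp
        rcases hN a (hRU ha) hac.symm with rfl | rfl | rfl
        exacts [absurd ha sR, absurd ha sR', absurd ha tR]
      by_cases hcS : c ∈ ({p, s, s', t, z} : Set V)
      · right; simpa [hcp] using hcS
      · exact Or.inl (comp_clo _ _ a ha c ⟨hc, hcS⟩ hac)
    by_cases hRB : Disjoint R B
    swap
    · exact hi.pl.k33a {p} {z} R {s} {s'} {t} (conn_singleton _) (conn_singleton _)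
        (hRc.reach (not_disjoint_iff_nonempty_inter.1 hRB))
        (conn_singleton _) (conn_singleton _) (conn_singleton _) (sub1 hi.hx.1) (sub1 hzU) hRU
        (sub1 St.hs.1) (sub1 St.hs'.1) (sub1 St.ht) (by simpa using zp.symm) (dis1 pR) (dis1 zR)
        (by simpa using St.ne) (by simpa using St.st.ne) (by simpa using St.st'.ne)
        (by simpa using St.ps.ne) (by simpa using St.ps'.ne) (by simpa using St.pt.ne)
        (by simpa using hsz.ne') (by simpa using sz.ne') (by simpa using tz.ne')
        (dis1 sR) (dis1 sR') (dis1 tR) (tch1 St.ps) (tch1 St.ps') (tch1 St.pt)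
        (tch1 hsz.symm) (tch1 sz.symm) (tch1 tz.symm)
        (Or.inl ⟨s, rfl, St.hs.2⟩) (Or.inl ⟨s', rfl, St.hs'.2⟩) (Or.inr ttR)
    by_cases h1 : Tch G {s} R
    · by_cases h2 : Tch G {s'} R
      · exact hi.pl.k33 {p} {z} R {s} {s'} {t} (conn_singleton _) (conn_singleton _) hRc
          (conn_singleton _) (conn_singleton _) (conn_singleton _) (sub1 hi.hx.1) (sub1 hzU) hRU
          (sub1 St.hs.1) (sub1 St.hs'.1) (sub1 St.ht) (by simpa using zp.symm) (dis1 pR) (dis1 zR)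
          (by simpa using St.ne) (by simpa using St.st.ne) (by simpa using St.st'.ne)
          (by simpa using St.ps.ne) (by simpa using St.ps'.ne) (by simpa using St.pt.ne)
          (by simpa using hsz.ne') (by simpa using sz.ne') (by simpa using tz.ne')
          (dis1 sR) (dis1 sR') (dis1 tR) (tch1 St.ps) (tch1 St.ps') (tch1 St.pt)
          (tch1 hsz.symm) (tch1 sz.symm) (tch1 tz.symm) h1 h2 ttR
      · exact h.R2 St.ht hzU St.hs tz St.st.symm hsz.symm (K := R) (fun a ha => ⟨hRU ha, by
          rintro (rfl | rfl | rfl); exacts [tR ha, zR ha, sR ha]⟩) (by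
          intro a ha c hc' hac
          rcases hcl a ha c hc'.1 hac with h | rfl | rfl | rfl | rfl
          · exact h
          · exact absurd (by simp) hc'.2
          · exact absurd ⟨c, rfl, a, ha, hac.symm⟩ h2
          · exact absurd (by simp) hc'.2
          · exact absurd (by simp) hc'.2) hRc.1 hRB
    · exact h.R2 St.ht hzU St.hs' tz St.st'.symm sz.symm (K := R) (fun a ha => ⟨hRU ha, by
        rintro (rfl | rfl | rfl); exacts [tR ha, zR ha, sR' ha]⟩) (by
        intro a ha c hc' hac
        rcases hcl a ha c hc'.1 hac with h | rfl | rfl | rfl | rfl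
        · exact h
        · exact absurd ⟨c, rfl, a, ha, hac.symm⟩ h1
        · exact absurd (by simp) hc'.2
        · exact absurd (by simp) hc'.2
        · exact absurd (by simp) hc'.2) hRc.1 hRB
  obtain ⟨φ, hφ⟩ := h.use (U' := U \ {t}) (L' := L) sdiff_subset ⟨t, St.ht, by simp⟩
    ⟨hi.pl.mono sdiff_subset inter_subset_left, ⟨⟨hi.hx.1, St.pt.ne⟩, hi.hx.2⟩,
      ⟨⟨hi.hx.1, St.pt.ne⟩, hi.hx.2⟩, Or.inl rfl, ⟨⟨hi.hw.1, htw.symm⟩, hi.hw.2⟩, hi.wx, hi.wy,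
      hi.lx, hi.ly, hi.hM, hi.lw, hi.lst.mono' sdiff_subset (fun _ _ h => h) (fun _ _ h => h)
        (fun _ _ _ => Finset.Subset.refl _)⟩ (by
    rintro (⟨-, q, hq, r, hr, qw, rw', pq, pr, qr, -⟩ | ⟨_, hh, _⟩)
    · rcases hN q hq.1.1 pq with rfl | rfl | rfl
      · rcases hN r hr.1.1 pr with rfl | rfl | rfl
        · exact G.irrefl qr
        · exact hss qr
        · exact hr.1.2 rfl
      · rcases hN r hr.1.1 pr with rfl | rfl | rfl
        · exact hss qr.symm
        · exact G.irrefl qr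
        · exact hr.1.2 rfl
      · exact hq.1.2 rfl
    · exact hh rfl)
  have hc5 : 5 ≤ (L t).card := (hi.lst t St.ht (by
      rintro (rfl | rfl | rfl)
      exacts [St.htB hi.hx.2, St.htB hi.hx.2, St.htB hi.hw.2])).2 St.htB
  obtain ⟨d, hd⟩ : (L t \ {φ p, φ s, φ s', φ z}).Nonempty := by
    rw [← Finset.card_pos]
    refine card_sdiff_ge _ _ 1 ?_
    have := Finset.card_le_four (a := φ p) (b := φ s) (c := φ s') (d := φ z)
    omega
  rw [Finset.mem_sdiff] at hd
  refine h.nc (Col.extend1 hφ hd.1 ?_)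
  intro a ha hat had
  subst had
  rcases hNt a ha hat.symm with rfl | rfl | rfl | rfl <;> exact hd.2 (by simp)

lemma Crit.fan
    (h : Crit G U B L p p w {c}) (hns : NoSep G U B) {t : V} (ht : t ∈ U) (htB : t ∉ B)
    {M : Finset ℕ} (hM : M.card = 2) (hwM : L w ≠ M) (hMt : M ⊆ L t) :
    ∀ n : ℕ, ∀ (D : Set V) (b b' : V) (e : ℕ), (U \ D).ncard ≤ n → D ⊆ U ∩ B → p ∈ D → w ∉ D →
      b ∈ U ∩ B → b ∉ D → b ≠ w → G.Adj b t → b' ∈ D → G.Adj b' b → G.Adj b' t → e ∈ L b →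
      e ∉ M → ∃ φ, IsCol G (U \ D) L φ ∧ φ b = e ∧ φ t ∈ M := by
  classical
  intro n
  have hi := h.inst
  have htw : t ≠ w := fun hh => htB (hh ▸ hi.hw.2)
  induction n with
  | zero =>
    intro D b b' e hn hD hpD hwD hb hbD
    have : (U \ D) = ∅ := (ncard_eq_zero (toFinite _)).1 (by omega)
    exact absurd (show b ∈ U \ D from ⟨hb.1, hbD⟩) (by simp [this])
  | succ n ih =>
    intro D b b' e hn hD hpD hwD hb hbD hbw hbt hb'D hb'b hb't heb heM
    have htD : t ∉ D := fun hh => htB (hD hh).2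
    have hpl : PL G (U \ D) (B ∪ {t}) := (run_pl hi.pl hD).mono subset_rfl (by
      rintro v ⟨hv | rfl, _⟩
      · exact Or.inl hv
      · exact Or.inr ⟨b', hb'D, hb't⟩)
    have hlst : ∀ v ∈ U \ D, v ≠ w → v ≠ t → 3 ≤ (L v).card ∧ (v ∉ B ∪ {t} → 5 ≤ (L v).card) := by
      intro v hv vw vt
      have := hi.lst v hv.1 (by
        rintro (rfl | rfl | rfl)
        exacts [hv.2 hpD, hv.2 hpD, vw rfl])
      exact ⟨this.1, fun hh => this.2 fun hB => hh (Or.inl hB)⟩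
    let L' := Function.update (Function.update L t (insert e M)) b {e}
    have hLt : L' t = insert e M := by simp [L', Function.update_of_ne hbt.ne']
    have hLb : L' b = {e} := by simp [L']
    have hLo : ∀ v, v ≠ t → v ≠ b → L' v = L v := fun v h1 h2 => by
      simp [L', Function.update_of_ne h2, Function.update_of_ne h1]
    have hbU : b ∈ (U \ D) ∩ (B ∪ {t}) := ⟨⟨hb.1, hbD⟩, Or.inl hb.2⟩
    have hwU : w ∈ (U \ D) ∩ (B ∪ {t}) := ⟨⟨hi.hw.1, hwD⟩, Or.inl hi.hw.2⟩
    by_cases hT : Tight G (U \ D) (B ∪ {t}) L' b b w {e}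
    swap
    · obtain ⟨φ, hφ⟩ := h.use sdiff_subset ⟨p, hi.hx.1, fun hh => hh.2 hpD⟩
        ⟨hpl, hbU, hbU, Or.inl rfl, hwU, hbw.symm, hbw.symm, hLb, hLb, Or.inr ⟨by simp, rfl⟩,
          by rw [hLo w htw.symm hbw.symm]; exact hi.lw, by
            intro v hv hvS
            have vb : v ≠ b := fun hh => hvS (by simp [hh])
            have vw : v ≠ w := fun hh => hvS (by simp [hh])
            by_cases vt : v = t
            · subst vt
              rw [hLt, Finset.card_insert_of_notMem heM, hM]
              exact ⟨le_rfl, fun hh => absurd (Or.inr rfl) hh⟩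
            · rw [hLo v vt vb]; exact hlst v hv vw vt⟩ hT
      have hφb : φ b = e := by
        have := hφ.1 b hbU.1
        rw [hLb] at this; simpa using this
      have hφt : φ t ∈ M := by
        have := hφ.1 t ⟨ht, htD⟩
        rw [hLt] at this
        rcases Finset.mem_insert.1 this with hh | hh
        · exact absurd (hφb.trans hh.symm) (hφ.2 b hbU.1 t ⟨ht, htD⟩ hbt)
        · exact hh
      refine ⟨φ, ⟨fun v hv => ?_, hφ.2⟩, hφb, hφt⟩
      by_cases vt : v = t
      · subst vt; exact hMt hφt
      by_cases vb : v = b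
      · subst vb; rwa [hφb]
      · rw [← hLo v vt vb]; exact hφ.1 v hv
    rcases hT with ⟨-, q, hq, r, hr, qw, rw', bq, br, qr, heq, hcard, -⟩ | ⟨_, hh, _⟩
    swap
    · exact absurd rfl hh
    have key : ∃ b1 ∈ U ∩ B, b1 ∉ D ∧ b1 ≠ w ∧ G.Adj b b1 ∧ G.Adj b1 t ∧ L b1 \ {e} = M := by
      have hMe : L' t \ {e} = M := by
        rw [hLt]; ext a
        simp only [Finset.mem_sdiff, Finset.mem_insert, Finset.mem_singleton]
        constructor
        · rintro ⟨h1 | h1, h2⟩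
          · exact absurd h1 h2
          · exact h1
        · intro h1; exact ⟨Or.inr h1, fun hh => heM (hh ▸ h1)⟩
      by_cases hqB : q ∈ B
      · by_cases hrB : r ∈ B
        · exfalso
          rcases hns.deg2 hi.pl (sub1 hb) b rfl b' (hD hb'D) q ⟨hq.1.1, hqB⟩ r ⟨hr.1.1, hrB⟩
            hb'b.symm bq br with rfl | rfl | hh
          exacts [hq.1.2 hb'D, hr.1.2 hb'D, qr.ne hh]
        · have hrt : r = t := hr.2.resolve_left hrB
          subst hrt
          refine ⟨q, ⟨hq.1.1, hqB⟩, hq.1.2, qw, bq, qr, ?_⟩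
          rw [← hLo q qr.ne bq.ne', heq, hMe]
      · have hqt : q = t := hq.2.resolve_left hqB
        subst hqt
        have hrB : r ∈ B := hr.2.resolve_right (fun hh => qr.ne hh.symm)
        refine ⟨r, ⟨hr.1.1, hrB⟩, hr.1.2, rw', br, qr.symm, ?_⟩
        rw [← hLo r qr.ne' br.ne', ← heq, hMe]
    obtain ⟨b1, hb1, hb1D, hb1w, bb1, b1t, hLb1⟩ := key
    have hMb1 : M ⊆ L b1 := hLb1 ▸ Finset.sdiff_subset
    have hb'B := hD hb'D
    have hNb := h.middle hb hb'B hb1 ht hb'b.symm bb1 hbt hb't b1t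
      (fun hh => hb1D (hh ▸ hb'D)) (hns b hb b' hb'B (Or.inr hb'b.symm))
      (hns b hb b1 hb1 (Or.inr bb1))
    let L2 := Function.update (Function.update L t M) b1 M
    have h2t : L2 t = M := by simp [L2, Function.update_of_ne b1t.ne']
    have h2b : L2 b1 = M := by simp [L2]
    have h2o : ∀ v, v ≠ t → v ≠ b1 → L2 v = L v := fun v h1 h2 => by
      simp [L2, Function.update_of_ne h2, Function.update_of_ne h1]
    have tU : t ∈ ((U \ D) \ {b}) ∩ (B ∪ {t}) := ⟨⟨⟨ht, htD⟩, hbt.ne'⟩, Or.inr rfl⟩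
    have b1U : b1 ∈ ((U \ D) \ {b}) ∩ (B ∪ {t}) := ⟨⟨⟨hb1.1, hb1D⟩, bb1.ne'⟩, Or.inl hb1.2⟩
    by_cases hT : Tight G ((U \ D) \ {b}) (B ∪ {t}) L2 t b1 w M
    swap
    · obtain ⟨φ, hφ⟩ := h.use (sdiff_subset.trans sdiff_subset)
        ⟨p, hi.hx.1, fun hh => hh.1.2 hpD⟩
        ⟨hpl.mono sdiff_subset inter_subset_left, tU, b1U, Or.inr b1t.symm,
          ⟨⟨hwU.1, hbw.symm⟩, hwU.2⟩, htw.symm, hb1w.symm, h2t, h2b, Or.inl hM,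
          by rw [h2o w htw.symm hb1w.symm]; exact hi.lw, by
            intro v hv hvS
            have vb : v ≠ b1 := fun hh => hvS (by simp [hh])
            have vw : v ≠ w := fun hh => hvS (by simp [hh])
            have vt : v ≠ t := fun hh => hvS (by simp [hh])
            rw [h2o v vt vb]; exact hlst v hv.1 vw vt⟩ hT
      have e1 := hφ.1 t tU.1
      have e2 := hφ.1 b1 b1U.1
      rw [h2t] at e1
      rw [h2b] at e2
      refine ⟨Function.update φ b e, IsCol.upd (hφ.mono subset_rfl ?_) heb ?_, by simp,
        by rwa [Function.update_of_ne hbt.ne']⟩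
      · intro v hv
        by_cases vb : v = b1
        · subst vb; rwa [h2b]
        by_cases vt : v = t
        · subst vt; rwa [h2t]
        rw [h2o v vt vb]
      · intro a ha hab hae
        rcases hNb a ha.1 hab.symm with rfl | rfl | rfl
        · exact ha.2 hb'D
        · exact heM (hae ▸ e2)
        · exact heM (hae ▸ e1)
    rcases hT with ⟨h1, _⟩ | ⟨-, -, z, hz, tz, b1z, hzz⟩
    · omega
    have hzB : z ∈ B := hz.2.resolve_right tz.ne'
    rw [h2o z tz.ne' b1z.ne', h2o w htw.symm hb1w.symm] at hzz
    rcases hzz with ⟨zw, hMz, hz3⟩ | ⟨_, hh⟩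
    swap
    · exact absurd hh hwM
    obtain ⟨e2, he2⟩ : (L z \ M).Nonempty := by
      rw [← Finset.card_pos]; exact card_sdiff_ge _ _ 1 (by omega)
    rw [Finset.mem_sdiff] at he2
    have hzU : z ∈ U ∩ B := ⟨hz.1.1.1, hzB⟩
    have hNb1 := h.middle hb1 hb hzU ht bb1.symm b1z b1t hbt tz.symm
      (fun hh => hz.1.2 hh.symm) (hns b1 hb1 b hb (Or.inr bb1.symm))
      (hns b1 hb1 z hzU (Or.inr b1z))
    obtain ⟨φ, hφ, hφz, hφt⟩ := ih (insert b (insert b1 D)) z b1 e2 (by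
        have : (U \ (insert b (insert b1 D))).ncard < (U \ D).ncard := by
          refine ncard_lt_ncard ⟨fun v hv => ⟨hv.1, fun hh => hv.2 (by simp [hh])⟩, fun hh => ?_⟩
            (toFinite _)
          exact (hh hbU.1).2 (by simp)
        omega) (by
        rintro v (rfl | rfl | hv)
        exacts [hb, hb1, hD hv]) (by simp [hpD]) (by simp [hbw.symm, hb1w.symm, hwD]) hzU (by
        rintro (hh | hh | hh)
        exacts [hz.1.2 hh, b1z.ne' hh, hz.1.1.2 hh]) zw tz.symm (by simp) b1z b1t he2.1 he2.2
    obtain ⟨m, hm, hmt⟩ := exists_ne_of_two (show 2 ≤ M.card by omega) (φ t)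
    have hs1 : IsCol G ((U \ D) \ {b}) L (Function.update φ b1 m) := by
      refine IsCol.upd (hφ.mono ?_ fun _ _ => Finset.Subset.refl _) (hMb1 hm) ?_
      · rintro v ⟨⟨hv, hv1⟩, hv2⟩
        refine ⟨hv.1, ?_⟩
        rintro (hh | hh | hh)
        exacts [hv1 hh, hv2 hh, hv.2 hh]
      · intro a ha hab1 ham
        rcases hNb1 a ha.1.1 hab1.symm with rfl | rfl | rfl
        · exact ha.2 rfl
        · rw [hφz] at ham; exact he2.2 (ham ▸ hm)
        · exact hmt ham.symm
    refine ⟨Function.update (Function.update φ b1 m) b e, IsCol.upd hs1 heb ?_, by simp,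
      by rwa [Function.update_of_ne hbt.ne', Function.update_of_ne b1t.ne']⟩
    intro a ha hab hae
    rcases hNb a ha.1 hab.symm with rfl | rfl | rfl
    · exact ha.2 hb'D
    · rw [Function.update_self] at hae; exact heM (hae ▸ hm)
    · rw [Function.update_of_ne b1t.ne'] at hae; exact heM (hae ▸ hφt)

lemma Crit.chordlessV_aux
    (h : Crit G U B L p p w {c}) (hns : NoSep G U B) (hpw : ¬ G.Adj p w)
    {s s' t : V} {M1 M2 : Finset ℕ} (St : Start G U B L p c s s' t M1 M2) (hw1 : L w ≠ M1) :
    False := by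
  classical
  have hi := h.inst
  have hsw : s ≠ w := fun hh => hpw (hh ▸ St.ps)
  have hsw' : s' ≠ w := fun hh => hpw (hh ▸ St.ps')
  have hss : ¬ G.Adj s s' := fun hh => hns.tri hi.pl hi.hx St.hs St.hs' hi.hw St.ps St.ps' hh hi.wx
    hsw.symm hsw'.symm
  obtain ⟨z, hz, s'z, tz, zp, zs, hzz⟩ := h.stepD hns hpw St
  obtain ⟨z2, hz2, sz2, tz2, z2p, z2s, hzz2⟩ := h.stepD hns hpw St.symm
  rcases hzz2 with ⟨z2w, hMz, hz3⟩ | ⟨_, hh⟩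
  swap
  · exact hw1 hh
  obtain ⟨e2, he2⟩ : (L z2 \ M1).Nonempty := by
    rw [← Finset.card_pos]; exact card_sdiff_ge _ _ 1 (by have := St.m1; omega)
  rw [Finset.mem_sdiff] at he2
  have hNp := h.middle hi.hx St.hs St.hs' St.ht St.ps St.ps' St.pt St.st St.st' St.ne
    (hns p hi.hx s St.hs (Or.inr St.ps)) (hns p hi.hx s' St.hs' (Or.inr St.ps'))
  have hNs := h.middle St.hs hi.hx hz2 St.ht St.ps.symm sz2 St.st St.pt tz2.symm z2p.symm
    (hns _ St.hs _ hi.hx (Or.inr St.ps.symm)) (hns _ St.hs _ hz2 (Or.inr sz2))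
  have hNs' := h.middle St.hs' hi.hx hz St.ht St.ps'.symm s'z St.st' St.pt tz.symm zp.symm
    (hns _ St.hs' _ hi.hx (Or.inr St.ps'.symm)) (hns _ St.hs' _ hz (Or.inr s'z))
  obtain ⟨φ, hφ, hφz, hφt⟩ := h.fan hns St.ht St.htB St.m1 hw1
    (by rw [St.lt]; intro a ha; simp [ha]) _ {p, s, s'} z2 s e2 le_rfl
    (by rintro v (rfl | rfl | rfl); exacts [hi.hx, St.hs, St.hs']) (by simp)
    (by simp [hi.wx, hsw.symm, hsw'.symm]) hz2 (by simp [z2p, sz2.ne', z2s]) z2w tz2.symm (by simp)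
    sz2 St.st he2.1 he2.2
  obtain ⟨m2, hm2, hm2z⟩ := exists_ne_of_two (show 2 ≤ M2.card by have := St.m2; omega) (φ z)
  obtain ⟨m1, hm1, hm1t⟩ := exists_ne_of_two (show 2 ≤ M1.card by have := St.m1; omega) (φ t)
  have e1 : IsCol G ((U \ {p}) \ {s}) L (Function.update φ s' m2) := by
    refine IsCol.upd (hφ.mono ?_ fun _ _ => Finset.Subset.refl _) (by rw [St.ls']; simp [hm2]) ?_
    · rintro v ⟨⟨hv, hv1⟩, hv2⟩
      refine ⟨hv.1, ?_⟩
      rintro (hh | hh | hh)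
      exacts [hv.2 hh, hv1 hh, hv2 hh]
    · intro a ha has ham
      rcases hNs' a ha.1.1 has.symm with rfl | rfl | rfl
      · exact ha.1.2 rfl
      · exact hm2z ham.symm
      · exact Finset.disjoint_left.1 St.dis hφt (ham ▸ hm2)
  have e2' : IsCol G (U \ {p}) L (Function.update (Function.update φ s' m2) s m1) := by
    refine IsCol.upd e1 (by rw [St.ls]; simp [hm1]) ?_
    intro a ha has ham
    rcases hNs a ha.1 has.symm with rfl | rfl | rfl
    · exact ha.2 rfl
    · rw [Function.update_of_ne z2s, hφz] at ham; exact he2.2 (ham ▸ hm1)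
    · rw [Function.update_of_ne St.st'.ne'] at ham; exact hm1t ham.symm
  refine h.nc (Col.extend1 e2' (c := c) (by rw [hi.lx]; simp) ?_)
  intro a ha hap hac
  rcases hNp a ha hap.symm with rfl | rfl | rfl
  · rw [Function.update_self] at hac; exact St.c1 (hac ▸ hm1)
  · rw [Function.update_of_ne St.ne.symm, Function.update_self] at hac; exact St.c2 (hac ▸ hm2)
  · rw [Function.update_of_ne St.st.ne', Function.update_of_ne St.st'.ne'] at hac
    exact St.c1 (hac ▸ hφt)

/-- adjacent source and sink -/
lemma Crit.npw
    (h : Crit G U B L p p w {c}) : ¬ G.Adj p w := by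
  classical
  intro hpw
  have hi := h.inst
  obtain ⟨d, hd, hdc⟩ := exists_ne_of_two hi.lw c
  obtain ⟨φ, hφ, -⟩ := run_T (P := ∅) (X := ∅) hi.pl (empty_subset _) hi.lst (by simp) hi.hx (by simp)
    hi.hw (by simp) (Or.inr hpw) (by rintro v (rfl | rfl | rfl) _ <;> simp)
    (fun v => if v = w then d else c) (by simp [hi.wx.symm, hi.lx]) (by simpa using hd)
    (fun _ => by simp [hi.wx.symm, hdc.symm])
  exact h.nc ⟨φ, hφ.mono (by simp) fun v _ => rl_sub v⟩

lemma Crit.chordlessV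
    (h : Crit G U B L p p w {c}) (hns : NoSep G U B) : False := by
  classical
  have hi := h.inst
  have hpw := h.npw
  obtain ⟨s, s', t, M1, M2, St, -⟩ := h.start (hns.deg2 hi.pl (sub1 hi.hx)) hpw
    (fun s hs s' hs' ps ps' hh => hns.tri hi.pl hi.hx hs hs' hi.hw ps ps' hh hi.wx
      (fun hh => hpw (hh ▸ ps)) (fun hh => hpw (hh ▸ ps')))
    (fun s hs s' hs' _ _ _ => Or.inl (hns.deg2 hi.pl (sub1 hs)))
  by_cases h1 : L w = M1
  · refine h.chordlessV_aux hns hpw St.symm (fun h2 => ?_)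
    have hd := St.dis
    have hm := St.m1
    obtain ⟨a, ha⟩ : M1.Nonempty := by rw [← Finset.card_pos]; omega
    exact Finset.disjoint_left.1 hd ha (by rw [← h2, h1]; exact ha)
  · exact h.chordlessV_aux hns hpw St h1

end chordlessV2
end HC

namespace HC

section chords
variable {V : Type u} {G : SimpleGraph V} [Finite V]
variable {U B : Set V} {L : V → Finset ℕ} {x y w : V} {M : Finset ℕ}

lemma Crit.nosep1
    (h : Crit G U B L x y w M) {q : V} (hq : q ∈ U ∩ B) (hqw : q ≠ w) : ¬ Sep G U {q} x w := by
  rintro ⟨T, hT, hx, hw, hcl⟩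
  exact hw (h.nocut hq hT ⟨x, hx⟩ hcl ⟨h.inst.hw.1, hqw.symm⟩)

/-- in the vertex case tightness does not need the separation conditions -/
lemma Crit.NT
    (h : Crit G U B L x y w M) (hM : M.card = 1) {q r : V} (hq : q ∈ U ∩ B) (hr : r ∈ U ∩ B)
    (qw : q ≠ w) (rw' : r ≠ w) (xq : G.Adj x q) (xr : G.Adj x r) (qr : G.Adj q r)
    (he : L q \ M = L r \ M) (hc : (L q \ M).card = 2) : False := by
  have hi := h.inst
  have hxy : x = y := by
    rcases hi.hM with hh | hh
    · omega
    · exact hh.2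
  have hwS : w ∈ U \ {x, q, r} := ⟨hi.hw.1, by simp [hi.wx, qw.symm, rw'.symm]⟩
  set C := comp G (U \ {x, q, r}) w with hC
  have hwC : w ∈ C := mem_comp hwS
  have hCs : C ⊆ U \ {x, q, r} := comp_subset _ _
  have hCc : Conn G C := comp_conn hwS
  have xC : x ∉ C := fun hh => (hCs hh).2 (by simp)
  have qC : q ∉ C := fun hh => (hCs hh).2 (by simp)
  have rC : r ∉ C := fun hh => (hCs hh).2 (by simp)
  have hcl : ∀ a ∈ C, ∀ b ∈ U, G.Adj a b → b ∈ C ∨ b = x ∨ b = q ∨ b = r := by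
    intro a ha b hb hab
    by_cases hbS : b ∈ ({x, q, r} : Set V)
    · exact Or.inr (by simpa using hbS)
    · exact Or.inl (comp_clo _ _ a ha b ⟨hb, hbS⟩ hab)
  by_cases tx : Tch G {x} C
  swap
  · refine h.nt (Or.inl ⟨hM, q, hq, r, hr, qw, rw', xq, xr, qr, he, hc, ?_, h.nosep1 hq qw,
      h.nosep1 hr rw'⟩)
    refine ⟨(U \ {q, r}) \ C, sdiff_subset, ⟨⟨hi.hx.1, by simp [xq.ne, xr.ne]⟩, xC⟩,
      fun hh => hh.2 hwC, Clo.compl ?_ ?_⟩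
    · intro a ha b hb hab
      rcases hcl a ha b hb.1 hab with hh | rfl | rfl | rfl
      · exact hh
      · exact absurd ⟨b, rfl, a, ha, hab.symm⟩ tx
      · exact absurd (by simp) hb.2
      · exact absurd (by simp) hb.2
    · intro a ha
      exact ⟨(hCs ha).1, by rintro (rfl | rfl); exacts [qC ha, rC ha]⟩
  -- a second vertex of the triangle is not touched
  have aux : ∀ q' r' : V, q' ∈ U ∩ B → r' ∈ U ∩ B → G.Adj x q' → G.Adj x r' → G.Adj q' r' →
      q' ∉ C → (∀ a ∈ C, ∀ b ∈ U, G.Adj a b → b ∈ C ∨ b = x ∨ b = q' ∨ b = r') →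
      r' ∉ C → ¬ Tch G {r'} C → False := by
    intro q' r' hq' hr' xq' xr' qr' qC' hcl' rC' hn
    refine h.R1 hi.hx hq' (Or.inr xq') (K := (U \ {x, q'}) \ C) sdiff_subset
      (Clo.compl ?_ ?_) ⟨r', ⟨hr'.1, by simp [xr'.ne', qr'.ne']⟩, rC'⟩ (fun hh => hh.2 hwC)
      (fun hh => hh.1.2 (by simp)) (fun hh => hh.1.2 (by simp [hxy]))
    · intro a ha b hb hab
      rcases hcl' a ha b hb.1 hab with hh | rfl | rfl | rfl
      · exact hh
      · exact absurd (by simp) hb.2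
      · exact absurd (by simp) hb.2
      · exact absurd ⟨b, rfl, a, ha, hab.symm⟩ hn
    · intro a ha
      exact ⟨(hCs ha).1, by rintro (rfl | rfl); exacts [xC ha, qC' ha]⟩
  by_cases tr : Tch G {r} C
  swap
  · exact aux q r hq hr xq xr qr qC hcl rC tr
  by_cases tq : Tch G {q} C
  swap
  · exact aux r q hr hq xr xq qr.symm rC (fun a ha b hb hab => by
      have := hcl a ha b hb hab; tauto) qC tq
  exact hi.pl.k5 {x} {q} {r} C ∅ (conn_singleton _) (conn_singleton _) (conn_singleton _) hCc
    reach_empty (sub1 hi.hx.1) (sub1 hq.1) (sub1 hr.1) (hCs.trans sdiff_subset) (empty_subset _)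
    (by simpa using xq.ne) (by simpa using xr.ne) (dis1 xC) (by simpa using qr.ne) (dis1 qC)
    (dis1 rC) (by simp) (by simp) (by simp) (by simp) (tch1 xq) (tch1 xr) tx (tch1 qr) tq tr
    (Or.inl ⟨x, rfl, hi.hx.2⟩) (Or.inl ⟨q, rfl, hq.2⟩) (Or.inl ⟨r, rfl, hr.2⟩)
    (Or.inl ⟨w, hwC, hi.hw.2⟩)

/-- we may assume that the sink has a list of size two -/
lemma Crit.shrink
    (h : Crit G U B L x y w M) : ∃ L', Crit G U B L' x y w M ∧ (L' w).card = 2 := by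
  classical
  have hi := h.inst
  by_cases h2 : (L w).card = 2
  · exact ⟨L, h, h2⟩
  have h3 : 3 ≤ (L w).card := by have := hi.lw; omega
  obtain ⟨X, hX, hX2, hXM⟩ : ∃ X ⊆ L w, X.card = 2 ∧ X ≠ M := by
    obtain ⟨Y, hY, hY2⟩ := exists_sub2 hi.lw
    by_cases hYM : Y = M
    · subst hYM
      obtain ⟨e, he⟩ : (L w \ Y).Nonempty := by
        rw [← Finset.card_pos]; exact card_sdiff_ge _ _ 1 (by omega)
      obtain ⟨f, hf⟩ : Y.Nonempty := by rw [← Finset.card_pos]; omega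
      rw [Finset.mem_sdiff] at he
      refine ⟨{e, f}, ?_, Finset.card_pair (fun hh => he.2 (hh ▸ hf)), fun hh => he.2 (hh ▸ by simp)⟩
      intro a ha
      rcases Finset.mem_insert.1 ha with rfl | ha
      · exact he.1
      · rw [Finset.mem_singleton.1 ha]; exact hY hf
    · exact ⟨Y, hY, hY2, hYM⟩
  have ho : ∀ v, v ≠ w → Function.update L w X v = L v := fun v hv => Function.update_of_ne hv _ _
  refine ⟨Function.update L w X, ⟨⟨hi.pl, hi.hx, hi.hy, hi.hxy, hi.hw, hi.wx, hi.wy,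
    by rw [ho x hi.wx.symm, hi.lx], by rw [ho y hi.wy.symm, hi.ly], hi.hM, by simp [hX2],
    hi.lst.mono' subset_rfl (fun _ _ h => h) (fun _ _ h => h) (fun v _ hv => by
      rw [ho v (fun hh => hv (by simp [hh]))])⟩, ?_, ?_, h.ih⟩, by simp [hX2]⟩
  · rintro (⟨h1, q, hq, r, hr, h2, h3, h4, h5, h6, h7, h8, h9⟩ | ⟨h1, h2, z, hz, h3, h4, h5⟩)
    · rw [ho q h2, ho r h3] at h7
      rw [ho q h2] at h8
      exact h.nt (Or.inl ⟨h1, q, hq, r, hr, h2, h3, h4, h5, h6, h7, h8, h9⟩)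
    · rcases h5 with ⟨h5, h6, h7⟩ | ⟨h5, h6⟩
      · rw [ho z h5] at h6 h7
        exact h.nt (Or.inr ⟨h1, h2, z, hz, h3, h4, Or.inl ⟨h5, h6, h7⟩⟩)
      · exact hXM (by simpa using h6)
  · intro hc
    refine h.nc (hc.mono subset_rfl ?_)
    intro v _
    by_cases hv : v = w
    · subst hv; simpa using hX
    · rw [ho v hv]

/-- precolouring one source vertex -/
lemma Crit.runT {U B U1 P : Set V} {L : V → Finset ℕ} {x y w : V} {M X : Finset ℕ}
    (h : Crit G U B L x y w M) (hU1 : U1 ⊆ U) (hP : P ⊆ U1 ∩ B) (hX : X.card ≤ 2)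
    (hx : x ∈ U1 \ P) (hy : y ∈ U1 \ P) (hw : w ∉ U1 \ P) {m : ℕ} (hm : m ∈ M) :
    ∃ φ, IsCol G (U1 \ P) (rl G B L P X) φ ∧ φ x = m := by
  have hi := h.inst
  obtain ⟨f, hfx, hfy, hf⟩ := hi.pick hm
  obtain ⟨φ, hφ, h1, _⟩ := run_T (X := X) (hi.pl.mono hU1 inter_subset_left) hP
    (S := {x, y} ∪ (U1 ∩ {w})) (hi.lst.mono' hU1 (fun _ _ h => h) (by
      rintro v hv (rfl | rfl | rfl)
      exacts [by simp, by simp, Or.inr ⟨hv, rfl⟩]) (fun _ _ _ => Finset.Subset.refl _)) hX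
    ⟨hx.1, hi.hx.2⟩ hx.2 ⟨hy.1, hi.hy.2⟩ hy.2 hi.hxy (by
      rintro v ((hv | hv) | ⟨h1, hv⟩) h2
      · exact Or.inl hv
      · exact Or.inr hv
      · rw [mem_singleton_iff] at hv; subst hv; exact absurd ⟨h1, h2⟩ hw) f
    (by rw [hfx, hi.lx]; exact hm) (by rw [hi.ly]; exact hfy) hf
  exact ⟨φ, hφ, h1.trans hfx⟩

lemma sdiff_two {A X : Finset ℕ} (hX : X.card = 2) (h3 : 3 ≤ A.card) (h : ¬ X ⊆ A) :
    2 ≤ (A \ X).card ∧ (4 ≤ A.card → 3 ≤ (A \ X).card) := by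
  have h4 : (A ∩ X).card < X.card := Finset.card_lt_card
    ⟨Finset.inter_subset_right, fun hh => h (hh.trans Finset.inter_subset_left)⟩
  have := Finset.card_sdiff_add_card_inter A X
  omega

/-- a new sink -/
lemma Crit.sink0 {U B U1 P : Set V} {L : V → Finset ℕ} {x y w v : V} {M X Y : Finset ℕ}
    (h : Crit G U B L x y w M) (hU1 : U1 ⊆ U) (hP : P ⊆ U1 ∩ B) (hX : X.card ≤ 2)
    (hx : x ∈ U1 \ P) (hy : y ∈ U1 \ P) (hw : w ∉ U1 \ P) (hv : v ∈ U1 ∩ B) (hvP : v ∉ P)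
    (hvx : v ≠ x) (hvy : v ≠ y) (hY : Y ⊆ L v) (hY2 : 2 ≤ Y.card)
    (hYM : G.Adj x v → G.Adj y v → x ≠ y → Y ≠ M)
    (hB : ∀ u ∈ U1 \ P, G.Adj x u → G.Adj y u → u ∈ Nb G P → u ∈ B) :
    ∃ φ, IsCol G (U1 \ P) (rl G B L P X) φ ∧ φ v ∈ Y := by
  classical
  have hi := h.inst
  let L' := Function.update (rl G B L P X) v Y
  have hLv : L' v = Y := by simp [L']
  have hLo : ∀ u, u ≠ v → L' u = rl G B L P X u := fun u hu => Function.update_of_ne hu _ _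
  have hLB : ∀ u ∈ (U1 \ P) ∩ (B ∪ Nb G P), u ≠ v → G.Adj x u → G.Adj y u → u ∈ B ∧ L' u = L u := by
    intro u hu huv xu yu
    have huB : u ∈ B := by
      rcases hu.2 with hh | hh
      · exact hh
      · exact hB u hu.1 xu yu hh
    exact ⟨huB, by rw [hLo u huv, rl_B huB]⟩
  obtain ⟨φ, hφ⟩ := h.use (U' := U1 \ P) (L' := L') (sdiff_subset.trans hU1)
    ⟨w, hi.hw.1, hw⟩
    ⟨run_pl (hi.pl.mono hU1 inter_subset_left) hP, ⟨hx, Or.inl hi.hx.2⟩, ⟨hy, Or.inl hi.hy.2⟩,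
      hi.hxy, ⟨⟨hv.1, hvP⟩, Or.inl hv.2⟩, hvx, hvy, by rw [hLo x hvx.symm, rl_B hi.hx.2, hi.lx],
      by rw [hLo y hvy.symm, rl_B hi.hy.2, hi.ly], hi.hM, by rwa [hLv],
      (run_lst (P := P) (S := {x, y} ∪ (U1 ∩ {w})) (hi.lst.mono' hU1 (fun _ _ h => h) (by
        rintro v hv (rfl | rfl | rfl)
        exacts [by simp, by simp, Or.inr ⟨hv, rfl⟩]) (fun _ _ _ => Finset.Subset.refl _)) hX).mono'
        subset_rfl (fun _ _ h => h) (by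
          rintro u hu ((rfl | rfl) | ⟨h1, h2⟩)
          · simp
          · simp
          · rw [mem_singleton_iff] at h2; subst h2; exact absurd hu hw) (by
          intro u hu huS
          rw [hLo u (fun hh => huS (by simp [hh]))])⟩
    (by
      rintro (⟨h1, q, hq, r, hr, h2, h3, h4, h5, h6, h7, h8, h9⟩ | ⟨h1, h2, z, hz, h3, h4, h5⟩)
      · have hxy : x = y := by
          rcases hi.hM with hh | hh
          · omega
          · exact hh.2
        obtain ⟨qB, e1⟩ := hLB q hq h2 h4 (hxy ▸ h4)
        obtain ⟨rB, e2⟩ := hLB r hr h3 h5 (hxy ▸ h5)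
        rw [e1, e2] at h7
        rw [e1] at h8
        exact h.NT h1 ⟨hU1 hq.1.1, qB⟩ ⟨hU1 hr.1.1, rB⟩ (fun hh => hw (hh ▸ hq.1))
          (fun hh => hw (hh ▸ hr.1)) h4 h5 h6 h7 h8
      · rcases h5 with ⟨h5, h6, h7⟩ | ⟨h5, h6⟩
        · obtain ⟨zB, e1⟩ := hLB z hz h5 h3 h4
          rw [e1] at h6 h7
          exact h.nt (Or.inr ⟨h1, h2, z, ⟨hU1 hz.1.1, zB⟩, h3, h4, Or.inl
            ⟨fun hh => hw (hh ▸ hz.1), h6, h7⟩⟩)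
        · subst h5
          rw [hLv] at h6
          exact hYM h3 h4 h2 h6)
  have hφv := hφ.1 v ⟨hv.1, hvP⟩
  rw [hLv] at hφv
  refine ⟨φ, hφ.mono subset_rfl ?_, hφv⟩
  intro u hu
  by_cases huv : u = v
  · subst huv; rw [hLv, rl_B hv.2]; exact hY
  · rw [hLo u huv]

lemma Crit.sink {U B U1 P : Set V} {L : V → Finset ℕ} {x y w v : V} {M X : Finset ℕ}
    (h : Crit G U B L x y w M) (hU1 : U1 ⊆ U) (hP : P ⊆ U1 ∩ B) (hX : X.card = 2)
    (hx : x ∈ U1 \ P) (hy : y ∈ U1 \ P) (hw : w ∉ U1 \ P) (hv : v ∈ U1 ∩ B) (hvP : v ∉ P)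
    (hXv : ¬ X ⊆ L v) (hvM : v = x ∨ v = y → M.card = 2)
    (hB : ∀ u ∈ U1 \ P, G.Adj x u → G.Adj y u → u ∈ Nb G P → u ∈ B) :
    ∃ φ, IsCol G (U1 \ P) (rl G B L P X) φ ∧ φ v ∉ X := by
  classical
  have hi := h.inst
  have hvw : v ≠ w := fun hh => hw (hh ▸ ⟨hv.1, hvP⟩)
  have pick : L v = M → M.card = 2 → ∃ m ∈ M, m ∉ X := by
    intro h1 h2
    by_contra hcon
    push Not at hcon
    have : M = X := Finset.eq_of_subset_of_card_le hcon (by omega)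
    exact hXv (by rw [h1, this])
  by_cases h1 : v = x
  · subst h1
    obtain ⟨m, hm, hmX⟩ := pick hi.lx (hvM (Or.inl rfl))
    obtain ⟨φ, hφ, hφm⟩ := h.runT hU1 hP hX.le hx hy hw hm
    exact ⟨φ, hφ, by rwa [hφm]⟩
  by_cases h2 : v = y
  · subst h2
    obtain ⟨m, hm, hmX⟩ := pick hi.ly (hvM (Or.inr rfl))
    obtain ⟨φ, hφ, hφm⟩ := h.swap.runT hU1 hP hX.le hy hx hw hm
    exact ⟨φ, hφ, by rwa [hφm]⟩
  have h3 : 3 ≤ (L v).card := (hi.lst v (hU1 hv.1) (by simp [h1, h2, hvw])).1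
  obtain ⟨h4, h5⟩ := sdiff_two hX h3 hXv
  obtain ⟨φ, hφ, hφv⟩ := h.sink0 hU1 hP hX.le hx hy hw hv hvP h1 h2 (Y := L v \ X)
    Finset.sdiff_subset h4 (by
      intro xv yv hxy he
      have hM2 : M.card = 2 := by
        rcases hi.hM with hh | hh
        · exact hh
        · exact absurd hh.2 hxy
      by_cases h6 : 4 ≤ (L v).card
      · have := h5 h6; rw [he] at this; omega
      · exact h.nt (Or.inr ⟨hM2, hxy, v, ⟨hU1 hv.1, hv.2⟩, xv, yv, Or.inl ⟨hvw,
          he ▸ Finset.sdiff_subset, by omega⟩⟩)) hB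
  exact ⟨φ, hφ, (Finset.mem_sdiff.1 hφv).2⟩

structure Cut (G : SimpleGraph V) (U B : Set V) (x y w a b : V) (K : Set V) : Prop where
  ha : a ∈ U ∩ B
  hb : b ∈ U ∩ B
  ab : G.Adj a b
  hK : K ⊆ U \ {a, b}
  cl : Clo G (U \ {a, b}) K
  cn : Conn G K
  hw : w ∈ K
  nx : x ∉ K
  ny : y ∉ K
  src : (x ≠ a ∧ x ≠ b) ∨ (y ≠ a ∧ y ≠ b)

lemma Cut.swap {U B : Set V} {x y w a b : V} {K : Set V} (C : Cut G U B x y w a b K) :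
    Cut G U B y x w a b K := ⟨C.ha, C.hb, C.ab, C.hK, C.cl, C.cn, C.hw, C.ny, C.nx, C.src.symm⟩

lemma Cut.symm {U B : Set V} {x y w a b : V} {K : Set V} (C : Cut G U B x y w a b K) :
    Cut G U B x y w b a K := ⟨C.hb, C.ha, C.ab.symm, by rw [pair_comm]; exact C.hK,
      by rw [pair_comm]; exact C.cl, C.cn, C.hw, C.nx, C.ny, C.src.imp And.symm And.symm⟩

lemma Cut.nb {U B : Set V} {x y w a b : V} {K : Set V} (C : Cut G U B x y w a b K) {k v : V}
    (hk : k ∈ K) (hv : v ∈ U) (hkv : G.Adj k v) : v ∈ K ∨ v = a ∨ v = b := by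
  by_cases hvS : v ∈ ({a, b} : Set V)
  · exact Or.inr (by simpa using hvS)
  · exact Or.inl (C.cl k hk v ⟨hv, hvS⟩ hkv)

/-- common neighbours of the source lie outside `K` -/
lemma Cut.src_nb {U B : Set V} {L : V → Finset ℕ} {x y w a b : V} {M : Finset ℕ} {K : Set V}
    (C : Cut G U B x y w a b K) (hx : x ∈ U) (hy : y ∈ U) {u : V} (h1 : G.Adj x u)
    (h2 : G.Adj y u) : u ∉ K := by
  intro hu
  rcases C.src with hh | hh
  · rcases C.nb hu hx h1.symm with h | h | h
    exacts [C.nx h, hh.1 h, hh.2 h]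
  · rcases C.nb hu hy h2.symm with h | h | h
    exacts [C.ny h, hh.1 h, hh.2 h]

lemma Crit.cut_aux
    (h : Crit G U B L x y w M) {a b : V} {K : Set V} (ha : a ∈ U ∩ B) (hb : b ∈ U ∩ B)
    (hab : G.Adj a b) (hK : K ⊆ U \ {a, b}) (hne : K.Nonempty)
    (hcl : Clo G (U \ {a, b}) K) (hn : ¬ U \ {a, b} ⊆ K) (hx : x ∉ K) (hy : y ∉ K) :
    Cut G U B x y w a b (comp G (U \ {a, b}) w) := by
  have hwK : w ∈ K := by
    by_contra hwK
    exact h.R1 ha hb (Or.inr hab) hK hcl hne hwK hx hy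
  have hsub : comp G (U \ {a, b}) w ⊆ K := comp_min hwK hcl
  refine ⟨ha, hb, hab, comp_subset _ _, comp_clo _ _, comp_conn (hK hwK), mem_comp (hK hwK),
    fun hh => hx (hsub hh), fun hh => hy (hsub hh), ?_⟩
  by_contra hcon
  obtain ⟨v, hv, hvK⟩ := not_subset.1 hn
  have e1 : x ∈ ({a, b} : Set V) := by
    by_contra h1
    exact hcon (Or.inl (by simpa using h1))
  have e2 : y ∈ ({a, b} : Set V) := by
    by_contra h1
    exact hcon (Or.inr (by simpa using h1))
  exact h.R1 ha hb (Or.inr hab) (K := (U \ {a, b}) \ K) sdiff_subset (hcl.compl hK) ⟨v, hv, hvK⟩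
    (fun hh => hh.2 hwK) (fun hh => hh.1.2 e1) (fun hh => hh.1.2 e2)

lemma Crit.cut
    (h : Crit G U B L x y w M) {a b : V} {K : Set V} (ha : a ∈ U ∩ B) (hb : b ∈ U ∩ B)
    (hab : a = b ∨ G.Adj a b) (hK : K ⊆ U \ {a, b}) (hne : K.Nonempty)
    (hcl : Clo G (U \ {a, b}) K) (hn : ¬ U \ {a, b} ⊆ K) :
    Cut G U B x y w a b (comp G (U \ {a, b}) w) := by
  rcases hab with rfl | hab
  · rw [pair_eq_singleton] at hK hcl hn
    exact absurd (h.nocut ha hK hne hcl) hn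
  have hi := h.inst
  by_cases hs : x ∉ K ∧ y ∉ K
  · exact h.cut_aux ha hb hab hK hne hcl hn hs.1 hs.2
  have hK2 : Clo G (U \ {a, b}) ((U \ {a, b}) \ K) := hcl.compl hK
  refine h.cut_aux ha hb hab (K := (U \ {a, b}) \ K) sdiff_subset (not_subset.1 hn) hK2
    (fun hh => ?_) ?_ ?_
  · obtain ⟨k, hk⟩ := hne
    exact (hh (hK hk)).2 hk
  · intro hx
    have hyK : y ∈ K := by
      by_contra hyK
      exact hs ⟨hx.2, hyK⟩
    rcases hi.hxy with he | he
    · exact hx.2 (he ▸ hyK)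
    · exact hx.2 (hcl y hyK x hx.1 he.symm)
  · intro hy
    have hxK : x ∈ K := by
      by_contra hxK
      exact hs ⟨hxK, hy.2⟩
    rcases hi.hxy with he | he
    · exact hy.2 (he ▸ hxK)
    · exact hy.2 (hcl x hxK y hy.1 he)

lemma Crit.min_aux
    (h : Crit G U B L x y w M) {a b : V} {K : Set V} (C : Cut G U B x y w a b K) {a' b' : V}
    {Q : Set V} (ha' : a' ∈ U ∩ B) (hb' : b' ∈ U ∩ B) (hab : a' = b' ∨ G.Adj a' b')
    (hain : a' ∈ K ∪ {a, b}) (hbin : b' ∈ K ∪ {a, b}) (hQ : Q ⊆ K) (hQ' : Q ⊆ U \ {a', b'})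
    (hne : Q.Nonempty) (hcl : Clo G (U \ {a', b'}) Q)
    (hmin : ∀ K', Cut G U B x y w a' b' K' → K.ncard ≤ K'.ncard) :
    K ⊆ Q ∧ a' ≠ b' ∧ a' ∈ ({a, b} : Set V) ∧ b' ∈ ({a, b} : Set V) := by
  have hi := h.inst
  have hxQ : x ∉ Q := fun hh => C.nx (hQ hh)
  have hyQ : y ∉ Q := fun hh => C.ny (hQ hh)
  have hwQ : w ∈ Q := by
    by_contra hwK
    exact h.R1 ha' hb' hab hQ' hcl hne hwK hxQ hyQ
  have hn : ¬ U \ {a', b'} ⊆ Q := by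
    intro hh
    rcases C.src with hs | hs
    · have hxn : x ∉ K ∪ {a, b} := by
        rintro (h1 | h1 | h1)
        exacts [C.nx h1, hs.1 h1, hs.2 h1]
      exact hxQ (hh ⟨hi.hx.1, by rintro (rfl | rfl); exacts [hxn hain, hxn hbin]⟩)
    · have hyn : y ∉ K ∪ {a, b} := by
        rintro (h1 | h1 | h1)
        exacts [C.ny h1, hs.1 h1, hs.2 h1]
      exact hyQ (hh ⟨hi.hy.1, by rintro (rfl | rfl); exacts [hyn hain, hyn hbin]⟩)
  have C' := h.cut ha' hb' hab hQ' hne hcl hn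
  have hsub : comp G (U \ {a', b'}) w ⊆ Q := comp_min hwQ hcl
  have hKQ : Q = K := eq_of_subset_of_ncard_le hQ
    ((hmin _ C').trans (ncard_le_ncard hsub (toFinite _))) (toFinite _)
  subst hKQ
  exact ⟨subset_rfl, C'.ab.ne, hain.resolve_left fun hh => (hQ' hh).2 (by simp),
    hbin.resolve_left fun hh => (hQ' hh).2 (by simp)⟩

lemma NoSep.mk' {U B : Set V} {a b : V} (hab : G.Adj a b)
    (haux : ∀ x ∈ U ∩ B, ∀ y ∈ U ∩ B, (x = y ∨ G.Adj x y) → ∀ K ⊆ U \ {x, y}, K.Nonempty →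
      Clo G (U \ {x, y}) K → a ∉ K → b ∉ K → U \ {x, y} ⊆ K) : NoSep G U B := by
  intro x hx y hy hxy K hK hne hcl
  by_contra hn
  by_cases hs : a ∉ K ∧ b ∉ K
  · exact hn (haux x hx y hy hxy K hK hne hcl hs.1 hs.2)
  obtain ⟨k, hk⟩ := hne
  refine (haux x hx y hy hxy ((U \ {x, y}) \ K) sdiff_subset (not_subset.1 hn) (hcl.compl hK)
    ?_ ?_ (hK hk)).2 hk
  · intro ha
    have hb : b ∈ K := by
      by_contra hb
      exact hs ⟨ha.2, hb⟩
    exact ha.2 (hcl b hb a ha.1 hab.symm)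
  · intro hb
    have ha : a ∈ K := by
      by_contra ha
      exact hs ⟨ha, hb.2⟩
    exact hb.2 (hcl a ha b hb.1 hab)

lemma Crit.minNoSep
    (h : Crit G U B L x y w M) {a b : V} {K : Set V} (C : Cut G U B x y w a b K)
    (hmin : ∀ a' b' K', Cut G U B x y w a' b' K' → K.ncard ≤ K'.ncard) :
    NoSep G (K ∪ {a, b}) B := by
  have hsub : K ∪ {a, b} ⊆ U := by
    rintro v (hv | rfl | rfl)
    exacts [(C.hK hv).1, C.ha.1, C.hb.1]
  refine NoSep.mk' C.ab ?_
  intro a' ha' b' hb' hab Q hQ hne hcl haQ hbQ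
  have hQK : Q ⊆ K := by
    intro v hv
    rcases (hQ hv).1 with hh | rfl | rfl
    exacts [hh, absurd hv haQ, absurd hv hbQ]
  obtain ⟨h1, h2, h3, h4⟩ := h.min_aux C ⟨hsub ha'.1, ha'.2⟩ ⟨hsub hb'.1, hb'.2⟩ hab ha'.1 hb'.1 hQK
    (fun v hv => ⟨hsub (hQ hv).1, (hQ hv).2⟩) hne (by
      intro k hk v hv hkv
      refine hcl k hk v ⟨?_, hv.2⟩ hkv
      rcases C.nb (hQK hk) hv.1 hkv with hh | hh | hh
      exacts [Or.inl hh, Or.inr (Or.inl hh), Or.inr (Or.inr hh)]) (hmin a' b')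
  intro v hv
  rcases hv.1 with hh | hh
  · exact h1 hh
  · exfalso
    apply hv.2
    simp only [mem_insert_iff, mem_singleton_iff] at h3 h4 hh ⊢
    rcases h3 with rfl | rfl <;> rcases h4 with rfl | rfl <;> first | exact absurd rfl h2 | tauto

lemma two_run {U B P : Set V} (hpl : PL G U B) (hns : NoSep G U B) (hP : Conn G P)
    (hPB : P ⊆ U ∩ B) {w : V} (hw : w ∈ U ∩ B) (hwP : w ∉ P) : TwoCol G P := by
  have hd := hns.deg2 hpl hPB
  by_cases hcl : Clo G (U ∩ B) P
  · exact cyc hpl hns hP hPB hcl hw hwP (hd.mono subset_rfl hPB)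
  · simp only [Clo] at hcl
    push Not at hcl
    obtain ⟨a, ha, b, hb, hab, hbP⟩ := hcl
    refine bip (C := insert b P) (hP.insert ha hab.symm) (subset_insert _ _)
      (fun hh => hbP (hh (mem_insert _ _))) (hd.mono subset_rfl ?_)
    rintro v (rfl | hv)
    exacts [hb, hPB hv]

end chords
end HC

namespace HC
variable {V : Type u} {G : SimpleGraph V} [Finite V]

lemma glueK {U K : Set V} {L : V → Finset ℕ} {a b : V} {φ φ' : V → ℕ}
    (hn : ∀ k ∈ K, ∀ v ∈ U, G.Adj k v → v ∈ K ∨ v = a ∨ v = b)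
    (h1 : IsCol G (U \ K) L φ) (h2 : IsCol G (K ∪ {a, b}) L φ') (ea : φ' a = φ a)
    (eb : φ' b = φ b) (aK : a ∉ K) (bK : b ∉ K) :
    ∃ ψ, IsCol G U L ψ ∧ (∀ v ∈ U \ K, ψ v = φ v) ∧ ∀ v ∈ K, ψ v = φ' v := by
  classical
  have h := h1.glue (h2.mono (U' := K) subset_union_left (fun _ _ => Finset.Subset.refl _)) (by
    intro p hp q hq _ hpq
    rcases hn q hq p hp.1 hpq.symm with hh | rfl | rfl
    · exact absurd hh hp.2
    · rw [← ea]; exact h2.2 _ (Or.inr (by simp)) _ (Or.inl hq) hpq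
    · rw [← eb]; exact h2.2 _ (Or.inr (by simp)) _ (Or.inl hq) hpq)
  refine ⟨_, h.mono (fun v hv => ?_) (fun _ _ => Finset.Subset.refl _), fun v hv => if_pos hv, fun v hv => ?_⟩
  · by_cases hk : v ∈ K
    · exact Or.inr hk
    · exact Or.inl ⟨hv, hk⟩
  · exact if_neg fun hh => hh.2 hv

/-- the minimal sink side of a chord is a triangle -/
lemma Crit.minTri {U B : Set V} {L : V → Finset ℕ} {x y w : V} {M : Finset ℕ}
    (h : Crit G U B L x y w M) (hw2 : (L w).card = 2) {a b : V} {K : Set V}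
    (C : Cut G U B x y w a b K)
    (hmin : ∀ a' b' K', Cut G U B x y w a' b' K' → K.ncard ≤ K'.ncard) : K = {w} := by
  classical
  by_contra hKw
  have hi := h.inst
  have hns := h.minNoSep C hmin
  have hKU : K ⊆ U := C.hK.trans sdiff_subset
  have aK : a ∉ K := fun hh => (C.hK hh).2 (by simp)
  have bK : b ∉ K := fun hh => (C.hK hh).2 (by simp)
  have hGU : K ∪ {a, b} ⊆ U := by
    rintro v (hv | rfl | rfl)
    exacts [hKU hv, C.ha.1, C.hb.1]
  have hpl : PL G (K ∪ {a, b}) B := hi.pl.mono hGU inter_subset_left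
  set Gm := K ∪ {a, b} with hGm
  have haG : a ∈ Gm ∩ B := ⟨Or.inr (by simp), C.ha.2⟩
  have hbG : b ∈ Gm ∩ B := ⟨Or.inr (by simp), C.hb.2⟩
  have hnbG : ∀ k ∈ K, ∀ v ∈ U, G.Adj k v → v ∈ Gm := by
    intro k hk v hv hkv
    rcases C.nb hk hv hkv with hh | hh | hh
    · exact Or.inl hh
    · exact Or.inr (by simp [hh])
    · exact Or.inr (by simp [hh])
  set Q : Set V := {v | v ∈ B ∧ v ∈ K ∧ L w ⊆ L v} with hQ
  set P := comp G Q w with hPdef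
  have hwQ : w ∈ Q := ⟨hi.hw.2, C.hw, Finset.Subset.refl _⟩
  have hwP : w ∈ P := mem_comp hwQ
  have hPQ : P ⊆ Q := comp_subset _ _
  have hPK : P ⊆ K := fun v hv => (hPQ hv).2.1
  have hPc : Conn G P := comp_conn hwQ
  have hPB : P ⊆ U ∩ B := fun v hv => ⟨hKU (hPK hv), (hPQ hv).1⟩
  have hPG : P ⊆ Gm ∩ B := fun v hv => ⟨Or.inl (hPK hv), (hPQ hv).1⟩
  have hL : ∀ v ∈ P, L w ⊆ L v := fun v hv => (hPQ hv).2.2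
  have hdG : Deg2 G (Gm ∩ B) (Gm ∩ B) := hns.deg2 hpl subset_rfl
  have hd : Deg2 G P (U ∩ B) := by
    intro v hv p hp q hq r hr h1 h2 h3
    exact hdG v (hPG hv) p ⟨hnbG v (hPK hv) p hp.1 h1, hp.2⟩ q ⟨hnbG v (hPK hv) q hq.1 h2, hq.2⟩
      r ⟨hnbG v (hPK hv) r hr.1 h3, hr.2⟩ h1 h2 h3
  have hxU : x ∈ U \ P := ⟨hi.hx.1, fun hh => C.nx (hPK hh)⟩
  have hyU : y ∈ U \ P := ⟨hi.hy.1, fun hh => C.ny (hPK hh)⟩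
  have hport : ∀ v ∈ P, ∀ u ∈ U ∩ B, u ∉ P → G.Adj v u → L w ⊆ L u := by
    intro v hv u hu huP hvu
    by_contra hLu
    obtain ⟨φ, h1, h2⟩ := h.sink subset_rfl hPB hw2 hxU hyU (fun hh => hh.2 hwP) hu huP hLu (by
      intro hux
      rcases hi.hM with hh | ⟨_, hh⟩
      · exact hh
      · exfalso
        subst hh
        have hux : u = x := by tauto
        subst hux
        rcases C.nb (hPK hv) hu.1 hvu with hh | hh | hh
        · exact C.nx hh
        · rcases C.src with h1 | h1 <;> exact h1.1 hh
        · rcases C.src with h1 | h1 <;> exact h1.2 hh) (by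
      intro u' hu' h1 h2 ⟨k, hk, hku⟩
      rcases C.nb (hPK hk) hu'.1 hku with hh | hh | hh
      · exact absurd hh (C.src_nb (L := L) (M := M) hi.hx.1 hi.hy.1 h1 h2)
      · exact hh ▸ C.ha.2
      · exact hh ▸ C.hb.2)
    obtain ⟨φ', h', _⟩ := run_port hPB hw2 hPc hd h1 hL hv hu huP hvu h2
    exact h.nc ⟨φ', h'⟩
  have hport2 : ∀ v ∈ P, ∀ u ∈ U ∩ B, u ∉ P → G.Adj v u → u = a ∨ u = b := by
    intro v hv u hu huP hvu
    rcases C.nb (hPK hv) hu.1 hvu with hh | hh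
    · exact absurd (comp_clo _ _ v hv u ⟨hu.2, hh, hport v hv u hu huP hvu⟩ hvu) huP
    · exact hh
  have haP : a ∉ P := fun hh => aK (hPK hh)
  have hbP : b ∉ P := fun hh => bK (hPK hh)
  obtain ⟨pa, hpa⟩ : ∃ pa, ∀ v ∈ P, G.Adj v a → v = pa := by
    by_cases hh : ∃ v ∈ P, G.Adj v a
    · obtain ⟨v, hv, hva⟩ := hh
      refine ⟨v, fun v' hv' h' => ?_⟩
      rcases hdG a haG v' (hPG hv') v (hPG hv) b hbG h'.symm hva.symm C.ab with e | e | e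
      · exact e
      · exact absurd (e ▸ hv') hbP
      · exact absurd (e ▸ hv) hbP
    · exact ⟨a, fun v hv hva => absurd ⟨v, hv, hva⟩ hh⟩
  obtain ⟨pb, hpb⟩ : ∃ pb, ∀ v ∈ P, G.Adj v b → v = pb := by
    by_cases hh : ∃ v ∈ P, G.Adj v b
    · obtain ⟨v, hv, hva⟩ := hh
      refine ⟨v, fun v' hv' h' => ?_⟩
      rcases hdG b hbG v' (hPG hv') v (hPG hv) a haG h'.symm hva.symm C.ab.symm with e | e | e
      · exact e
      · exact absurd (e ▸ hv') haP
      · exact absurd (e ▸ hv) haP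
    · exact ⟨a, fun v hv hva => absurd ⟨v, hv, hva⟩ hh⟩
  obtain ⟨m, hm⟩ := hi.Mne
  obtain ⟨φ, hφ, _⟩ := h.runT (U1 := U \ K) (P := ∅) (X := ∅) sdiff_subset (empty_subset _)
    (by simp) ⟨⟨hi.hx.1, C.nx⟩, by simp⟩ ⟨⟨hi.hy.1, C.ny⟩, by simp⟩ (fun hh => hh.1.2 C.hw) hm
  have hφ : IsCol G (U \ K) L φ := hφ.mono (by simp) (fun v _ => rl_sub v)
  have haK : a ∈ U \ K := ⟨C.ha.1, aK⟩
  have hbK : b ∈ U \ K := ⟨C.hb.1, bK⟩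
  have hφab : φ a ≠ φ b := hφ.2 a haK b hbK C.ab
  have hlG : Lst Gm B {a, b, w} L := hi.lst.mono' hGU (fun _ _ h => h) (by
    rintro v hv (rfl | rfl | rfl)
    · rcases hv with hv | rfl | rfl
      · exact absurd hv C.nx
      · simp
      · simp
    · rcases hv with hv | rfl | rfl
      · exact absurd hv C.ny
      · simp
      · simp
    · simp) (fun _ _ _ => Finset.Subset.refl _)
  have fin : ∀ φ', IsCol G Gm L φ' → φ' a = φ a → φ' b = φ b → False := by
    intro φ' h' ea eb
    obtain ⟨ψ, hψ, _⟩ := glueK (fun k hk v hv => C.nb hk hv) hφ h' ea eb aK bK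
    exact h.nc ⟨ψ, hψ⟩
  obtain ⟨φ2, hφ2, e2a, e2b⟩ := run_T hpl hPG hlG hw2.le haG haP hbG hbP (Or.inr C.ab) (by
    rintro v (rfl | rfl | rfl) hv
    exacts [Or.inl rfl, Or.inr rfl, absurd hwP hv]) φ (hφ.1 a haK) (hφ.1 b hbK) (fun _ => hφab)
  have ht : TwoCol G P := two_run hpl hns hPc hPG haG haP
  have fin2 : ∀ b2 u2, (∀ v ∈ P, ∀ u ∈ Gm ∩ B, u ∉ P → G.Adj v u → φ2 u ∉ L w ∨ (v = b2 ∧ u = u2)) →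
      False := by
    intro b2 u2 h4
    obtain ⟨φ', h', h''⟩ := run_fin (hPG.trans inter_subset_left) hw2 hφ2 ht hL h4
    exact fin φ' h' ((h'' a ⟨haG.1, haP⟩).trans e2a) ((h'' b ⟨hbG.1, hbP⟩).trans e2b)
  have hGUB : Gm ∩ B ⊆ U ∩ B := fun v hv => ⟨hGU hv.1, hv.2⟩
  by_cases fa : φ a ∈ L w ∧ ∃ v ∈ P, G.Adj v a
  swap
  · refine fin2 pb b fun v hv u hu huP hvu => ?_
    rcases hport2 v hv u (hGUB hu) huP hvu with rfl | rfl
    · exact Or.inl fun hh => fa ⟨e2a ▸ hh, v, hv, hvu⟩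
    · exact Or.inr ⟨hpb v hv hvu, rfl⟩
  by_cases fb : φ b ∈ L w ∧ ∃ v ∈ P, G.Adj v b
  swap
  · refine fin2 pa a fun v hv u hu huP hvu => ?_
    rcases hport2 v hv u (hGUB hu) huP hvu with rfl | rfl
    · exact Or.inr ⟨hpa v hv hvu, rfl⟩
    · exact Or.inl fun hh => fb ⟨e2b ▸ hh, v, hv, hvu⟩
  obtain ⟨fa, va, hva, hvaa⟩ := fa
  obtain ⟨fb, vb, hvb, hvbb⟩ := fb
  by_cases hP1 : P ⊆ {w}
  · obtain rfl : va = w := hP1 hva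
    obtain rfl : vb = va := hP1 hvb
    have hne : (K \ {vb}).Nonempty := by
      by_contra hh
      rw [not_nonempty_iff_eq_empty, sdiff_eq_empty] at hh
      exact hKw (Subset.antisymm hh (sub1 hvb |>.trans hPK))
    refine h.R2 (K := K \ {vb}) C.ha.1 C.hb.1 hi.hw C.ab hvaa.symm hvbb.symm (fun v hv => ⟨hKU hv.1, ?_⟩) ?_ hne ?_
    · rintro (rfl | rfl | rfl)
      exacts [aK hv.1, bK hv.1, hv.2 rfl]
    · intro p hp q hq hpq
      have := C.cl p hp.1 q ⟨hq.1, fun hh => hq.2 (by rcases hh with rfl | rfl <;> simp)⟩ hpq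
      exact ⟨this, fun hh => hq.2 (by rw [mem_singleton_iff] at hh; simp [hh])⟩
    · rw [Set.disjoint_left]
      intro v hv hvB
      exact hns.tri hpl haG hbG (hPG hva) ⟨Or.inl hv.1, hvB⟩ C.ab hvaa.symm hvbb.symm
        (fun e => aK (e ▸ hv.1)) (fun e => bK (e ▸ hv.1)) hv.2
  obtain ⟨b0, hb0, hb0w⟩ := not_subset.1 hP1
  have hb0w : b0 ≠ w := hb0w
  have hb0a : b0 ≠ a := fun e => haP (e ▸ hb0)
  have hb0b : b0 ≠ b := fun e => hbP (e ▸ hb0)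
  set R : Set V := (P ∪ {a, b}) \ {b0} with hR
  have hPab : P ∪ {a, b} ⊆ Gm ∩ B := by
    rintro v (hv | rfl | rfl)
    exacts [hPG hv, haG, hbG]
  have hRG : R ⊆ Gm ∩ B := sdiff_subset.trans hPab
  have hcon : Conn G (P ∪ {a, b}) := hPc.union (conn_pair C.ab) ⟨va, hva, a, by simp, hvaa⟩
  have hRt : TwoCol G R := bip hcon sdiff_subset (fun hh => (hh (Or.inl hb0)).2 rfl)
    (hdG.mono hRG hPab)
  obtain ⟨ψ, hψ, hψa⟩ := twocol_pick hRt hw2 a fa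
  have haR : a ∈ R := ⟨Or.inr (by simp), hb0a.symm⟩
  have hbR : b ∈ R := ⟨Or.inr (by simp), hb0b.symm⟩
  have hψb : ψ b = φ b := by
    have h1 : ψ b ∈ L w := hψ.1 b hbR
    have h2 : ψ a ≠ ψ b := hψ.2 a haR b hbR C.ab
    obtain ⟨α, β, hαβ, he⟩ := Finset.card_eq_two.1 hw2
    rw [he] at h1 fa fb
    simp only [Finset.mem_insert, Finset.mem_singleton] at h1 fa fb
    rw [hψa] at h2
    grind
  have h3 : 3 ≤ (L b0).card := (hlG b0 (hPG hb0).1 (by simp [hb0a, hb0b, hb0w])).1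
  obtain ⟨d, hd1, hd2⟩ : ∃ d ∈ L b0, d ∉ L w := by
    by_contra hh
    push Not at hh
    have := Finset.card_le_card (show L b0 ⊆ L w from hh)
    omega
  obtain ⟨φ3, h31, h32⟩ := run_T1 (P := R) (X := L w) hpl hRG hlG hw2.le (hPG hb0) (fun hh => hh.2 rfl) (by
    rintro v (rfl | rfl | rfl) hv
    exacts [absurd haR hv, absurd hbR hv, absurd ⟨Or.inl hwP, hb0w.symm⟩ hv]) hd1
  obtain ⟨φ', h', _, h''⟩ := run_ext (hRG.trans inter_subset_left) h31 hψ (by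
    rintro v ⟨hv | rfl | rfl, _⟩
    · exact hL v hv
    · exact hport va hva _ C.ha haP hvaa
    · exact hport vb hvb _ C.hb hbP hvbb) (by
    intro v hv u hu huR hvu
    by_cases hub : u = b0
    · subst hub
      rw [h32]
      exact fun e => hd2 (e ▸ hψ.1 v hv)
    · exfalso
      have huP : u ∉ P := fun hh => huR ⟨Or.inl hh, hub⟩
      have hua : u ≠ a := fun e => huR (e ▸ haR)
      have hub : u ≠ b := fun e => huR (e ▸ hbR)
      rcases hv with ⟨hv | rfl | rfl, _⟩
      · rcases hport2 v hv u (hGUB hu) huP hvu with e | e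
        exacts [hua e, hub e]
      · rcases hdG _ haG va (hPG hva) u hu b hbG hvaa.symm hvu C.ab with e | e | e
        · exact huP (e ▸ hva)
        · exact hbP (e ▸ hva)
        · exact hub e
      · rcases hdG _ hbG vb (hPG hvb) u hu a haG hvbb.symm hvu C.ab.symm with e | e | e
        · exact huP (e ▸ hvb)
        · exact haP (e ▸ hvb)
        · exact hua e)
  exact fin φ' h' ((h'' a haR).trans hψa) ((h'' b hbR).trans hψb)

end HC

namespace HC
variable {V : Type u} {G : SimpleGraph V} [Finite V]

/-- the sink is a degree two vertex on the chord `u1 u2` -/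
structure Ear (G : SimpleGraph V) (U B : Set V) (L : V → Finset ℕ) (x y w : V) (M : Finset ℕ)
    (u1 u2 : V) : Prop where
  crit : Crit G U B L x y w M
  w2 : (L w).card = 2
  cut : Cut G U B x y w u1 u2 {w}

variable {U B : Set V} {L : V → Finset ℕ} {x y w u1 u2 : V} {M : Finset ℕ}

lemma Ear.swap (E : Ear G U B L x y w M u1 u2) : Ear G U B L y x w M u1 u2 :=
  ⟨E.crit.swap, E.w2, E.cut.swap⟩

lemma Ear.symm (E : Ear G U B L x y w M u1 u2) : Ear G U B L x y w M u2 u1 :=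
  ⟨E.crit, E.w2, E.cut.symm⟩

lemma Ear.nb (E : Ear G U B L x y w M u1 u2) {v : V} (hv : v ∈ U) (h : G.Adj w v) :
    v = u1 ∨ v = u2 := by
  rcases E.cut.nb rfl hv h with hh | hh
  · exact absurd hh h.ne'
  · exact hh

lemma Ear.w1 (E : Ear G U B L x y w M u1 u2) : u1 ≠ w :=
  fun e => (E.cut.hK rfl).2 (by simp [e])

lemma Ear.u1U (E : Ear G U B L x y w M u1 u2) : u1 ∈ (U \ {w}) ∩ B :=
  ⟨⟨E.cut.ha.1, E.w1⟩, E.cut.ha.2⟩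

lemma Ear.adj1 (E : Ear G U B L x y w M u1 u2) : G.Adj w u1 := by
  by_contra hn
  have := E.crit.nocut (v := u2) (K := {w}) E.cut.hb
    (by rintro _ rfl; exact ⟨E.crit.inst.hw.1, E.symm.w1.symm⟩) ⟨w, rfl⟩ (by
      rintro _ rfl v hv hwv
      rcases E.nb hv.1 hwv with rfl | rfl
      · exact absurd hwv hn
      · exact absurd rfl hv.2)
  exact E.w1 (this ⟨E.cut.ha.1, E.cut.ab.ne⟩)

lemma Ear.finW (E : Ear G U B L x y w M u1 u2) {φ : V → ℕ} (h : IsCol G (U \ {w}) L φ)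
    (h1 : φ u1 ∉ L w ∨ φ u2 ∉ L w) : False := by
  obtain ⟨c, hc, hc1, hc2⟩ : ∃ c ∈ L w, φ u1 ≠ c ∧ φ u2 ≠ c := by
    rcases h1 with h1 | h1
    · obtain ⟨c, hc, hn⟩ := exists_ne_of_two E.w2.ge (φ u2)
      exact ⟨c, hc, fun e => h1 (e ▸ hc), hn.symm⟩
    · obtain ⟨c, hc, hn⟩ := exists_ne_of_two E.w2.ge (φ u1)
      exact ⟨c, hc, hn.symm, fun e => h1 (e ▸ hc)⟩
  refine E.crit.nc (Col.extend1 h hc ?_)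
  intro v hv hvw
  rcases E.nb hv hvw.symm with rfl | rfl
  exacts [hc1, hc2]

lemma Ear.srcV (E : Ear G U B L x y w M u1 u2) (hM : M.card = 1) : x ≠ u1 ∧ x ≠ u2 := by
  rcases E.crit.inst.hM with h | ⟨_, h⟩
  · omega
  · subst h; rcases E.cut.src with h | h <;> exact h

lemma Ear.srcx (E : Ear G U B L x y w M u1 u2) (h : u1 = x) : M = L w := by
  have hi := E.crit.inst
  by_contra hn
  have : ¬ M ⊆ L w := by
    intro hh
    have h2 : M.card = 2 := by
      rcases hi.hM with h2 | ⟨h2, _⟩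
      · exact h2
      · exact absurd h.symm (E.srcV h2).1
    exact hn (Finset.eq_of_subset_of_card_le hh (by rw [h2, E.w2]))
  obtain ⟨m, hm, hmw⟩ := Finset.not_subset.1 this
  obtain ⟨φ, h1, h2⟩ := E.crit.runT (U1 := U \ {w}) (P := ∅) (X := ∅) sdiff_subset (empty_subset _)
    (by simp) ⟨⟨hi.hx.1, hi.wx.symm⟩, by simp⟩ ⟨⟨hi.hy.1, hi.wy.symm⟩, by simp⟩
    (fun hh => hh.1.2 rfl) hm
  exact E.finW (h1.mono (by simp) fun v _ => rl_sub v) (Or.inl (by rw [h, h2]; exact hmw))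

lemma Ear.sub (E : Ear G U B L x y w M u1 u2) (h : u1 ≠ x) (h' : u1 ≠ y) : L w ⊆ L u1 := by
  by_contra hn
  have hi := E.crit.inst
  obtain ⟨φ, h1, h2⟩ := E.crit.sink (U1 := U \ {w}) (P := ∅) (X := L w) (v := u1) sdiff_subset
    (empty_subset _) E.w2 ⟨⟨hi.hx.1, hi.wx.symm⟩, by simp⟩ ⟨⟨hi.hy.1, hi.wy.symm⟩, by simp⟩
    (fun hh => hh.1.2 rfl) E.u1U (by simp) hn (by tauto)
    (by rintro _ _ _ _ ⟨k, hk, _⟩; exact absurd hk (by simp))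
  exact E.finW (h1.mono (by simp) fun v _ => rl_sub v) (Or.inl h2)

lemma Ear.extra (E : Ear G U B L x y w M u1 u2) (h : u1 ≠ x) (h' : u1 ≠ y) :
    ∃ d ∈ L u1, d ∉ L w := by
  by_contra hh
  push Not at hh
  have := Finset.card_le_card (show L u1 ⊆ L w from hh)
  have := (E.crit.inst.lst u1 E.cut.ha.1 (by simp [h, h', E.w1])).1
  have := E.w2
  omega

lemma Ear.finX (E : Ear G U B L x y w M u1 u2) {P : Set V} {X : Finset ℕ} {d : ℕ} {φ : V → ℕ}
    (hP : P ⊆ U \ {w}) (ht : TwoCol G P) (hX : X.card = 2) (hd : d ∈ X) (hdw : d ∉ L w)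
    (h3 : ∀ v ∈ P, X ⊆ L v) (h1 : u1 ∈ P) (h2 : u2 ∉ P)
    (hφ : IsCol G ((U \ {w}) \ P) (rl G B L P X) φ)
    (h4 : ∀ v ∈ P, ∀ u ∈ (U \ {w}) ∩ B, u ∉ P → G.Adj v u → φ u ∉ X ∨ (v = u1 ∧ u = u2)) :
    False := by
  have hu2 : u2 ∈ (U \ {w}) \ P := ⟨E.symm.u1U.1, h2⟩
  obtain ⟨c, hc, hcn, hor⟩ : ∃ c ∈ X, c ≠ φ u2 ∧ (c = d ∨ φ u2 = d) := by
    by_cases hh : φ u2 = d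
    · obtain ⟨c, hc, hn⟩ := exists_ne_of_two hX.ge (φ u2)
      exact ⟨c, hc, hn, Or.inr hh⟩
    · exact ⟨d, hd, fun e => hh e.symm, Or.inl rfl⟩
  obtain ⟨ψ, hψ, hψ1⟩ := twocol_pick ht hX u1 hc
  obtain ⟨φ', h', e1, e2⟩ := run_ext hP hφ hψ h3 (by
    intro v hv u hu huP hvu
    rcases h4 v hv u hu huP hvu with hh | ⟨rfl, rfl⟩
    · exact fun e => hh (e ▸ hψ.1 v hv)
    · rw [hψ1]; exact hcn.symm)
  refine E.finW h' ?_
  rcases hor with e | e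
  · left; rw [e2 u1 h1, hψ1, e]; exact hdw
  · right; rw [e1 u2 hu2, e]; exact hdw

lemma Ear.run (E : Ear G U B L x y w M u1 u2) {F P : Set V} {X : Finset ℕ} {d : ℕ} {s0 : V}
    (hF : F ⊆ U \ {w}) (hns : NoSep G F B) (hP : Conn G P)
    (hPF : P ⊆ F ∩ B) (h1 : u1 ∈ P) (hu2 : u2 ∈ F ∩ B) (h2 : u2 ∉ P)
    (hnb : ∀ k ∈ P, ∀ v ∈ U \ {w}, G.Adj k v → v ∈ F) (hs0 : s0 ∈ F ∩ B) (hs0P : s0 ∉ P)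
    (hs02 : s0 ≠ u2) (hX : X.card = 2) (hd : d ∈ X) (hdw : d ∉ L w)
    (h3 : ∀ v ∈ P, X ⊆ L v) (hxP : x ∉ P) (hyP : y ∉ P) :
    TwoCol G P ∧ ∃ b ∈ P, ∃ v ∈ F ∩ B, v ∉ P ∧ v ≠ u2 ∧ G.Adj b v ∧
      (∀ φ, IsCol G ((U \ {w}) \ P) (rl G B L P X) φ → φ v ∈ X) ∧
      ∀ p ∈ P, ∀ q ∈ (U \ {w}) ∩ B, q ∉ P → G.Adj p q → (p = u1 ∧ q = u2) ∨ (p = b ∧ q = v) := by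
  classical
  have hi := E.crit.inst
  have hpl : PL G F B := hi.pl.mono (hF.trans sdiff_subset) inter_subset_left
  have hPU : P ⊆ U \ {w} := fun v hv => hF (hPF hv).1
  have ht : TwoCol G P := two_run hpl hns hP hPF hs0 hs0P
  refine ⟨ht, ?_⟩
  have hdF : Deg2 G (F ∩ B) (F ∩ B) := hns.deg2 hpl subset_rfl
  by_cases hb : ∃ b ∈ P, ∃ v ∈ (U \ {w}) ∩ B, v ∉ P ∧ G.Adj b v ∧ v ≠ u2
  · obtain ⟨b, hb, v, hv, hvP, hbv, hv2⟩ := hb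
    have hvF := hnb b hb v hv.1 hbv
    obtain ⟨b2, t2, hbt⟩ := ports hP hPF (hdF.mono hPF subset_rfl) h1 hu2 h2 E.cut.ab
    have hall : ∀ p ∈ P, ∀ q ∈ (U \ {w}) ∩ B, q ∉ P → G.Adj p q →
        (p = u1 ∧ q = u2) ∨ (p = b ∧ q = v) := by
      intro p hp q hq hqP hpq
      rcases hbt p hp q ⟨hnb p hp q hq.1 hpq, hq.2⟩ hqP hpq with hh | ⟨rfl, rfl⟩
      · exact Or.inl hh
      · rcases hbt b hb v ⟨hvF, hv.2⟩ hvP hbv with ⟨_, hh⟩ | ⟨rfl, rfl⟩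
        · exact absurd hh hv2
        · exact Or.inr ⟨rfl, rfl⟩
    refine ⟨b, hb, v, ⟨hvF, hv.2⟩, hvP, hv2, hbv, fun φ hφ => ?_, hall⟩
    by_contra hvX
    refine E.finX hPU ht hX hd hdw h3 h1 h2 hφ fun p hp q hq hqP hpq => ?_
    rcases hall p hp q hq hqP hpq with hh | ⟨_, rfl⟩
    · exact Or.inr hh
    · exact Or.inl hvX
  exfalso
  push Not at hb
  obtain ⟨m, hm⟩ := hi.Mne
  obtain ⟨φ, hφ, _⟩ := E.crit.runT (X := X) sdiff_subset (fun v hv => ⟨hPU hv, (hPF hv).2⟩) hX.le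
    ⟨⟨hi.hx.1, hi.wx.symm⟩, hxP⟩ ⟨⟨hi.hy.1, hi.wy.symm⟩, hyP⟩ (fun hh => hh.1.2 rfl) hm
  by_cases hu : (∀ v ∈ P, G.Adj v u2 → v = u1) ∨ φ u2 ∉ X
  · refine E.finX hPU ht hX hd hdw h3 h1 h2 hφ fun p hp q hq hqP hpq => ?_
    obtain rfl := hb p hp q hq hqP hpq
    rcases hu with hu | hu
    · exact Or.inr ⟨hu p hp hpq, rfl⟩
    · exact Or.inl hu
  push Not at hu
  obtain ⟨⟨b, hbP, hbu, hb1⟩, huX⟩ := hu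
  have hcl : Clo G (F ∩ B) (insert u2 P) := by
    rintro p (rfl | hp) q hq hpq
    · rcases hdF _ hu2 u1 (hPF h1) b (hPF hbP) q hq E.cut.ab.symm hbu.symm hpq with e | e | e
      · exact absurd e.symm hb1
      · exact Or.inr (e ▸ h1)
      · exact Or.inr (e ▸ hbP)
    · by_cases hqP : q ∈ P
      · exact Or.inr hqP
      · exact Or.inl (hb p hp q ⟨hF hq.1, hq.2⟩ hqP hpq)
  have hsub : insert u2 P ⊆ F ∩ B := insert_subset hu2 hPF
  have ht2 : TwoCol G (insert u2 P) := cyc hpl hns (hP.insert h1 E.cut.ab.symm) hsub hcl hs0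
    (by rintro (e | e); exacts [hs02 e, hs0P e]) (hdF.mono hsub hsub)
  obtain ⟨ψ, hψ, hψ2⟩ := twocol_pick ht2 hX u2 huX
  obtain ⟨φ', h', e1, e2⟩ := run_ext hPU hφ (hψ.mono (subset_insert _ _) fun _ _ => Finset.Subset.refl _) h3 (by
    intro v hv u hu huP hvu
    obtain rfl := hb v hv u hu huP hvu
    rw [← hψ2]
    exact (hψ.2 v (Or.inr hv) _ (Or.inl rfl) hvu).symm)
  refine E.finW h' ?_
  rw [e2 u1 h1, e1 u2 ⟨hF hu2.1, h2⟩]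
  have h5 := hψ.2 u1 (Or.inr h1) u2 (Or.inl rfl) E.cut.ab
  have h6 : ψ u1 ∈ X := hψ.1 u1 (Or.inr h1)
  obtain ⟨α, β, hαβ, rfl⟩ := Finset.card_eq_two.1 hX
  rw [hψ2] at h5
  simp only [Finset.mem_insert, Finset.mem_singleton] at h6 huX hd
  grind

end HC

namespace HC
variable {V : Type u} {G : SimpleGraph V} [Finite V]
variable {U B : Set V} {L : V → Finset ℕ} {x y w u1 u2 : V} {M : Finset ℕ}

lemma Ear.runI (E : Ear G U B L x y w M u1 u2) {a b : V} {K : Set V}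
    (C : Cut G U B x y w a b K) (h1 : u1 ∈ K) (hns : NoSep G ((K ∪ {a, b}) \ {w}) B)
    {X : Finset ℕ} {d : ℕ} (hX : X.card = 2) (hd : d ∈ X) (hdw : d ∉ L w) (hXu : X ⊆ L u1) :
    ∃ P : Set V, ∃ v, Conn G P ∧ P ⊆ K ∩ B ∧ w ∉ P ∧ u2 ∉ P ∧ u1 ∈ P ∧ (∀ p ∈ P, X ⊆ L p) ∧ (v = a ∨ v = b) ∧
      v ≠ u2 ∧ X ⊆ L v ∧ (∀ φ, IsCol G ((U \ {w}) \ P) (rl G B L P X) φ → φ v ∈ X) ∧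
      (∃ p ∈ P, G.Adj p v) ∧
      (∀ p ∈ P, ∀ q ∈ (U \ {w}) ∩ B, q ∉ P → G.Adj p q → q = u2 ∨ q = v) ∧
      ∀ P' ⊆ K ∩ B, Conn G P' → w ∉ P' → u2 ∉ P' → u1 ∈ P' → (∀ p ∈ P', X ⊆ L p) → P' ⊆ P := by
  classical
  have hi := E.crit.inst
  have hKU : K ⊆ U := C.hK.trans sdiff_subset
  have aK : a ∉ K := fun hh => (C.hK hh).2 (by simp)
  have bK : b ∉ K := fun hh => (C.hK hh).2 (by simp)
  have aw : a ≠ w := fun e => aK (e ▸ C.hw)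
  have bw : b ≠ w := fun e => bK (e ▸ C.hw)
  set F := (K ∪ {a, b}) \ {w} with hFdef
  have hF : F ⊆ U \ {w} := by
    rintro v ⟨hv | rfl | rfl, hvw⟩
    exacts [⟨hKU hv, hvw⟩, ⟨C.ha.1, hvw⟩, ⟨C.hb.1, hvw⟩]
  have hnbK : ∀ k ∈ K, ∀ v ∈ U, v ≠ w → G.Adj k v → v ∈ F := by
    intro k hk v hv hvw hkv
    rcases C.nb hk hv hkv with hh | rfl | rfl
    exacts [⟨Or.inl hh, hvw⟩, ⟨Or.inr (by simp), hvw⟩, ⟨Or.inr (by simp), hvw⟩]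
  have haF : a ∈ F ∩ B := ⟨⟨Or.inr (by simp), aw⟩, C.ha.2⟩
  have hbF : b ∈ F ∩ B := ⟨⟨Or.inr (by simp), bw⟩, C.hb.2⟩
  set Q : Set V := {v | v ∈ K ∩ B ∧ v ≠ w ∧ v ≠ u2 ∧ X ⊆ L v} with hQ
  set P := comp G Q u1 with hPdef
  have h1Q : u1 ∈ Q := ⟨⟨h1, E.u1U.2⟩, E.w1, E.cut.ab.ne, hXu⟩
  have h1P : u1 ∈ P := mem_comp h1Q
  have hPQ : P ⊆ Q := comp_subset _ _
  have hPK : P ⊆ K ∩ B := fun v hv => (hPQ hv).1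
  have hPc : Conn G P := comp_conn h1Q
  have hPF : P ⊆ F ∩ B := fun v hv => ⟨⟨Or.inl (hPK hv).1, (hPQ hv).2.1⟩, (hPK hv).2⟩
  have h2P : u2 ∉ P := fun hh => (hPQ hh).2.2.1 rfl
  have hwP : w ∉ P := fun hh => (hPQ hh).2.1 rfl
  have h2F : u2 ∈ F ∩ B := ⟨hnbK u1 h1 u2 E.cut.hb.1 E.symm.w1 E.cut.ab, E.cut.hb.2⟩
  have hXP : ∀ v ∈ P, X ⊆ L v := fun v hv => (hPQ hv).2.2.2
  have hxP : x ∉ P := fun hh => C.nx (hPK hh).1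
  have hyP : y ∉ P := fun hh => C.ny (hPK hh).1
  have hnb : ∀ k ∈ P, ∀ v ∈ U \ {w}, G.Adj k v → v ∈ F :=
    fun k hk v hv hkv => hnbK k (hPK hk).1 v hv.1 hv.2 hkv
  have haP : a ∉ P := fun hh => aK (hPK hh).1
  have hbP : b ∉ P := fun hh => bK (hPK hh).1
  obtain ⟨s0, hs0, hs0P, hs02⟩ : ∃ s0 ∈ F ∩ B, s0 ∉ P ∧ s0 ≠ u2 := by
    by_cases e : a = u2
    · exact ⟨b, hbF, hbP, fun e' => C.ab.ne (e.trans e'.symm)⟩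
    · exact ⟨a, haF, haP, e⟩
  obtain ⟨ht, p0, hp0, v, hv, hvP, hv2, hpv, hφ, hall⟩ := E.run hF hns hPc hPF h1P h2F h2P hnb hs0
    hs0P hs02 hX hd hdw hXP hxP hyP
  have hPU : P ⊆ (U \ {w}) ∩ B := fun p hp => ⟨hF (hPF hp).1, (hPF hp).2⟩
  have hvU : v ∈ (U \ {w}) ∩ B := ⟨hF hv.1, hv.2⟩
  have hXv : X ⊆ L v := by
    by_contra hXv
    obtain ⟨φ, hφ1, hφ2⟩ := E.crit.sink (U1 := U \ {w}) sdiff_subset hPU hX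
      ⟨⟨hi.hx.1, hi.wx.symm⟩, hxP⟩ ⟨⟨hi.hy.1, hi.wy.symm⟩, hyP⟩ (fun hh => hh.1.2 rfl)
      hvU hvP hXv (by
        intro hux
        rcases hi.hM with hh | ⟨_, hh⟩
        · exact hh
        · exfalso
          subst hh
          obtain rfl : v = x := by tauto
          rcases hv.1.1 with hh | hh | hh
          · exact C.nx hh
          · rcases C.src with h1 | h1 <;> exact h1.1 hh
          · rcases C.src with h1 | h1 <;> exact h1.2 hh) (by
        intro u' hu' h1 h2 ⟨k, hk, hku⟩
        rcases C.nb (hPK hk).1 hu'.1.1 hku with hh | hh | hh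
        · exact absurd hh (C.src_nb (L := L) (M := M) hi.hx.1 hi.hy.1 h1 h2)
        · exact hh ▸ C.ha.2
        · exact hh ▸ C.hb.2)
    exact hφ2 (hφ φ hφ1)
  refine ⟨P, v, hPc, hPK, hwP, h2P, h1P, hXP, ?_, hv2, hXv, hφ, ⟨p0, hp0, hpv⟩, ?_, ?_⟩
  · rcases hv.1.1 with hh | hh
    · exact absurd (comp_clo _ _ p0 hp0 v ⟨⟨hh, hv.2⟩, hv.1.2, hv2, hXv⟩ hpv) hvP
    · exact hh
  · intro p hp q hq hqP hpq
    rcases hall p hp q hq hqP hpq with hh | hh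
    exacts [Or.inl hh.2, Or.inr hh.2]
  · intro P' hP' hc hw' hu2' hu1' hX'
    exact hc.subset_comp hu1' (fun p hp => ⟨hP' hp, fun e => hw' (e ▸ hp), fun e => hu2' (e ▸ hp), hX' p hp⟩)

set_option maxHeartbeats 800000 in
lemma Ear.caseI_aux (E : Ear G U B L x y w M u1 u2) {a b : V} {K : Set V}
    (C : Cut G U B x y w a b K) (h1 : u1 ∈ K) (hns : NoSep G ((K ∪ {a, b}) \ {w}) B) : False := by
  classical
  have hi := E.crit.inst
  have hu1x : u1 ≠ x := fun e => C.nx (e ▸ h1)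
  have hu1y : u1 ≠ y := fun e => C.ny (e ▸ h1)
  have hsub := E.sub hu1x hu1y
  obtain ⟨d, hd, hdw⟩ := E.extra hu1x hu1y
  obtain ⟨α, β, hαβ, hw⟩ := Finset.card_eq_two.1 E.w2
  have hα : α ∈ L w := by simp [hw]
  have hβ : β ∈ L w := by simp [hw]
  have hdα : d ≠ α := fun e => hdw (e ▸ hα)
  have hdβ : d ≠ β := fun e => hdw (e ▸ hβ)
  have hX1 : ({α, d} : Finset ℕ).card = 2 := Finset.card_pair hdα.symm
  have hX2 : ({β, d} : Finset ℕ).card = 2 := Finset.card_pair hdβ.symm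
  have hXu : ∀ γ ∈ L w, ({γ, d} : Finset ℕ) ⊆ L u1 := by
    intro γ hγ c hc
    simp only [Finset.mem_insert, Finset.mem_singleton] at hc
    rcases hc with rfl | rfl
    exacts [hsub hγ, hd]
  obtain ⟨P, v, hPc, hPK, hwP, h2P, h1P, hXP, hvab, hv2, hXv, hφP, hpv, hall, hmax⟩ :=
    E.runI C h1 hns hX1 (d := d) (by simp) hdw (hXu α hα)
  obtain ⟨P', v', hPc', hPK', hwP', h2P', h1P', hXP', hvab', hv2', hXv', hφP', hpv', hall', hmax'⟩ :=
    E.runI C h1 hns hX2 (d := d) (by simp) hdw (hXu β hβ)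
  have hKU : K ⊆ U := C.hK.trans sdiff_subset
  have aK : a ∉ K := fun hh => (C.hK hh).2 (by simp)
  have bK : b ∉ K := fun hh => (C.hK hh).2 (by simp)
  have aw : a ≠ w := fun e => aK (e ▸ C.hw)
  have bw : b ≠ w := fun e => bK (e ▸ C.hw)
  have nK : ∀ t, t = a ∨ t = b → t ∉ K := by
    rintro t (rfl | rfl) <;> assumption
  have key : ∀ S S' : Set V, ∀ t, Conn G S → S ⊆ K ∩ B → w ∉ S → u2 ∉ S → u1 ∈ S → u1 ∈ S' →
      (t = a ∨ t = b) →
      (∀ p ∈ S', ∀ q ∈ (U \ {w}) ∩ B, q ∉ S' → G.Adj p q → q = u2 ∨ q = t) → S ⊆ S' := by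
    intro S S' t hS hSK hwS h2S h1S h1S' htab hall
    by_contra hn
    obtain ⟨p, hp, q, hq, hqn, hpq⟩ := hS.exit (T := S ∩ S') inter_subset_left ⟨u1, h1S, h1S'⟩
      (fun hh => hn fun z hz => (hh hz).2)
    rcases hall p hp.2 q ⟨⟨hKU (hSK hq).1, fun e => hwS (e ▸ hq)⟩, (hSK hq).2⟩
      (fun hh => hqn ⟨hq, hh⟩) hpq with rfl | rfl
    · exact h2S hq
    · exact nK _ htab (hSK hq).1
  obtain rfl : P = P' := Subset.antisymm (key P P' v' hPc hPK hwP h2P h1P h1P' hvab' hall')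
    (key P' P v hPc' hPK' hwP' h2P' h1P' h1P hvab hall)
  have hvUB : v ∈ (U \ {w}) ∩ B := by
    rcases hvab with rfl | rfl
    exacts [⟨⟨C.ha.1, aw⟩, C.ha.2⟩, ⟨⟨C.hb.1, bw⟩, C.hb.2⟩]
  have hvP : v ∉ P := fun hh => nK v hvab (hPK hh).1
  obtain rfl : v = v' := by
    obtain ⟨p, hp, hpv⟩ := hpv
    rcases hall' p hp v hvUB hvP hpv with e | e
    exacts [absurd e hv2, e]
  have hav : α ∈ L v := hXv (by simp)
  have hbv : β ∈ L v := hXv' (by simp)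
  have hdv : d ∈ L v := hXv (by simp)
  have h3v : 3 ≤ (L v).card := by
    have : ({α, β, d} : Finset ℕ) ⊆ L v := by
      intro c hc
      simp only [Finset.mem_insert, Finset.mem_singleton] at hc
      rcases hc with rfl | rfl | rfl <;> assumption
    have h := Finset.card_le_card this
    rwa [Finset.card_eq_three.2 ⟨α, β, d, hαβ, hdα.symm, hdβ.symm, rfl⟩] at h
  have hM2 : M.card ≤ 2 := by rcases hi.hM with hh | ⟨hh, _⟩ <;> omega
  have hvx : v ≠ x := fun e => by rw [e, hi.lx] at h3v; omega
  have hvy : v ≠ y := fun e => by rw [e, hi.ly] at h3v; omega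
  have hYc : (L v \ {d}).card = (L v).card - 1 := by
    rw [Finset.card_sdiff_of_subset (by simpa using hdv)]; simp
  obtain ⟨φ, hφ, hφv⟩ := E.crit.sink0 (U1 := U \ K) (P := ∅) (X := ∅) (v := v) (Y := L v \ {d})
    sdiff_subset (empty_subset _) (by simp) ⟨⟨hi.hx.1, C.nx⟩, by simp⟩ ⟨⟨hi.hy.1, C.ny⟩, by simp⟩
    (fun hh => hh.1.2 C.hw) ⟨⟨hvUB.1.1, nK v hvab⟩, hvUB.2⟩ (by simp) hvx hvy Finset.sdiff_subset (by omega)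
    (by
      intro h1 h2 hxy hYM
      have hMc : M.card = 2 := by
        have : 2 ≤ M.card := by rw [← hYM]; omega
        omega
      refine E.crit.nt (Or.inr ⟨hMc, hxy, v, ⟨hvUB.1.1, hvUB.2⟩, h1, h2, Or.inl ⟨hvUB.1.2, ?_, ?_⟩⟩)
      · rw [← hYM]; exact Finset.sdiff_subset
      · rw [← hYM] at hMc; omega)
    (by rintro _ _ _ _ ⟨k, hk, _⟩; exact absurd hk (by simp))
  have hφ : IsCol G (U \ K) L φ := hφ.mono (by simp) fun v _ => rl_sub v
  have fin : ∀ X : Finset ℕ, X.card = 2 → (∀ p ∈ P, X ⊆ L p) → φ v ∉ X →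
      (∀ φ, IsCol G ((U \ {w}) \ P) (rl G B L P X) φ → φ v ∈ X) → False := by
    intro X hX hXP hvX hφP
    have hPF : P ⊆ ((K ∪ {a, b}) \ {w}) ∩ B := fun p hp =>
      ⟨⟨Or.inl (hPK hp).1, fun e => hwP (e ▸ hp)⟩, (hPK hp).2⟩
    have hF : (K ∪ {a, b}) \ {w} ⊆ U := by
      rintro v ⟨hv | rfl | rfl, hvw⟩
      exacts [hKU hv, C.ha.1, C.hb.1]
    have haP : a ∉ P := fun hh => aK (hPK hh).1
    have hbP : b ∉ P := fun hh => bK (hPK hh).1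
    obtain ⟨φ2, hφ2, ea, eb⟩ := run_T (X := X) (S := {a, b}) (hi.pl.mono hF inter_subset_left) hPF
      (hi.lst.mono' hF (fun _ _ h => h) (by
        rintro v ⟨hv, hvw⟩ (rfl | rfl | rfl)
        · rcases hv with hv | hv
          · exact absurd hv C.nx
          · exact hv
        · rcases hv with hv | hv
          · exact absurd hv C.ny
          · exact hv
        · exact absurd rfl hvw) (fun _ _ _ => Finset.Subset.refl _)) hX.le (p := a) (q := b)
      ⟨⟨Or.inr (by simp), aw⟩, C.ha.2⟩ haP ⟨⟨Or.inr (by simp), bw⟩, C.hb.2⟩ hbP (Or.inr C.ab)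
      (fun v hv _ => hv) φ (hφ.1 a ⟨C.ha.1, aK⟩) (hφ.1 b ⟨C.hb.1, bK⟩)
      (fun _ => hφ.2 a ⟨C.ha.1, aK⟩ b ⟨C.hb.1, bK⟩ C.ab)
    obtain ⟨ψ, hψ, e1, _⟩ := glueK (U := (U \ {w}) \ P) (K := (K \ {w}) \ P) (a := a) (b := b)
      (L := rl G B L P X) (φ := φ) (φ' := φ2) (by
        intro k hk v hv hkv
        rcases C.nb hk.1.1 hv.1.1 hkv with hh | hh
        · exact Or.inl ⟨⟨hh, hv.1.2⟩, hv.2⟩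
        · exact Or.inr hh) (by
        have hU' : ((U \ {w}) \ P) \ ((K \ {w}) \ P) ⊆ U \ K := fun v hv =>
          ⟨hv.1.1.1, fun hh => hv.2 ⟨⟨hh, hv.1.1.2⟩, hv.1.2⟩⟩
        refine hφ.mono hU' fun v hv => ?_
        have : v ∉ Nb G P \ B := by
          rintro ⟨⟨k, hk, hkv⟩, hvB⟩
          rcases C.nb (hPK hk).1 (hU' hv).1 hkv with hh | rfl | rfl
          exacts [(hU' hv).2 hh, hvB C.ha.2, hvB C.hb.2]
        rw [rl, rm_nmem this]) (by
        refine hφ2.mono ?_ fun _ _ => Finset.Subset.refl _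
        rintro v (hv | rfl | rfl)
        exacts [⟨⟨Or.inl hv.1.1, hv.1.2⟩, hv.2⟩, ⟨⟨Or.inr (by simp), aw⟩, haP⟩,
          ⟨⟨Or.inr (by simp), bw⟩, hbP⟩]) ea eb (fun hh => aK hh.1.1) (fun hh => bK hh.1.1)
    have := hφP ψ hψ
    rw [e1 v ⟨⟨hvUB.1, hvP⟩, fun hh => nK v hvab hh.1.1⟩] at this
    exact hvX this
  simp only [Finset.mem_sdiff, Finset.mem_singleton] at hφv
  by_cases e : φ v = α
  · exact fin _ hX2 hXP' (by simp only [Finset.mem_insert, Finset.mem_singleton]; rw [e]; exact fun hh => hh.elim hαβ hdα.symm) hφP'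
  · exact fin _ hX1 hXP (by simp only [Finset.mem_insert, Finset.mem_singleton]; exact fun hh => hh.elim e hφv.2) hφP

/-- no second separating edge -/
lemma Ear.caseI (E : Ear G U B L x y w M u1 u2) {a b : V} {K : Set V}
    (C : Cut G U B x y w a b K) (hab : ({a, b} : Set V) ≠ {u1, u2})
    (hmin : ∀ a' b' K', ({a', b'} : Set V) ≠ {u1, u2} → Cut G U B x y w a' b' K' →
      K.ncard ≤ K'.ncard) : False := by
  classical
  have hi := E.crit.inst
  have aK : a ∉ K := fun hh => (C.hK hh).2 (by simp)
  have bK : b ∉ K := fun hh => (C.hK hh).2 (by simp)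
  have aw : a ≠ w := fun e => aK (e ▸ C.hw)
  have bw : b ≠ w := fun e => bK (e ▸ C.hw)
  have hFU : (K ∪ {a, b}) \ {w} ⊆ U := by
    rintro v ⟨hv | rfl | rfl, hvw⟩
    exacts [(C.hK hv).1, C.ha.1, C.hb.1]
  have m1 : u1 ∈ (K ∪ {a, b}) \ {w} := by
    rcases C.nb C.hw E.cut.ha.1 E.adj1 with hh | hh
    exacts [⟨Or.inl hh, E.w1⟩, ⟨Or.inr hh, E.w1⟩]
  have m2 : u2 ∈ (K ∪ {a, b}) \ {w} := by
    rcases C.nb C.hw E.cut.hb.1 E.symm.adj1 with hh | hh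
    exacts [⟨Or.inl hh, E.symm.w1⟩, ⟨Or.inr hh, E.symm.w1⟩]
  have hns : NoSep G ((K ∪ {a, b}) \ {w}) B := by
    refine NoSep.mk' C.ab ?_
    intro p hp q hq hpq Q hQ hne hcl haQ hbQ
    have hQK : Q ⊆ K \ {w} := by
      intro v hv
      rcases (hQ hv).1.1 with hh | rfl | rfl
      exacts [⟨hh, (hQ hv).1.2⟩, absurd hv haQ, absurd hv hbQ]
    have hpU : p ∈ U ∩ B := ⟨hFU hp.1, hp.2⟩
    have hqU : q ∈ U ∩ B := ⟨hFU hq.1, hq.2⟩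
    have hwpq : w ∉ ({p, q} : Set V) := by
      rintro (e | e)
      exacts [hp.1.2 e.symm, hq.1.2 e.symm]
    have hclQ : ∀ k ∈ Q, ∀ v ∈ U \ {p, q}, v ≠ w → G.Adj k v → v ∈ Q := by
      intro k hk v hv hvw hkv
      refine hcl k hk v ⟨⟨?_, hvw⟩, hv.2⟩ hkv
      rcases C.nb (hQK hk).1 hv.1 hkv with hh | hh
      exacts [Or.inl hh, Or.inr hh]
    by_cases hu : u1 ∈ Q ∨ u2 ∈ Q
    · have hcl2 : Clo G (U \ {p, q}) (insert w Q) := by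
        rintro k (rfl | hk) v hv hkv
        · have h12 : ∀ t t', t ∈ Q → G.Adj t t' → t' ≠ k → t' ∈ U → t' = v → v ∈ insert k Q := by
            rintro t t' ht htt hw' hU' rfl
            exact Or.inr (hclQ t ht _ hv hw' htt)
          rcases E.nb hv.1 hkv with e | e
          · rcases hu with hu | hu
            · exact Or.inr (e ▸ hu)
            · exact h12 u2 u1 hu E.cut.ab.symm E.w1 E.cut.ha.1 e.symm
          · rcases hu with hu | hu
            · exact h12 u1 u2 hu E.cut.ab E.symm.w1 E.cut.hb.1 e.symm
            · exact Or.inr (e ▸ hu)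
        · by_cases e : v = w
          · exact Or.inl e
          · exact Or.inr (hclQ k hk v hv e hkv)
      obtain ⟨h1, h2, h3, h4⟩ := E.crit.min_aux C (a' := p) (b' := q) (Q := insert w Q) hpU hqU hpq
        hp.1.1 hq.1.1
        (insert_subset C.hw fun v hv => (hQK hv).1)
        (insert_subset ⟨hi.hw.1, hwpq⟩ fun v hv => ⟨hFU (hQ hv).1, (hQ hv).2⟩) ⟨w, Or.inl rfl⟩ hcl2
        (fun K' hK' => hmin p q K' (by
          intro e
          rcases hu with hu | hu
          · exact (hQ hu).2 (by rw [e]; simp)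
          · exact (hQ hu).2 (by rw [e]; simp)) hK')
      rintro v ⟨⟨hv, hvw⟩, hvn⟩
      have hvK : v ∈ K := by
        rcases hv with hv | hv
        · exact hv
        · exfalso
          apply hvn
          rcases hv with rfl | rfl <;> rcases h3 with rfl | rfl <;> rcases h4 with rfl | rfl <;>
            first | exact absurd rfl h2 | simp
      rcases h1 hvK with e | e
      exacts [absurd e hvw, e]
    · push Not at hu
      exfalso
      refine E.crit.R1 hpU hqU hpq (K := Q) (fun v hv => ⟨hFU (hQ hv).1, (hQ hv).2⟩) ?_ hne
        (fun hh => (hQK hh).2 rfl) (fun hh => C.nx (hQK hh).1) (fun hh => C.ny (hQK hh).1)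
      intro k hk v hv hkv
      refine hclQ k hk v hv ?_ hkv
      rintro rfl
      rcases E.nb (hFU (hQ hk).1) hkv.symm with rfl | rfl
      exacts [hu.1 hk, hu.2 hk]
  by_cases h1 : u1 ∈ K
  · exact E.caseI_aux C h1 hns
  by_cases h2 : u2 ∈ K
  · exact E.symm.caseI_aux C h2 hns
  have n1 : u1 ∈ ({a, b} : Set V) := m1.1.resolve_left h1
  have n2 : u2 ∈ ({a, b} : Set V) := m2.1.resolve_left h2
  apply hab
  have := E.cut.ab.ne
  rcases n1 with rfl | rfl <;> rcases n2 with rfl | rfl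
  exacts [absurd rfl this, rfl, pair_comm _ _, absurd rfl this]

end HC

namespace HC
variable {V : Type u} {G : SimpleGraph V} [Finite V]
variable {U B : Set V} {L : V → Finset ℕ} {x y w u1 u2 : V} {M : Finset ℕ}

lemma Crit.srcmove (h : Crit G U B L x y w M) (hM : M.card = 2) {P : Set V} (hPB : P ⊆ U ∩ B)
    (hPc : Conn G P) (hd : Deg2 G P (U ∩ B)) (hxP : x ∈ P) (hyP : y ∈ P) (hwP : w ∉ P)
    (hML : ∀ v ∈ P, M ⊆ L v) {b u : V} (hb : b ∈ P) (hu : u ∈ U ∩ B) (huP : u ∉ P)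
    (hbu : G.Adj b u) (huw : u ≠ w) (hMu : ¬ M ⊆ L u) : False := by
  classical
  have hi := h.inst
  have hS : ∀ v ∈ ({x, y, w} : Set V), v ∉ P → v = w := by
    rintro v (rfl | rfl | rfl) hv
    exacts [absurd hxP hv, absurd hyP hv, rfl]
  have hux : u ≠ x := fun hh => huP (hh ▸ hxP)
  have huy : u ≠ y := fun hh => huP (hh ▸ hyP)
  have h3 : 3 ≤ (L u).card := (hi.lst u hu.1 (by simp [hux, huy, huw])).1
  obtain ⟨Y, hY, hY2⟩ := exists_sub2 (sdiff_two hM h3 hMu).1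
  obtain ⟨φ, hφ⟩ := h.use (U' := U \ P) sdiff_subset ⟨x, hi.hx.1, fun hh => hh.2 hxP⟩
    (B' := B ∪ Nb G P) (L' := Function.update (rl G B L P M) u Y) (x' := u) (y' := u) (w' := w)
    (M' := Y) ⟨run_pl hi.pl hPB, ⟨⟨hu.1, huP⟩, Or.inl hu.2⟩, ⟨⟨hu.1, huP⟩, Or.inl hu.2⟩, Or.inl rfl,
      ⟨⟨hi.hw.1, hwP⟩, Or.inl hi.hw.2⟩, huw.symm, huw.symm, by simp, by simp, Or.inl hY2,
      by rw [Function.update_of_ne huw.symm, rl_B hi.hw.2]; exact hi.lw,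
      (run_lst hi.lst hM.le).mono' subset_rfl (fun _ _ h => h) (by
        intro v hv hvS
        simp [hS v hvS hv.2]) (by
        intro v _ hv
        rw [Function.update_of_ne (fun h => hv (by simp [h]))])⟩
    (by
      rintro (⟨h1, _⟩ | ⟨_, h2, _⟩)
      · omega
      · exact h2 rfl)
  have hφu : φ u ∈ Y := by simpa using hφ.1 u ⟨hu.1, huP⟩
  obtain ⟨φ', h', _⟩ := run_port hPB hM hPc hd (φ := φ) (hφ.mono subset_rfl (by
    intro v hv
    by_cases hvu : v = u
    · subst hvu
      rw [Function.update_self, rl_B hu.2]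
      exact hY.trans Finset.sdiff_subset
    · rw [Function.update_of_ne hvu])) hML hb hu huP hbu
    (Finset.mem_sdiff.1 (hY hφu)).2
  exact h.nc ⟨φ', h'⟩

lemma Ear.noSep (E : Ear G U B L x y w M u1 u2)
    (hall : ∀ a b K, Cut G U B x y w a b K → ({a, b} : Set V) = {u1, u2}) :
    NoSep G (U \ {w}) B := by
  have hi := E.crit.inst
  refine NoSep.mk' E.cut.ab ?_
  intro p hp q hq hpq Q hQ hne hcl h1 h2
  have hwpq : w ∉ ({p, q} : Set V) := by
    rintro (e | e)
    exacts [hp.1.2 e.symm, hq.1.2 e.symm]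
  have hQU : Q ⊆ U \ {p, q} := fun v hv => ⟨(hQ hv).1.1, (hQ hv).2⟩
  have hwQ : w ∉ Q := fun hh => (hQ hh).1.2 rfl
  have hcl2 : Clo G (U \ {p, q}) Q := by
    intro k hk v hv hkv
    refine hcl k hk v ⟨⟨hv.1, ?_⟩, hv.2⟩ hkv
    rintro rfl
    rcases E.nb (hQU hk).1 hkv.symm with rfl | rfl
    exacts [h1 hk, h2 hk]
  have hpU : p ∈ U ∩ B := ⟨hp.1.1, hp.2⟩
  have hqU : q ∈ U ∩ B := ⟨hq.1.1, hq.2⟩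
  have C := E.crit.cut hpU hqU hpq hQU hne hcl2 (fun hh => hwQ (hh ⟨hi.hw.1, hwpq⟩))
  have he := hall _ _ _ C
  have hpq' : G.Adj p q := C.ab
  by_contra hn
  have hclw : Clo G (U \ {p, q}) {w} := he ▸ E.cut.cl
  have hrest : ∀ Q' ⊆ U \ {p, q}, Q'.Nonempty → Clo G (U \ {p, q}) Q' → w ∉ Q' → x ∈ Q' ∨ y ∈ Q' := by
    intro Q' hQ' hne hcl hw
    by_contra hh
    push Not at hh
    exact E.crit.R1 hpU hqU (Or.inr hpq') hQ' hcl hne hw hh.1 hh.2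
  have hR : ((U \ {p, q}) \ (insert w Q)).Nonempty := by
    obtain ⟨v, hv, hvQ⟩ := not_subset.1 hn
    refine ⟨v, ⟨hv.1.1, hv.2⟩, ?_⟩
    rintro (e | e)
    exacts [hv.1.2 e, hvQ e]
  have hclR : Clo G (U \ {p, q}) ((U \ {p, q}) \ insert w Q) := by
    refine Clo.compl ?_ (insert_subset ⟨hi.hw.1, hwpq⟩ hQU)
    rintro k (rfl | hk) v hv hkv
    · exact Or.inl (hclw k rfl v hv hkv)
    · exact Or.inr (hcl2 k hk v hv hkv)
  have key : ∀ s s', s ∈ Q → s' ∈ (U \ {p, q}) \ insert w Q → ¬ (s = s' ∨ G.Adj s s') := by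
    rintro s s' hs hs' (rfl | hss)
    · exact hs'.2 (Or.inr hs)
    · exact hs'.2 (Or.inr (hcl2 s hs s' hs'.1 hss))
  rcases hrest Q hQU hne hcl2 hwQ with hx | hx <;>
    rcases hrest _ sdiff_subset hR hclR (fun hh => hh.2 (Or.inl rfl)) with hy | hy
  · exact hy.2 (Or.inr hx)
  · exact key x y hx hy hi.hxy
  · exact key y x hx hy (hi.hxy.imp Eq.symm fun h => h.symm)
  · exact hy.2 (Or.inr hx)

lemma Ear.degU (E : Ear G U B L x y w M u1 u2) (hns : NoSep G (U \ {w}) B) {P : Set V}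
    (hP : P ⊆ (U \ {w}) ∩ B) (h1 : u1 ∉ P) (h2 : u2 ∉ P) : Deg2 G P (U ∩ B) := by
  have hd := hns.deg2 (E.crit.inst.pl.mono sdiff_subset inter_subset_left) hP
  have key : ∀ v ∈ P, ∀ a ∈ U ∩ B, G.Adj v a → a ∈ (U \ {w}) ∩ B := by
    intro v hv a ha hva
    refine ⟨⟨ha.1, ?_⟩, ha.2⟩
    rintro rfl
    rcases E.nb (hP hv).1.1 hva.symm with rfl | rfl
    exacts [h1 hv, h2 hv]
  intro v hv a ha b hb c hc h1 h2 h3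
  exact hd v hv a (key v hv a ha h1) b (key v hv b hb h2) c (key v hv c hc h3) h1 h2 h3

lemma Ear.D1 (E : Ear G U B L x y w M u1 u2) (hns : NoSep G (U \ {w}) B) (hM : M.card = 2)
    (h1x : u1 ≠ x) (h1y : u1 ≠ y) (h2x : u2 ≠ x) (h2y : u2 ≠ y) : False := by
  classical
  have hi := E.crit.inst
  have hpl : PL G (U \ {w}) B := hi.pl.mono sdiff_subset inter_subset_left
  set Q : Set V := {b | b ∈ (U \ {w}) ∩ B ∧ b ≠ u1 ∧ b ≠ u2 ∧ M ⊆ L b} with hQ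
  set P := comp G Q x with hPdef
  have hxQ : x ∈ Q := ⟨⟨⟨hi.hx.1, hi.wx.symm⟩, hi.hx.2⟩, h1x.symm, h2x.symm, by rw [hi.lx]⟩
  have hyQ : y ∈ Q := ⟨⟨⟨hi.hy.1, hi.wy.symm⟩, hi.hy.2⟩, h1y.symm, h2y.symm, by rw [hi.ly]⟩
  have hxP : x ∈ P := mem_comp hxQ
  have hyP : y ∈ P := by
    rcases hi.hxy with he | he
    · exact he ▸ hxP
    · exact comp_clo _ _ x hxP y hyQ he
  have hPQ : P ⊆ Q := comp_subset _ _
  have hPB : P ⊆ (U \ {w}) ∩ B := fun a ha => (hPQ ha).1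
  have hPU : P ⊆ U ∩ B := fun a ha => ⟨(hPB ha).1.1, (hPB ha).2⟩
  have hPc : Conn G P := comp_conn hxQ
  have hwP : w ∉ P := fun hh => (hPB hh).1.2 rfl
  have h1P : u1 ∉ P := fun hh => (hPQ hh).2.1 rfl
  have h2P : u2 ∉ P := fun hh => (hPQ hh).2.2.1 rfl
  have hML : ∀ v ∈ P, M ⊆ L v := fun v hv => (hPQ hv).2.2.2
  have hd : Deg2 G P (U ∩ B) := E.degU hns hPB h1P h2P
  have hport : ∀ v ∈ P, ∀ u ∈ (U \ {w}) ∩ B, u ∉ P → G.Adj v u → u = u1 ∨ u = u2 := by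
    intro v hv u hu huP hvu
    by_contra hn
    push Not at hn
    refine E.crit.srcmove hM hPU hPc hd hxP hyP hwP hML hv ⟨hu.1.1, hu.2⟩ huP hvu hu.1.2 fun hh => ?_
    exact huP (comp_clo _ _ v hv u ⟨hu, hn.1, hn.2, hh⟩ hvu)
  have hdG : Deg2 G ((U \ {w}) ∩ B) ((U \ {w}) ∩ B) := hns.deg2 hpl subset_rfl
  have huniq : ∀ a b, a ∈ (U \ {w}) ∩ B → b ∈ (U \ {w}) ∩ B → G.Adj a b → b ∉ P →
      ∃ pa, ∀ v ∈ P, G.Adj v a → v = pa := by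
    intro a b ha hb hab hbP
    by_cases hh : ∃ v ∈ P, G.Adj v a
    · obtain ⟨v, hv, hva⟩ := hh
      refine ⟨v, fun v' hv' h' => ?_⟩
      rcases hdG a ha v' (hPB hv') v (hPB hv) b hb h'.symm hva.symm hab with e | e | e
      · exact e
      · exact absurd (e ▸ hv') hbP
      · exact absurd (e ▸ hv) hbP
    · exact ⟨a, fun v hv hva => absurd ⟨v, hv, hva⟩ hh⟩
  obtain ⟨pa, hpa⟩ := huniq u1 u2 E.u1U E.symm.u1U E.cut.ab h2P
  obtain ⟨pb, hpb⟩ := huniq u2 u1 E.symm.u1U E.u1U E.cut.ab.symm h1P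
  obtain ⟨d, hd1, hdw⟩ := E.extra h1x h1y
  have h3 : 3 ≤ (L u2).card := (hi.lst u2 E.cut.hb.1 (by simp [h2x, h2y, E.symm.w1])).1
  obtain ⟨e, he, hde, hor⟩ : ∃ e ∈ L u2, d ≠ e ∧ (d ∉ M ∨ e ∉ M) := by
    by_cases hdM : d ∈ M
    · obtain ⟨e, he⟩ : (L u2 \ M).Nonempty := by
        rw [← Finset.card_pos]; exact card_sdiff_ge _ _ 1 (by omega)
      rw [Finset.mem_sdiff] at he
      exact ⟨e, he.1, fun e' => he.2 (e' ▸ hdM), Or.inr he.2⟩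
    · obtain ⟨e, he, hn⟩ := exists_ne_of_two (show 2 ≤ (L u2).card by omega) d
      exact ⟨e, he, hn.symm, Or.inl hdM⟩
  obtain ⟨φ, hφ, e1, e2⟩ := run_T (X := M) (S := {x, y}) hpl hPB
    (hi.lst.mono' sdiff_subset (fun _ _ h => h) (by
      rintro v hv (rfl | rfl | rfl)
      exacts [Or.inl rfl, Or.inr rfl, absurd rfl hv.2]) (fun _ _ _ => Finset.Subset.refl _)) hM.le
    E.u1U h1P E.symm.u1U h2P (Or.inr E.cut.ab) (by
      rintro v (rfl | rfl) hv
      exacts [absurd hxP hv, absurd hyP hv]) (fun v => if v = u1 then d else e)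
    (by simpa using hd1) (by simpa [E.cut.ab.ne'] using he) (fun _ => by simpa [E.cut.ab.ne'] using hde)
  rw [if_pos rfl] at e1
  rw [if_neg E.cut.ab.ne'] at e2
  have ht : TwoCol G P := two_run hpl hns hPc hPB E.u1U h1P
  have fin2 : ∀ b2 t2, (∀ v ∈ P, ∀ u ∈ (U \ {w}) ∩ B, u ∉ P → G.Adj v u →
      φ u ∉ M ∨ (v = b2 ∧ u = t2)) → False := by
    intro b2 t2 h4
    obtain ⟨φ', h', h''⟩ := run_fin (hPB.trans inter_subset_left) hM hφ ht hML h4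
    refine E.finW h' (Or.inl ?_)
    rw [h'' u1 ⟨E.u1U.1, h1P⟩, e1]
    exact hdw
  rcases hor with hor | hor
  · refine fin2 pb u2 fun v hv u hu huP hvu => ?_
    rcases hport v hv u hu huP hvu with rfl | rfl
    · left; rw [e1]; exact hor
    · exact Or.inr ⟨hpb v hv hvu, rfl⟩
  · refine fin2 pa u1 fun v hv u hu huP hvu => ?_
    rcases hport v hv u hu huP hvu with rfl | rfl
    · exact Or.inr ⟨hpa v hv hvu, rfl⟩
    · left; rw [e2]; exact hor

lemma Ear.D2 (E : Ear G U B L x y w M u1 u2) (hns : NoSep G (U \ {w}) B) (hx : u1 = x) : False := by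
  classical
  have hi := E.crit.inst
  have hpl : PL G (U \ {w}) B := hi.pl.mono sdiff_subset inter_subset_left
  have hMw := E.srcx hx
  have hy : y ≠ u1 ∧ y ≠ u2 := by
    rcases E.cut.src with hh | hh
    · exact absurd hx.symm hh.1
    · exact hh
  subst hx
  have h2 : u2 ≠ u1 := E.cut.ab.ne'
  obtain ⟨d, hd, hdw⟩ := E.symm.extra h2 hy.2.symm
  have hxy : G.Adj u1 y := hi.hxy.resolve_left hy.1.symm
  have hPB : ({u1, y} : Set V) ⊆ (U \ {w}) ∩ B := by
    rintro v (rfl | rfl)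
    exacts [E.u1U, ⟨⟨hi.hy.1, hi.wy.symm⟩, hi.hy.2⟩]
  have h2P : u2 ∉ ({u1, y} : Set V) := by
    rintro (e | e)
    exacts [h2 e, hy.2 e.symm]
  have hM : M.card = 2 := by rw [hMw, E.w2]
  obtain ⟨φ, hφ, e⟩ := run_T1 (X := M) (S := {u1, y}) hpl hPB
    (hi.lst.mono' sdiff_subset (fun _ _ h => h) (by
      rintro v hv (rfl | rfl | rfl)
      exacts [Or.inl rfl, Or.inr rfl, absurd rfl hv.2]) (fun _ _ _ => Finset.Subset.refl _)) hM.le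
    E.symm.u1U h2P (fun v hv hv' => absurd hv hv') hd
  obtain ⟨φ', h', h''⟩ := run_port hPB hM (conn_pair hxy) (hns.deg2 hpl hPB) hφ (by
    rintro v (rfl | rfl)
    · rw [hi.lx]
    · rw [hi.ly]) (b := u1) (u := u2) (by simp) E.symm.u1U h2P E.cut.ab (by rw [e, hMw]; exact hdw)
  refine E.finW h' (Or.inr ?_)
  rw [h'' u2 ⟨E.symm.u1U.1, h2P⟩, e]
  exact hdw

end HC

namespace HC
variable {V : Type u} {G : SimpleGraph V} [Finite V]
variable {U B : Set V} {L : V → Finset ℕ} {x y w u1 u2 : V} {M : Finset ℕ}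

lemma fin_aux {M1 M2 X : Finset ℕ} {c : ℕ} (h1 : c ∉ M1) (h2 : c ∉ M2) (hd : Disjoint M1 M2)
    (c2 : M2.card = 2) (hX : X.card = 2)
    (hA : ((insert c (M1 ∪ M2)) \ X) \ {c} = (insert c M1) \ {c}) : X = M2 := by
  symm
  refine Finset.eq_of_subset_of_card_le (fun a ha => ?_) (by omega)
  by_contra hn
  have hac : a ≠ c := fun e => h2 (e ▸ ha)
  have : a ∈ (insert c M1) \ {c} := by
    rw [← hA]; simp [ha, hn, hac]
  simp [hac] at this
  exact Finset.disjoint_left.1 hd this ha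

lemma Ear.Vrun {p : V} {c : ℕ} (E : Ear G U B L p p w {c} u1 u2) (hns : NoSep G (U \ {w}) B)
    (hpu : ¬ G.Adj p u1) {s s' t : V} {M1 M2 X : Finset ℕ} {d : ℕ}
    (St : Start G U B L p c s s' t M1 M2)
    (hN : ∀ v ∈ U, G.Adj p v → v = s ∨ v = s' ∨ v = t) (hss : ¬ G.Adj s s')
    (hX : X.card = 2) (hd : d ∈ X) (hdw : d ∉ L w) (hXu : X ⊆ L u1) (hX1 : X ≠ M1)
    (hX2 : X ≠ M2) : False := by
  classical
  have hi := E.crit.inst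
  have hpl : PL G (U \ {w}) B := hi.pl.mono sdiff_subset inter_subset_left
  obtain ⟨hp1, hp2⟩ := E.srcV (by simp)
  set Q : Set V := {b | b ∈ (U \ {w}) ∩ B ∧ b ≠ p ∧ b ≠ u2 ∧ X ⊆ L b} with hQ
  set P := comp G Q u1 with hPdef
  have hpG : p ∈ (U \ {w}) ∩ B := ⟨⟨hi.hx.1, hi.wx.symm⟩, hi.hx.2⟩
  have h1Q : u1 ∈ Q := ⟨E.u1U, hp1.symm, E.cut.ab.ne, hXu⟩
  have h1P : u1 ∈ P := mem_comp h1Q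
  have hPQ : P ⊆ Q := comp_subset _ _
  have hPB : P ⊆ (U \ {w}) ∩ B := fun a ha => (hPQ ha).1
  have hPc : Conn G P := comp_conn h1Q
  have hpP : p ∉ P := fun hh => (hPQ hh).2.1 rfl
  have h2P : u2 ∉ P := fun hh => (hPQ hh).2.2.1 rfl
  have hXL : ∀ v ∈ P, X ⊆ L v := fun v hv => (hPQ hv).2.2.2
  obtain ⟨ht, b, hb, v, hv, hvP, hv2, hbv, hφv, hports⟩ := E.run (F := U \ {w}) (s0 := p) subset_rfl
    hns hPc hPB h1P E.symm.u1U h2P (fun k hk v hv _ => hv) hpG hpP hp2 hX hd hdw hXL hpP hpP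
  have hlst : Lst (U \ {w}) B {p} L := hi.lst.mono' sdiff_subset (fun _ _ h => h) (by
      rintro v hv (rfl | rfl | rfl)
      exacts [rfl, rfl, absurd rfl hv.2]) (fun _ _ _ => Finset.Subset.refl _)
  by_cases hvp : v = p
  · subst hvp
    by_cases hc : c ∈ X
    · have hb1 : b ≠ u1 := fun e => hpu (e ▸ hbv.symm)
      have h3 : 3 ≤ (L b).card := (hlst b (hPB hb).1 (fun e => hpP (e ▸ hb))).1
      obtain ⟨e, he⟩ : (L b \ X).Nonempty := by
        rw [← Finset.card_pos]; exact card_sdiff_ge _ _ 1 (by omega)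
      rw [Finset.mem_sdiff] at he
      have hec : e ≠ c := fun h => he.2 (h ▸ hc)
      have hvb : v ≠ b := hbv.ne'
      obtain ⟨φ, hφ, e1, e2⟩ := run_T (X := X) (S := {v}) (P := P \ {b}) hpl
        (sdiff_subset.trans hPB) hlst hX.le hpG (fun h => hpP h.1) (hPB hb) (fun h => h.2 rfl)
        (Or.inr hbv.symm) (by rintro a rfl _; exact Or.inl rfl) (fun a => if a = v then c else e)
        (by rw [if_pos rfl, hi.lx]; simp) (by rw [if_neg hvb.symm]; exact he.1)
        (by intro _; rw [if_pos rfl, if_neg hvb.symm]; exact hec.symm)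
      rw [if_neg hvb.symm] at e2
      refine E.finX (P := P \ {b}) (sdiff_subset.trans (hPB.trans inter_subset_left))
        (ht.mono sdiff_subset) hX hd hdw (fun a ha => hXL a ha.1) ⟨h1P, hb1.symm⟩
        (fun h => h2P h.1) hφ ?_
      intro a ha u hu hun hau
      by_cases hub : u = b
      · subst hub; left; rw [e2]; exact he.2
      · rcases hports a ha.1 u hu (fun h => hun ⟨h, hub⟩) hau with h | h
        · exact Or.inr h
        · exact absurd h.1 ha.2
    · obtain ⟨φ, hφ, e1⟩ := run_T1 (X := X) (S := {v}) hpl hPB hlst hX.le hpG hpP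
        (fun a ha _ => ha) (d := c) (by rw [hi.lx]; simp)
      have := hφv φ hφ
      rw [e1] at this
      exact hc this
  · have hXv : ¬ X ⊆ L v := fun hh => hvP (comp_clo _ _ b hb v ⟨hv, hvp, hv2, hh⟩ hbv)
    have h3 : 3 ≤ (L v).card := (hlst v hv.1 hvp).1
    have hY2 := (sdiff_two hX h3 hXv).1
    obtain ⟨φ, hφ⟩ := E.crit.use (U' := (U \ {w}) \ P) (sdiff_subset.trans sdiff_subset)
      ⟨w, hi.hw.1, fun hh => hh.1.2 rfl⟩
      (B' := B ∪ Nb G P) (L' := Function.update (rl G B L P X) v (L v \ X)) (x' := p) (y' := p)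
      (w' := v) (M' := {c}) ⟨run_pl hpl hPB, ⟨⟨hpG.1, hpP⟩, Or.inl hpG.2⟩,
        ⟨⟨hpG.1, hpP⟩, Or.inl hpG.2⟩, Or.inl rfl, ⟨⟨hv.1, hvP⟩, Or.inl hv.2⟩, hvp, hvp,
        by rw [Function.update_of_ne (Ne.symm hvp), rl_B hpG.2, hi.lx],
        by rw [Function.update_of_ne (Ne.symm hvp), rl_B hpG.2, hi.lx], Or.inr ⟨by simp, rfl⟩,
        by simpa using hY2,
        (run_lst hlst hX.le).mono' subset_rfl (fun _ _ h => h) (by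
          intro v hv hvS; exact Or.inl hvS) (by
          intro a _ ha
          rw [Function.update_of_ne (fun h => ha (by simp [h]))])⟩
      (by
        rintro (⟨_, q, hq, r, hr, hqv, hrv, pq, pr, qr, he, _⟩ | ⟨h1, _⟩)
        swap
        · simp at h1
        have hqU : q ∈ U := hq.1.1.1
        have hrU : r ∈ U := hr.1.1.1
        have key : ∀ a z N1 N2, a ∈ B → a ≠ v → z = t → z ∈ B ∪ Nb G P → L a = insert c N1 →
            L t = insert c (N1 ∪ N2) → c ∉ N1 → c ∉ N2 → Disjoint N1 N2 → N2.card = 2 →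
            Function.update (rl G B L P X) v (L v \ X) z \ {c} =
            Function.update (rl G B L P X) v (L v \ X) a \ {c} → X = N2 := by
          intro a z N1 N2 haB hav hz hzB ha hz' c1 c2 hd h2 heq
          subst hz
          have hzv : z ≠ v := fun e => St.htB (e ▸ hv.2)
          rw [Function.update_of_ne hzv, Function.update_of_ne hav, rl_B haB, ha] at heq
          have : rl G B L P X z = L z \ X := rm_mem ⟨hzB.resolve_left St.htB, St.htB⟩
          rw [this, hz'] at heq
          exact fin_aux c1 c2 hd h2 hX heq
        have lt' : L t = insert c (M2 ∪ M1) := by rw [St.lt, Finset.union_comm]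
        rcases hN q hqU pq with e | e | e <;> rcases hN r hrU pr with e' | e' | e'
        · exact qr.ne (e.trans e'.symm)
        · exact hss (e ▸ e' ▸ qr)
        · exact hX2 (key q r M1 M2 (e ▸ St.hs.2) hqv e' hr.2 (e ▸ St.ls) St.lt St.c1 St.c2 St.dis
            St.m2 he.symm)
        · exact hss (e ▸ e' ▸ qr.symm)
        · exact qr.ne (e.trans e'.symm)
        · exact hX1 (key q r M2 M1 (e ▸ St.hs'.2) hqv e' hr.2 (e ▸ St.ls') lt' St.c2 St.c1
            St.dis.symm St.m1 he.symm)
        · exact hX2 (key r q M1 M2 (e' ▸ St.hs.2) hrv e hq.2 (e' ▸ St.ls) St.lt St.c1 St.c2 St.dis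
            St.m2 he)
        · exact hX1 (key r q M2 M1 (e' ▸ St.hs'.2) hrv e hq.2 (e' ▸ St.ls') lt' St.c2 St.c1
            St.dis.symm St.m1 he)
        · exact qr.ne (e.trans e'.symm))
    have h1 : φ v ∈ L v \ X := by simpa using hφ.1 v ⟨hv.1, hvP⟩
    refine (Finset.mem_sdiff.1 h1).2 (hφv φ (hφ.mono subset_rfl fun a _ => ?_))
    by_cases ha : a = v
    · subst ha; rw [Function.update_self, rl_B hv.2]; exact Finset.sdiff_subset
    · rw [Function.update_of_ne ha]

lemma Ear.V_aux {p : V} {c : ℕ} (E : Ear G U B L p p w {c} u1 u2) (hns : NoSep G (U \ {w}) B)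
    (hall : ∀ a b K, Cut G U B p p w a b K → ({a, b} : Set V) = {u1, u2})
    (hpu : ¬ G.Adj p u1) : False := by
  classical
  have hi := E.crit.inst
  have hpw := E.crit.npw
  have hpl : PL G (U \ {w}) B := hi.pl.mono sdiff_subset inter_subset_left
  obtain ⟨hp1, hp2⟩ := E.srcV (by simp)
  have hpG : p ∈ (U \ {w}) ∩ B := ⟨⟨hi.hx.1, hi.wx.symm⟩, hi.hx.2⟩
  have hin : ∀ s ∈ U ∩ B, G.Adj p s → s ∈ (U \ {w}) ∩ B := fun s hs ps =>
    ⟨⟨hs.1, fun e => hpw ((show s = w from e) ▸ ps)⟩, hs.2⟩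
  have hne1 : ∀ s, G.Adj p s → u1 ≠ s := fun s ps e => hpu (e ▸ ps)
  have htri : ∀ s ∈ U ∩ B, ∀ s' ∈ U ∩ B, G.Adj p s → G.Adj p s' → ¬ G.Adj s s' :=
    fun s hs s' hs' ps ps' hss => hns.tri hpl hpG (hin s hs ps) (hin s' hs' ps') E.u1U ps ps' hss
      hp1.symm (hne1 s ps) (hne1 s' ps')
  obtain ⟨s, s', t, M1, M2, St, -⟩ := E.crit.start (E.degU hns (sub1 hpG) (by simpa using hp1.symm)
    (by simpa using hp2.symm)) hpw htri (by
      intro s hs s' hs' hne ps ps'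
      have : u2 ≠ s ∨ u2 ≠ s' := by
        by_contra hh
        push Not at hh
        exact hne (hh.1.symm.trans hh.2)
      rcases this with h | h
      · exact Or.inl (E.degU hns (sub1 (hin s hs ps)) (by simpa using hne1 s ps) (by simpa using h))
      · exact Or.inr (E.degU hns (sub1 (hin s' hs' ps')) (by simpa using hne1 s' ps')
          (by simpa using h)))
  have hNS : ∀ s ∈ U ∩ B, G.Adj p s → NSep G U p s := by
    intro s hs ps K hK hne hcl
    by_contra hn
    have hC := hall _ _ _ (E.crit.cut hi.hx hs (Or.inr ps) hK hne hcl hn)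
    have : p ∈ ({u1, u2} : Set V) := hC ▸ (by simp)
    rcases this with e | e
    exacts [hp1 e, hp2 e]
  have hN := E.crit.middle hi.hx St.hs St.hs' St.ht St.ps St.ps' St.pt St.st St.st' St.ne
    (hNS s St.hs St.ps) (hNS s' St.hs' St.ps')
  have hss := htri s St.hs s' St.hs' St.ps St.ps'
  obtain ⟨d, hd, hdw⟩ := E.extra hp1.symm hp1.symm
  have hsub := E.sub hp1.symm hp1.symm
  obtain ⟨α, β, hαβ, hw⟩ := Finset.card_eq_two.1 E.w2
  have hα : α ∈ L w := by simp [hw]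
  have hβ : β ∈ L w := by simp [hw]
  have hdα : d ≠ α := fun e => hdw (e ▸ hα)
  have hdβ : d ≠ β := fun e => hdw (e ▸ hβ)
  have hXu : ∀ γ ∈ L w, ({γ, d} : Finset ℕ) ⊆ L u1 := by
    intro γ hγ c hc
    simp only [Finset.mem_insert, Finset.mem_singleton] at hc
    rcases hc with rfl | rfl
    exacts [hsub hγ, hd]
  have hX1 : ({α, d} : Finset ℕ).card = 2 := Finset.card_pair hdα.symm
  have hX2 : ({β, d} : Finset ℕ).card = 2 := Finset.card_pair hdβ.symm
  have hneX : ({α, d} : Finset ℕ) ≠ {β, d} := by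
    intro e
    have : α ∈ ({β, d} : Finset ℕ) := e ▸ (by simp)
    simp [hαβ, hdα.symm] at this
  by_cases hA : ({α, d} : Finset ℕ) = M1 ∨ ({α, d} : Finset ℕ) = M2
  · refine E.Vrun hns hpu St hN hss hX2 (d := d) (by simp) hdw (hXu β hβ) (fun e => ?_) (fun e => ?_)
    · rcases hA with h | h
      · exact hneX (h.trans e.symm)
      · exact Finset.disjoint_left.1 St.dis (e ▸ (by simp) : d ∈ M1) (h ▸ (by simp) : d ∈ M2)
    · rcases hA with h | h
      · exact Finset.disjoint_left.1 St.dis (h ▸ (by simp) : d ∈ M1) (e ▸ (by simp) : d ∈ M2)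
      · exact hneX (h.trans e.symm)
  · push Not at hA
    exact E.Vrun hns hpu St hN hss hX1 (d := d) (by simp) hdw (hXu α hα) hA.1 hA.2

lemma Ear.Vadj {p : V} {c : ℕ} (E : Ear G U B L p p w {c} u1 u2) (hpu : G.Adj p u1) :
    L u1 \ {c} = L w := by
  classical
  have hi := E.crit.inst
  have hpl : PL G (U \ {w}) B := hi.pl.mono sdiff_subset inter_subset_left
  obtain ⟨hp1, hp2⟩ := E.srcV (by simp)
  have hpG : p ∈ (U \ {w}) ∩ B := ⟨⟨hi.hx.1, hi.wx.symm⟩, hi.hx.2⟩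
  have hlst : Lst (U \ {w}) B {p} L := hi.lst.mono' sdiff_subset (fun _ _ h => h) (by
      rintro v hv (rfl | rfl | rfl)
      exacts [rfl, rfl, absurd rfl hv.2]) (fun _ _ _ => Finset.Subset.refl _)
  have h3 : 3 ≤ (L u1).card := (hlst u1 E.u1U.1 hp1.symm).1
  have hs : L u1 \ {c} ⊆ L w := by
    intro d hd
    simp only [Finset.mem_sdiff, Finset.mem_singleton] at hd
    by_contra hdw
    obtain ⟨φ, hφ, e1, e2⟩ := run_T (X := ∅) (S := {p}) (P := ∅) hpl
        (by simp) hlst (by simp) hpG (by simp) E.u1U (by simp)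
        (Or.inr hpu) (by rintro a rfl _; exact Or.inl rfl) (fun a => if a = p then c else d)
        (by rw [if_pos rfl, hi.lx]; simp) (by rw [if_neg hp1.symm]; exact hd.1)
        (by intro _; rw [if_pos rfl, if_neg hp1.symm]; exact Ne.symm hd.2)
    rw [if_neg hp1.symm] at e2
    exact E.finW (hφ.mono (by simp) fun v _ => rl_sub v) (Or.inl (by rw [e2]; exact hdw))
  refine Finset.eq_of_subset_of_card_le hs ?_
  rw [E.w2]
  exact card_sdiff_ge _ _ 2 (by simp; omega)

lemma Ear.caseV {p : V} {c : ℕ} (E : Ear G U B L p p w {c} u1 u2) (hns : NoSep G (U \ {w}) B)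
    (hall : ∀ a b K, Cut G U B p p w a b K → ({a, b} : Set V) = {u1, u2}) : False := by
  by_cases h1 : G.Adj p u1
  · by_cases h2 : G.Adj p u2
    · have e1 := E.Vadj h1
      have e2 := E.symm.Vadj h2
      exact E.crit.NT (by simp) E.cut.ha E.cut.hb E.w1 E.symm.w1 h1 h2 E.cut.ab
        (e1.trans e2.symm) (by rw [e1, E.w2])
    · refine E.symm.V_aux hns (fun a b K C => ?_) h2
      rw [hall a b K C, pair_comm]
  · exact E.V_aux hns hall h1

lemma Crit.false_aux (h : Crit G U B L x y w M) (hw2 : (L w).card = 2) : False := by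
  classical
  have hi := h.inst
  have hMV : M.card = 1 → ∃ c, M = {c} ∧ x = y := by
    intro h1
    obtain ⟨c, hc⟩ := Finset.card_eq_one.1 h1
    refine ⟨c, hc, ?_⟩
    rcases hi.hM with hh | hh
    · omega
    · exact hh.2
  by_cases hns : NoSep G U B
  · rcases hi.hM with h2 | ⟨h1, _⟩
    · exact h.chordlessD h2 hns
    · obtain ⟨c, rfl, rfl⟩ := hMV h1
      exact h.chordlessV hns
  have hex : ∃ n : ℕ, ∃ a b K, Cut G U B x y w a b K ∧ K.ncard = n := by
    unfold NoSep at hns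
    push Not at hns
    obtain ⟨a, ha, b, hb, hab, K, hK, hne, hcl, hn⟩ := hns
    exact ⟨_, a, b, _, h.cut ha hb hab hK hne hcl hn, rfl⟩
  obtain ⟨u1, u2, K, C, hK⟩ := Nat.find_spec hex
  have hKw := h.minTri hw2 C fun a' b' K' C' => by
    rw [hK]; exact Nat.find_min' hex ⟨a', b', K', C', rfl⟩
  subst hKw
  have E : Ear G U B L x y w M u1 u2 := ⟨h, hw2, C⟩
  by_cases hall : ∀ a b K, Cut G U B x y w a b K → ({a, b} : Set V) = {u1, u2}
  · have hns := E.noSep hall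
    rcases hi.hM with h2 | ⟨h1, _⟩
    · by_cases e1 : u1 = x
      · exact E.D2 hns e1
      by_cases e2 : u1 = y
      · exact E.swap.D2 hns e2
      by_cases e3 : u2 = x
      · exact E.symm.D2 hns e3
      by_cases e4 : u2 = y
      · exact E.symm.swap.D2 hns e4
      exact E.D1 hns h2 e1 e2 e3 e4
    · obtain ⟨c, rfl, rfl⟩ := hMV h1
      exact E.caseV hns hall
  · have hex : ∃ n : ℕ, ∃ a b K, Cut G U B x y w a b K ∧ ({a, b} : Set V) ≠ {u1, u2} ∧
        K.ncard = n := by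
      push Not at hall
      obtain ⟨a, b, K, hC, hn⟩ := hall
      exact ⟨_, a, b, K, hC, hn, rfl⟩
    obtain ⟨a, b, K, C, hne, hK⟩ := Nat.find_spec hex
    exact E.caseI C hne fun a' b' K' hn' C' => by
      rw [hK]; exact Nat.find_min' hex ⟨a', b', K', C', hn', rfl⟩

theorem nn_all (U : Set V) : NN G U := by
  induction hn : U.ncard using Nat.strong_induction_on generalizing U with
  | _ n ih =>
    intro B L x y w M hi ht
    by_contra hc
    have hcr : Crit G U B L x y w M := ⟨hi, ht, hc, fun U' hU' =>
      ih _ (hn ▸ Set.ncard_lt_ncard hU' (Set.toFinite U)) U' rfl⟩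
    obtain ⟨L', h', hw⟩ := hcr.shrink
    exact h'.false_aux hw

end HC

namespace HC
variable {V : Type u} {G : SimpleGraph V} [Finite V] [DecidableEq V]
variable {U B : Set V} {L : V → Finset ℕ} {x y w : V} {M : Finset ℕ}

/-- abstract coloring harmonicas on the subgraph induced by `H` -/
inductive AH (G : SimpleGraph V) : Set V → (V → Finset ℕ) → V ⊕ V × V → V → Prop where
  | tri (L : V → Finset ℕ) (u v w : V) (huv : G.Adj u v) (hvw : G.Adj v w) (huw : G.Adj u w)
      (hLuv : L u = L v) (hLvw : L v = L w) (hc : (L u).card = 2) :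
      AH G {u, v, w} L (Sum.inr (u, v)) w
  | step (H : Set V) (L : V → Finset ℕ) (u v w z : V) (s : Set V) (huw : u ≠ w) (hvw : v ≠ w)
      (hu : u ∈ H) (hv : v ∈ H) (hz : z ∈ H) (huv : G.Adj u v) (huz : G.Adj u z) (hvz : G.Adj v z)
      (hLuv : L u = L v) (hsub : L u ⊆ L z) (hc : (L u).card = 2) (hcz : (L z).card = 3)
      (hs : s = {u} ∨ s = {v} ∨ s = {u, v})
      (hdeg : (∀ a ∈ H, G.Adj u a → a = v ∨ a = z) ∨ (∀ a ∈ H, G.Adj v a → a = u ∨ a = z))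
      (hrec : AH G (H \ s) (Function.update L z (L z \ L u)) (Sum.inl z) w) :
      AH G H L (Sum.inr (u, v)) w
  | vert (H : Set V) (L : V → Finset ℕ) (u w x y : V) (huw : u ≠ w)
      (hu : u ∈ H) (hx : x ∈ H) (hy : y ∈ H) (hux : G.Adj u x) (huy : G.Adj u y) (hxy : G.Adj x y)
      (hcu : (L u).card = 1) (hLxy : L x \ L u = L y \ L u) (hcx : (L x \ L u).card = 2)
      (hdeg : ∀ a ∈ H, G.Adj u a → a = x ∨ a = y)
      (hrec : AH G (H \ {u})
        (Function.update (Function.update L x (L x \ L u)) y (L y \ L u)) (Sum.inr (x, y)) w) :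
      AH G H L (Sum.inl u) w

lemma AH.congr {H : Set V} {L L' : V → Finset ℕ} {st : V ⊕ V × V} {w : V} (h : AH G H L st w)
    (hL : ∀ v ∈ H, L v = L' v) : AH G H L' st w := by
  induction h generalizing L' with
  | tri L u v w huv hvw huw hLuv hLvw hc =>
    rw [hL u (by simp), hL v (by simp)] at hLuv
    rw [hL v (by simp), hL w (by simp)] at hLvw
    rw [hL u (by simp)] at hc
    exact AH.tri L' u v w huv hvw huw hLuv hLvw hc
  | step H L u v w z s huw hvw hu hv hz huv huz hvz hLuv hsub hc hcz hs hdeg hrec ih =>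
    rw [hL u hu, hL v hv] at hLuv
    rw [hL u hu, hL z hz] at hsub
    rw [hL u hu] at hc
    rw [hL z hz] at hcz
    refine AH.step H L' u v w z s huw hvw hu hv hz huv huz hvz hLuv hsub hc hcz hs hdeg
      (ih fun a ha => ?_)
    by_cases haz : a = z
    · subst haz; simp [hL a hz, hL u hu]
    · simp [haz, hL a ha.1]
  | vert H L u w x y huw hu hx hy hux huy hxy hcu hLxy hcx hdeg hrec ih =>
    rw [hL u hu] at hcu
    rw [hL u hu, hL x hx, hL y hy] at hLxy
    rw [hL u hu, hL x hx] at hcx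
    refine AH.vert H L' u w x y huw hu hx hy hux huy hxy hcu hLxy hcx hdeg (ih fun a ha => ?_)
    by_cases hay : a = y
    · subst hay; simp [hL a hy, hL u hu]
    · by_cases hax : a = x
      · subst hax; simp [hay, hL a hx, hL u hu]
      · simp [hax, hay, hL a ha.1]

lemma AH.swap {H : Set V} {u v : V} (h : AH G H L (Sum.inr (u, v)) w) :
    AH G H L (Sum.inr (v, u)) w := by
  cases h with
  | tri _ _ _ _ huv hvw huw hLuv hLvw hc =>
    rw [show ({u, v, w} : Set V) = {v, u, w} from insert_comm _ _ _]
    exact AH.tri L v u w huv.symm huw hvw hLuv.symm (hLuv.trans hLvw) (hLuv ▸ hc)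
  | step _ _ _ _ _ z s huw hvw hu hv hz huv huz hvz hLuv hsub hc hcz hs hdeg hrec =>
    refine AH.step H L v u w z s hvw huw hv hu hz huv.symm hvz huz hLuv.symm (hLuv ▸ hsub)
      (hLuv ▸ hc) hcz ?_ hdeg.symm (hLuv ▸ hrec)
    rcases hs with h | h | h
    exacts [Or.inr (Or.inl h), Or.inl h, Or.inr (Or.inr (by rw [h, pair_comm]))]

lemma AH.memD {H : Set V} {u v : V} (h : AH G H L (Sum.inr (u, v)) w) : u ∈ H ∧ v ∈ H := by
  cases h with
  | tri => simp
  | step _ _ _ _ _ z s huw hvw hu hv => exact ⟨hu, hv⟩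

lemma AH.memV {H : Set V} {u : V} (h : AH G H L (Sum.inl u) w) : u ∈ H := by
  cases h with
  | vert _ _ _ _ x y huw hu => exact hu

/-- the exceptional instances contain a harmonica -/
def Harm (G : SimpleGraph V) (U B : Set V) (L : V → Finset ℕ) (x y w : V) (M : Finset ℕ) : Prop :=
  (M.card = 2 ∧ ∃ H ⊆ U ∩ B, AH G H L (Sum.inr (x, y)) w) ∨
  (M.card = 1 ∧ ∃ H ⊆ U ∩ B, AH G H L (Sum.inl x) w)

def HB (G : SimpleGraph V) (U : Set V) : Prop := ∀ B L x y w M, Inst G U B L x y w M →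
  ¬ Col G U L → Harm G U B L x y w M

structure Bad (G : SimpleGraph V) (U B : Set V) (L : V → Finset ℕ) (x y w : V) (M : Finset ℕ) :
    Prop where
  inst : Inst G U B L x y w M
  nc : ¬ Col G U L
  nh : ¬ Harm G U B L x y w M
  ih : ∀ U' ⊂ U, HB G U'

lemma Bad.swap (h : Bad G U B L x y w M) : Bad G U B L y x w M := by
  refine ⟨h.inst.swap, h.nc, fun hh => h.nh ?_, h.ih⟩
  rcases hh with ⟨h2, H, hH, hA⟩ | ⟨h1, H, hH, hA⟩
  · exact Or.inl ⟨h2, H, hH, hA.swap⟩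
  · rcases h.inst.hM with hM | ⟨_, rfl⟩
    · omega
    · exact Or.inr ⟨h1, H, hH, hA⟩

lemma Bad.remove {K : Set V} (h : Bad G U B L x y w M) (hK : K ⊆ U) (hne : K.Nonempty) (hwK : w ∉ K)
    (hx : x ∉ K) (hy : y ∉ K) : Col G (U \ K) L := by
  by_contra hc
  have hi := h.inst
  have hsub : U \ K ⊆ U := sdiff_subset
  have := h.ih (U \ K) ⟨hsub, fun hh => by
      obtain ⟨k, hk⟩ := hne
      exact (hh (hK hk)).2 hk⟩ B L x y w M
    ⟨hi.pl.mono sdiff_subset inter_subset_left, ⟨⟨hi.hx.1, hx⟩, hi.hx.2⟩, ⟨⟨hi.hy.1, hy⟩, hi.hy.2⟩,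
      hi.hxy, ⟨⟨hi.hw.1, hwK⟩, hi.hw.2⟩, hi.wx, hi.wy, hi.lx, hi.ly, hi.hM, hi.lw,
      hi.lst.mono' sdiff_subset (fun _ _ h => h) (fun _ _ h => h)
        (fun _ _ _ => Finset.Subset.refl _)⟩ hc
  refine h.nh ?_
  have hs : (U \ K) ∩ B ⊆ U ∩ B := inter_subset_inter_left _ hsub
  rcases this with ⟨h2, H, hH, hA⟩ | ⟨h1, H, hH, hA⟩
  exacts [Or.inl ⟨h2, H, hH.trans hs, hA⟩, Or.inr ⟨h1, H, hH.trans hs, hA⟩]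

lemma Bad.lstK {K : Set V} (h : Bad G U B L x y w M) (hK : K ⊆ U) (hwK : w ∉ K) (hx : x ∉ K)
    (hy : y ∉ K) : Lst K B ∅ L := h.inst.lst.mono' hK (fun _ _ h => h)
    (by rintro v hv (rfl | rfl | rfl) <;> exact absurd hv ‹_›) (fun _ _ _ => Finset.Subset.refl _)

lemma Bad.R1 {K : Set V} (h : Bad G U B L x y w M) {a b : V} (ha : a ∈ U ∩ B) (hb : b ∈ U ∩ B)
    (hab : a = b ∨ G.Adj a b) (hK : K ⊆ U \ {a, b}) (hcl : Clo G (U \ {a, b}) K)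
    (hne : K.Nonempty) (hwK : w ∉ K) (hx : x ∉ K) (hy : y ∉ K) : False := by
  obtain ⟨φ, hφ⟩ := h.remove (hK.trans sdiff_subset) hne hwK hx hy
  obtain ⟨φ', h', _⟩ := TP.split (thomassen _) h.inst.pl ha hb hab hK hcl hφ
    (h.lstK (hK.trans sdiff_subset) hwK hx hy)
  exact h.nc ⟨φ', h'⟩

lemma Bad.R2 {K : Set V} (h : Bad G U B L x y w M) {a b z : V} (ha : a ∈ U) (hb : b ∈ U)
    (hz : z ∈ U ∩ B) (hab : G.Adj a b) (haz : G.Adj a z) (hbz : G.Adj b z)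
    (hK : K ⊆ U \ {a, b, z}) (hcl : Clo G (U \ {a, b, z}) K)
    (hne : K.Nonempty) (hKB : Disjoint K B) : False := by
  have hi := h.inst
  have hwK : w ∉ K := fun hh => disjoint_left.1 hKB hh hi.hw.2
  have hxK : x ∉ K := fun hh => disjoint_left.1 hKB hh hi.hx.2
  have hyK : y ∉ K := fun hh => disjoint_left.1 hKB hh hi.hy.2
  obtain ⟨φ, hφ⟩ := h.remove (hK.trans sdiff_subset) hne hwK hxK hyK
  exact h.nc (hi.pl.tri ha hb hz hab haz hbz hK hcl hKB hφ
    (h.lstK (hK.trans sdiff_subset) hwK hxK hyK))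

lemma Bad.triComp {K : Set V} (h : Bad G U B L x y w M) {a b z : V} (ha : a ∈ U ∩ B)
    (hb : b ∈ U ∩ B) (hz : z ∈ U ∩ B) (hab : G.Adj a b) (haz : G.Adj a z) (hbz : G.Adj b z)
    (hK : K ⊆ U \ {a, b, z}) (hcl : Clo G (U \ {a, b, z}) K) (hc : Conn G K)
    (hwK : w ∉ K) (hx : x ∉ K) (hy : y ∉ K) : False := by
  have hi := h.inst
  have haK : a ∉ K := fun h => (hK h).2 (by simp)
  have hbK : b ∉ K := fun h => (hK h).2 (by simp)
  have hzK : z ∉ K := fun h => (hK h).2 (by simp)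
  by_cases hKB : Disjoint K B
  · exact h.R2 ha.1 hb.1 hz hab haz hbz hK hcl hc.1 hKB
  have key : ∀ c a' b', a' ∈ U ∩ B → b' ∈ U ∩ B → G.Adj a' b' →
      (∀ v, v = a ∨ v = b ∨ v = z → v = c ∨ v = a' ∨ v = b') → a' ∉ K → b' ∉ K →
      Tch G {c} K := by
    intro c a' b' ha' hb' hab' hv ha'K hb'K
    by_contra hn
    refine h.R1 ha' hb' (Or.inr hab') (K := K) (fun k hk => ⟨(hK hk).1, ?_⟩) ?_ hc.1 hwK hx hy
    · rintro (rfl | rfl)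
      exacts [ha'K hk, hb'K hk]
    · intro k hk v hvU hkv
      refine hcl k hk v ⟨hvU.1, fun hh => ?_⟩ hkv
      rcases hv v (by simpa using hh) with rfl | hh
      · exact hn ⟨v, rfl, k, hk, hkv.symm⟩
      · exact hvU.2 hh
  refine hi.pl.k5 {a} {b} {z} K ∅ (conn_singleton _) (conn_singleton _) (conn_singleton _) hc
    (reach_empty) (sub1 ha.1) (sub1 hb.1) (sub1 hz.1) (hK.trans sdiff_subset) (by simp)
    (by simpa using hab.ne) (by simpa using haz.ne) (dis1 haK)
    (by simpa using hbz.ne) (dis1 hbK) (dis1 hzK) (by simp) (by simp) (by simp) (by simp)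
    (tch1 hab) (tch1 haz)
    (key a b z hb hz hbz (by tauto) hbK hzK) (tch1 hbz) (key b a z ha hz haz (by tauto) haK hzK)
    (key z a b ha hb hab (by tauto) haK hbK)
    (Or.inl ⟨a, rfl, ha.2⟩) (Or.inl ⟨b, rfl, hb.2⟩) (Or.inl ⟨z, rfl, hz.2⟩)
    (Or.inl (not_disjoint_iff_nonempty_inter.1 hKB))

lemma Bad.dstep (h : Bad G U B L x y w M) (hM : M.card = 2) {z : V} (hz : z ∈ U ∩ B)
    (hxy : G.Adj x y) (hxz : G.Adj x z) (hyz : G.Adj y z) (hzw : z ≠ w) (hML : M ⊆ L z)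
    (hz3 : (L z).card = 3) (hN : ∀ v ∈ U, G.Adj x v → v = y ∨ v = z) : False := by
  have hi := h.inst
  have h1 : (L z \ M).card = 1 := by rw [Finset.card_sdiff_of_subset hML]; omega
  have hyz' := hyz.ne
  have hwz := hzw.symm
  have hwy := hi.wy
  have hUx : U \ {x} ⊆ U := sdiff_subset
  have hUxs : U \ {x} ⊂ U := ⟨hUx, fun hh => (hh hi.hx.1).2 rfl⟩
  have hyU : y ∈ (U \ {x}) ∩ B := ⟨⟨hi.hy.1, hxy.ne'⟩, hi.hy.2⟩
  have hzU : z ∈ (U \ {x}) ∩ B := ⟨⟨hz.1, hxz.ne'⟩, hz.2⟩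
  have hwU : w ∈ (U \ {x}) ∩ B := ⟨⟨hi.hw.1, hi.wx⟩, hi.hw.2⟩
  have hsB : (U \ {x}) ∩ B ⊆ U ∩ B := inter_subset_inter_left _ hUx
  set L' := Function.update (Function.update L y (L z)) z (L z \ M) with hL'
  have eL : ∀ v, v ≠ y → v ≠ z → L' v = L v := by
    intro v hvy hvz; simp [hL', hvy, hvz]
  have eLz : L' z = L z \ M := by simp [hL']
  have eLy : L' y = L z := by simp [hL', hyz']
  have hinst : Inst G (U \ {x}) B L' z z w (L z \ M) :=
    ⟨hi.pl.mono hUx inter_subset_left, hzU, hzU, Or.inl rfl, hwU, hwz, hwz, eLz, eLz,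
      Or.inr ⟨h1, rfl⟩, by rw [eL w hwy hwz]; exact hi.lw, by
        intro v hv hvS
        have hvz : v ≠ z := fun e => hvS (by simp [e])
        have hvw : v ≠ w := fun e => hvS (by simp [e])
        by_cases hvy : v = y
        · subst hvy
          rw [eLy]
          exact ⟨by omega, fun hh => absurd hi.hy.2 hh⟩
        · rw [eL v hvy hvz]
          exact hi.lst v hv.1 (by simp [hvy, hvw, show v ≠ x from hv.2])⟩
  have hnc : ¬ Col G (U \ {x}) L' := by
    rintro ⟨φ, hφ⟩
    have hφz : φ z ∈ L z \ M := eLz ▸ hφ.1 z hzU.1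
    have hφy : φ y ∈ L z := eLy ▸ hφ.1 y hyU.1
    have hne : φ y ≠ φ z := hφ.2 y hyU.1 z hzU.1 hyz
    have hφyM : φ y ∈ M := by
      by_contra hn
      obtain ⟨e, he⟩ := Finset.card_eq_one.1 h1
      have h2 : φ y ∈ L z \ M := Finset.mem_sdiff.2 ⟨hφy, hn⟩
      rw [he, Finset.mem_singleton] at h2 hφz
      exact hne (h2.trans hφz.symm)
    have hcol : IsCol G (U \ {x}) L φ := by
      refine ⟨fun v hv => ?_, hφ.2⟩
      by_cases hvy : v = y
      · rw [hvy, hi.ly]; exact hφyM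
      by_cases hvz : v = z
      · rw [hvz]; exact (Finset.mem_sdiff.1 hφz).1
      · rw [← eL v hvy hvz]; exact hφ.1 v hv
    obtain ⟨e, he, hey⟩ := exists_ne_of_two hM.ge (φ y)
    refine h.nc (Col.extend1 (v := x) (c := e) hcol (by rw [hi.lx]; exact he) ?_)
    intro a ha hax
    rcases hN a ha hax.symm with rfl | rfl
    · exact hey.symm
    · exact fun hh => (Finset.mem_sdiff.1 hφz).2 (hh ▸ he)
  rcases h.ih _ hUxs B L' z z w _ hinst hnc with ⟨h2, _⟩ | ⟨_, H, hH, hA⟩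
  · omega
  have hxH : x ∉ H := fun hh => (hH hh).1.2 rfl
  have hzH := hA.memV
  have hHU := hH.trans hsB
  refine h.nh (Or.inl ⟨hM, ?_⟩)
  have hLz : Function.update L z (L z \ L x) = Function.update L z (L z \ M) := by rw [hi.lx]
  by_cases hyH : y ∈ H
  · refine ⟨insert x H, insert_subset hi.hx hHU, AH.step _ L x y w z {x} hi.wx.symm hwy.symm
      (by simp) (by simp [hyH]) (by simp [hzH]) hxy hxz hyz (by rw [hi.lx, hi.ly])
      (by rw [hi.lx]; exact hML) (by rw [hi.lx]; exact hM) hz3 (Or.inl rfl)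
      (Or.inl fun a ha hxa => hN a (insert_subset hi.hx hHU ha).1 hxa) ?_⟩
    rw [insert_sdiff_self_of_notMem hxH, hLz]
    cases hA with
    | vert _ _ _ _ q r huw hu hq hr huq hur hqr hcu hLqr hcq hdeg hrec =>
      have e1 : (Function.update L z (L z \ M)) z = L z \ M := by simp
      have hM1 : M \ (L z \ M) = M := by
        rw [Finset.sdiff_eq_self_iff_disjoint]; exact Finset.disjoint_sdiff
      have hM2 : L z \ (L z \ M) = M := by
        exact Finset.sdiff_sdiff_eq_self hML
      have hgen : ∀ v, v ≠ z → (Function.update L z (L z \ M)) v \ (L z \ M) = L' v \ (L z \ M) := by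
        intro v hv
        rw [Function.update_of_ne hv]
        by_cases hvy : v = y
        · subst hvy; rw [eLy, hi.ly, hM1, hM2]
        · rw [eL v hvy hv]
      rw [eLz] at hcu hLqr hcq hrec
      have hqz := huq.ne'
      have hrz := hur.ne'
      refine AH.vert _ _ _ _ q r huw hu hq hr huq hur hqr (by rw [e1]; exact hcu)
        (by rw [e1, hgen q hqz, hgen r hrz]; exact hLqr) (by rw [e1, hgen q hqz]; exact hcq)
        hdeg (hrec.congr fun v hv => ?_)
      rw [e1]
      by_cases hvr : v = r
      · subst hvr; simp only [Function.update_self]; exact (hgen v hrz).symm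
      rw [Function.update_of_ne hvr, Function.update_of_ne hvr]
      by_cases hvq : v = q
      · subst hvq; simp only [Function.update_self]; exact (hgen v hqz).symm
      rw [Function.update_of_ne hvq, Function.update_of_ne hvq]
      have hvz : v ≠ z := hv.2
      rw [Function.update_of_ne hvz]
      refine eL v (fun e => ?_) hvz
      rcases hdeg y hyH hyz.symm with e' | e'
      exacts [hvq (e.trans e'), hvr (e.trans e')]
  · have hsub : insert x (insert y H) ⊆ U ∩ B := insert_subset hi.hx (insert_subset hi.hy hHU)
    refine ⟨insert x (insert y H), hsub, AH.step _ L x y w z {x, y} hi.wx.symm hwy.symm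
      (by simp) (by simp) (by simp [hzH]) hxy hxz hyz (by rw [hi.lx, hi.ly])
      (by rw [hi.lx]; exact hML) (by rw [hi.lx]; exact hM) hz3 (Or.inr (Or.inr rfl))
      (Or.inl fun a ha hxa => hN a (hsub ha).1 hxa) ?_⟩
    have hHe : (insert x (insert y H)) \ {x, y} = H := by
      ext v
      simp only [mem_sdiff, mem_insert_iff, mem_singleton_iff]
      constructor
      · rintro ⟨h1, h2⟩; tauto
      · intro hv
        exact ⟨Or.inr (Or.inr hv), by rintro (rfl | rfl); exacts [hxH hv, hyH hv]⟩
    rw [hHe, hLz]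
    refine hA.congr fun v hv => ?_
    by_cases hvz : v = z
    · subst hvz; rw [eLz]; simp
    · rw [Function.update_of_ne hvz]
      exact eL v (fun e => hyH (e ▸ hv)) hvz

lemma Bad.nbr (h : Bad G U B L x y w M) {a b z : V} (ha : a ∈ U ∩ B)
    (hb : b ∈ U ∩ B) (hz : z ∈ U ∩ B) (hab : G.Adj a b) (haz : G.Adj a z) (hbz : G.Adj b z)
    (hxa : x = a ∨ x = b) (hya : y = a ∨ y = b)
    {T : Set V} (hwT : w ∈ T) (hT : T ⊆ U \ {a, b, z}) (hcl : Clo G (U \ {a, b, z}) T)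
    (hc : Conn G T) (hn : ¬ Tch G {a} T) : ∀ v ∈ U, G.Adj a v → v = b ∨ v = z := by
  intro v hv hav
  by_contra hn'
  push Not at hn'
  have hvS : v ∈ U \ {a, b, z} := ⟨hv, by simp [hav.ne', hn'.1, hn'.2]⟩
  have hcs := comp_subset (G := G) (U \ {a, b, z}) v
  have hnK : ∀ t, t = a ∨ t = b → t ∉ comp G (U \ {a, b, z}) v := by
    intro t ht hh
    exact (hcs hh).2 (by rcases ht with rfl | rfl <;> simp)
  refine h.triComp ha hb hz hab haz hbz hcs (comp_clo _ _) (comp_conn hvS) ?_ (hnK x hxa) (hnK y hya)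
  intro hw
  have : comp G (U \ {a, b, z}) v ⊆ T := (comp_conn hvS).subset_of_clo hcs hcl ⟨w, hw, hwT⟩
  exact hn ⟨a, rfl, v, this (mem_comp hvS), hav⟩

lemma Bad.D (h : Bad G U B L x y w M) (hM : M.card = 2) : False := by
  have hi := h.inst
  have ht : Tight G U B L x y w M := by
    by_contra hn
    exact h.nc (nn_all U B L x y w M hi hn)
  rcases ht with ⟨h1, _⟩ | ⟨_, hne, z, hz, hxz, hyz, hor⟩
  · omega
  have hxy := hi.hxy.resolve_left hne
  rcases hor with ⟨hzw, hML, hz3⟩ | ⟨rfl, hLw⟩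
  swap
  · refine h.nh (Or.inl ⟨hM, {x, y, z}, ?_, AH.tri L x y z hxy hyz hxz (by rw [hi.lx, hi.ly])
      (by rw [hi.ly, hLw]) (by rw [hi.lx, hM])⟩)
    rintro v (rfl | rfl | rfl)
    exacts [hi.hx, hi.hy, hz]
  have hwS : w ∈ U \ {x, y, z} := ⟨hi.hw.1, by simp [hi.wx, hi.wy, hzw.symm]⟩
  set K := comp G (U \ {x, y, z}) w with hK
  have hKs : K ⊆ U \ {x, y, z} := comp_subset _ _
  have hcl : Clo G (U \ {x, y, z}) K := comp_clo _ _
  have hc : Conn G K := comp_conn hwS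
  have hwK : w ∈ K := mem_comp hwS
  have hxK : x ∉ K := fun h => (hKs h).2 (by simp)
  have hyK : y ∉ K := fun h => (hKs h).2 (by simp)
  have hzK : z ∉ K := fun h => (hKs h).2 (by simp)
  by_cases tx : Tch G {x} K
  swap
  · exact h.dstep hM hz hxy hxz hyz hzw hML hz3 (h.nbr hi.hx hi.hy hz hxy hxz hyz (Or.inl rfl)
      (Or.inr rfl) hwK hKs hcl hc tx)
  by_cases ty : Tch G {y} K
  swap
  · refine h.swap.dstep hM hz hxy.symm hyz hxz hzw hML hz3 (h.nbr hi.hy hi.hx hz hxy.symm hyz hxz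
      (Or.inr rfl) (Or.inl rfl) hwK ?_ ?_ hc ty)
    · rw [insert_comm]; exact hKs
    · rw [insert_comm]; exact hcl
  by_cases tz : Tch G {z} K
  · exact hi.pl.k5 {x} {y} {z} K ∅ (conn_singleton _) (conn_singleton _) (conn_singleton _) hc
      (reach_empty) (sub1 hi.hx.1) (sub1 hi.hy.1) (sub1 hz.1) (hKs.trans sdiff_subset) (by simp)
      (by simpa using hxy.ne) (by simpa using hxz.ne) (dis1 hxK)
      (by simpa using hyz.ne) (dis1 hyK) (dis1 hzK) (by simp) (by simp) (by simp) (by simp)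
      (tch1 hxy) (tch1 hxz) tx (tch1 hyz) ty tz
      (Or.inl ⟨x, rfl, hi.hx.2⟩) (Or.inl ⟨y, rfl, hi.hy.2⟩) (Or.inl ⟨z, rfl, hz.2⟩)
      (Or.inl ⟨w, hwK, hi.hw.2⟩)
  · have hK2 : K ⊆ U \ {x, y} := fun k hk => ⟨(hKs hk).1, fun hh => (hKs hk).2 (by
      rcases hh with hh | hh
      · exact Or.inl hh
      · exact Or.inr (Or.inl hh))⟩
    have hcl2 : Clo G (U \ {x, y}) K := by
      intro k hk v hv hkv
      refine hcl k hk v ⟨hv.1, ?_⟩ hkv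
      rintro (e | e | e)
      · exact hv.2 (Or.inl e)
      · exact hv.2 (Or.inr e)
      · exact tz ⟨z, rfl, k, hk, (show v = z from e) ▸ hkv.symm⟩
    exact h.R1 hi.hx hi.hy (Or.inr hxy) (K := (U \ {x, y}) \ K) sdiff_subset
      (hcl2.compl hK2) ⟨z, ⟨hz.1, by simp [hxz.ne', hyz.ne']⟩, hzK⟩
      (fun hh => hh.2 hwK) (fun hh => hh.1.2 (by simp)) (fun hh => hh.1.2 (by simp))

lemma Bad.caseV {p : V} (h : Bad G U B L p p w M) (hM : M.card = 1) : False := by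
  have hi := h.inst
  have ht : Tight G U B L p p w M := by
    by_contra hn
    exact h.nc (nn_all U B L p p w M hi hn)
  rcases ht with ⟨_, q, hq, r, hr, hqw, hrw, pq, pr, qr, he, hc2, ⟨T, hT, hpT, hwT, hTcl⟩, _⟩ | ⟨h2, _⟩
  swap
  · omega
  have hN : ∀ v ∈ U, G.Adj p v → v = q ∨ v = r := by
    intro v hv pv
    by_contra hn
    push Not at hn
    have hvS : v ∈ U \ {p, q, r} := ⟨hv, by simp [pv.ne', hn.1, hn.2]⟩
    have hcs := comp_subset (G := G) (U \ {p, q, r}) v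
    have hpK : p ∉ comp G (U \ {p, q, r}) v := fun hh => (hcs hh).2 (by simp)
    refine h.triComp hi.hx hq hr pq pr qr hcs (comp_clo _ _) (comp_conn hvS) ?_ hpK hpK
    intro hw
    have hvT : v ∈ T := hTcl p hpT v ⟨hv, by simp [hn.1, hn.2]⟩ pv
    refine hwT ((comp_conn hvS).subset_of_clo (A := T ∩ (U \ {p, q, r})) hcs ?_
      ⟨v, mem_comp hvS, hvT, hvS⟩ hw).1
    intro a ha b hb hab
    refine ⟨hTcl a ha.1 b ⟨hb.1, fun hh => hb.2 (Or.inr hh)⟩ hab, hb⟩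
  have hUp : U \ {p} ⊆ U := sdiff_subset
  have hUps : U \ {p} ⊂ U := ⟨hUp, fun hh => (hh hi.hx.1).2 rfl⟩
  have hsB : (U \ {p}) ∩ B ⊆ U ∩ B := inter_subset_inter_left _ hUp
  set L' := Function.update (Function.update L q (L q \ L p)) r (L r \ L p) with hL'
  have hqr := qr.ne
  rw [← hi.lx] at he hc2
  have e0 : ∀ v, v ≠ q → v ≠ r → L' v = L v := by intro v h1 h2; simp [hL', h1, h2]
  have eq : L' q = L q \ L p := by simp [hL', hqr]
  have er : L' r = L q \ L p := by simp [hL', he]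
  have hinst : Inst G (U \ {p}) B L' q r w (L q \ L p) :=
    ⟨hi.pl.mono hUp inter_subset_left, ⟨⟨hq.1, pq.ne'⟩, hq.2⟩, ⟨⟨hr.1, pr.ne'⟩, hr.2⟩, Or.inr qr,
      ⟨⟨hi.hw.1, hi.wx⟩, hi.hw.2⟩, hqw.symm, hrw.symm, eq, er, Or.inl hc2,
      by rw [e0 w hqw.symm hrw.symm]; exact hi.lw, by
        intro v hv hvS
        simp only [mem_insert_iff, mem_singleton_iff, not_or] at hvS
        rw [e0 v hvS.1 hvS.2.1]
        exact hi.lst v hv.1 (by simp [hvS.2.2, show v ≠ p from hv.2])⟩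
  have hnc : ¬ Col G (U \ {p}) L' := by
    rintro ⟨φ, hφ⟩
    obtain ⟨c, hc⟩ := Finset.card_eq_one.1 (hi.lx ▸ hM : (L p).card = 1)
    refine h.nc (Col.extend1 (v := p) (c := c) (φ := φ) (hφ.mono subset_rfl fun v hv => ?_)
      (by rw [hc]; simp) ?_)
    · by_cases h1 : v = q
      · rw [h1, eq]; exact Finset.sdiff_subset
      by_cases h2 : v = r
      · rw [h2, er, he]; exact Finset.sdiff_subset
      · rw [e0 v h1 h2]
    · intro a ha hap
      have hmem := hφ.1 a ⟨ha, hap.ne⟩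
      have : φ a ∉ L p := by
        rcases hN a ha hap.symm with h1 | h1
        · rw [h1, eq] at hmem; rw [h1]; exact (Finset.mem_sdiff.1 hmem).2
        · rw [h1, er] at hmem; rw [h1]; exact (Finset.mem_sdiff.1 hmem).2
      rw [hc] at this
      simpa using this
  rcases h.ih _ hUps B L' q r w _ hinst hnc with ⟨_, H, hH, hA⟩ | ⟨h1, _⟩
  swap
  · omega
  have hpH : p ∉ H := fun hh => (hH hh).1.2 rfl
  have hsub : insert p H ⊆ U ∩ B := insert_subset hi.hx (hH.trans hsB)
  refine h.nh (Or.inr ⟨hM, insert p H, hsub, AH.vert _ L p w q r hi.wx.symm (by simp)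
    (by simp [hA.memD.1]) (by simp [hA.memD.2]) pq pr qr (hi.lx ▸ hM) he hc2
    (fun a ha hpa => hN a (hsub ha).1 hpa) ?_⟩)
  rw [insert_sdiff_self_of_notMem hpH]
  exact hA

theorem hb_all (U : Set V) : HB G U := by
  induction hn : U.ncard using Nat.strong_induction_on generalizing U with
  | _ n ih =>
    intro B L x y w M hi hc
    by_contra hh
    have hbad : Bad G U B L x y w M := ⟨hi, hc, hh, fun U' hU' =>
      ih _ (hn ▸ Set.ncard_lt_ncard hU' (Set.toFinite U)) U' rfl⟩
    rcases hi.hM with h2 | ⟨h1, rfl⟩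
    · exact hbad.D h2
    · exact hbad.caseV h1

end HC

namespace HC

/-! ### Continuous logarithms -/

lemma exists_log {X : Type*} [TopologicalSpace X] [SimplyConnectedSpace X]
    [LocallyPathConnectedSpace X] (f : X → ℂ) (hf : Continuous f) (h0 : ∀ x, f x ≠ 0) :
    ∃ g : X → ℂ, Continuous g ∧ ∀ x, Complex.exp (g x) = f x := by
  obtain ⟨a⟩ : Nonempty X := inferInstance
  obtain ⟨F, ⟨_, hF⟩, _⟩ := Complex.isCoveringMapOn_exp.existsUnique_continuousMap_lifts
    (⟨f, hf⟩ : C(X, ℂ)) (a₀ := a) (e₀ := Complex.log (f a)) (by simp [Complex.exp_log (h0 a)])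
    (by simpa using h0)
  exact ⟨F, F.continuous, fun x => congrFun hF x⟩

lemma log_const {X : Type*} [TopologicalSpace X] {S : Set X} (hS : IsPreconnected S)
    {g : X → ℂ} (hg : ContinuousOn g S) (h1 : ∀ x ∈ S, Complex.exp (g x) = 1) {x y : X}
    (hx : x ∈ S) (hy : y ∈ S) : g x = g y := by
  have key : ∀ x ∈ S, ∃ n : ℤ, g x = n * (2 * Real.pi * Complex.I) := fun x hx =>
    Complex.exp_eq_one_iff.1 (h1 x hx)
  let h : X → ℝ := fun x => (g x).im / (2 * Real.pi)
  have hh : ContinuousOn h S := (Complex.continuous_im.comp_continuousOn hg).div_const _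
  have hn : ∀ x n, g x = (n : ℤ) * (2 * Real.pi * Complex.I) → h x = n := by
    intro x n hx
    have := Real.pi_ne_zero
    simp only [h, hx]
    simp
  have aux : ∀ x y, x ∈ S → y ∈ S → ∀ n m : ℤ, g x = n * (2 * Real.pi * Complex.I) →
      g y = m * (2 * Real.pi * Complex.I) → ¬ n < m := by
    intro x y hx hy n m hgx hgy hlt
    have hlt' : (n : ℝ) + 1 ≤ m := by exact_mod_cast hlt
    obtain ⟨z, hz, hzz⟩ := hS.intermediate_value hx hy hh
      (show (n : ℝ) + 1 / 2 ∈ Icc (h x) (h y) by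
        rw [hn x n hgx, hn y m hgy]; constructor <;> linarith)
    obtain ⟨k, hk⟩ := key z hz
    rw [hn z k hk] at hzz
    have h2 : (2 * k : ℝ) = 2 * n + 1 := by linarith
    have : (2 * k : ℤ) = 2 * n + 1 := by exact_mod_cast h2
    omega
  obtain ⟨n, hgn⟩ := key x hx
  obtain ⟨m, hgm⟩ := key y hy
  have : n = m := le_antisymm (not_lt.1 (aux y x hy hx m n hgm hgn))
    (not_lt.1 (aux x y hx hy n m hgn hgm))
  rw [hgn, hgm, this]

/-- change of a logarithm does not depend on the logarithm -/
lemma log_change {X : Type*} [TopologicalSpace X] {S : Set X} (hS : IsPreconnected S)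
    {g g' : X → ℂ} (hg : ContinuousOn g S) (hg' : ContinuousOn g' S)
    {c : ℂ} (h1 : ∀ x ∈ S, Complex.exp (g x) = c * Complex.exp (g' x)) {x y : X}
    (hx : x ∈ S) (hy : y ∈ S) : g y - g x = g' y - g' x := by
  have hc : c ≠ 0 := by
    rintro rfl
    have := h1 x hx
    simp [Complex.exp_ne_zero] at this
  have := log_const hS (g := fun x => g x - g' x - Complex.log c)
    ((hg.sub hg').sub continuousOn_const) (fun x hx => by
      rw [Complex.exp_sub, Complex.exp_sub, Complex.exp_log hc, h1 x hx]
      field_simp [Complex.exp_ne_zero]) hx hy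
  linear_combination -this

/-- the plane as the complex numbers -/
noncomputable def toC (z : ℝ × ℝ) : ℂ := ⟨z.1, z.2⟩

lemma toC_eq : toC = Complex.equivRealProdCLM.symm := by
  funext z; exact Complex.ext (by simp [toC]) (by simp [toC])

lemma toC_cont : Continuous toC := by rw [toC_eq]; exact Complex.equivRealProdCLM.symm.continuous

lemma toC_inj {z w : ℝ × ℝ} (h : toC z = toC w) : z = w := by
  rw [toC_eq] at h; exact Complex.equivRealProdCLM.symm.injective h

lemma toC_sub_ne {z w : ℝ × ℝ} (h : z ≠ w) : toC z - toC w ≠ 0 :=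
  sub_ne_zero.2 fun hh => h (toC_inj hh)

/-! ### The deleted product obstruction -/

/-- winding relation for two disjoint paths -/
lemma square_rel {γ δ : ℝ → ℝ × ℝ} (hγ : Continuous γ) (hδ : Continuous δ)
    (hd : ∀ s t, γ s ≠ δ t) {a0 a1 b0 b1 : ℝ → ℂ}
    (ha0 : Continuous a0) (ha1 : Continuous a1) (hb0 : Continuous b0) (hb1 : Continuous b1)
    (ea0 : ∀ s, Complex.exp (a0 s) = toC (γ s) - toC (δ 0))
    (ea1 : ∀ s, Complex.exp (a1 s) = toC (γ s) - toC (δ 1))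
    (eb0 : ∀ s, Complex.exp (b0 s) = toC (δ s) - toC (γ 0))
    (eb1 : ∀ s, Complex.exp (b1 s) = toC (δ s) - toC (γ 1)) :
    (a0 1 - a0 0) + (b1 1 - b1 0) - (a1 1 - a1 0) - (b0 1 - b0 0) = 0 := by
  obtain ⟨g, hg, eg⟩ := exists_log (fun p : ℝ × ℝ => toC (γ p.1) - toC (δ p.2))
    ((toC_cont.comp (hγ.comp continuous_fst)).sub (toC_cont.comp (hδ.comp continuous_snd)))
    (fun p => toC_sub_ne (hd _ _))
  have h1 := log_change (S := univ) isPreconnected_univ (g := fun s : ℝ => g (s, 0)) (g' := a0)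
    (c := 1) (by fun_prop) ha0.continuousOn (fun s _ => by rw [eg, ea0]; ring) (mem_univ 0) (mem_univ 1)
  have h2 := log_change (S := univ) isPreconnected_univ (g := fun s : ℝ => g (s, 1)) (g' := a1)
    (c := 1) (by fun_prop) ha1.continuousOn (fun s _ => by rw [eg, ea1]; ring) (mem_univ 0) (mem_univ 1)
  have h3 := log_change (S := univ) isPreconnected_univ (g := fun s : ℝ => g (0, s)) (g' := b0)
    (c := -1) (by fun_prop) hb0.continuousOn (fun s _ => by rw [eg, eb0]; ring) (mem_univ 0) (mem_univ 1)
  have h4 := log_change (S := univ) isPreconnected_univ (g := fun s : ℝ => g (1, s)) (g' := b1)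
    (c := -1) (by fun_prop) hb1.continuousOn (fun s _ => by rw [eg, eb1]; ring) (mem_univ 0) (mem_univ 1)
  linear_combination -h1 + h2 + h3 - h4

/-- Combinatorial form of the winding relations: `N` points, paths between pairs `i < j` in `A`. -/
lemma wind {N : ℕ} (P : Fin N → ℝ × ℝ) (hP : ∀ i j, i ≠ j → P i ≠ P j)
    (A : Fin N → Fin N → Prop) (γ : Fin N → Fin N → ℝ → ℝ × ℝ)
    (hγ : ∀ i j, A i j → Continuous (γ i j) ∧ γ i j 0 = P i ∧ γ i j 1 = P j)
    (hd : ∀ i j k l, A i j → A k l → i ≠ k → i ≠ l → j ≠ k → j ≠ l → ∀ s t, γ i j s ≠ γ k l t)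
    (hn : ∀ i j v, A i j → i ≠ v → j ≠ v → ∀ s, γ i j s ≠ P v) :
    ∃ n : Fin N → Fin N → Fin N → ℤ, ∀ i j k l, A i j → A k l → i ≠ j → k ≠ l →
      i ≠ k → i ≠ l → j ≠ k → j ≠ l →
      2 * (n k i j - n l i j + n j k l - n i k l) =
        ((if k < j then 1 else 0) - (if j < k then 1 else 0))
        + ((if i < k then 1 else 0) - (if k < i then 1 else 0))
        + ((if j < l then 1 else 0) - (if l < j then 1 else 0))
        + ((if l < i then 1 else 0) - (if i < l then (1 : ℤ) else 0)) := by
  classical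
  let Θ : Fin N → Fin N → ℂ := fun u v => if u < v then Complex.log (toC (P v) - toC (P u))
    else Complex.log (toC (P u) - toC (P v)) + Real.pi * Complex.I
  have hΘ : ∀ u v, u ≠ v → Complex.exp (Θ u v) = toC (P v) - toC (P u) := by
    intro u v huv
    simp only [Θ]
    split_ifs
    · rw [Complex.exp_log (toC_sub_ne (hP _ _ huv.symm))]
    · rw [Complex.exp_add, Complex.exp_log (toC_sub_ne (hP _ _ huv)), Complex.exp_pi_mul_I]
      ring
  have hσ : ∀ u v, u ≠ v → Θ u v - Θ v u =
      (Real.pi * Complex.I) * (((if v < u then 1 else 0) - (if u < v then 1 else 0) : ℤ) : ℂ) := by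
    intro u v huv
    rcases lt_or_gt_of_ne huv with h | h
    · simp [Θ, h, h.not_gt]
    · simp [Θ, h, h.not_gt]
  have key : ∀ v i j, ∃ n : ℤ, A i j → i ≠ v → j ≠ v → ∃ a : ℝ → ℂ, Continuous a ∧
      (∀ s, Complex.exp (a s) = toC (γ i j s) - toC (P v)) ∧
      a 1 - a 0 = Θ v j - Θ v i + n * (2 * Real.pi * Complex.I) := by
    intro v i j
    by_cases h : A i j ∧ i ≠ v ∧ j ≠ v
    · obtain ⟨a, ha, ea⟩ := exists_log (fun s : ℝ => toC (γ i j s) - toC (P v))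
        ((toC_cont.comp (hγ i j h.1).1).sub continuous_const)
        (fun s => toC_sub_ne (hn i j v h.1 h.2.1 h.2.2 s))
      have e : Complex.exp (a 1 - a 0) = Complex.exp (Θ v j - Θ v i) := by
        rw [Complex.exp_sub, Complex.exp_sub, ea, ea, hΘ _ _ h.2.1.symm, hΘ _ _ h.2.2.symm,
          (hγ i j h.1).2.1, (hγ i j h.1).2.2]
      obtain ⟨n, hn⟩ := Complex.exp_eq_exp_iff_exists_int.1 e
      exact ⟨n, fun _ _ _ => ⟨a, ha, ea, hn⟩⟩
    · exact ⟨0, fun h1 h2 h3 => absurd ⟨h1, h2, h3⟩ h⟩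
  choose n hnn using key
  refine ⟨n, fun i j k l hij hkl nij nkl nik nil njk njl => ?_⟩
  obtain ⟨a0, ca0, ea0, da0⟩ := hnn k i j hij nik njk
  obtain ⟨a1, ca1, ea1, da1⟩ := hnn l i j hij nil njl
  obtain ⟨b0, cb0, eb0, db0⟩ := hnn i k l hkl nik.symm nil.symm
  obtain ⟨b1, cb1, eb1, db1⟩ := hnn j k l hkl njk.symm njl.symm
  obtain ⟨c1, s1, t1⟩ := hγ i j hij
  obtain ⟨c2, s2, t2⟩ := hγ k l hkl
  have := square_rel c1 c2 (hd i j k l hij hkl nik nil njk njl) ca0 ca1 cb0 cb1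
    (by rw [s2]; exact ea0) (by rw [t2]; exact ea1) (by rw [s1]; exact eb0) (by rw [t1]; exact eb1)
  have hpi : (Real.pi * Complex.I : ℂ) ≠ 0 :=
    mul_ne_zero (by exact_mod_cast Real.pi_ne_zero) Complex.I_ne_zero
  have fin : (Real.pi * Complex.I : ℂ) * ((2 * (n k i j - n l i j + n j k l - n i k l) : ℤ) : ℂ) =
      (Real.pi * Complex.I : ℂ) * ((((if k < j then 1 else 0) - (if j < k then 1 else 0))
        + ((if i < k then 1 else 0) - (if k < i then 1 else 0))
        + ((if j < l then 1 else 0) - (if l < j then 1 else 0))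
        + ((if l < i then 1 else 0) - (if i < l then (1 : ℤ) else 0)) : ℤ) : ℂ) := by
    have e1 := hσ j k njk
    have e2 := hσ k i nik.symm
    have e3 := hσ l j njl.symm
    have e4 := hσ i l nil
    push_cast at e1 e2 e3 e4 ⊢
    linear_combination this - da0 - db1 + da1 + db0 + e1 + e2 + e3 + e4
  exact_mod_cast mul_left_cancel₀ hpi fin

lemma no_K5 (P : Fin 5 → ℝ × ℝ) (hP : ∀ i j, i ≠ j → P i ≠ P j)
    (γ : Fin 5 → Fin 5 → ℝ → ℝ × ℝ)
    (hγ : ∀ i j, i < j → Continuous (γ i j) ∧ γ i j 0 = P i ∧ γ i j 1 = P j)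
    (hd : ∀ i j k l, i < j → k < l → i ≠ k → i ≠ l → j ≠ k → j ≠ l → ∀ s t, γ i j s ≠ γ k l t)
    (hn : ∀ i j v, i < j → i ≠ v → j ≠ v → ∀ s, γ i j s ≠ P v) : False := by
  obtain ⟨n, h⟩ := wind P hP (fun i j => i < j) γ hγ hd hn
  have g : ∀ i j k l : Fin 5, (_ : i < j ∧ k < l ∧ i ≠ k ∧ i ≠ l ∧ j ≠ k ∧ j ≠ l := by decide) → _ :=
    fun i j k l e => h i j k l e.1 e.2.1 e.1.ne e.2.1.ne e.2.2.1 e.2.2.2.1 e.2.2.2.2.1 e.2.2.2.2.2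
  have e1 := g 0 1 2 3
  have e2 := g 0 1 2 4
  have e3 := g 0 1 3 4
  have e4 := g 0 2 1 3
  have e5 := g 0 2 1 4
  have e6 := g 0 2 3 4
  have e7 := g 0 3 1 2
  have e8 := g 0 3 1 4
  have e9 := g 0 3 2 4
  have e10 := g 0 4 1 2
  have e11 := g 0 4 1 3
  have e12 := g 0 4 2 3
  have e13 := g 1 2 3 4
  have e14 := g 1 3 2 4
  have e15 := g 1 4 2 3
  simp (decide := true) only [if_true, if_false] at e1 e2 e3 e4 e5 e6 e7 e8 e9 e10 e11 e12 e13 e14 e15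
  clear g h hn hd hγ hP
  omega

lemma no_K33 (P : Fin 6 → ℝ × ℝ) (hP : ∀ i j, i ≠ j → P i ≠ P j)
    (γ : Fin 6 → Fin 6 → ℝ → ℝ × ℝ)
    (hγ : ∀ i j, i < 3 ∧ 3 ≤ j → Continuous (γ i j) ∧ γ i j 0 = P i ∧ γ i j 1 = P j)
    (hd : ∀ i j k l, i < 3 ∧ 3 ≤ j → k < 3 ∧ 3 ≤ l → i ≠ k → i ≠ l → j ≠ k → j ≠ l →
      ∀ s t, γ i j s ≠ γ k l t)
    (hn : ∀ i j v, i < 3 ∧ 3 ≤ j → i ≠ v → j ≠ v → ∀ s, γ i j s ≠ P v) : False := by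
  obtain ⟨n, h⟩ := wind P hP (fun i j => i < 3 ∧ 3 ≤ j) γ hγ hd hn
  have g : ∀ i j k l : Fin 6, (_ : (i < 3 ∧ 3 ≤ j) ∧ (k < 3 ∧ 3 ≤ l) ∧ i ≠ j ∧ k ≠ l ∧ i ≠ k ∧ i ≠ l ∧
      j ≠ k ∧ j ≠ l := by decide) → _ :=
    fun i j k l e => h i j k l e.1 e.2.1 e.2.2.1 e.2.2.2.1 e.2.2.2.2.1 e.2.2.2.2.2.1
      e.2.2.2.2.2.2.1 e.2.2.2.2.2.2.2
  have e1 := g 0 3 1 4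
  have e2 := g 0 3 1 5
  have e3 := g 0 4 1 3
  have e4 := g 0 4 1 5
  have e5 := g 0 5 1 3
  have e6 := g 0 5 1 4
  have e7 := g 0 3 2 4
  have e8 := g 0 3 2 5
  have e9 := g 0 4 2 3
  have e10 := g 0 4 2 5
  have e11 := g 0 5 2 3
  have e12 := g 0 5 2 4
  have e13 := g 1 3 2 4
  have e14 := g 1 3 2 5
  have e15 := g 1 4 2 3
  have e16 := g 1 4 2 5
  have e17 := g 1 5 2 3
  have e18 := g 1 5 2 4
  simp (decide := true) only [if_true, if_false] at e1 e2 e3 e4 e5 e6 e7 e8 e9 e10 e11 e12 e13 e14 e15 e16 e17 e18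
  clear g h hn hd hγ hP
  omega

end HC

namespace HC

/-! ### The unbounded component of the complement of a compact set -/

def Out (K : Set (ℝ × ℝ)) : Set (ℝ × ℝ) :=
  {p | p ∉ K ∧ ¬Bornology.IsBounded (connectedComponentIn Kᶜ p)}

lemma far_conn (R : ℝ) : IsPreconnected {p : ℝ × ℝ | R < |p.1| ∨ R < |p.2|} := by
  have hc1 : IsPreconnected {p : ℝ × ℝ | R < p.1} :=
    (convex_halfSpace_gt (IsLinearMap.mk (fun _ _ => rfl) (fun _ _ => rfl)) R).isPreconnected
  have hc2 : IsPreconnected {p : ℝ × ℝ | R < p.2} :=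
    (convex_halfSpace_gt (IsLinearMap.mk (fun _ _ => rfl) (fun _ _ => rfl)) R).isPreconnected
  have hc3 : IsPreconnected {p : ℝ × ℝ | p.1 < -R} :=
    (convex_halfSpace_lt (IsLinearMap.mk (fun _ _ => rfl) (fun _ _ => rfl)) (-R)).isPreconnected
  have hc4 : IsPreconnected {p : ℝ × ℝ | p.2 < -R} :=
    (convex_halfSpace_lt (IsLinearMap.mk (fun _ _ => rfl) (fun _ _ => rfl)) (-R)).isPreconnected
  have h12 := hc1.union ((R + 1, R + 1) : ℝ × ℝ) (by simp) (by simp) hc2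
  have h123 := h12.union ((-R - 1, R + 1) : ℝ × ℝ) (by right; simp) (by simp) hc3
  have h1234 := h123.union ((-R - 1, -R - 1) : ℝ × ℝ) (by right; simp) (by simp) hc4
  convert h1234 using 1
  ext p
  simp only [mem_setOf_eq, mem_union, lt_abs]
  constructor
  · rintro ((h | h) | (h | h))
    · exact Or.inl (Or.inl (Or.inl h))
    · exact Or.inl (Or.inr (by linarith))
    · exact Or.inl (Or.inl (Or.inr h))
    · exact Or.inr (by linarith)
  · rintro (((h | h) | h) | h)
    · exact Or.inl (Or.inl h)
    · exact Or.inr (Or.inl h)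
    · exact Or.inl (Or.inr (by linarith))
    · exact Or.inr (Or.inr (by linarith))

variable {K K' : Set (ℝ × ℝ)}

lemma exists_far (hK : IsCompact K) : ∃ R : ℝ, ∀ p ∈ K, |p.1| ≤ R ∧ |p.2| ≤ R := by
  obtain ⟨R, hR⟩ := hK.isBounded.exists_norm_le
  refine ⟨R, fun p hp => ?_⟩
  have := hR p hp
  rw [Prod.norm_def, max_le_iff] at this
  exact this

lemma far_unbounded (R : ℝ) (S : Set (ℝ × ℝ)) (h : {p : ℝ × ℝ | R < |p.1| ∨ R < |p.2|} ⊆ S) :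
    ¬ Bornology.IsBounded S := by
  intro hb
  obtain ⟨r, hr⟩ := hb.exists_norm_le
  have := hr (|R| + |r| + 1, 0) (h (by
    left
    have := abs_nonneg r
    have h1 := le_abs_self R
    have h2 := le_abs_self (|R| + |r| + 1)
    simp only
    linarith))
  rw [Prod.norm_def] at this
  have h2 := (le_max_left _ _).trans this
  simp only [Real.norm_eq_abs] at h2
  have h3 := le_abs_self (|R| + |r| + 1)
  have h4 := le_abs_self r
  have h5 := abs_nonneg R
  linarith

/-- there is a far set contained in `Out K`, and `Out K` is one component -/
lemma out_eq (hK : IsCompact K) {R : ℝ} (hR : ∀ p ∈ K, |p.1| ≤ R ∧ |p.2| ≤ R) {o : ℝ × ℝ}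
    (ho : R < |o.1| ∨ R < |o.2|) : Out K = connectedComponentIn Kᶜ o := by
  have hfar : {p : ℝ × ℝ | R < |p.1| ∨ R < |p.2|} ⊆ Kᶜ := by
    intro p hp hpK
    have := hR p hpK
    rcases hp with hp | hp <;> linarith
  have hsub := (far_conn R).subset_connectedComponentIn (F := Kᶜ) (x := o) ho hfar
  ext p
  constructor
  · rintro ⟨hp, hb⟩
    by_contra hn
    refine hb ((Metric.isBounded_closedBall (x := (0 : ℝ × ℝ)) (r := R)).subset ?_)
    intro q hq
    rw [mem_closedBall_zero_iff, Prod.norm_def, max_le_iff]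
    by_contra hq'
    have hqo : q ∈ connectedComponentIn Kᶜ o := by
      refine hsub ?_
      simp only [mem_setOf_eq]
      by_contra h
      push Not at h
      exact hq' h
    have e1 := connectedComponentIn_eq hq
    have e2 := connectedComponentIn_eq hqo
    rw [e2, ← e1] at hn
    exact hn (mem_connectedComponentIn hp)
  · intro hp
    refine ⟨connectedComponentIn_subset _ _ hp, ?_⟩
    rw [← connectedComponentIn_eq hp]
    exact far_unbounded R _ hsub

lemma out_open (hK : IsCompact K) : IsOpen (Out K) := by
  obtain ⟨R, hR⟩ := exists_far hK
  rw [out_eq hK hR (o := (|R| + 1, 0)) (by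
    left; simp only; have := le_abs_self R; have := le_abs_self (|R| + 1); linarith)]
  exact hK.isClosed.isOpen_compl.connectedComponentIn

lemma out_conn (hK : IsCompact K) : IsConnected (Out K) := by
  obtain ⟨R, hR⟩ := exists_far hK
  have ho : R < |((|R| + 1, 0) : ℝ × ℝ).1| ∨ R < |((|R| + 1, 0) : ℝ × ℝ).2| := by
    left; simp only; have := le_abs_self R; have := le_abs_self (|R| + 1); linarith
  rw [out_eq hK hR ho]
  refine isConnected_connectedComponentIn_iff.2 fun h => ?_
  have := hR _ h
  rcases ho with ho | ho <;> linarith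

lemma out_pathConn (hK : IsCompact K) : IsPathConnected (Out K) :=
  (out_open hK).isConnected_iff_isPathConnected.1 (out_conn hK)

/-- a connected set avoiding `K` and meeting `Out K` is in `Out K` -/
lemma out_subset {S : Set (ℝ × ℝ)} (hS : IsPreconnected S) (hSK : Disjoint S K) {p : ℝ × ℝ}
    (hp : p ∈ S) (hpo : p ∈ Out K) : S ⊆ Out K := by
  intro q hq
  refine ⟨disjoint_left.1 hSK hq, ?_⟩
  have h1 : S ⊆ connectedComponentIn Kᶜ p :=
    hS.subset_connectedComponentIn hp (disjoint_left.1 hSK)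
  rw [← connectedComponentIn_eq (h1 hq)]
  exact hpo.2

lemma out_anti (hKK : K ⊆ K') : Out K' ⊆ Out K := by
  rintro p ⟨hp, hb⟩
  exact ⟨fun h => hp (hKK h), fun h => hb (h.subset
    (connectedComponentIn_mono _ (compl_subset_compl.2 hKK)))⟩

lemma out_closure (hK : IsCompact K) {p : ℝ × ℝ} (hp : p ∈ closure (Out K)) (hpK : p ∉ K) :
    p ∈ Out K := by
  obtain ⟨ε, hε, hb⟩ := Metric.isOpen_iff.1 hK.isClosed.isOpen_compl p hpK
  obtain ⟨q, hq, hd⟩ := Metric.mem_closure_iff.1 hp ε hε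
  exact out_subset (Metric.isPreconnected_ball (x := p) (r := ε))
    (disjoint_left.2 fun x hx => hb hx) (p := q) (by rwa [Metric.mem_ball, dist_comm]) hq
    (Metric.mem_ball_self hε)

lemma out_frontier (hK : IsCompact K) {p : ℝ × ℝ} : p ∈ frontier (Out K) ↔
    p ∈ K ∧ p ∈ closure (Out K) := by
  rw [(out_open hK).frontier_eq]
  constructor
  · rintro ⟨h1, h2⟩
    exact ⟨by by_contra hn; exact h2 (out_closure hK h1 hn), h1⟩
  · rintro ⟨h1, h2⟩
    exact ⟨h2, fun h => h.1 h1⟩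

lemma joined_path {F : Set (ℝ × ℝ)} {x y : ℝ × ℝ} (h : JoinedIn F x y) :
    ∃ γ : ℝ → ℝ × ℝ, Continuous γ ∧ γ 0 = x ∧ γ 1 = y ∧ ∀ s, γ s ∈ F := by
  refine ⟨h.somePath.extend, h.somePath.continuous_extend, by simp, by simp, fun s => ?_⟩
  have := mem_range_self (f := h.somePath.extend) s
  rw [Path.extend_range] at this
  obtain ⟨t, ht⟩ := this
  rw [← ht]
  exact h.somePath_mem t

end HC

namespace HC
section plane
variable {V : Type u} (G : PlaneGraph V)

lemma pg_mem2 {u v : V} (h : G.Adj u v) : v ∈ G.verts := G.adj_mem v u (G.adj_symm u v h)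

lemma pg_arc_compact {u v : V} (h : G.Adj u v) : IsCompact (G.arc s(u, v)) := by
  obtain ⟨f, hf, _, he, _, _⟩ := G.arc_arc u v h
  rw [← he]
  exact isCompact_Icc.image_of_continuousOn hf

lemma pg_arc_left {u v : V} (h : G.Adj u v) : G.pos u ∈ G.arc s(u, v) := by
  obtain ⟨f, hf, _, he, h0, _⟩ := G.arc_arc u v h
  rw [← he, ← h0]
  exact mem_image_of_mem f (by simp)

lemma pg_arc_right {u v : V} (h : G.Adj u v) : G.pos v ∈ G.arc s(u, v) := by
  rw [Sym2.eq_swap]; exact pg_arc_left G (G.adj_symm u v h)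

lemma pg_arc_joined {u v : V} (h : G.Adj u v) {F : Set (ℝ × ℝ)} (hF : G.arc s(u, v) ⊆ F) :
    JoinedIn F (G.pos u) (G.pos v) := by
  obtain ⟨f, hf, _, he, h0, h1⟩ := G.arc_arc u v h
  have hp : IsPathConnected (f '' Icc 0 1) :=
    IsPathConnected.image' ((convex_Icc (0 : ℝ) 1).isPathConnected ⟨0, by simp⟩) hf
  rw [he] at hp
  exact (hp.joinedIn _ (pg_arc_left G h) _ (pg_arc_right G h)).mono hF

/-- the part of the drawing consisting of vertices and edges satisfying a predicate -/
def part (P : V → Prop) (Q : V → V → Prop) : Set (ℝ × ℝ) :=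
  {z | (∃ v ∈ G.verts, P v ∧ z = G.pos v) ∨ ∃ u v, G.Adj u v ∧ Q u v ∧ z ∈ G.arc s(u, v)}

lemma part_compact (P : V → Prop) (Q : V → V → Prop) : IsCompact (part G P Q) := by
  have h1 : IsCompact (G.pos '' {v | v ∈ G.verts ∧ P v}) :=
    ((G.finite_verts.subset fun v hv => hv.1).image _).isCompact
  have h2 : IsCompact (⋃ e ∈ {e : V × V | G.Adj e.1 e.2 ∧ Q e.1 e.2}, G.arc s(e.1, e.2)) :=
    ((G.finite_verts.prod G.finite_verts).subset fun e he =>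
      ⟨G.adj_mem _ _ he.1, pg_mem2 G he.1⟩).isCompact_biUnion fun e he => pg_arc_compact G he.1
  convert h1.union h2 using 1
  ext z
  simp only [part, mem_setOf_eq, mem_union, mem_image, mem_iUnion, exists_prop, Prod.exists]
  refine or_congr ⟨?_, ?_⟩ ⟨?_, ?_⟩
  · rintro ⟨v, hv, hP, rfl⟩; exact ⟨v, ⟨hv, hP⟩, rfl⟩
  · rintro ⟨v, ⟨hv, hP⟩, rfl⟩; exact ⟨v, hv, hP, rfl⟩
  · rintro ⟨u, v, h, hQ, hz⟩; exact ⟨u, v, ⟨h, hQ⟩, hz⟩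
  · rintro ⟨u, v, ⟨h, hQ⟩, hz⟩; exact ⟨u, v, h, hQ, hz⟩

lemma image_eq_part : G.image = part G (fun _ => True) (fun _ _ => True) := by
  ext z
  simp only [PlaneGraph.image, part, mem_setOf_eq, mem_union, mem_image, mem_iUnion, exists_prop,
    true_and]
  refine or_congr ⟨?_, ?_⟩ Iff.rfl
  · rintro ⟨v, hv, rfl⟩; exact ⟨v, hv, rfl⟩
  · rintro ⟨v, hv, rfl⟩; exact ⟨v, hv, rfl⟩

lemma image_compact : IsCompact G.image := by rw [image_eq_part]; exact part_compact G _ _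

lemma part_subset_image (P : V → Prop) (Q : V → V → Prop) : part G P Q ⊆ G.image := by
  rw [image_eq_part]
  rintro z (⟨v, hv, _, rfl⟩ | ⟨u, v, h, _, hz⟩)
  exacts [Or.inl ⟨v, hv, trivial, rfl⟩, Or.inr ⟨u, v, h, trivial, hz⟩]

/-- distance from a vertex to the parts not touching it -/
lemma exists_eps (b : V) (hb : b ∈ G.verts) : ∃ ε > 0, Disjoint (Metric.ball (G.pos b) ε)
    (part G (fun v => v ≠ b) (fun u v => u ≠ b ∧ v ≠ b)) := by
  have hn : G.pos b ∉ part G (fun v => v ≠ b) (fun u v => u ≠ b ∧ v ≠ b) := by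
    rintro (⟨v, hv, hne, he⟩ | ⟨u, v, h, ⟨hu, hv⟩, hz⟩)
    · exact hne (G.pos_injOn hv hb he.symm)
    · rcases G.arc_avoid u v h b hb hz with rfl | rfl
      exacts [hu rfl, hv rfl]
  obtain ⟨ε, hε, h⟩ := Metric.isOpen_iff.1 (part_compact G _ _).isClosed.isOpen_compl _ hn
  exact ⟨ε, hε, disjoint_left.2 fun z hz => h hz⟩

/-- the underlying simple graph -/
def sg : SimpleGraph G.verts where
  Adj a b := G.Adj a b
  symm := ⟨fun a b h => G.adj_symm _ _ h⟩
  loopless := ⟨fun a h => G.adj_irrefl _ h⟩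

variable (B : Set G.verts) (o : ℝ × ℝ) (ε : G.verts → ℝ)

def ptOf : Option G.verts → ℝ × ℝ
  | none => o
  | some v => G.pos v

/-- vertices and edges inside `E` -/
def R0 (E : Set (Option G.verts)) : Set (ℝ × ℝ) :=
  part G (fun v => ∃ h : v ∈ G.verts, some ⟨v, h⟩ ∈ E)
    (fun u v => (∃ h : u ∈ G.verts, some ⟨u, h⟩ ∈ E) ∧ (∃ h : v ∈ G.verts, some ⟨v, h⟩ ∈ E))

def R1 (E : Set (Option G.verts)) : Set (ℝ × ℝ) :=
  {z | none ∈ E ∧ (z ∈ G.outerFace ∨ ∃ b ∈ B, some b ∈ E ∧ z ∈ Metric.ball (G.pos b) (ε b))}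

variable {G} {B} {o} {ε}

lemma R0_disj {E E' : Set (Option G.verts)} (h : Disjoint E E') : Disjoint (R0 G E) (R0 G E') := by
  rw [disjoint_left] at h ⊢
  rintro z (⟨v, hv, ⟨_, hE⟩, rfl⟩ | ⟨u, v, huv, ⟨⟨hu, hEu⟩, ⟨hv, hEv⟩⟩, hz⟩)
    (⟨v', hv', ⟨_, hE'⟩, hz'⟩ | ⟨u', v', huv', ⟨⟨hu', hEu'⟩, ⟨hv', hEv'⟩⟩, hz'⟩)
  · have := G.pos_injOn hv hv' hz'
    subst this
    exact h hE hE'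
  · rcases G.arc_avoid u' v' huv' v hv hz' with rfl | rfl
    exacts [h hE hEu', h hE hEv']
  · subst hz'
    rcases G.arc_avoid u v huv v' hv' hz with rfl | rfl
    exacts [h hEu hE', h hEv hE']
  · have hne : s(u, v) ≠ s(u', v') := by
      intro he
      have : u ∈ s(u', v') := he ▸ Sym2.mem_mk_left u v
      rcases Sym2.mem_iff.1 this with rfl | rfl
      exacts [h hEu hEu', h hEu hEv']
    obtain ⟨c, ⟨hc1, hc2⟩, _⟩ := G.arc_meet u v u' v' huv huv' hne ⟨hz, hz'⟩
    rcases hc1 with rfl | rfl <;> rcases hc2 with hc2 | hc2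
    · subst hc2; exact h hEu hEu'
    · have hc2 : c = v' := hc2
      subst hc2; exact h hEu hEv'
    · subst hc2; exact h hEv hEu'
    · have hc2 : c = v' := hc2
      subst hc2; exact h hEv hEv'

lemma R10_disj (hε : ∀ b : G.verts, Disjoint (Metric.ball (G.pos b) (ε b))
      (part G (fun v => v ≠ b) (fun u v => u ≠ b ∧ v ≠ b)))
    {E E' : Set (Option G.verts)} (h : Disjoint E E') : Disjoint (R1 G B ε E) (R0 G E') := by
  rw [disjoint_left] at h ⊢
  rintro z ⟨_, hz | ⟨b, hb, hbE, hz⟩⟩ hz'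
  · exact hz.1 (part_subset_image G _ _ hz')
  · refine disjoint_left.1 (hε b) hz ?_
    rcases hz' with ⟨v, hv, ⟨_, hE⟩, rfl⟩ | ⟨u, v, huv, ⟨⟨hu, hEu⟩, ⟨hv, hEv⟩⟩, hz'⟩
    · exact Or.inl ⟨v, hv, by rintro rfl; exact h hbE hE, rfl⟩
    · exact Or.inr ⟨u, v, huv, ⟨by rintro rfl; exact h hbE hEu, by rintro rfl; exact h hbE hEv⟩, hz'⟩

lemma R_disj (hε : ∀ b : G.verts, Disjoint (Metric.ball (G.pos b) (ε b))
      (part G (fun v => v ≠ b) (fun u v => u ≠ b ∧ v ≠ b)))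
    {E E' : Set (Option G.verts)} (h : Disjoint E E') :
    Disjoint (R0 G E ∪ R1 G B ε E) (R0 G E' ∪ R1 G B ε E') := by
  simp only [disjoint_union_left, disjoint_union_right]
  refine ⟨⟨R0_disj h, (R10_disj hε h)⟩, (R10_disj hε h.symm).symm, ?_⟩
  rw [disjoint_left]
  rintro z ⟨h1, _⟩ ⟨h2, _⟩
  exact disjoint_left.1 h h1 h2

lemma R_joined (ho : o ∈ G.outerFace) (hεp : ∀ b, 0 < ε b) (hB : ∀ b ∈ B, G.OnOuter b)
    {E : Set (Option G.verts)} (hE : Conn (Ap (sg G) B) E) {a b : Option G.verts} (ha : a ∈ E)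
    (hb : b ∈ E) : JoinedIn (R0 G E ∪ R1 G B ε E) (ptOf G o a) (ptOf G o b) := by
  have hmem : ∀ a ∈ E, ptOf G o a ∈ R0 G E ∪ R1 G B ε E := by
    rintro (_ | v) hv
    · exact Or.inr ⟨hv, Or.inl ho⟩
    · exact Or.inl (Or.inl ⟨v, v.2, ⟨v.2, hv⟩, rfl⟩)
  have hout : ∀ b : G.verts, b ∈ B → some b ∈ E → none ∈ E →
      JoinedIn (R0 G E ∪ R1 G B ε E) o (G.pos b) := by
    intro b hbB hbE hnE
    have hfr := hB b hbB
    have hcl : G.pos b ∈ closure G.outerFace := frontier_subset_closure hfr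
    obtain ⟨q, hq, hd⟩ := Metric.mem_closure_iff.1 hcl (ε b) (hεp b)
    have hpc : IsPathConnected (G.outerFace ∪ Metric.ball (G.pos b) (ε b)) :=
      (out_pathConn (image_compact G)).union (Metric.isPathConnected_ball (hεp b))
        ⟨q, hq, by rwa [Metric.mem_ball, dist_comm]⟩
    refine (hpc.joinedIn o (Or.inl ho) (G.pos b) (Or.inr (Metric.mem_ball_self (hεp b)))).mono ?_
    rintro z (hz | hz)
    exacts [Or.inr ⟨hnE, Or.inl hz⟩, Or.inr ⟨hnE, Or.inr ⟨b, hbB, hbE, hz⟩⟩]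
  have := hE.2 {c | c ∈ E ∧ JoinedIn (R0 G E ∪ R1 G B ε E) (ptOf G o a) (ptOf G o c)}
    (fun c hc => hc.1) ⟨a, ha, JoinedIn.refl (hmem a ha)⟩ (by
      rintro c ⟨hc, hj⟩ d hd hcd
      refine ⟨hd, hj.trans ?_⟩
      rcases c with _ | c <;> rcases d with _ | d
      · exact absurd hcd id
      · exact hout d hcd hd hc
      · exact (hout c hcd hc hd).symm
      · refine pg_arc_joined G (show G.Adj c d from hcd) fun z hz => Or.inl (Or.inr
          ⟨c, d, hcd, ⟨⟨c.2, hc⟩, ⟨d.2, hd⟩⟩, hz⟩))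
  exact (this hb).2

theorem pl_plane (G : PlaneGraph V) (B : Set G.verts) (hB : ∀ b ∈ B, G.OnOuter b) :
    PL (sg G) univ B := by
  obtain ⟨o, ho⟩ := (out_conn (image_compact G)).1
  choose ε hεp hε using fun b : G.verts => exists_eps G b.1 b.2
  constructor
  · rintro ⟨p, E, hE, hdis⟩
    have hJ : ∀ i j, ∃ γ : ℝ → ℝ × ℝ, i < j → Continuous γ ∧ γ 0 = ptOf G o (p i) ∧
        γ 1 = ptOf G o (p j) ∧ ∀ s, γ s ∈ R0 G (E i j) ∪ R1 G B ε (E i j) := by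
      intro i j
      by_cases h : i < j
      · obtain ⟨h1, h2, h3, h4, _⟩ := hE i j h.ne
        obtain ⟨γ, hγ⟩ := joined_path (R_joined ho hεp hB h1 h3 h4)
        exact ⟨γ, fun _ => hγ⟩
      · exact ⟨fun _ => 0, fun h' => absurd h' h⟩
    choose γ hγ using hJ
    have hmem : ∀ i j, i ≠ j → ptOf G o (p i) ∈ R0 G (E i j) ∪ R1 G B ε (E i j) := by
      intro i j hij
      obtain ⟨h1, h2, h3, h4, _⟩ := hE i j hij
      exact (R_joined ho hεp hB h1 h3 h3).source_mem
    have hR : ∀ i j k l, i ≠ j → k ≠ l → i ≠ k → i ≠ l → j ≠ k → j ≠ l → ∀ x ∈ R0 G (E i j) ∪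
        R1 G B ε (E i j), ∀ y ∈ R0 G (E k l) ∪ R1 G B ε (E k l), x ≠ y := by
      intro i j k l a1 a2 a3 a4 a5 a6 x hx y hy hxy
      exact disjoint_left.1 (R_disj hε (hdis i j k l a1 a2 a3 a4 a5 a6)) hx (hxy ▸ hy)
    have ex : ∀ i j : Fin 5, ∃ k l : Fin 5, k ≠ l ∧ k ≠ i ∧ k ≠ j ∧ l ≠ i ∧ l ≠ j := by decide
    have ex3 : ∀ i j v : Fin 5, ∃ l : Fin 5, l ≠ v ∧ l ≠ i ∧ l ≠ j := by decide
    refine no_K5 (fun i => ptOf G o (p i)) ?_ γ (fun i j h => ⟨(hγ i j h).1, (hγ i j h).2.1,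
      (hγ i j h).2.2.1⟩) ?_ ?_
    · intro i j hij
      obtain ⟨k, l, h1, h2, h3, h4, h5⟩ := ex i j
      exact hR i k j l h2.symm h5.symm hij h4.symm h3 h1 _ (hmem i k h2.symm) _ (hmem j l h5.symm)
    · intro i j k l hij hkl a1 a2 a3 a4 s t
      exact hR i j k l hij.ne hkl.ne a1 a2 a3 a4 _ ((hγ i j hij).2.2.2 s) _ ((hγ k l hkl).2.2.2 t)
    · intro i j v hij a1 a2 s
      obtain ⟨l, h1, h2, h3⟩ := ex3 i j v
      exact hR i j v l hij.ne h1.symm a1 h2.symm a2 h3.symm _ ((hγ i j hij).2.2.2 s) _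
        (hmem v l h1.symm)
  · rintro ⟨p, q, E, hE, hdis⟩
    have hR : ∀ i j k l, i ≠ k → j ≠ l → ∀ x ∈ R0 G (E i j) ∪
        R1 G B ε (E i j), ∀ y ∈ R0 G (E k l) ∪ R1 G B ε (E k l), x ≠ y := by
      intro i j k l a1 a2 x hx y hy hxy
      exact disjoint_left.1 (R_disj hε (hdis i j k l a1 a2)) hx (hxy ▸ hy)
    have hJ : ∀ i j, ∃ γ : ℝ → ℝ × ℝ, Continuous γ ∧ γ 0 = ptOf G o (p i) ∧
        γ 1 = ptOf G o (q j) ∧ ∀ s, γ s ∈ R0 G (E i j) ∪ R1 G B ε (E i j) := by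
      intro i j
      obtain ⟨h1, h2, h3, h4⟩ := hE i j
      exact joined_path (R_joined ho hεp hB h1 h3 h4)
    choose γ hγ0 hγ1 hγ2 hγ using hJ
    have hp : ∀ i j, ptOf G o (p i) ∈ R0 G (E i j) ∪ R1 G B ε (E i j) := fun i j =>
      hγ1 i j ▸ hγ i j 0
    have hq : ∀ i j, ptOf G o (q j) ∈ R0 G (E i j) ∪ R1 G B ε (E i j) := fun i j =>
      hγ2 i j ▸ hγ i j 1
    have ex : ∀ i : Fin 3, ∃ k : Fin 3, k ≠ i := by decide
    have ex2 : ∀ i j : Fin 3, ∃ k : Fin 3, k ≠ i ∧ k ≠ j := by decide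
    have hpp : ∀ i k, i ≠ k → ptOf G o (p i) ≠ ptOf G o (p k) := fun i k h =>
      hR i 0 k 1 h (by decide) _ (hp i 0) _ (hp k 1)
    have hqq : ∀ i k, i ≠ k → ptOf G o (q i) ≠ ptOf G o (q k) := fun i k h =>
      hR 0 i 1 k (by decide) h _ (hq 0 i) _ (hq 1 k)
    have hpq : ∀ i k, ptOf G o (p i) ≠ ptOf G o (q k) := fun i k => by
      obtain ⟨i', hi⟩ := ex i
      obtain ⟨k', hk⟩ := ex k
      exact hR i k' i' k hi.symm hk _ (hp i k') _ (hq i' k)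
    let dn : Fin 6 → Fin 3 := fun i => ⟨i.1 % 3, Nat.mod_lt _ (by decide)⟩
    have hdn : ∀ i j : Fin 6, i ≠ j → (i < 3 ↔ j < 3) → dn i ≠ dn j := by
      intro i j hij h he
      simp only [dn, Fin.mk.injEq] at he
      have h3 : ((3 : Fin 6) : ℕ) = 3 := rfl
      simp only [Fin.lt_def, h3] at h
      refine hij (Fin.ext ?_)
      omega
    let P : Fin 6 → ℝ × ℝ := fun i => if i < 3 then ptOf G o (p (dn i)) else ptOf G o (q (dn i))
    refine no_K33 P ?_ (fun i j => γ (dn i) (dn j)) ?_ ?_ ?_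
    · intro i j hij
      simp only [P]
      split_ifs with h1 h2 h2
      · exact hpp _ _ (hdn i j hij (by simp [h1, h2]))
      · exact hpq _ _
      · exact (hpq _ _).symm
      · exact hqq _ _ (hdn i j hij (by simp [h1, h2]))
    · rintro i j ⟨h1, h2⟩
      refine ⟨hγ0 _ _, ?_, ?_⟩
      · simp only [P, h1, if_true]; exact hγ1 _ _
      · simp only [P, h2.not_gt, if_false]; exact hγ2 _ _
    · rintro i j k l ⟨h1, h2⟩ ⟨h3, h4⟩ a1 a2 a3 a4 s t
      exact hR _ _ _ _ (hdn i k a1 (by simp [h1, h3])) (hdn j l a4 (by simp [h2.not_gt, h4.not_gt]))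
        _ (hγ _ _ s) _ (hγ _ _ t)
    · rintro i j v ⟨h1, h2⟩ a1 a2 s
      simp only [P]
      split_ifs with h3
      · obtain ⟨l, hl⟩ := ex (dn j)
        exact hR _ _ (dn v) l (hdn i v a1 (by simp [h1, h3])) hl.symm _ (hγ _ _ s) _ (hp _ _)
      · obtain ⟨l, hl⟩ := ex (dn i)
        exact hR _ _ l (dn v) hl.symm (hdn j v a2 (by simp [h2.not_gt, h3])) _ (hγ _ _ s) _ (hq _ _)

end plane
end HC

namespace HC

/-! ### Eilenberg's criterion and edges on the outer face -/

def HasLog (K : Set (ℝ × ℝ)) (q : ℝ × ℝ) : Prop :=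
  ∃ g : ℝ × ℝ → ℂ, ContinuousOn g K ∧ ∀ z ∈ K, Complex.exp (g z) = toC z - toC q

lemma slit_mem {K : Set (ℝ × ℝ)} {q q' : ℝ × ℝ} {ε : ℝ}
    (h1 : ∀ z ∈ K, ε ≤ ‖toC z - toC q‖) (hε : 0 < ε) (h2 : ‖toC q' - toC q‖ < ε) :
    ∃ l : ℝ × ℝ → ℂ, ContinuousOn l K ∧
      ∀ z ∈ K, Complex.exp (l z) = (toC z - toC q') / (toC z - toC q) := by
  have h0 : ∀ z ∈ K, toC z - toC q ≠ 0 := fun z hz h => by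
    have := h1 z hz; rw [h, norm_zero] at this; linarith
  have hs : ∀ z ∈ K, (toC z - toC q') / (toC z - toC q) ∈ Complex.slitPlane := by
    intro z hz
    have e : (toC z - toC q') / (toC z - toC q) = 1 + -((toC q' - toC q) / (toC z - toC q)) := by
      have := h0 z hz
      field_simp
      ring
    rw [e]
    apply Complex.mem_slitPlane_of_norm_lt_one
    rw [norm_neg, norm_div, div_lt_one (by have := h1 z hz; linarith)]
    exact lt_of_lt_of_le h2 (h1 z hz)
  refine ⟨fun z => Complex.log ((toC z - toC q') / (toC z - toC q)), ?_, ?_⟩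
  · apply ContinuousOn.clog _ hs
    exact ((toC_cont.sub continuous_const).continuousOn).div
      ((toC_cont.sub continuous_const).continuousOn) h0
  · intro z hz
    rw [Complex.exp_log (Complex.slitPlane_ne_zero (hs z hz))]

lemma hasLog_of_out {K : Set (ℝ × ℝ)} (hK : IsCompact K) {q : ℝ × ℝ} (hq : q ∈ Out K) :
    HasLog K q := by
  obtain ⟨R, hR⟩ := exists_far hK
  have ho : R < |((R + 1, 0) : ℝ × ℝ).1| ∨ R < |((R + 1, 0) : ℝ × ℝ).2| :=
    Or.inl (lt_of_lt_of_le (by linarith) (le_abs_self (R + 1)))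
  have hoK : ((R + 1, 0) : ℝ × ℝ) ∉ K := fun h => by
    have := (hR _ h).1
    have h2 := le_abs_self (R + 1)
    simp only at this
    linarith
  have hoO : ((R + 1, 0) : ℝ × ℝ) ∈ Out K := by
    rw [out_eq hK hR ho]; exact mem_connectedComponentIn hoK
  have hlo : HasLog K (R + 1, 0) := by
    have hs : ∀ z ∈ K, toC (R + 1, 0) - toC z ∈ Complex.slitPlane := by
      intro z hz
      left
      have := (le_abs_self z.1).trans (hR z hz).1
      simp [toC]
      linarith
    refine ⟨fun z => Complex.log (toC (R + 1, 0) - toC z) + Real.pi * Complex.I, ?_, ?_⟩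
    · exact (ContinuousOn.clog (continuous_const.sub toC_cont).continuousOn hs).add
        continuousOn_const
    · intro z hz
      rw [Complex.exp_add, Complex.exp_log (Complex.slitPlane_ne_zero (hs z hz)),
        Complex.exp_pi_mul_I]
      ring
  have key : HasLog K q ↔ HasLog K (R + 1, 0) := by
    refine (out_conn hK).isPreconnected.induction₂ (fun a b => HasLog K a ↔ HasLog K b) ?_ ?_ ?_
      hq hoO
    · intro x hx
      have hne : (toC '' K)ᶜ ∈ nhds (toC x) := by
        apply ((hK.image toC_cont).isClosed.isOpen_compl).mem_nhds
        rintro ⟨z, hz, he⟩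
        exact hx.1 (toC_inj he ▸ hz)
      obtain ⟨ε, hε, hb⟩ := Metric.mem_nhds_iff.1 hne
      have h1 : ∀ z ∈ K, ε ≤ ‖toC z - toC x‖ := by
        intro z hz
        by_contra hlt
        push Not at hlt
        exact hb (by rw [Metric.mem_ball, dist_eq_norm]; exact hlt) (mem_image_of_mem _ hz)
      have hnear : ∀ᶠ y in nhds x, ‖toC y - toC x‖ < ε := by
        have := (toC_cont.tendsto x).eventually (Metric.ball_mem_nhds (toC x) hε)
        filter_upwards [this] with y hy
        rwa [← dist_eq_norm]
      filter_upwards [nhdsWithin_le_nhds hnear, self_mem_nhdsWithin] with y hy hyO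
      obtain ⟨l, hl, hle⟩ := slit_mem h1 hε hy
      have h0 : ∀ z ∈ K, toC z - toC x ≠ 0 := fun z hz =>
        toC_sub_ne fun h => hx.1 (h ▸ hz)
      have h0' : ∀ z ∈ K, toC z - toC y ≠ 0 := fun z hz =>
        toC_sub_ne fun h => hyO.1 (h ▸ hz)
      constructor
      · rintro ⟨g, hg, hge⟩
        refine ⟨fun z => g z + l z, hg.add hl, fun z hz => ?_⟩
        rw [Complex.exp_add, hge z hz, hle z hz, mul_div_cancel₀ _ (h0 z hz)]
      · rintro ⟨g, hg, hge⟩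
        refine ⟨fun z => g z - l z, hg.sub hl, fun z hz => ?_⟩
        rw [Complex.exp_sub, hge z hz, hle z hz, div_div_cancel₀ (h0' z hz)]
    · intro x y z _ _ _ h1 h2; exact h1.trans h2
    · intro x y _ _ h; exact h.symm
  exact key.2 hlo

lemma out_of_hasLog {K : Set (ℝ × ℝ)} (hK : IsCompact K) {q : ℝ × ℝ} (hq : q ∉ K)
    (hl : HasLog K q) : q ∈ Out K := by
  by_contra hn
  have hbd : Bornology.IsBounded (connectedComponentIn Kᶜ q) := by
    by_contra h; exact hn ⟨hq, h⟩
  obtain ⟨g, hg, hge⟩ := hl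
  set D := connectedComponentIn Kᶜ q with hD
  have hqD : q ∈ D := mem_connectedComponentIn hq
  have hDo : IsOpen D := hK.isClosed.isOpen_compl.connectedComponentIn
  have hfr : frontier D ⊆ K := by
    intro z hz
    by_contra hzK
    have hz1 : z ∈ closure D := hz.1
    have hz2 : z ∉ D := by rw [hDo.frontier_eq] at hz; exact hz.2
    have ho : IsOpen (connectedComponentIn Kᶜ z) := hK.isClosed.isOpen_compl.connectedComponentIn
    obtain ⟨a, ha, haD⟩ := mem_closure_iff.1 hz1 _ ho (mem_connectedComponentIn hzK)
    have e1 := connectedComponentIn_eq ha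
    have e2 := connectedComponentIn_eq haD
    apply hz2
    rw [hD, e2, ← e1]
    exact mem_connectedComponentIn hzK
  obtain ⟨G, hG⟩ := ContinuousMap.exists_restrict_eq hK.isClosed
    (⟨K.domRestrict g, continuousOn_iff_continuous_domRestrict.1 hg⟩ : C(K, ℂ))
  have hGK : ∀ z ∈ K, G z = g z := fun z hz => by
    have := congrArg (fun (k : C(K, ℂ)) => k ⟨z, hz⟩) hG
    exact this
  classical
  have hf : Continuous (fun z => if z ∈ D then Complex.exp (G z) else toC z - toC q) := by
    apply Continuous.if
    · intro a ha
      have haK := hfr ha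
      rw [hGK a haK, hge a haK]
    · exact Complex.continuous_exp.comp G.continuous
    · exact toC_cont.sub continuous_const
  obtain ⟨h, hh, he⟩ := exists_log _ hf (by
    intro z
    split_ifs with hz
    · exact Complex.exp_ne_zero _
    · exact toC_sub_ne fun e => hz (e ▸ hqD))
  obtain ⟨R, hR0, hR⟩ := hbd.subset_ball_lt 0 q
  -- big circle
  let c : ℝ → ℝ × ℝ := fun t => (q.1 + 2 * R * Real.cos t, q.2 + 2 * R * Real.sin t)
  have hc : Continuous c := by fun_prop
  have hcv : ∀ t, toC (c t) - toC q = 2 * R * Complex.exp (t * Complex.I) := by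
    intro t
    rw [Complex.exp_mul_I, ← Complex.ofReal_cos, ← Complex.ofReal_sin]
    apply Complex.ext
    · simp only [toC, c, Complex.sub_re, Complex.mul_re, Complex.add_re, Complex.ofReal_re,
        Complex.ofReal_im, Complex.I_re, Complex.I_im, Complex.re_ofNat, Complex.im_ofNat,
        Complex.mul_im, Complex.add_im]
      ring
    · simp only [toC, c, Complex.sub_im, Complex.mul_re, Complex.add_re, Complex.ofReal_re,
        Complex.ofReal_im, Complex.I_re, Complex.I_im, Complex.re_ofNat, Complex.im_ofNat,
        Complex.mul_im, Complex.add_im]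
      ring
  have hcD : ∀ t, c t ∉ D := by
    intro t ht
    have h1 := hR ht
    rw [Metric.mem_ball, Prod.dist_eq, max_lt_iff] at h1
    simp only [Real.dist_eq, c, add_sub_cancel_left] at h1
    have h2 := abs_lt.1 h1.1
    have h3 := abs_lt.1 h1.2
    have h4 := Real.sin_sq_add_cos_sq t
    have h5 : |2 * R * Real.cos t| ^ 2 < R ^ 2 := pow_lt_pow_left₀ h1.1 (abs_nonneg _) two_ne_zero
    have h6 : |2 * R * Real.sin t| ^ 2 < R ^ 2 := pow_lt_pow_left₀ h1.2 (abs_nonneg _) two_ne_zero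
    rw [sq_abs] at h5 h6
    have h7 : (2 * R * Real.cos t) ^ 2 + (2 * R * Real.sin t) ^ 2 = 4 * R ^ 2 := by
      linear_combination (4 * R ^ 2) * h4
    nlinarith [sq_nonneg R]
  have h1 : ∀ t : ℝ, Complex.exp (h (c t)) = (2 * R) * Complex.exp (t * Complex.I) := by
    intro t; rw [he, if_neg (hcD t), hcv]
  have := log_change (S := (univ : Set ℝ)) isPreconnected_univ (g := fun t => h (c t))
    (g' := fun t => t * Complex.I) (hh.comp hc).continuousOn
    (by fun_prop) (c := 2 * R) (fun t _ => h1 t) (mem_univ 0) (mem_univ (2 * Real.pi))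
  have e : c (2 * Real.pi) = c 0 := by simp [c]
  simp only [e, sub_self] at this
  simp at this

lemma hasLog_arc {K : Set (ℝ × ℝ)} (hK : IsCompact K) {q : ℝ × ℝ} (hl : HasLog K q)
    {f : ℝ → ℝ × ℝ} {a b c : ℝ} (hc : c ∈ Icc a b) (hf : ContinuousOn f (Icc a b))
    (hi : InjOn f (Icc a b)) (hq : q ∉ f '' Icc a b) (hm : ∀ s ∈ Icc a b, f s ∈ K → s = c) :
    HasLog (K ∪ f '' Icc a b) q := by
  obtain ⟨g, hg, hge⟩ := hl
  have hab : a ≤ b := hc.1.trans hc.2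
  have hfr : Continuous ((Icc a b).domRestrict f) := continuousOn_iff_continuous_domRestrict.1 hf
  obtain ⟨k0, hk0, hke0⟩ := exists_log (fun s : ℝ => toC ((Icc a b).domRestrict f (projIcc a b hab s))
    - toC q) ((toC_cont.comp (hfr.comp continuous_projIcc)).sub continuous_const) (by
      intro s
      apply toC_sub_ne
      rintro h
      exact hq ⟨_, (projIcc a b hab s).2, h⟩)
  have hke1 : ∀ s ∈ Icc a b, Complex.exp (k0 s) = toC (f s) - toC q := by
    intro s hs
    rw [hke0 s, projIcc_of_mem hab hs]; rfl
  obtain ⟨k, hk, hke, hkc⟩ : ∃ k : ℝ → ℂ, Continuous k ∧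
      (∀ s ∈ Icc a b, Complex.exp (k s) = toC (f s) - toC q) ∧ (f c ∈ K → k c = g (f c)) := by
    by_cases hcK : f c ∈ K
    · refine ⟨fun s => k0 s + (g (f c) - k0 c), hk0.add continuous_const, ?_, fun _ => by ring⟩
      intro s hs
      rw [Complex.exp_add, Complex.exp_sub, hke1 s hs, hge _ hcK, hke1 c hc, div_self, mul_one]
      exact toC_sub_ne fun h => hq ⟨c, hc, h⟩
    · exact ⟨k0, hk0, hke1, fun h => absurd h hcK⟩
  classical
  let G : ℝ × ℝ → ℂ := fun z => if z ∈ K then g z else k (Function.invFunOn f (Icc a b) z)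
  have hinv : ∀ s ∈ Icc a b, Function.invFunOn f (Icc a b) (f s) = s := fun s hs =>
    hi.leftInvOn_invFunOn hs
  have hGf : ∀ s ∈ Icc a b, G (f s) = k s := by
    intro s hs
    by_cases hsK : f s ∈ K
    · have : s = c := hm s hs hsK
      subst this
      simp only [G, if_pos hsK]
      exact (hkc hsK).symm
    · simp only [G, if_neg hsK, hinv s hs]
  have hGK : ∀ z ∈ K, G z = g z := fun z hz => if_pos hz
  refine ⟨G, ContinuousOn.union_of_isClosed (hg.congr hGK) ?_ hK.isClosed
    (isCompact_Icc.image_of_continuousOn hf).isClosed, ?_⟩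
  · rw [continuousOn_iff_isClosed]
    intro T hT
    refine ⟨f '' (Icc a b ∩ k ⁻¹' T), ?_, ?_⟩
    · exact ((isCompact_Icc.inter_right (hT.preimage hk)).image_of_continuousOn
        (hf.mono inter_subset_left)).isClosed
    · ext z
      constructor
      · rintro ⟨hz, s, hs, rfl⟩
        rw [mem_preimage, hGf s hs] at hz
        exact ⟨⟨s, ⟨hs, hz⟩, rfl⟩, s, hs, rfl⟩
      · rintro ⟨⟨s, ⟨hs, hz⟩, rfl⟩, _⟩
        refine ⟨?_, s, hs, rfl⟩
        rw [mem_preimage, hGf s hs]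
        exact hz
  · rintro z (hz | ⟨s, hs, rfl⟩)
    · rw [hGK z hz, hge z hz]
    · rw [hGf s hs, hke s hs]

theorem edgeOnOuter_deg2 {V : Type u} (G : PlaneGraph V) {x v z : V} (hx : G.OnOuter x)
    (hxv : G.Adj x v) (hxz : G.Adj x z) (hvz : v ≠ z)
    (hdeg : ∀ a, G.Adj x a → a = v ∨ a = z) : G.EdgeOnOuter x v := by
  have hxm := G.adj_mem _ _ hxv
  have hvm := pg_mem2 G hxv
  have hzm := pg_mem2 G hxz
  have hxv' : x ≠ v := fun h => G.adj_irrefl v (h ▸ hxv)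
  have hxz' : x ≠ z := fun h => G.adj_irrefl z (h ▸ hxz)
  have hXc := image_compact G
  obtain ⟨f, hf, hfi, hfe, hf0, hf1⟩ := G.arc_arc x v hxv
  obtain ⟨f2, hf2, hf2i, hf2e, hf20, hf21⟩ := G.arc_arc x z hxz
  have h01 : (0 : ℝ) ∈ Icc (0 : ℝ) 1 := ⟨le_rfl, zero_le_one⟩
  have h11 : (1 : ℝ) ∈ Icc (0 : ℝ) 1 := ⟨zero_le_one, le_rfl⟩
  have hΩ : G.outerFace = Out G.image := rfl
  have hpx : G.pos x ∈ closure (Out G.image) := by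
    have : G.pos x ∈ frontier (Out G.image) := hx
    exact this.1
  have harc : G.arc s(x, v) ⊆ G.image := by
    intro y hy
    exact Or.inr (by simp only [mem_iUnion]; exact ⟨x, v, hxv, hy⟩)
  have harc2 : G.arc s(x, z) ⊆ G.image := by
    intro y hy
    exact Or.inr (by simp only [mem_iUnion]; exact ⟨x, z, hxz, hy⟩)
  -- the two arcs only share the point of `x`
  have hmeet : ∀ y ∈ G.arc s(x, v), y ∈ G.arc s(x, z) → y = G.pos x := by
    intro y h1 h2
    obtain ⟨a, ⟨ha1, ha2⟩, rfl⟩ := G.arc_meet x v x z hxv hxz (by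
      intro h
      rw [Sym2.eq_iff] at h
      rcases h with h | h
      · exact hvz h.2
      · exact hxz' h.1) ⟨h1, h2⟩
    rcases ha1 with rfl | rfl
    · rfl
    · rcases ha2 with h | h
      · rw [h]
      · exact absurd h hvz
  let X2 := part G (fun a => a ≠ x) (fun a b => a ≠ x ∧ b ≠ x)
  have hX2c : IsCompact X2 := part_compact G _ _
  -- meeting of an arc at `x` with `X2`
  have hX2 : ∀ w, G.Adj x w → ∀ y ∈ G.arc s(x, w), y ∈ X2 → y = G.pos w := by
    intro w hw y hy hy2
    rcases hy2 with ⟨a, ha, hax, rfl⟩ | ⟨a, b, hab, ⟨hax, hbx⟩, hy2⟩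
    · rcases G.arc_avoid x w hw a ha hy with h | h
      · exact absurd h hax
      · rw [h]
    · obtain ⟨c, ⟨hc1, hc2⟩, rfl⟩ := G.arc_meet x w a b hw hab (by
        intro h
        rw [Sym2.eq_iff] at h
        rcases h with h | h
        · exact hax h.1.symm
        · exact hbx h.1.symm) ⟨hy, hy2⟩
      rcases hc1 with rfl | hc1
      · rcases hc2 with h | h
        · exact absurd h.symm hax
        · exact absurd h.symm hbx
      · rw [hc1]
  have hpX2 : G.pos x ∉ X2 := by
    intro h
    have := hX2 v hxv _ (pg_arc_left G hxv) h
    exact hxv' (G.pos_injOn hxm hvm this)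
  have hcover : ∀ y ∈ G.image, y ∈ X2 ∨ y ∈ G.arc s(x, v) ∨ y ∈ G.arc s(x, z) := by
    intro y hy
    rw [image_eq_part] at hy
    rcases hy with ⟨a, ha, _, rfl⟩ | ⟨a, b, hab, _, hy⟩
    · by_cases hax : a = x
      · subst hax; exact Or.inr (Or.inl (pg_arc_left G hxv))
      · exact Or.inl (Or.inl ⟨a, ha, hax, rfl⟩)
    · by_cases hax : a = x
      · subst hax
        rcases hdeg b hab with rfl | rfl
        · exact Or.inr (Or.inl hy)
        · exact Or.inr (Or.inr hy)
      · by_cases hbx : b = x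
        · subst hbx
          rw [Sym2.eq_swap] at hy
          rcases hdeg a (G.adj_symm _ _ hab) with rfl | rfl
          · exact Or.inr (Or.inl hy)
          · exact Or.inr (Or.inr hy)
        · exact Or.inl (Or.inr ⟨a, b, hab, ⟨hax, hbx⟩, hy⟩)
  -- main claim
  have key : ∀ t ∈ Ioo (0 : ℝ) 1, f t ∈ closure (Out G.image) := by
    intro t ht
    by_contra hq
    have htI : t ∈ Icc (0 : ℝ) 1 := ⟨ht.1.le, ht.2.le⟩
    have hopen : IsOpen (closure (Out G.image))ᶜ := isClosed_closure.isOpen_compl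
    have hnear : ∀ᶠ s in nhds t, s ∈ Ioo (0 : ℝ) 1 ∧ f s ∈ (closure (Out G.image))ᶜ := by
      have h1 : ∀ᶠ s in nhds t, s ∈ Ioo (0 : ℝ) 1 := Ioo_mem_nhds ht.1 ht.2
      have hcf : ContinuousAt f t := hf.continuousAt (Icc_mem_nhds ht.1 ht.2)
      exact h1.and (hcf.eventually (hopen.mem_nhds hq))
    obtain ⟨η, hη, hball⟩ := Metric.eventually_nhds_iff.1 hnear
    have hin : ∀ s, t - η / 2 ≤ s → s ≤ t + η / 2 →
        s ∈ Ioo (0 : ℝ) 1 ∧ f s ∈ (closure (Out G.image))ᶜ := by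
      intro s h1 h2
      apply hball
      rw [Real.dist_eq, abs_lt]
      constructor <;> linarith
    set a := t - η / 2 with ha
    set b := t + η / 2 with hb
    have ha01 := (hin a le_rfl (by linarith)).1
    have hb01 := (hin b (by linarith) le_rfl).1
    have hIa : Icc 0 a ⊆ Icc (0 : ℝ) 1 := Icc_subset_Icc le_rfl ha01.2.le
    have hIb : Icc b 1 ⊆ Icc (0 : ℝ) 1 := Icc_subset_Icc hb01.1.le le_rfl
    -- `f t` is in the outer component of `X2`
    have hqO : f t ∈ Out X2 := by
      have hp : G.pos x ∈ Out X2 := by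
        apply out_closure hX2c _ hpX2
        exact closure_mono (out_anti (part_subset_image G _ _)) hpx
      have hIt : Icc 0 t ⊆ Icc (0 : ℝ) 1 := Icc_subset_Icc le_rfl htI.2
      refine out_subset (S := f '' Icc 0 t) (isPreconnected_Icc.image _ (hf.mono hIt)) ?_
        ⟨0, ⟨le_rfl, ht.1.le⟩, hf0⟩ hp ⟨t, ⟨ht.1.le, le_rfl⟩, rfl⟩
      rw [Set.disjoint_left]
      rintro _ ⟨s, hs, rfl⟩ hs2
      have := hX2 v hxv (f s) (hfe ▸ mem_image_of_mem f (hIt hs)) hs2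
      rw [← hf1] at this
      have := hfi (hIt hs) h11 this
      linarith [hs.2, ht.2]
    have hqx : f t ≠ G.pos x := by
      rw [← hf0]; intro h; have := hfi htI h01 h; linarith [ht.1]
    have hqarc : f t ∈ G.arc s(x, v) := hfe ▸ mem_image_of_mem f htI
    have hl1 : HasLog X2 (f t) := hasLog_of_out hX2c hqO
    have hl2 : HasLog (X2 ∪ f2 '' Icc 0 1) (f t) := by
      refine hasLog_arc hX2c hl1 (c := 1) h11 hf2 hf2i ?_ ?_
      · intro h
        rw [hf2e] at h
        exact hqx (hmeet _ hqarc h)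
      · intro s hs h
        have := hX2 z hxz (f2 s) (hf2e ▸ mem_image_of_mem f2 hs) h
        rw [← hf21] at this
        exact hf2i hs h11 this
    have hc2 : IsCompact (X2 ∪ f2 '' Icc 0 1) :=
      hX2c.union (isCompact_Icc.image_of_continuousOn hf2)
    have hl3 : HasLog (X2 ∪ f2 '' Icc 0 1 ∪ f '' Icc b 1) (f t) := by
      refine hasLog_arc hc2 hl2 (c := 1) ⟨hb01.2.le, le_rfl⟩ (hf.mono hIb) (hfi.mono hIb) ?_ ?_
      · rintro ⟨s, hs, h⟩
        have := hfi (hIb hs) htI h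
        linarith [hs.1]
      · rintro s hs (h | h)
        · have := hX2 v hxv (f s) (hfe ▸ mem_image_of_mem f (hIb hs)) h
          rw [← hf1] at this
          exact hfi (hIb hs) h11 this
        · rw [hf2e] at h
          have := hmeet (f s) (hfe ▸ mem_image_of_mem f (hIb hs)) h
          rw [← hf0] at this
          have := hfi (hIb hs) h01 this
          linarith [hs.1, hb01.1]
    have hc3 : IsCompact (X2 ∪ f2 '' Icc 0 1 ∪ f '' Icc b 1) :=
      hc2.union (isCompact_Icc.image_of_continuousOn (hf.mono hIb))
    have hl4 : HasLog (X2 ∪ f2 '' Icc 0 1 ∪ f '' Icc b 1 ∪ f '' Icc 0 a) (f t) := by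
      refine hasLog_arc hc3 hl3 (c := 0) ⟨le_rfl, ha01.1.le⟩ (hf.mono hIa) (hfi.mono hIa) ?_ ?_
      · rintro ⟨s, hs, h⟩
        have := hfi (hIa hs) htI h
        linarith [hs.2]
      · rintro s hs ((h | h) | ⟨s', hs', h⟩)
        · have := hX2 v hxv (f s) (hfe ▸ mem_image_of_mem f (hIa hs)) h
          rw [← hf1] at this
          have := hfi (hIa hs) h11 this
          linarith [hs.2, ha01.2]
        · rw [hf2e] at h
          have := hmeet (f s) (hfe ▸ mem_image_of_mem f (hIa hs)) h
          rw [← hf0] at this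
          exact hfi (hIa hs) h01 this
        · have := hfi (hIb hs') (hIa hs) h
          linarith [hs.2, hs'.1]
    set X' := X2 ∪ f2 '' Icc 0 1 ∪ f '' Icc b 1 ∪ f '' Icc 0 a with hX'
    have hc4 : IsCompact X' := hc3.union (isCompact_Icc.image_of_continuousOn (hf.mono hIa))
    have hqX' : f t ∉ X' := by
      rintro (((h | h) | ⟨s, hs, h⟩) | ⟨s, hs, h⟩)
      · exact hqO.1 h
      · rw [hf2e] at h
        exact hqx (hmeet _ hqarc h)
      · have := hfi (hIb hs) htI h
        linarith [hs.1]
      · have := hfi (hIa hs) htI h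
        linarith [hs.2]
    have hqO' : f t ∈ Out X' := out_of_hasLog hc4 hqX' hl4
    have hX'X : X' ⊆ G.image := by
      rintro y (((h | h) | h) | h)
      · exact part_subset_image G _ _ h
      · rw [hf2e] at h; exact harc2 h
      · apply harc; rw [← hfe]; exact image_mono hIb h
      · apply harc; rw [← hfe]; exact image_mono hIa h
    have hΩX' : Out G.image ⊆ Out X' := out_anti hX'X
    have hsub : Out X' ⊆ Out G.image := by
      refine IsPreconnected.subset_left_of_subset_union (out_open hXc) hopen ?_ ?_ ?_
        (out_conn hc4).isPreconnected
      · rw [Set.disjoint_left]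
        intro y h1 h2
        exact h2 (subset_closure h1)
      · intro y hy
        by_cases hyc : y ∈ closure (Out G.image)
        · left
          apply out_closure hXc hyc
          intro hyX
          rcases hcover y hyX with h | h | h
          · exact hy.1 (Or.inl (Or.inl (Or.inl h)))
          · rw [← hfe] at h
            obtain ⟨s, hs, rfl⟩ := h
            by_cases h1 : s ≤ a
            · exact hy.1 (Or.inr ⟨s, ⟨hs.1, h1⟩, rfl⟩)
            · by_cases h2 : b ≤ s
              · exact hy.1 (Or.inl (Or.inr ⟨s, ⟨h2, hs.2⟩, rfl⟩))
              · exact (hin s (by linarith) (by linarith)).2 hyc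
          · rw [← hf2e] at h
            exact hy.1 (Or.inl (Or.inl (Or.inr h)))
        · exact Or.inr hyc
      · obtain ⟨y, hy⟩ := (out_conn hXc).nonempty
        exact ⟨y, hΩX' hy, hy⟩
    exact (hsub hqO').1 (harc hqarc)
  intro y hy
  have : y ∈ frontier (Out G.image) := by
    rw [out_frontier hXc]
    refine ⟨harc hy, ?_⟩
    rw [← hfe] at hy
    obtain ⟨t, ht, rfl⟩ := hy
    have hcl : f '' closure (Ioo (0 : ℝ) 1) ⊆ closure (Out G.image) := by
      have h1 : closure (Ioo (0 : ℝ) 1) = Icc 0 1 := closure_Ioo zero_ne_one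
      refine (ContinuousOn.image_closure (h1 ▸ hf)).trans ?_
      apply closure_minimal _ isClosed_closure
      rintro _ ⟨s, hs, rfl⟩
      exact key s hs
    rw [closure_Ioo zero_ne_one] at hcl
    exact hcl ⟨t, ht, rfl⟩
  exact this

end HC

namespace HC

/-! ### Transfer to plane graphs -/

section transfer
variable {V : Type u} [DecidableEq V]

lemma two_colors {X : Finset ℕ} (h : X.card = 2) {a b c : ℕ} (ha : a ∈ X) (hb : b ∈ X)
    (hab : a ≠ b) (hc : c ∈ X) : c = a ∨ c = b := by
  obtain ⟨p, q, hpq, rfl⟩ := Finset.card_eq_two.1 h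
  simp only [Finset.mem_insert, Finset.mem_singleton] at ha hb hc
  omega

lemma harm_not_col {K : PlaneGraph V} {L : V → Finset ℕ} {st : V ⊕ V × V} {w : V}
    (h : IsColoringHarmonica K L st w) : ¬ K.HasLColoring L := by
  induction h with
  | tri G L u v w hconn huv huw hvw hu hv hw huvout hverts hadjuv hadjvw hadjuw hLuv hLvw hcard =>
    rintro ⟨φ, h1, h2⟩
    have a1 := h1 u (by rw [hverts]; simp)
    have a2 := h1 v (by rw [hverts]; simp)
    have a3 := h1 w (by rw [hverts]; simp)
    rw [← hLuv] at a2
    rw [← hLvw, ← hLuv] at a3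
    rcases two_colors hcard a1 a2 (h2 _ _ hadjuv) a3 with h | h
    · exact h2 _ _ hadjuw h.symm
    · exact h2 _ _ hadjvw h.symm
  | step G L u v w z s hconn huv huw hvw hu hv hw huvout hadjuv hadjuz hadjvz hz hLuv hsub hcardu
      hcardz hs hrec ih =>
    rintro ⟨φ, h1, h2⟩
    apply ih
    refine ⟨φ, ?_, fun a b h => h2 a b h.1⟩
    intro a ha
    by_cases haz : a = z
    · subst haz
      rw [Function.update_self, Finset.mem_sdiff]
      refine ⟨h1 a ha.1, fun h => ?_⟩
      have a1 := h1 u (G.adj_mem _ _ hadjuv)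
      have a2 := h1 v (G.adj_mem _ _ hadjvz)
      rw [← hLuv] at a2
      rcases two_colors hcardu a1 a2 (h2 _ _ hadjuv) h with h | h
      · exact h2 _ _ hadjuz h.symm
      · exact h2 _ _ hadjvz h.symm
    · rw [Function.update_of_ne haz]; exact h1 a ha.1
  | vert G L u w x y hconn huw hu hw hx hy hadjux hadjuy hadjxy hcardu hLxy hcardx hrec ih =>
    rintro ⟨φ, h1, h2⟩
    apply ih
    refine ⟨φ, ?_, fun a b h => h2 a b h.1⟩
    have hLu : L u = {φ u} := by
      obtain ⟨c, hc⟩ := Finset.card_eq_one.1 hcardu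
      have := h1 u (G.adj_mem _ _ hadjux)
      rw [hc, Finset.mem_singleton] at this
      rw [hc, this]
    intro a ha
    by_cases hay : a = y
    · subst hay
      rw [Function.update_self, Finset.mem_sdiff, hLu, Finset.mem_singleton]
      exact ⟨h1 a ha.1, fun h => h2 _ _ hadjuy h.symm⟩
    · rw [Function.update_of_ne hay]
      by_cases hax : a = x
      · subst hax
        rw [Function.update_self, Finset.mem_sdiff, hLu, Finset.mem_singleton]
        exact ⟨h1 a ha.1, fun h => h2 _ _ hadjux h.symm⟩
      · rw [Function.update_of_ne hax]; exact h1 a ha.1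

lemma contains_not_col {G : PlaneGraph V} {L : V → Finset ℕ} {st : V ⊕ V × V} {w : V}
    (h : ContainsColoringHarmonica G L st w) : ¬ G.HasLColoring L := by
  obtain ⟨H, L', hs, hL, hh⟩ := h
  rintro ⟨φ, h1, h2⟩
  apply harm_not_col hh
  exact ⟨φ, fun v hv => by rw [hL v hv]; exact h1 v (hs.1 hv), fun a b h => h2 a b (hs.2.1 a b h)⟩

lemma harm_conn {K : PlaneGraph V} {L : V → Finset ℕ} {st : V ⊕ V × V} {w : V}
    (h : IsColoringHarmonica K L st w) : K.Connected := by
  cases h <;> assumption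

lemma conn_of_hub {K : PlaneGraph V} {z : V} (hz : z ∈ K.verts)
    (h : ∀ a ∈ K.verts, Relation.ReflTransGen K.Adj a z) : K.Connected := by
  have hsym : ∀ a b, Relation.ReflTransGen K.Adj a b → Relation.ReflTransGen K.Adj b a := by
    intro a b hab
    induction hab with
    | refl => exact .refl
    | tail _ h ih => exact Relation.ReflTransGen.head (K.adj_symm _ _ h) ih
  exact ⟨⟨z, hz⟩, fun a ha b hb => (h a ha).trans (hsym _ _ (h b hb))⟩

lemma conn_of_delete {K : PlaneGraph V} {s : Set V} {z : V} (hz : z ∈ K.verts) (hzs : z ∉ s)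
    (hc : (K.deleteVerts s).Connected) (h : ∀ a ∈ s, K.Adj a z) : K.Connected := by
  apply conn_of_hub hz
  intro a ha
  by_cases has : a ∈ s
  · exact .single (h a has)
  · have := hc.2 a ⟨ha, has⟩ z ⟨hz, hzs⟩
    have hm : ∀ x y, (K.deleteVerts s).Adj x y → K.Adj x y := fun _ _ h => h.1
    clear h hzs hz
    induction this with
    | refl => exact .refl
    | tail _ h ih => exact ih.tail (hm _ _ h)

/-- `K` is the plane subgraph of `G` induced by `H`. -/
structure IsInd (G K : PlaneGraph V) (H : Set G.verts) : Prop where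
  verts : ∀ v, v ∈ K.verts ↔ ∃ h : v ∈ G.verts, (⟨v, h⟩ : G.verts) ∈ H
  adj : ∀ u v, K.Adj u v ↔ G.Adj u v ∧ u ∈ K.verts ∧ v ∈ K.verts
  pos : K.pos = G.pos
  arc : K.arc = G.arc

variable {G K : PlaneGraph V} {H : Set G.verts}

lemma IsInd.delete (h : IsInd G K H) (s : Set G.verts) :
    IsInd G (K.deleteVerts (Subtype.val '' s)) (H \ s) := by
  have hv : ∀ v, v ∈ (K.deleteVerts (Subtype.val '' s)).verts ↔
      v ∈ K.verts ∧ v ∉ Subtype.val '' s := fun v => Iff.rfl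
  refine ⟨?_, ?_, h.pos, h.arc⟩
  · intro v
    rw [hv, h.verts]
    constructor
    · rintro ⟨⟨hv, hH⟩, hs⟩
      exact ⟨hv, hH, fun hvs => hs ⟨_, hvs, rfl⟩⟩
    · rintro ⟨hv, hH, hs⟩
      refine ⟨⟨hv, hH⟩, ?_⟩
      rintro ⟨a, ha, rfl⟩
      exact hs ha
  · intro u v
    rw [hv, hv]
    have : (K.deleteVerts (Subtype.val '' s)).Adj u v ↔
      K.Adj u v ∧ u ∉ Subtype.val '' s ∧ v ∉ Subtype.val '' s := Iff.rfl
    rw [this, h.adj]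
    tauto

lemma IsInd.sub (h : IsInd G K H) : K.IsSubgraph G :=
  ⟨fun v hv => ((h.verts v).1 hv).1, fun u v huv => ((h.adj u v).1 huv).1,
    fun v _ => by rw [h.pos], fun u v _ => by rw [h.arc]⟩

lemma IsInd.mem (h : IsInd G K H) {a : G.verts} (ha : a ∈ H) : a.1 ∈ K.verts :=
  (h.verts _).2 ⟨a.2, ha⟩

lemma IsInd.adj' (h : IsInd G K H) {a b : G.verts} (ha : a ∈ H) (hb : b ∈ H)
    (hab : (sg G).Adj a b) : K.Adj a b := (h.adj _ _).2 ⟨hab, h.mem ha, h.mem hb⟩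

lemma IsInd.onOuter (h : IsInd G K H) {a : G.verts} (ha : a ∈ H) (ho : G.OnOuter a) :
    K.OnOuter a := by
  have hsub : K.image ⊆ G.image := by
    rintro y (⟨v, hv, rfl⟩ | hy)
    · rw [h.pos]; exact Or.inl ⟨v, h.sub.1 hv, rfl⟩
    · simp only [mem_iUnion] at hy
      obtain ⟨u, v, huv, hy⟩ := hy
      right
      simp only [mem_iUnion]
      exact ⟨u, v, h.sub.2.1 u v huv, h.arc ▸ hy⟩
  have ho' : G.pos a ∈ frontier (Out G.image) := ho
  have : K.pos a ∈ frontier (Out K.image) := by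
    rw [out_frontier (image_compact K)]
    refine ⟨Or.inl ⟨a, h.mem ha, rfl⟩, ?_⟩
    rw [h.pos]
    exact closure_mono (out_anti hsub) ho'.1
  exact this

lemma IsInd.edge (h : IsInd G K H) {a b c : G.verts} (ha : a ∈ H) (hb : b ∈ H) (hc : c ∈ H)
    (hab : (sg G).Adj a b) (hac : (sg G).Adj a c) (hbc : (sg G).Adj b c) (ho : G.OnOuter a)
    (hdeg : ∀ x ∈ H, (sg G).Adj a x → x = b ∨ x = c) : K.EdgeOnOuter a b := by
  refine edgeOnOuter_deg2 K (h.onOuter ha ho) (h.adj' ha hb hab) (h.adj' ha hc hac)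
    (fun e => hbc.ne (Subtype.ext e)) ?_
  intro x hx
  have hx2 := (h.adj _ _).1 hx
  obtain ⟨hxG, hxH⟩ := (h.verts x).1 hx2.2.2
  rcases hdeg ⟨x, hxG⟩ hxH hx2.1 with e | e
  · left; exact congrArg Subtype.val e
  · right; exact congrArg Subtype.val e

/-- source of a harmonica, as seen in `V` -/
def srcV : G.verts ⊕ G.verts × G.verts → V ⊕ V × V
  | Sum.inl a => Sum.inl a.1
  | Sum.inr p => Sum.inr (p.1.1, p.2.1)

lemma AH.toHarm {Λ : G.verts → Finset ℕ} {st : G.verts ⊕ G.verts × G.verts} {w : G.verts}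
    (hAH : AH (sg G) H Λ st w) : ∀ (K : PlaneGraph V) (L : V → Finset ℕ), IsInd G K H →
    (∀ a ∈ H, L a.1 = Λ a) → (∀ a ∈ H, G.OnOuter a) →
    w ∈ H ∧ IsColoringHarmonica K L (srcV st) w.1 := by
  induction hAH with
  | tri Λ u v w huv hvw huw hLuv hLvw hc =>
    intro K L hK hL hO
    have mu : u ∈ ({u, v, w} : Set G.verts) := by simp
    have mv : v ∈ ({u, v, w} : Set G.verts) := by simp
    have mw : w ∈ ({u, v, w} : Set G.verts) := by simp
    have hverts : K.verts = {u.1, v.1, w.1} := by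
      ext a
      rw [hK.verts]
      constructor
      · rintro ⟨ha, (h | h | h)⟩
        · left; exact congrArg Subtype.val h
        · right; left; exact congrArg Subtype.val h
        · right; right; exact congrArg Subtype.val h
      · rintro (rfl | rfl | rfl)
        · exact ⟨u.2, mu⟩
        · exact ⟨v.2, mv⟩
        · exact ⟨w.2, mw⟩
    have ne : ∀ {a b : G.verts}, (sg G).Adj a b → a.1 ≠ b.1 := fun h e => h.ne (Subtype.ext e)
    refine ⟨mw, IsColoringHarmonica.tri K L u v w ?_ (ne huv) (ne huw) (ne hvw)
      (hK.onOuter mu (hO u mu)) (hK.onOuter mv (hO v mv)) (hK.onOuter mw (hO w mw)) ?_ hverts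
      (hK.adj' mu mv huv) (hK.adj' mv mw hvw) (hK.adj' mu mw huw) ?_ ?_ ?_⟩
    · apply conn_of_hub (hK.mem mw)
      intro a ha
      rw [hverts] at ha
      rcases ha with rfl | rfl | rfl
      · exact .single (hK.adj' mu mw huw)
      · exact .single (hK.adj' mv mw hvw)
      · exact .refl
    · refine hK.edge mu mv mw huv huw hvw (hO u mu) ?_
      rintro x (rfl | rfl | rfl) hx
      · exact absurd hx ((sg G).irrefl)
      · exact Or.inl rfl
      · exact Or.inr rfl
    · rw [hL u mu, hL v mv, hLuv]
    · rw [hL v mv, hL w mw, hLvw]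
    · rw [hL u mu, hc]
  | step H Λ u v w z s huw hvw hu hv hz huv huz hvz hLuv hsub hc hcz hs hdeg hrec ih =>
    intro K L hK hL hO
    have ne : ∀ {a b : G.verts}, (sg G).Adj a b → a.1 ≠ b.1 := fun h e => h.ne (Subtype.ext e)
    have hsa : ∀ a ∈ s, a = u ∨ a = v := by
      rcases hs with rfl | rfl | rfl <;> simp
    have hzs : z ∉ s := fun h => by
      rcases hsa z h with e | e
      · exact huz.ne e.symm
      · exact hvz.ne e.symm
    obtain ⟨hw, hrec'⟩ := ih (K.deleteVerts (Subtype.val '' s))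
      (Function.update L z.1 (L z.1 \ L u.1)) (hK.delete s) (by
        intro a ha
        by_cases haz : a = z
        · subst haz; simp [hL a hz, hL u hu]
        · have : a.1 ≠ z.1 := fun e => haz (Subtype.ext e)
          simp [haz, this, hL a ha.1]) (fun a ha => hO a ha.1)
    refine ⟨hw.1, IsColoringHarmonica.step K L u v w z (Subtype.val '' s) ?_ (ne huv)
      (fun e => huw (Subtype.ext e)) (fun e => hvw (Subtype.ext e))
      (hK.onOuter hu (hO u hu)) (hK.onOuter hv (hO v hv)) (hK.onOuter hw.1 (hO w hw.1)) ?_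
      (hK.adj' hu hv huv) (hK.adj' hu hz huz) (hK.adj' hv hz hvz) (hK.onOuter hz (hO z hz))
      ?_ ?_ ?_ ?_ ?_ hrec'⟩
    · refine conn_of_delete (hK.mem hz) ?_ (harm_conn hrec') ?_
      · rintro ⟨a, ha, e⟩
        exact hzs (Subtype.ext e ▸ ha)
      · rintro _ ⟨a, ha, rfl⟩
        rcases hsa a ha with rfl | rfl
        · exact hK.adj' hu hz huz
        · exact hK.adj' hv hz hvz
    · rcases hdeg with hd | hd
      · exact hK.edge hu hv hz huv huz hvz (hO u hu) hd
      · have := hK.edge hv hu hz huv.symm hvz huz (hO v hv) hd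
        unfold PlaneGraph.EdgeOnOuter at this ⊢
        rwa [Sym2.eq_swap] at this
    · rw [hL u hu, hL v hv, hLuv]
    · rw [hL u hu, hL z hz]; exact hsub
    · rw [hL u hu, hc]
    · rw [hL z hz, hcz]
    · rcases hs with rfl | rfl | rfl
      · left; simp
      · right; left; simp
      · right; right; simp [image_insert_eq]
  | vert H Λ u w x y huw hu hx hy hux huy hxy hcu hLxy hcx hdeg hrec ih =>
    intro K L hK hL hO
    have hi := hK.delete {u}
    rw [image_singleton] at hi
    obtain ⟨hw, hrec'⟩ := ih (K.deleteVerts {u.1})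
      (Function.update (Function.update L x.1 (L x.1 \ L u.1)) y.1 (L y.1 \ L u.1)) hi (by
        intro a ha
        by_cases hay : a = y
        · subst hay; simp [hL a hy, hL u hu]
        · have h1 : a.1 ≠ y.1 := fun e => hay (Subtype.ext e)
          by_cases hax : a = x
          · subst hax; simp [hay, h1, hL a hx, hL u hu]
          · have h2 : a.1 ≠ x.1 := fun e => hax (Subtype.ext e)
            simp [hay, hax, h1, h2, hL a ha.1]) (fun a ha => hO a ha.1)
    refine ⟨hw.1, IsColoringHarmonica.vert K L u w x y ?_ (fun e => huw (Subtype.ext e))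
      (hK.onOuter hu (hO u hu)) (hK.onOuter hw.1 (hO w hw.1))
      (hK.onOuter hx (hO x hx)) (hK.onOuter hy (hO y hy))
      (hK.adj' hu hx hux) (hK.adj' hu hy huy) (hK.adj' hx hy hxy) ?_ ?_ ?_ hrec'⟩
    · refine conn_of_delete (hK.mem hx) ?_ (harm_conn hrec') ?_
      · intro e
        exact hux.ne (Subtype.ext e).symm
      · rintro _ rfl
        exact hK.adj' hu hx hux
    · rw [hL u hu, hcu]
    · rw [hL u hu, hL x hx, hL y hy, hLxy]
    · rw [hL u hu, hL x hx, hcx]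

lemma exists_ind (G : PlaneGraph V) (H : Set G.verts) : ∃ K, IsInd G K H := by
  refine ⟨G.deleteVerts (Subtype.val '' Hᶜ), ?_, ?_, rfl, rfl⟩
  · intro v
    constructor
    · rintro ⟨hv, h⟩
      refine ⟨hv, ?_⟩
      by_contra hn
      exact h ⟨⟨v, hv⟩, hn, rfl⟩
    · rintro ⟨hv, h⟩
      refine ⟨hv, ?_⟩
      rintro ⟨a, ha, rfl⟩
      exact ha h
  · intro u v
    constructor
    · rintro ⟨h, hu, hv⟩
      exact ⟨h, ⟨G.adj_mem _ _ h, hu⟩, ⟨pg_mem2 G h, hv⟩⟩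
    · rintro ⟨h, hu, hv⟩
      exact ⟨h, hu.2, hv.2⟩

lemma col_lift {L : V → Finset ℕ} {Λ : G.verts → Finset ℕ} (hL : ∀ a : G.verts, Λ a ⊆ L a)
    (h : Col (sg G) univ Λ) : G.HasLColoring L := by
  obtain ⟨φ, h1, h2⟩ := h
  classical
  have hφ : ∀ v (hv : v ∈ G.verts), (if h : v ∈ G.verts then φ ⟨v, h⟩ else 0) = φ ⟨v, hv⟩ :=
    fun v hv => dif_pos hv
  refine ⟨fun v => if h : v ∈ G.verts then φ ⟨v, h⟩ else 0, ?_, ?_⟩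
  · intro v hv
    simp only [hφ v hv]
    exact hL _ (h1 _ (mem_univ _))
  · intro u v huv
    have hu := G.adj_mem _ _ huv
    have hv := pg_mem2 G huv
    simp only [hφ u hu, hφ v hv]
    exact h2 _ (mem_univ _) _ (mem_univ _) huv

theorem main (G : PlaneGraph V) (C : List V) (p1 p2 : V) (L : V → Finset ℕ)
    (hC : G.IsOuterCycle C)
    (hp1 : p1 ∈ C) (hp2 : p2 ∈ C) (hp12 : p1 ≠ p2)
    (h5 : ∀ v ∈ G.verts, v ∉ C → 5 ≤ (L v).card)
    (h3 : ∀ v ∈ C, v ≠ p1 → v ≠ p2 → 3 ≤ (L v).card)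
    (h1 : 1 ≤ (L p1).card) (h2 : 2 ≤ (L p2).card) (hnc : ¬ G.HasLColoring L) :
    ContainsColoringHarmonica G L (Sum.inl p1) p2 := by
  obtain ⟨_, _, hCv, _, hfr⟩ := hC
  have hfin : Finite G.verts := G.finite_verts.to_subtype
  have hOut : ∀ v ∈ C, G.OnOuter v := by
    intro v hv
    unfold PlaneGraph.OnOuter
    rw [hfr]
    exact Or.inl ⟨v, hv, rfl⟩
  let B : Set G.verts := {b | b.1 ∈ C}
  have hpl : PL (sg G) univ B := pl_plane G B fun b hb => hOut b hb
  let q1 : G.verts := ⟨p1, hCv p1 hp1⟩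
  let q2 : G.verts := ⟨p2, hCv p2 hp2⟩
  have hq : q2 ≠ q1 := fun e => hp12 (congrArg Subtype.val e).symm
  -- the instance with the list of `p1` replaced by `M`
  have hinst : ∀ M : Finset ℕ, M ⊆ L p1 → (M.card = 2 ∨ M.card = 1) →
      Inst (sg G) univ B (Function.update (fun a : G.verts => L a.1) q1 M) q1 q1 q2 M := by
    intro M hM hMc
    refine ⟨hpl, ⟨mem_univ _, hp1⟩, ⟨mem_univ _, hp1⟩, Or.inl rfl, ⟨mem_univ _, hp2⟩, hq, hq,
      Function.update_self _ _ _, Function.update_self _ _ _, ?_, ?_, ?_⟩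
    · rcases hMc with h | h
      · exact Or.inl h
      · exact Or.inr ⟨h, rfl⟩
    · rw [Function.update_of_ne hq]; exact h2
    · intro v _ hv
      simp only [mem_insert_iff, mem_singleton_iff, not_or] at hv
      rw [Function.update_of_ne hv.1]
      have n1 : v.1 ≠ p1 := fun e => hv.1 (Subtype.ext e)
      have n2 : v.1 ≠ p2 := fun e => hv.2.2 (Subtype.ext e)
      by_cases hvC : v.1 ∈ C
      · exact ⟨h3 v hvC n1 n2, fun h => absurd hvC h⟩
      · have := h5 v v.2 hvC
        exact ⟨by omega, fun _ => this⟩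
  have hlift : ∀ M : Finset ℕ, M ⊆ L p1 →
      ¬ Col (sg G) univ (Function.update (fun a : G.verts => L a.1) q1 M) := by
    intro M hM hcol
    apply hnc
    refine col_lift ?_ hcol
    intro a
    by_cases ha : a = q1
    · subst ha; rw [Function.update_self]; exact hM
    · rw [Function.update_of_ne ha]
  by_cases hc : 2 ≤ (L p1).card
  · exfalso
    obtain ⟨M, hM, hMc⟩ := Finset.exists_subset_card_eq hc
    apply hlift M hM
    apply nn_all univ _ _ _ _ _ _ (hinst M hM (Or.inl hMc))
    rintro (⟨h, _⟩ | ⟨_, h, _⟩)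
    · omega
    · exact h rfl
  · have hc1 : (L p1).card = 1 := by omega
    have hh := hb_all univ _ _ _ _ _ _ (hinst (L p1) (Finset.Subset.refl _) (Or.inr hc1))
      (hlift (L p1) (Finset.Subset.refl _))
    rcases hh with ⟨h, _⟩ | ⟨_, H, hH, hAH⟩
    · omega
    · obtain ⟨K, hK⟩ := exists_ind G H
      obtain ⟨_, hharm⟩ := hAH.toHarm K L hK (by
        intro a ha
        by_cases e : a = q1
        · subst e; rw [Function.update_self]
        · rw [Function.update_of_ne e]) (fun a ha => hOut _ (hH ha).2)
      exact ⟨K, L, hK.sub, fun _ _ => rfl, hharm⟩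

end transfer
end HC

/-- Theorem 1.3, the main theorem: Let `G` be a plane graph with
outer cycle `C`, let `p₁, p₂ ∈ V(C)`, and let `L` be a list assignment for
`G` with `|L(v)| ≥ 5` for `v ∈ V(G) − V(C)`, `|L(v)| ≥ 3` for
`v ∈ V(C) − {p₁, p₂}`, `|L(p₁)| ≥ 1` and `|L(p₂)| ≥ 2`. Then `G` is
`L`-colorable if and only if `(G, L)` does not contain a coloring harmonica
from `p₁` to `p₂`. -/
theorem colorable_iff_no_coloring_harmonica {V : Type u} [DecidableEq V]
    (G : PlaneGraph V) (C : List V) (p1 p2 : V) (L : V → Finset ℕ)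
    (hC : G.IsOuterCycle C)
    (hp1 : p1 ∈ C) (hp2 : p2 ∈ C) (hp12 : p1 ≠ p2)
    (hnonempty : ∀ v ∈ G.verts, (L v).Nonempty)
    (h5 : ∀ v ∈ G.verts, v ∉ C → 5 ≤ (L v).card)
    (h3 : ∀ v ∈ C, v ≠ p1 → v ≠ p2 → 3 ≤ (L v).card)
    (h1 : 1 ≤ (L p1).card) (h2 : 2 ≤ (L p2).card) :
    G.HasLColoring L ↔ ¬ContainsColoringHarmonica G L (Sum.inl p1) p2 := by
  refine ⟨fun h hc => HC.contains_not_col hc h, fun h => ?_⟩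
  by_contra hn
  exact h (HC.main G C p1 p2 L hC hp1 hp2 hp12 h5 h3 h1 h2 hn)
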